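/- Almost conservation law in ℝ³. Let s ∈ (5/6, 1) and let ε > 0 be sufficiently small. There exist an absolute constant δ > 0 and C = C(s, ε, m₁) such that: for every N ≥ 1, every Schwartz datum φ₀ on ℝ³ with E(I_N φ₀) ≤ 1, and every solution φ of the cubic defocussing NLS on ℝ³ × [0, δ] with data φ₀, one has |E(I_N φ)(t) − E(I_N φ₀)| ≤ C N^{−1 + ε} for all t ∈ [0, δ]. -/

import Mathlib

open MeasureTheory Complex Set
open scoped FourierTransform BigOperators RealInnerProductSpace

noncomputable section

abbrev Rn (n : ℕ) := EuclideanSpace ℝ (Fin n)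

/-- Japanese bracket of a vector. -/
def jap {n : ℕ} (ξ : Rn n) : ℝ := Real.sqrt (1 + ‖ξ‖ ^ 2)

/-- Japanese bracket of a real number. -/
def japR (x : ℝ) : ℝ := Real.sqrt (1 + x ^ 2)

/-- Inhomogeneous Sobolev norm ‖⟨ξ⟩^s f̂‖_{L²}. -/
def sobNorm (n : ℕ) (s : ℝ) (f : Rn n → ℂ) : ℝ :=
  (∫ ξ : Rn n, jap ξ ^ (2 * s) * ‖𝓕 f ξ‖ ^ 2) ^ (1/2 : ℝ)

/-- Homogeneous Sobolev norm ‖|ξ|^s f̂‖_{L²}. -/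
def sobNormHom (n : ℕ) (s : ℝ) (f : Rn n → ℂ) : ℝ :=
  (∫ ξ : Rn n, ‖ξ‖ ^ (2 * s) * ‖𝓕 f ξ‖ ^ 2) ^ (1/2 : ℝ)

/-- L^p norm on ℝⁿ. -/
def lpNorm (n : ℕ) (p : ℝ) (f : Rn n → ℂ) : ℝ :=
  (∫ x : Rn n, ‖f x‖ ^ p) ^ (1/p)

/-- Laplacian: sum of second partial derivatives. -/
def laplacian {n : ℕ} (f : Rn n → ℂ) (x : Rn n) : ℂ :=
  ∑ i : Fin n, fderiv ℝ (fun y => fderiv ℝ f y (EuclideanSpace.single i 1)) x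
    (EuclideanSpace.single i 1)

/-- Complex gradient as a vector in Euclidean space. -/
def gradC {n : ℕ} (f : Rn n → ℂ) (x : Rn n) : EuclideanSpace ℂ (Fin n) :=
  (WithLp.equiv 2 (Fin n → ℂ)).symm fun i => fderiv ℝ f x (EuclideanSpace.single i 1)

/-- φ is a solution of the cubic defocussing NLS on ℝⁿ × [0,T] with data φ₀:
smooth, Schwartz in x uniformly for t ∈ [0,T] (with all derivatives),
satisfying i∂ₜφ + Δφ = |φ|²φ and φ(·,0) = φ₀. -/
def IsNLSSolution (n : ℕ) (T : ℝ) (φ : Rn n → ℝ → ℂ) (φ₀ : Rn n → ℂ) : Prop :=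
  ContDiff ℝ (⊤ : ℕ∞) (fun p : Rn n × ℝ => φ p.1 p.2) ∧
  (∀ k l : ℕ, ∃ C : ℝ, ∀ t ∈ Icc (0:ℝ) T, ∀ x : Rn n,
      ‖x‖ ^ k * ‖iteratedFDeriv ℝ l (fun y => φ y t) x‖ ≤ C) ∧
  (∀ x : Rn n, ∀ t ∈ Icc (0:ℝ) T,
      Complex.I * deriv (fun t' => φ x t') t + laplacian (fun y => φ y t) x
        = (‖φ x t‖ : ℂ) ^ 2 * φ x t) ∧
  (∀ x : Rn n, φ x 0 = φ₀ x)

/-- The energy E(f) = ∫ (1/2)|∇f|² + (1/4)|f|⁴. -/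
def energy {n : ℕ} (f : Rn n → ℂ) : ℝ :=
  ∫ x : Rn n, ((1/2 : ℝ) * ∑ i : Fin n, ‖fderiv ℝ f x (EuclideanSpace.single i 1)‖ ^ 2
    + (1/4 : ℝ) * ‖f x‖ ^ 4)

/-- m₁ is a smooth, radially symmetric, nonincreasing multiplier with
m₁ = 1 on the unit ball, m₁(ξ) = |ξ|^{-(1-s)} for |ξ| ≥ 2, 0 < m₁ ≤ 1. -/
def IsAdmissibleMultiplier (n : ℕ) (s : ℝ) (m₁ : Rn n → ℝ) : Prop :=
  ContDiff ℝ (⊤ : ℕ∞) m₁ ∧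
  (∀ ξ : Rn n, 0 < m₁ ξ ∧ m₁ ξ ≤ 1) ∧
  (∀ ξ η : Rn n, ‖ξ‖ = ‖η‖ → m₁ ξ = m₁ η) ∧
  (∀ ξ η : Rn n, ‖ξ‖ ≤ ‖η‖ → m₁ η ≤ m₁ ξ) ∧
  (∀ ξ : Rn n, ‖ξ‖ ≤ 1 → m₁ ξ = 1) ∧
  (∀ ξ : Rn n, 2 ≤ ‖ξ‖ → m₁ ξ = ‖ξ‖ ^ (-(1 - s)))

/-- The rescaled multiplier m_N(ξ) = m₁(ξ/N). -/
def mN {n : ℕ} (m₁ : Rn n → ℝ) (N : ℝ) (ξ : Rn n) : ℝ := m₁ (N⁻¹ • ξ)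

/-- The smoothing operator I_N with Fourier multiplier m_N. -/
def Iop {n : ℕ} (m₁ : Rn n → ℝ) (N : ℝ) (f : Rn n → ℂ) : Rn n → ℂ :=
  fun x => 𝓕⁻ (fun ξ => (mN m₁ N ξ : ℂ) * 𝓕 f ξ) x

/-- The spatial multiplier ⟨∇⟩^s. -/
def japMul (n : ℕ) (s : ℝ) (f : Rn n → ℂ) : Rn n → ℂ :=
  fun x => 𝓕⁻ (fun ξ => ((jap ξ ^ s : ℝ) : ℂ) * 𝓕 f ξ) x

/-- Sharp Littlewood–Paley projection onto {M ≤ ⟨ξ⟩ ≤ 2M}. -/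
def LP (n : ℕ) (M : ℝ) (f : Rn n → ℂ) : Rn n → ℂ :=
  fun x => 𝓕⁻ (fun ξ => if M ≤ jap ξ ∧ jap ξ ≤ 2 * M then 𝓕 f ξ else 0) x

/-- Space-time Fourier transform ψ̃(ξ,τ). -/
def stFourier (n : ℕ) {E : Type*} [NormedAddCommGroup E] [NormedSpace ℂ E]
    (ψ : Rn n → ℝ → E) (ξ : Rn n) (τ : ℝ) : E :=
  ∫ x : Rn n, ∫ t : ℝ,
    Complex.exp (Complex.I * ((-2 * Real.pi * (⟪x, ξ⟫ + t * τ) : ℝ) : ℂ)) • ψ x t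

/-- The X_{s,b} norm ‖⟨ξ⟩^s ⟨τ-|ξ|²⟩^b ψ̃‖_{L²}. -/
def XNorm (n : ℕ) {E : Type*} [NormedAddCommGroup E] [NormedSpace ℂ E]
    (s b : ℝ) (ψ : Rn n → ℝ → E) : ℝ :=
  (∫ ξ : Rn n, ∫ τ : ℝ,
    jap ξ ^ (2 * s) * japR (τ - ‖ξ‖ ^ 2) ^ (2 * b) * ‖stFourier n ψ ξ τ‖ ^ 2) ^ (1/2 : ℝ)

/-- The restricted norm X^δ_{s,b}: infimum over Schwartz extensions off ℝⁿ × [0,δ]. -/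
def XRNorm (n : ℕ) {E : Type*} [NormedAddCommGroup E] [NormedSpace ℂ E]
    (s b δ : ℝ) (f : Rn n → ℝ → E) : ℝ :=
  sInf { r : ℝ | ∃ ψ : SchwartzMap (Rn n × ℝ) E,
    (∀ x : Rn n, ∀ t ∈ Icc (0:ℝ) δ, ψ (x, t) = f x t) ∧
    r = XNorm n s b (fun x t => ψ (x, t)) }

/-- Space-time L^p norm on ℝⁿ × ℝ. -/
def lpNormST (n : ℕ) {E : Type*} [NormedAddCommGroup E] (p : ℝ) (F : Rn n → ℝ → E) : ℝ :=
  (∫ t : ℝ, ∫ x : Rn n, ‖F x t‖ ^ p) ^ (1/p)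

/-- Space-time L^p norm on ℝⁿ × [0,δ]. -/
def lpNormSTt (n : ℕ) {E : Type*} [NormedAddCommGroup E] (p δ : ℝ) (F : Rn n → ℝ → E) : ℝ :=
  (∫ t in Icc (0:ℝ) δ, ∫ x : Rn n, ‖F x t‖ ^ p) ^ (1/p)

local notation "E3" => EuclideanSpace ℝ (Fin 3)

theorem lintegral_comp_abs_eq (f : ℝ → ENNReal) :
    ∫⁻ x : ℝ, f |x| = 2 * ∫⁻ x in Ioi (0:ℝ), f x := by
  have h1 : ∫⁻ x in Ioi (0:ℝ), f |x| = ∫⁻ x in Ioi (0:ℝ), f x :=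
    setLIntegral_congr_fun measurableSet_Ioi (fun x hx => by rw [abs_of_pos hx])
  have h2 : ∫⁻ x in Iio (0:ℝ), f |x| = ∫⁻ x in Ioi (0:ℝ), f x := by
    have := (Measure.measurePreserving_neg (volume : Measure ℝ)).setLIntegral_comp_emb
      (MeasurableEquiv.neg ℝ).measurableEmbedding f (Iio 0)
    rw [show Neg.neg '' (Iio (0:ℝ)) = Ioi 0 by simp] at this
    rw [← this]
    exact setLIntegral_congr_fun measurableSet_Iio (fun x hx => by
      rw [abs_of_neg hx])
  rw [← lintegral_add_compl _ (measurableSet_Ioi (a := (0:ℝ))), compl_Ioi, h1,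
    setLIntegral_congr (Iio_ae_eq_Iic (a := (0:ℝ))).symm, h2, two_mul]

theorem lintegral_abs_rpow_tail {p R : ℝ} (hp : p < -1) (hR : 0 < R) :
    ∫⁻ x : ℝ, ENNReal.ofReal (if R ≤ |x| then |x| ^ p else 0)
      ≤ ENNReal.ofReal (2 * (R ^ (p + 1) / (-(p + 1)))) := by
  rw [lintegral_comp_abs_eq (fun x => ENNReal.ofReal (if R ≤ x then x ^ p else 0))]
  have : ∫⁻ x in Ioi (0:ℝ), ENNReal.ofReal (if R ≤ x then x ^ p else 0)
      ≤ ∫⁻ x in Ici R, ENNReal.ofReal (x ^ p) := by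
    rw [← lintegral_indicator measurableSet_Ici]
    refine (setLIntegral_le_lintegral _ _).trans (lintegral_mono fun x => ?_)
    by_cases h : R ≤ x <;> simp [h]
  rw [setLIntegral_congr Ioi_ae_eq_Ici.symm, ← ofReal_integral_eq_lintegral_ofReal
    (integrableOn_Ioi_rpow_of_lt hp hR), integral_Ioi_rpow_of_lt hp hR] at this
  · rw [ENNReal.ofReal_mul (by norm_num), ENNReal.ofReal_ofNat]
    refine mul_le_mul_right (this.trans (ENNReal.ofReal_le_ofReal (le_of_eq ?_))) _
    rw [div_neg, neg_div]
  · filter_upwards [ae_restrict_mem measurableSet_Ioi] with x hx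
    exact Real.rpow_nonneg (hR.trans hx).le _

theorem lintegral_abs_rpow_ball {p R : ℝ} (hp : -1 < p) (hR : 0 < R) :
    ∫⁻ x : ℝ, ENNReal.ofReal (if |x| ≤ R then |x| ^ p else 0)
      ≤ ENNReal.ofReal (2 * (R ^ (p + 1) / (p + 1))) := by
  rw [lintegral_comp_abs_eq (fun x => ENNReal.ofReal (if x ≤ R then x ^ p else 0))]
  have : ∫⁻ x in Ioi (0:ℝ), ENNReal.ofReal (if x ≤ R then x ^ p else 0)
      ≤ ∫⁻ x in Ioc 0 R, ENNReal.ofReal (x ^ p) := by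
    rw [← lintegral_indicator measurableSet_Ioc, ← lintegral_indicator measurableSet_Ioi]
    refine (lintegral_mono fun x => ?_)
    by_cases h : x ≤ R <;> by_cases h0 : 0 < x <;> simp [h, h0, indicator]
  have hi : IntervalIntegrable (fun x : ℝ => x ^ p) volume 0 R :=
    intervalIntegral.intervalIntegrable_rpow' hp
  rw [← ofReal_integral_eq_lintegral_ofReal
    ((intervalIntegrable_iff_integrableOn_Ioc_of_le hR.le).1 hi),
    ← intervalIntegral.integral_of_le hR.le, integral_rpow (Or.inl hp),
    Real.zero_rpow (by linarith), sub_zero] at this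
  · rw [ENNReal.ofReal_mul (by norm_num), ENNReal.ofReal_ofNat]
    exact mul_le_mul_right this _
  · filter_upwards [ae_restrict_mem measurableSet_Ioc] with x hx
    exact Real.rpow_nonneg hx.1.le _

theorem lintegral_one_add_abs_rpow {p : ℝ} (hp : p < -1) :
    ∫⁻ x : ℝ, ENNReal.ofReal ((1 + |x|) ^ p)
      ≤ ENNReal.ofReal (2 * (1 / (-(p + 1)))) := by
  rw [lintegral_comp_abs_eq (fun x => ENNReal.ofReal ((1 + x) ^ p))]
  have : ∫⁻ x in Ioi (0:ℝ), ENNReal.ofReal ((1 + x) ^ p)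
      = ∫⁻ x in Ioi (1:ℝ), ENNReal.ofReal (x ^ p) := by
    have := (measurePreserving_add_left (volume : Measure ℝ) 1).setLIntegral_comp_emb
      (MeasurableEquiv.addLeft (1:ℝ)).measurableEmbedding
      (fun x => ENNReal.ofReal (x ^ p)) (Ioi 0)
    rw [this]; simp
  rw [this, ← ofReal_integral_eq_lintegral_ofReal
    (integrableOn_Ioi_rpow_of_lt hp one_pos), integral_Ioi_rpow_of_lt hp one_pos]
  · rw [ENNReal.ofReal_mul (by norm_num), ENNReal.ofReal_ofNat, Real.one_rpow]
    refine mul_le_mul_right ((ENNReal.ofReal_le_ofReal (le_of_eq ?_))) _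
    rw [div_neg, neg_div]
  · filter_upwards [ae_restrict_mem measurableSet_Ioi] with x hx
    exact Real.rpow_nonneg (one_pos.trans hx).le _

/-- The two dimensional integral over level sets of a paraboloid is bounded uniformly. -/
theorem lintegral_paraboloid {p : ℝ} (hp : p < -1) (T : ℝ) :
    ∫⁻ y : ℝ × ℝ, ENNReal.ofReal ((1 + |T - 2 * (y.1 ^ 2 + y.2 ^ 2)|) ^ p)
      ≤ ENNReal.ofReal (2 * Real.pi * (2 * (1 / (-(p + 1))))) := by
  rw [← lintegral_comp_polarCoord_symm]
  have hsq : ∀ q : ℝ × ℝ, (polarCoord.symm q).1 ^ 2 + (polarCoord.symm q).2 ^ 2 = q.1 ^ 2 := by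
    intro q
    simp only [polarCoord_symm_apply]
    linear_combination q.1 ^ 2 * Real.sin_sq_add_cos_sq q.2
  simp only [hsq, smul_eq_mul]
  rw [polarCoord_target, Measure.volume_eq_prod, ← Measure.prod_restrict,
    lintegral_prod _ (by fun_prop)]
  simp only [lintegral_const, MeasurableSet.univ, Measure.restrict_apply, univ_inter,
    Real.volume_Ioo]
  rw [lintegral_mul_const _ (by fun_prop)]
  have key : ∫⁻ r in Ioi (0:ℝ), ENNReal.ofReal r * ENNReal.ofReal ((1 + |T - 2 * r ^ 2|) ^ p)
      ≤ ENNReal.ofReal (2 * (1 / (-(p + 1)))) := by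
    have hd : ∀ x ∈ Ioi (0:ℝ), HasDerivWithinAt (fun r : ℝ => 2 * r ^ 2 - T) (4 * x) (Ioi 0) x := by
      intro x _
      have := (((hasDerivAt_id x).pow 2).const_mul 2).sub_const T
      refine (this.congr_deriv ?_).hasDerivWithinAt
      simp; ring
    have hinj : InjOn (fun r : ℝ => 2 * r ^ 2 - T) (Ioi 0) := by
      intro x hx y hy h
      have h2 : x ^ 2 = y ^ 2 := by simpa using h
      exact (pow_left_inj₀ (le_of_lt hx) (le_of_lt hy) two_ne_zero).1 h2
    have := lintegral_image_eq_lintegral_abs_deriv_mul measurableSet_Ioi hd hinj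
      (fun u => ENNReal.ofReal ((1 + |u|) ^ p))
    calc _ ≤ ∫⁻ r in Ioi (0:ℝ), ENNReal.ofReal |4 * r| *
          ENNReal.ofReal ((1 + |2 * r ^ 2 - T|) ^ p) := by
          refine setLIntegral_mono' measurableSet_Ioi fun r hr => ?_
          rw [abs_sub_comm T]
          refine mul_le_mul_left (ENNReal.ofReal_le_ofReal ?_) _
          rw [abs_of_pos (by have : 0 < r := hr; linarith)]
          have : 0 < r := hr; linarith
      _ = _ := this.symm
      _ ≤ _ := (setLIntegral_le_lintegral _ _).trans (lintegral_one_add_abs_rpow hp)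
  refine (mul_le_mul_left key _).trans ?_
  rw [← ENNReal.ofReal_mul (by
    apply mul_nonneg (by norm_num); apply div_nonneg <;> linarith)]
  exact ENNReal.ofReal_le_ofReal (le_of_eq (by ring))

/-- Splitting off the `j`-th coordinate of a vector in `ℝ³`. -/
def splitCoord (j : Fin 3) (x : ℝ) (y : ℝ × ℝ) : EuclideanSpace ℝ (Fin 3) :=
  WithLp.toLp 2 (j.insertNth x ![y.1, y.2])

theorem splitCoord_same (j : Fin 3) (x : ℝ) (y : ℝ × ℝ) : splitCoord j x y j = x := by
  simp [splitCoord]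

theorem splitCoord_zero (j : Fin 3) (x : ℝ) (y : ℝ × ℝ) :
    splitCoord j x y (j.succAbove 0) = y.1 := by
  simp [splitCoord]

theorem splitCoord_one (j : Fin 3) (x : ℝ) (y : ℝ × ℝ) :
    splitCoord j x y (j.succAbove 1) = y.2 := by
  simp [splitCoord]

theorem norm_sq_split (j : Fin 3) (η : EuclideanSpace ℝ (Fin 3)) :
    ‖η‖ ^ 2 = η j ^ 2 + (η (j.succAbove 0) ^ 2 + η (j.succAbove 1) ^ 2) := by
  rw [EuclideanSpace.norm_sq_eq, Fin.sum_univ_succAbove _ j]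
  simp [Fin.sum_univ_two]

theorem measurePreserving_splitCoord (j : Fin 3) :
    MeasurePreserving (fun p : ℝ × (ℝ × ℝ) => splitCoord j p.1 p.2) := by
  have h1 := (EuclideanSpace.volume_preserving_symm_measurableEquiv_toLp (Fin 3)).symm
  have h2 := (volume_preserving_piFinSuccAbove (fun _ : Fin 3 => ℝ) j).symm
  have h3 := (MeasurePreserving.id (volume : Measure ℝ)).prod
    (volume_preserving_finTwoArrow ℝ).symm
  have := (h1.comp h2).comp h3
  exact this

theorem measurable_splitCoord (j : Fin 3) :
    Measurable (fun p : ℝ × (ℝ × ℝ) => splitCoord j p.1 p.2) :=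
  (measurePreserving_splitCoord j).measurable

theorem lintegral_splitCoord (j : Fin 3) {F : EuclideanSpace ℝ (Fin 3) → ENNReal}
    (hF : Measurable F) :
    ∫⁻ η, F η = ∫⁻ x : ℝ, ∫⁻ y : ℝ × ℝ, F (splitCoord j x y) := by
  rw [← (measurePreserving_splitCoord j).lintegral_comp hF, Measure.volume_eq_prod,
    lintegral_prod (fun p : ℝ × (ℝ × ℝ) => F (splitCoord j p.1 p.2))
      (hF.comp (measurable_splitCoord j)).aemeasurable]

theorem lintegral_splitCoord' (j : Fin 3) {F : EuclideanSpace ℝ (Fin 3) → ENNReal}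
    (hF : Measurable F) :
    ∫⁻ η, F η = ∫⁻ y : ℝ × ℝ, ∫⁻ x : ℝ, F (splitCoord j x y) := by
  rw [← (measurePreserving_splitCoord j).lintegral_comp hF, Measure.volume_eq_prod,
    lintegral_prod_symm (fun p : ℝ × (ℝ × ℝ) => F (splitCoord j p.1 p.2))
      (hF.comp (measurable_splitCoord j)).aemeasurable]

theorem ae_coord_ne_zero : ∀ᵐ η : EuclideanSpace ℝ (Fin 3), ∀ i, η i ≠ 0 := by
  rw [ae_all_iff]
  intro i
  let L : EuclideanSpace ℝ (Fin 3) →ₗ[ℝ] ℝ :=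
    (EuclideanSpace.proj i : EuclideanSpace ℝ (Fin 3) →L[ℝ] ℝ).toLinearMap
  have hL : ∀ η, L η = η i := fun η => rfl
  have : LinearMap.ker L ≠ ⊤ := by
    intro h
    have h1 : EuclideanSpace.single i (1:ℝ) ∈ LinearMap.ker L := h ▸ trivial
    simp [hL] at h1
  have h2 := Measure.addHaar_submodule (volume : Measure (EuclideanSpace ℝ (Fin 3))) _ this
  rw [ae_iff]
  refine measure_mono_null ?_ h2
  intro η hη
  simpa [hL] using hη

/-- The reference symbol `min(|ξ|, N^{1/6}|ξ|^{5/6})`. -/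
def refSymb (N : ℝ) (ξ : EuclideanSpace ℝ (Fin 3)) : ℝ :=
  min ‖ξ‖ (N ^ (1/6 : ℝ) * ‖ξ‖ ^ (5/6 : ℝ))

theorem refSymb_nonneg {N : ℝ} (hN : 0 ≤ N) (ξ : EuclideanSpace ℝ (Fin 3)) :
    0 ≤ refSymb N ξ := le_min (norm_nonneg _) (by positivity)

theorem continuous_refSymb (N : ℝ) : Continuous (refSymb N) := by
  unfold refSymb
  refine continuous_norm.min (continuous_const.mul (continuous_norm.rpow_const ?_))
  intro x; right; norm_num

theorem measurable_refSymb (N : ℝ) : Measurable (refSymb N) := (continuous_refSymb N).measurable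

/-- For large frequencies the second term governs the symbol. -/
theorem refSymb_ge_of_le {N c : ℝ} (hN : 1 ≤ N) (hc : 0 < c) (hc1 : c ≤ 1)
    {ξ : EuclideanSpace ℝ (Fin 3)} (h : c * N ≤ ‖ξ‖) :
    c ^ (1/6 : ℝ) * (N ^ (1/6 : ℝ) * ‖ξ‖ ^ (5/6 : ℝ)) ≤ refSymb N ξ := by
  have hN0 : 0 < N := by linarith
  have hx : 0 < ‖ξ‖ := lt_of_lt_of_le (by positivity) h
  refine le_min ?_ ?_
  · rw [← mul_assoc, ← Real.mul_rpow hc.le hN0.le]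
    calc (c * N) ^ (1/6 : ℝ) * ‖ξ‖ ^ (5/6 : ℝ) ≤ ‖ξ‖ ^ (1/6 : ℝ) * ‖ξ‖ ^ (5/6 : ℝ) := by gcongr
      _ = ‖ξ‖ := by rw [← Real.rpow_add hx]; norm_num
  · exact mul_le_of_le_one_left (by positivity) (Real.rpow_le_one hc.le hc1 (by norm_num))

/-- For moderate frequencies the symbol is close to the modulus. -/
theorem refSymb_ge_of_le' {N c n : ℝ} (hN : 1 ≤ N) (hc : 0 < c) (hc1 : c ≤ 1)
    (hn : c * N ≤ n) {ξ : EuclideanSpace ℝ (Fin 3)} (h : ‖ξ‖ ≤ n) :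
    c ^ (1/6 : ℝ) * ((N / n) ^ (1/6 : ℝ) * ‖ξ‖) ≤ refSymb N ξ := by
  have hN0 : 0 < N := by linarith
  have hn0 : 0 < n := lt_of_lt_of_le (by positivity) hn
  rcases eq_or_lt_of_le (norm_nonneg ξ) with h0 | hx
  · rw [← h0]; simpa using refSymb_nonneg hN0.le ξ
  refine le_min ?_ ?_
  · rw [← mul_assoc, ← Real.mul_rpow hc.le (by positivity)]
    refine mul_le_of_le_one_left hx.le (Real.rpow_le_one (by positivity) ?_ (by norm_num))
    rw [← mul_div_assoc, div_le_one hn0]; exact hn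
  · refine (mul_le_of_le_one_left (by positivity)
      (Real.rpow_le_one hc.le hc1 (by norm_num))).trans ?_
    rw [Real.div_rpow hN0.le hn0.le, div_mul_eq_mul_div, mul_div_assoc]
    refine mul_le_mul_of_nonneg_left ?_ (by positivity)
    rw [div_le_iff₀ (by positivity)]
    calc ‖ξ‖ = ‖ξ‖ ^ (5/6 : ℝ) * ‖ξ‖ ^ (1/6 : ℝ) := by rw [← Real.rpow_add hx]; norm_num
      _ ≤ _ := by gcongr

/-- The resonance function. -/
def resFn (n : ℝ) (k η : E3) : ℝ := n ^ 2 - ‖η‖ ^ 2 - ‖k - η‖ ^ 2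

theorem continuous_resFn (n : ℝ) (k : E3) : Continuous (resFn n k) := by
  unfold resFn; fun_prop

theorem resFn_split (j : Fin 3) (n : ℝ) (k : E3) (x : ℝ) (y : ℝ × ℝ) :
    resFn n k (splitCoord j x y) =
      (n ^ 2 - x ^ 2 - (k j - x) ^ 2
        - (k (j.succAbove 0) ^ 2 + k (j.succAbove 1) ^ 2) / 2)
      - 2 * ((y.1 - k (j.succAbove 0) / 2) ^ 2 + (y.2 - k (j.succAbove 1) / 2) ^ 2) := by
  unfold resFn
  rw [norm_sq_split j, norm_sq_split j (k - _)]
  simp only [PiLp.sub_apply, splitCoord_same, splitCoord_zero, splitCoord_one]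
  ring

theorem lintegral_resFn_two {p : ℝ} (hp : p < -1) (j : Fin 3) (n : ℝ) (k : E3) (x : ℝ) :
    ∫⁻ y : ℝ × ℝ, ENNReal.ofReal ((1 + |resFn n k (splitCoord j x y)|) ^ p)
      ≤ ENNReal.ofReal (2 * Real.pi * (2 * (1 / (-(p + 1))))) := by
  simp only [resFn_split]
  exact (lintegral_sub_right_eq_self (fun y : ℝ × ℝ =>
    ENNReal.ofReal ((1 + |(n ^ 2 - x ^ 2 - (k j - x) ^ 2
        - (k (j.succAbove 0) ^ 2 + k (j.succAbove 1) ^ 2) / 2)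
      - 2 * (y.1 ^ 2 + y.2 ^ 2)|) ^ p))
      (k (j.succAbove 0) / 2, k (j.succAbove 1) / 2)).trans_le (lintegral_paraboloid hp _)

theorem exists_coord_ge (η : E3) : ∃ j, ‖η‖ / 2 ≤ |η j| := by
  by_contra! h
  have h0 : ∀ j, η j ^ 2 < (‖η‖ / 2) ^ 2 := fun j => sq_lt_sq.2 (by
    rw [abs_of_nonneg (by positivity : (0:ℝ) ≤ ‖η‖ / 2)]; exact h j)
  have := norm_sq_split 0 η
  have h1 := h0 0
  have h2 := h0 ((0 : Fin 3).succAbove 0)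
  have h3 := h0 ((0 : Fin 3).succAbove 1)
  nlinarith [sq_nonneg ‖η‖]

theorem abs_coord_le_norm (η : E3) (j : Fin 3) : |η j| ≤ ‖η‖ := by
  have := PiLp.norm_apply_le (p := 2) η j
  simpa using this

theorem norm_sub_sq_le (k η : E3) : ‖k - η‖ ^ 2 ≤ 2 * ‖k‖ ^ 2 + 2 * ‖η‖ ^ 2 := by
  have := norm_sub_le k η
  have h0 := norm_nonneg (k - η)
  nlinarith [sq_nonneg (‖k‖ - ‖η‖), norm_nonneg k, norm_nonneg η]

theorem regionA_pointwise {c e N n : ℝ} (hc : 0 < c) (hc1 : c ≤ 1) (he : 0 < e) (he1 : e ≤ 1)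
    (hN : 1 ≤ N) (hn : 0 ≤ n) {k η : E3} (hk : ‖k‖ ^ 2 ≤ 2 * n ^ 2)
    (h1 : n / 10 ≤ ‖η‖) (h2 : c * N ≤ ‖η‖) :
    ((refSymb N η)⁻¹) ^ 2 * (1 + |resFn n k η|)⁻¹
      ≤ (c ^ (-(1/3) : ℝ) * (503 + 1 / c ^ 2)) *
        (N ^ (-(1/3) : ℝ) * ‖η‖ ^ (-(5/3) + 2 * e) * (1 + |resFn n k η|) ^ (-1 - e)) := by
  have hN0 : 0 < N := by linarith
  have hx : 0 < ‖η‖ := lt_of_lt_of_le (by positivity) h2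
  set W := 1 + |resFn n k η| with hW
  have hW1 : 1 ≤ W := by rw [hW]; linarith [abs_nonneg (resFn n k η)]
  have hW0 : 0 < W := by linarith
  set D := 503 + 1 / c ^ 2 with hD
  have hD1 : 1 ≤ D := by
    have : 0 < 1 / c ^ 2 := by positivity
    linarith
  have hWD : W ≤ D * ‖η‖ ^ 2 := by
    have a1 : 1 ≤ 1 / c ^ 2 * ‖η‖ ^ 2 := by
      rw [div_mul_eq_mul_div, one_mul, le_div_iff₀ (by positivity), one_mul]
      refine pow_le_pow_left₀ hc.le (le_trans ?_ h2) 2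
      nlinarith
    have a2 : |resFn n k η| ≤ 5 * n ^ 2 + 3 * ‖η‖ ^ 2 := by
      have := norm_sub_sq_le k η
      unfold resFn
      rw [abs_le]
      constructor <;> nlinarith [sq_nonneg ‖k - η‖, sq_nonneg ‖η‖, sq_nonneg n]
    have a3 : n ^ 2 ≤ 100 * ‖η‖ ^ 2 := by nlinarith
    rw [hW, hD]; nlinarith
  have hWe : W ^ e ≤ D * ‖η‖ ^ (2 * e) := by
    calc W ^ e ≤ (D * ‖η‖ ^ 2) ^ e := by gcongr
      _ = D ^ e * ‖η‖ ^ (2 * e) := by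
        rw [Real.mul_rpow (by positivity) (by positivity), Real.rpow_mul hx.le]
        norm_num
      _ ≤ _ := by
        gcongr
        exact (Real.rpow_le_rpow_of_exponent_le hD1 he1).trans_eq (Real.rpow_one _)
  have hWinv : W⁻¹ = W ^ (-1 - e) * W ^ e := by
    rw [← Real.rpow_add hW0]; simp [Real.rpow_neg_one]
  have hsym := refSymb_ge_of_le hN hc hc1 h2
  have hpos : 0 < c ^ (1/6 : ℝ) * (N ^ (1/6 : ℝ) * ‖η‖ ^ (5/6 : ℝ)) := by positivity
  have hsq : ((refSymb N η)⁻¹) ^ 2 ≤ c ^ (-(1/3) : ℝ) * (N ^ (-(1/3) : ℝ) * ‖η‖ ^ (-(5/3) : ℝ)) := by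
    calc _ ≤ ((c ^ (1/6 : ℝ) * (N ^ (1/6 : ℝ) * ‖η‖ ^ (5/6 : ℝ)))⁻¹) ^ 2 :=
          pow_le_pow_left₀ (inv_nonneg.2 (refSymb_nonneg hN0.le η)) (inv_anti₀ hpos hsym) 2
      _ = _ := by
        rw [mul_inv, mul_inv, mul_pow, mul_pow, ← Real.rpow_neg hc.le, ← Real.rpow_neg hN0.le,
          ← Real.rpow_neg hx.le, ← Real.rpow_mul_natCast hc.le, ← Real.rpow_mul_natCast hN0.le,
          ← Real.rpow_mul_natCast hx.le]
        norm_num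
  rw [hWinv]
  calc _ ≤ (c ^ (-(1/3) : ℝ) * (N ^ (-(1/3) : ℝ) * ‖η‖ ^ (-(5/3) : ℝ))) *
        (W ^ (-1 - e) * (D * ‖η‖ ^ (2 * e))) := by gcongr
    _ = _ := by rw [Real.rpow_add hx]; ring

theorem regionA_bound {c e : ℝ} (hc : 0 < c) (hc1 : c ≤ 1) (he : 0 < e) (he1 : e ≤ 1/10) :
    ∃ C > 0, ∀ N n : ℝ, 1 ≤ N → 0 ≤ n → ∀ k : E3, ‖k‖ ^ 2 ≤ 2 * n ^ 2 →
    ∫⁻ η : E3, ENNReal.ofReal (if n / 10 ≤ ‖η‖ ∧ c * N ≤ ‖η‖ then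
      ((refSymb N η)⁻¹) ^ 2 * (1 + |resFn n k η|)⁻¹ else 0)
      ≤ ENNReal.ofReal (C * N ^ (-1 + 2 * e)) := by
  set A := c ^ (-(1/3) : ℝ) * (503 + 1 / c ^ 2) with hA
  have hA0 : 0 < A := by positivity
  set P := 2 * Real.pi * (2 * (1 / (-((-1 - e) + 1)))) with hP
  have hP0 : 0 < P := by
    have : 0 < -((-1 - e) + 1) := by linarith
    positivity
  set p := -(5/3) + 2 * e with hp
  have hp1 : p < -1 := by rw [hp]; linarith
  have hp2 : 0 < -(p + 1) := by linarith
  set B := 2 * ((c / 2) ^ (p + 1) / (-(p + 1))) with hB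
  have hB0 : 0 < B := by positivity
  refine ⟨3 * (A * P * B), by positivity, fun N n hN hn k hk => ?_⟩
  have hN0 : 0 < N := by linarith
  let f : Fin 3 → E3 → ENNReal := fun j η =>
    ENNReal.ofReal (A * N ^ (-(1/3) : ℝ)) *
    (ENNReal.ofReal (if c / 2 * N ≤ |η j| then |η j| ^ p else 0) *
      ENNReal.ofReal ((1 + |resFn n k η|) ^ (-1 - e)))
  have hfm : ∀ j, Measurable (f j) := by
    intro j
    have hm : Measurable fun η : E3 => η j := by fun_prop
    have h1 : Measurable (fun x : ℝ => if c / 2 * N ≤ |x| then |x| ^ p else 0) :=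
      Measurable.ite (measurableSet_le measurable_const measurable_norm)
        (measurable_norm.pow_const _) measurable_const
    have := (continuous_resFn n k).measurable
    have h2 := h1.comp hm
    exact measurable_const.mul (h2.ennreal_ofReal.mul
      (((this.norm).const_add 1).pow_const (-1 - e)).ennreal_ofReal)
  have step : ∫⁻ η : E3, ENNReal.ofReal (if n / 10 ≤ ‖η‖ ∧ c * N ≤ ‖η‖ then
      ((refSymb N η)⁻¹) ^ 2 * (1 + |resFn n k η|)⁻¹ else 0) ≤ ∫⁻ η, ∑ j, f j η := by
    refine lintegral_mono fun η => ?_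
    split_ifs with h
    · obtain ⟨j, hj⟩ := exists_coord_ge η
      refine le_trans ?_ (Finset.single_le_sum (fun i _ => zero_le (a := f i η)) (Finset.mem_univ j))
      have hx : 0 < ‖η‖ := lt_of_lt_of_le (by positivity) h.2
      have hjc : c / 2 * N ≤ |η j| := by linarith [h.2]
      simp only [f, if_pos hjc]
      rw [← ENNReal.ofReal_mul (by positivity), ← ENNReal.ofReal_mul (by positivity)]
      refine ENNReal.ofReal_le_ofReal ((regionA_pointwise hc hc1 he (by linarith) hN hn hk h.1 h.2).trans ?_)
      have hmono : ‖η‖ ^ p ≤ |η j| ^ p := Real.rpow_le_rpow_of_nonpos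
        (lt_of_lt_of_le (by positivity) hjc) (abs_coord_le_norm η j) (by linarith)
      rw [← hA, ← hp, mul_assoc A, mul_assoc (N ^ (-(1/3) : ℝ))]
      gcongr
    · simp
  refine step.trans ?_
  rw [lintegral_finsetSum _ (fun j _ => hfm j)]
  have each : ∀ j, ∫⁻ η, f j η ≤ ENNReal.ofReal (A * P * B * N ^ (-1 + 2 * e)) := by
    intro j
    rw [lintegral_splitCoord j (hfm j)]
    have hres : ∀ x, Measurable fun y : ℝ × ℝ =>
        ENNReal.ofReal ((1 + |resFn n k (splitCoord j x y)|) ^ (-1 - e)) := by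
      intro x
      have := ((continuous_resFn n k).measurable.comp ((measurable_splitCoord j).comp
        (measurable_prodMk_left (x := x))))
      exact (((this.norm).const_add 1).pow_const (-1 - e)).ennreal_ofReal
    have h1 : Measurable (fun x : ℝ => ENNReal.ofReal
        (if c / 2 * N ≤ |x| then |x| ^ p else 0)) :=
      (Measurable.ite (measurableSet_le measurable_const measurable_norm)
        (measurable_norm.pow_const _) measurable_const).ennreal_ofReal
    calc _ ≤ ∫⁻ x : ℝ, ENNReal.ofReal (A * N ^ (-(1/3) : ℝ)) *
            (ENNReal.ofReal (if c / 2 * N ≤ |x| then |x| ^ p else 0) * ENNReal.ofReal P) := by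
          refine lintegral_mono fun x => ?_
          simp only [f, splitCoord_same]
          rw [lintegral_const_mul _ ((hres x).const_mul _), lintegral_const_mul _ (hres x)]
          gcongr
          exact lintegral_resFn_two (by linarith) j n k x
      _ ≤ ENNReal.ofReal (A * N ^ (-(1/3) : ℝ)) *
            (ENNReal.ofReal (2 * ((c / 2 * N) ^ (p + 1) / (-(p + 1)))) * ENNReal.ofReal P) := by
          rw [lintegral_const_mul _ (h1.mul_const _), lintegral_mul_const _ h1]
          gcongr
          exact lintegral_abs_rpow_tail hp1 (by positivity)
      _ = _ := by
          rw [← ENNReal.ofReal_mul (by positivity), ← ENNReal.ofReal_mul (by positivity)]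
          congr 1
          have hNp : N ^ (-1 + 2 * e) = N ^ (-(1/3) : ℝ) * N ^ (p + 1) := by
            rw [← Real.rpow_add hN0, hp]; congr 1; ring
          rw [hB, Real.mul_rpow (by positivity) hN0.le, hNp]
          ring
  refine (Finset.sum_le_sum fun j _ => each j).trans ?_
  rw [mul_assoc 3, ENNReal.ofReal_mul (by norm_num : (0:ℝ) ≤ 3), ENNReal.ofReal_ofNat]
  simp

theorem quadratic_root_bound {n k A : ℝ} (hn : 0 < n) (hk : n / 4 < |k|) :
    ∃ x₀ : ℝ, ∀ x, |x| ≤ n / 10 → n / 20 * |x - x₀| ≤ |A - 2 * (x - k / 2) ^ 2| := by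
  have key : ∀ u : ℝ, n / 40 ≤ u → n / 20 * |u - √(A / 2)| ≤ |A - 2 * u ^ 2| := by
    intro u hu
    have hu0 : 0 < u := by linarith
    rcases le_or_gt 0 A with hA | hA
    · set r := √(A / 2) with hr
      have hr0 : 0 ≤ r := Real.sqrt_nonneg _
      have hAr : A = 2 * r ^ 2 := by rw [hr, Real.sq_sqrt (by linarith)]; ring
      rw [hAr, show 2 * r ^ 2 - 2 * u ^ 2 = -(2 * (u + r) * (u - r)) by ring, abs_neg, abs_mul]
      refine mul_le_mul_of_nonneg_right ?_ (abs_nonneg _)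
      rw [abs_of_pos (by positivity)]
      linarith
    · rw [Real.sqrt_eq_zero_of_nonpos (by linarith), sub_zero, abs_of_pos hu0,
        abs_of_nonpos (by nlinarith [sq_nonneg u])]
      nlinarith
  rcases lt_or_ge 0 k with h | h
  · rw [abs_of_pos h] at hk
    refine ⟨k / 2 - √(A / 2), fun x hx => ?_⟩
    have := key (k / 2 - x) (by linarith [le_abs_self x])
    rw [show x - (k / 2 - √(A / 2)) = -(k / 2 - x - √(A / 2)) by ring, abs_neg,
      show (x - k / 2) ^ 2 = (k / 2 - x) ^ 2 by ring]
    exact this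
  · rw [abs_of_nonpos h] at hk
    refine ⟨k / 2 + √(A / 2), fun x hx => ?_⟩
    have := key (x - k / 2) (by linarith [neg_abs_le x])
    rwa [show x - (k / 2 + √(A / 2)) = x - k / 2 - √(A / 2) by ring]

theorem inv_one_add_le_rpow {w q : ℝ} (hw : 0 < w) (hq : 0 ≤ q) (hq1 : q ≤ 1) :
    (1 + w)⁻¹ ≤ w ^ (-q) := by
  rw [Real.rpow_neg hw.le]
  refine inv_anti₀ (by positivity) ?_
  rcases le_or_gt w 1 with h | h
  · exact (Real.rpow_le_one hw.le h hq).trans (by linarith)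
  · exact (Real.rpow_le_rpow_of_exponent_le h.le hq1).trans (by rw [Real.rpow_one]; linarith)

theorem lintegral_quadratic_one {e : ℝ} (he : 0 < e) (he1 : e ≤ 1/10) {n k : ℝ} (A : ℝ)
    (hn : 0 < n) (hk : n / 4 < |k|) :
    ∫⁻ x : ℝ, ENNReal.ofReal (if |x| ≤ n / 10 then
      |x| ^ (-(2 * e)) * (1 + |A - 2 * (x - k / 2) ^ 2|)⁻¹ else 0)
      ≤ ENNReal.ofReal (20 * (4 / e + 2) * n ^ (-1 + 4 * e)) := by
  obtain ⟨x₀, hx₀⟩ := quadratic_root_bound (A := A) hn hk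
  have hae : ∀ᵐ x : ℝ, x ≠ 0 ∧ x ≠ x₀ :=
    (Measure.ae_ne volume 0).and (Measure.ae_ne volume x₀)
  set c := 20 * n ^ (-1 + 3 * e) with hc
  have hc0 : 0 < c := by positivity
  let g : ℝ → ℝ := fun x => if |x| ≤ n then |x| ^ (-1 + e) else 0
  have hg0 : ∀ x, 0 ≤ g x := fun x => by simp only [g]; split_ifs <;> positivity
  have hgm : Measurable g :=
    (Measurable.ite (measurableSet_le measurable_norm measurable_const)
        (measurable_norm.pow_const _) measurable_const)
  let b : ℝ → ℝ := fun x => if |x| ≤ n then n ^ (-1 + e) else 0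
  have hb0 : ∀ x, 0 ≤ b x := fun x => by simp only [b]; split_ifs <;> positivity
  have hbm : Measurable b :=
    (Measurable.ite (measurableSet_le measurable_norm measurable_const)
        measurable_const measurable_const)
  have pt : ∀ᵐ x : ℝ, ENNReal.ofReal (if |x| ≤ n / 10 then
      |x| ^ (-(2 * e)) * (1 + |A - 2 * (x - k / 2) ^ 2|)⁻¹ else 0) ≤
      ENNReal.ofReal c * (ENNReal.ofReal (g x) + ENNReal.ofReal (g (x - x₀))
        + ENNReal.ofReal (b x)) := by
    filter_upwards [hae] with x ⟨h0, h1⟩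
    rw [← ENNReal.ofReal_add (hg0 _) (hg0 _), ← ENNReal.ofReal_add (add_nonneg (hg0 _) (hg0 _))
      (hb0 _), ← ENNReal.ofReal_mul hc0.le]
    refine ENNReal.ofReal_le_ofReal ?_
    split_ifs with h
    · have hx : 0 < |x| := abs_pos.2 h0
      have hx1 : 0 < |x - x₀| := abs_pos.2 (sub_ne_zero.2 h1)
      have hw : 0 < n / 20 * |x - x₀| := by positivity
      have s1 : (1 + |A - 2 * (x - k / 2) ^ 2|)⁻¹ ≤ c * |x - x₀| ^ (-1 + 3 * e) := by
        calc _ ≤ (1 + n / 20 * |x - x₀|)⁻¹ :=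
              inv_anti₀ (by positivity) (by linarith [hx₀ x h])
          _ ≤ (n / 20 * |x - x₀|) ^ (-(1 - 3 * e)) :=
              inv_one_add_le_rpow hw (by linarith) (by linarith)
          _ = (1 / 20) ^ (-1 + 3 * e) * n ^ (-1 + 3 * e) * |x - x₀| ^ (-1 + 3 * e) := by
              rw [← Real.mul_rpow (by norm_num) hn.le, ← Real.mul_rpow (by positivity) hx1.le]
              congr 1 <;> ring
          _ ≤ _ := by
              rw [hc]
              gcongr
              calc (1 / 20 : ℝ) ^ (-1 + 3 * e) ≤ (1 / 20 : ℝ) ^ (-1 : ℝ) :=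
                    Real.rpow_le_rpow_of_exponent_ge (by norm_num) (by norm_num) (by linarith)
                _ = 20 := by rw [Real.rpow_neg_one]; norm_num
      have s2 : |x| ^ (-(2 * e)) * |x - x₀| ^ (-1 + 3 * e)
          ≤ |x| ^ (-1 + e) + |x - x₀| ^ (-1 + e) := by
        have r1 : |x| ^ (-1 + e) = |x| ^ (-(2 * e)) * |x| ^ (-1 + 3 * e) := by
          rw [← Real.rpow_add hx]; congr 1; ring
        have r2 : |x - x₀| ^ (-1 + e) = |x - x₀| ^ (-(2 * e)) * |x - x₀| ^ (-1 + 3 * e) := by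
          rw [← Real.rpow_add hx1]; congr 1; ring
        rcases le_total |x| |x - x₀| with h | h
        · have : |x - x₀| ^ (-1 + 3 * e) ≤ |x| ^ (-1 + 3 * e) :=
            Real.rpow_le_rpow_of_nonpos hx h (by linarith)
          rw [r1]
          have := mul_le_mul_of_nonneg_left this (by positivity : 0 ≤ |x| ^ (-(2 * e)))
          have : 0 ≤ |x - x₀| ^ (-1 + e) := by positivity
          linarith
        · have : |x| ^ (-(2 * e)) ≤ |x - x₀| ^ (-(2 * e)) :=
            Real.rpow_le_rpow_of_nonpos hx1 h (by linarith)
          rw [r2]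
          have := mul_le_mul_of_nonneg_right this
            (by positivity : 0 ≤ |x - x₀| ^ (-1 + 3 * e))
          have : 0 ≤ |x| ^ (-1 + e) := by positivity
          linarith
      have s3 : |x - x₀| ^ (-1 + e) ≤ g (x - x₀) + b x := by
        have hb : b x = n ^ (-1 + e) := if_pos (by linarith)
        rcases le_or_gt |x - x₀| n with h' | h'
        · have : g (x - x₀) = |x - x₀| ^ (-1 + e) := if_pos h'
          linarith [hb0 x]
        · have := Real.rpow_le_rpow_of_nonpos hn h'.le (by linarith : -1 + e ≤ 0)
          linarith [hg0 (x - x₀)]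
      have s4 : g x = |x| ^ (-1 + e) := if_pos (by linarith)
      calc _ ≤ |x| ^ (-(2 * e)) * (c * |x - x₀| ^ (-1 + 3 * e)) := by gcongr
        _ = c * (|x| ^ (-(2 * e)) * |x - x₀| ^ (-1 + 3 * e)) := by ring
        _ ≤ _ := mul_le_mul_of_nonneg_left (by linarith) hc0.le
    · exact mul_nonneg hc0.le (add_nonneg (add_nonneg (hg0 _) (hg0 _)) (hb0 _))
  refine (lintegral_mono_ae pt).trans ?_
  have hball := lintegral_abs_rpow_ball (p := -1 + e) (by linarith) hn
  rw [show -1 + e + 1 = e by ring] at hball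
  have hb_int : ∫⁻ x, ENNReal.ofReal (b x) ≤ ENNReal.ofReal (2 * n ^ e) := by
    have hbb : (fun x => ENNReal.ofReal (b x)) =
        (Icc (-n) n).indicator (fun _ => ENNReal.ofReal (n ^ (-1 + e))) := by
      ext x
      by_cases h : |x| ≤ n
      · rw [indicator_of_mem (mem_Icc.2 (abs_le.1 h))]; simp [b, h]
      · rw [indicator_of_notMem (fun h' => h (abs_le.2 (mem_Icc.1 h')))]; simp [b, h]
    rw [hbb, lintegral_indicator measurableSet_Icc, setLIntegral_const, Real.volume_Icc,
      ← ENNReal.ofReal_mul (by positivity)]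
    refine ENNReal.ofReal_le_ofReal (le_of_eq ?_)
    rw [Real.rpow_add hn, Real.rpow_neg_one]; field_simp; ring
  rw [lintegral_const_mul _ (by fun_prop), lintegral_add_left (by fun_prop),
    lintegral_add_left (by fun_prop),
    lintegral_sub_right_eq_self (fun x => ENNReal.ofReal (g x)) x₀]
  calc _ ≤ ENNReal.ofReal c * (ENNReal.ofReal (2 * (n ^ e / e)) + ENNReal.ofReal (2 * (n ^ e / e))
        + ENNReal.ofReal (2 * n ^ e)) := by gcongr
    _ = _ := by
      rw [← ENNReal.ofReal_add (by positivity) (by positivity),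
        ← ENNReal.ofReal_add (by positivity) (by positivity), ← ENNReal.ofReal_mul hc0.le]
      congr 1
      have hne : n ^ (-1 + 4 * e) = n ^ (-1 + 3 * e) * n ^ e := by
        rw [← Real.rpow_add hn]; congr 1; ring
      rw [hc, hne]
      ring

theorem resFn_ge_of_small {n : ℝ} (hn : 0 < n) {k η : E3} (hk : ∀ j, |k j| ≤ n / 4)
    (hη : ‖η‖ ≤ n / 10) : n ^ 2 / 2 ≤ |resFn n k η| := by
  have h0 : ∀ j, k j ^ 2 ≤ (n / 4) ^ 2 := fun j => sq_le_sq.2 (by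
    rw [abs_of_pos (by positivity : (0:ℝ) < n / 4)]; exact hk j)
  have h1 := norm_sq_split 0 k
  have hk2 : ‖k‖ ^ 2 ≤ 3 * (n / 4) ^ 2 := by
    have a := h0 0
    have b := h0 ((0 : Fin 3).succAbove 0)
    have d := h0 ((0 : Fin 3).succAbove 1)
    linarith
  have hk3 : ‖k‖ ≤ n * (9 / 20) := by
    refine le_of_sq_le_sq ?_ (by positivity)
    nlinarith
  have h4 : ‖k - η‖ ≤ n * (11 / 20) := by
    have := norm_sub_le k η
    linarith
  refine le_trans ?_ (le_abs_self _)
  unfold resFn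
  nlinarith [norm_nonneg (k - η), norm_nonneg η]

theorem norm_inv_sq_le {e : ℝ} (he : 0 < e) (he1 : e ≤ 1/10) (j : Fin 3) {η : E3}
    (hη : ∀ i, η i ≠ 0) :
    (‖η‖⁻¹) ^ 2 ≤ |η (j.succAbove 0)| ^ (-1 + e) * |η (j.succAbove 1)| ^ (-1 + e)
      * |η j| ^ (-(2 * e)) := by
  have hp : ∀ i, 0 < |η i| := fun i => abs_pos.2 (hη i)
  have hx : 0 < ‖η‖ := (hp 0).trans_le (abs_coord_le_norm η 0)
  calc (‖η‖⁻¹) ^ 2 = ‖η‖ ^ (-1 + e) * ‖η‖ ^ (-1 + e) * ‖η‖ ^ (-(2 * e)) := by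
        rw [← Real.rpow_add hx, ← Real.rpow_add hx, ← Real.rpow_neg_one,
          ← Real.rpow_mul_natCast hx.le]
        congr 1; push_cast; ring
    _ ≤ _ := by
        gcongr ?_ * ?_ * ?_ <;>
        exact Real.rpow_le_rpow_of_nonpos (hp _) (abs_coord_le_norm η _) (by linarith)

theorem regionB_inner {c e : ℝ} (hc : 0 < c) (hc1 : c ≤ 1) (he : 0 < e) (he1 : e ≤ 1/10) :
    ∃ C > 0, ∀ n : ℝ, c ≤ n → ∀ k : E3, ∃ j : Fin 3, ∀ y : ℝ × ℝ,
    ∫⁻ x : ℝ, ENNReal.ofReal (if ‖splitCoord j x y‖ ≤ n / 10 then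
      |x| ^ (-(2 * e)) * (1 + |resFn n k (splitCoord j x y)|)⁻¹ else 0)
      ≤ ENNReal.ofReal (C * n ^ (-1 + 4 * e)) := by
  refine ⟨20 * (4 / e + 2) + 8 * c⁻¹, by positivity, fun n hn k => ?_⟩
  have hn0 : 0 < n := by linarith
  by_cases hk : ∀ j, |k j| ≤ n / 4
  · refine ⟨0, fun y => ?_⟩
    have hball := lintegral_abs_rpow_ball (p := -(2 * e)) (by linarith) hn0
    have hm : Measurable fun x : ℝ => ENNReal.ofReal (if |x| ≤ n then |x| ^ (-(2 * e)) else 0) :=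
      (Measurable.ite (measurableSet_le measurable_norm measurable_const)
        (measurable_norm.pow_const _) measurable_const).ennreal_ofReal
    calc _ ≤ ∫⁻ x : ℝ, ENNReal.ofReal (2 / n ^ 2) *
          ENNReal.ofReal (if |x| ≤ n then |x| ^ (-(2 * e)) else 0) := by
          refine lintegral_mono fun x => ?_
          rw [← ENNReal.ofReal_mul (by positivity)]
          refine ENNReal.ofReal_le_ofReal ?_
          split_ifs with h1 h2 h2
          · have := resFn_ge_of_small hn0 hk h1
            have hinv : (1 + |resFn n k (splitCoord 0 x y)|)⁻¹ ≤ 2 / n ^ 2 := by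
              rw [← inv_div]
              exact inv_anti₀ (by positivity) (by linarith)
            rw [mul_comm]
            gcongr
          · have := abs_coord_le_norm (splitCoord 0 x y) 0
            rw [splitCoord_same] at this
            exact absurd (by linarith) h2
          · positivity
          · simp
      _ ≤ ENNReal.ofReal (2 / n ^ 2) *
          ENNReal.ofReal (2 * (n ^ (-(2 * e) + 1) / (-(2 * e) + 1))) := by
          rw [lintegral_const_mul _ hm]; gcongr
      _ ≤ _ := by
          rw [← ENNReal.ofReal_mul (by positivity)]
          refine ENNReal.ofReal_le_ofReal ?_
          have h1 : n ^ (-(2 * e) + 1) / (-(2 * e) + 1) ≤ 2 * n ^ (-(2 * e) + 1) := by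
            rw [div_le_iff₀ (by linarith)]
            have : 0 < n ^ (-(2 * e) + 1) := by positivity
            nlinarith
          have h2 : n ^ (-(2 * e) + 1) = n ^ 2 * (n ^ (-1 + 4 * e) * n ^ (-(6 * e))) := by
            rw [← Real.rpow_natCast n 2, ← Real.rpow_add hn0, ← Real.rpow_add hn0]
            congr 1; push_cast; ring
          have h3 : n ^ (-(6 * e)) ≤ c⁻¹ := by
            calc n ^ (-(6 * e)) ≤ c ^ (-(6 * e)) :=
                  Real.rpow_le_rpow_of_nonpos hc hn (by linarith)
              _ ≤ c ^ (-1 : ℝ) :=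
                  Real.rpow_le_rpow_of_exponent_ge hc hc1 (by linarith)
              _ = c⁻¹ := Real.rpow_neg_one c
          have hp : 0 < n ^ (-1 + 4 * e) := by positivity
          calc _ ≤ 2 / n ^ 2 * (2 * (2 * n ^ (-(2 * e) + 1))) := by gcongr
            _ = 8 * n ^ (-(6 * e)) * n ^ (-1 + 4 * e) := by rw [h2]; field_simp; ring
            _ ≤ _ := by
              gcongr
              have : 0 < 20 * (4 / e + 2) := by positivity
              linarith
  · push Not at hk
    obtain ⟨j, hj⟩ := hk
    refine ⟨j, fun y => ?_⟩
    have := lintegral_quadratic_one he he1 (n ^ 2 - k j ^ 2 / 2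
        - (k (j.succAbove 0) ^ 2 + k (j.succAbove 1) ^ 2) / 2
      - 2 * ((y.1 - k (j.succAbove 0) / 2) ^ 2 + (y.2 - k (j.succAbove 1) / 2) ^ 2)) hn0 hj
    refine le_trans (lintegral_mono fun x => ENNReal.ofReal_le_ofReal ?_) (this.trans ?_)
    · split_ifs with h1 h2 h2
      · refine le_of_eq ?_
        rw [resFn_split]
        congr 4
        ring
      · have := abs_coord_le_norm (splitCoord j x y) j
        rw [splitCoord_same] at this
        exact absurd (by linarith) h2
      · positivity
      · exact le_rfl
    · refine ENNReal.ofReal_le_ofReal ?_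
      gcongr
      have : 0 < 8 * c⁻¹ := by positivity
      linarith

theorem regionB_bound {c e : ℝ} (hc : 0 < c) (hc1 : c ≤ 1) (he : 0 < e) (he1 : e ≤ 1/10) :
    ∃ C > 0, ∀ N n : ℝ, 1 ≤ N → c * N ≤ n → ∀ k : E3,
    ∫⁻ η : E3, ENNReal.ofReal (if ‖η‖ ≤ n / 10 then
      ((refSymb N η)⁻¹) ^ 2 * (1 + |resFn n k η|)⁻¹ else 0)
      ≤ ENNReal.ofReal (C * N ^ (-1 + 6 * e)) := by
  obtain ⟨C1, hC1, hin⟩ := regionB_inner hc hc1 he he1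
  refine ⟨c ^ (-(1/3) : ℝ) * ((2 / e) * (2 / e)) * C1 * c ^ (-(2/3) + 6 * e), by positivity,
    fun N n hN hn k => ?_⟩
  have hN0 : 0 < N := by linarith
  have hn0 : 0 < n := lt_of_lt_of_le (by positivity) hn
  obtain ⟨j, hj⟩ := hin n (by nlinarith) k
  set D := c ^ (-(1/3) : ℝ) * (n / N) ^ (1/3 : ℝ) with hD
  have hD0 : 0 < D := by positivity
  let g : ℝ → ENNReal := fun x => ENNReal.ofReal (if |x| ≤ n then |x| ^ (-1 + e) else 0)
  have hgm : Measurable g :=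
    (Measurable.ite (measurableSet_le measurable_norm measurable_const)
        (measurable_norm.pow_const _) measurable_const).ennreal_ofReal
  let F : E3 → ENNReal := fun η => ENNReal.ofReal D *
    (g (η (j.succAbove 0)) * g (η (j.succAbove 1)) *
    ENNReal.ofReal (if ‖η‖ ≤ n / 10 then |η j| ^ (-(2 * e)) * (1 + |resFn n k η|)⁻¹ else 0))
  have hm3 : Measurable fun η : E3 => ENNReal.ofReal (if ‖η‖ ≤ n / 10 then
      |η j| ^ (-(2 * e)) * (1 + |resFn n k η|)⁻¹ else 0) := by
    have hmj : Measurable fun η : E3 => η j := by fun_prop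
    have hr := (continuous_resFn n k).measurable
    exact (Measurable.ite (measurableSet_le measurable_norm measurable_const)
      ((hmj.norm.pow_const _).mul ((hr.norm.const_add 1).inv)) measurable_const).ennreal_ofReal
  have hFm : Measurable F := by
    have hm : ∀ i, Measurable fun η : E3 => η i := fun i => by fun_prop
    exact measurable_const.mul (((hgm.comp (hm _)).mul (hgm.comp (hm _))).mul hm3)
  have step : ∫⁻ η : E3, ENNReal.ofReal (if ‖η‖ ≤ n / 10 then
      ((refSymb N η)⁻¹) ^ 2 * (1 + |resFn n k η|)⁻¹ else 0) ≤ ∫⁻ η, F η := by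
    refine lintegral_mono_ae ?_
    filter_upwards [ae_coord_ne_zero] with η hη
    by_cases h : ‖η‖ ≤ n / 10
    · have hle : ∀ i, |η i| ≤ n := fun i => (abs_coord_le_norm η i).trans (by linarith)
      have hx : 0 < ‖η‖ := (abs_pos.2 (hη 0)).trans_le (abs_coord_le_norm η 0)
      simp only [F, g, if_pos h, if_pos (hle _)]
      rw [← ENNReal.ofReal_mul (by positivity), ← ENNReal.ofReal_mul (by positivity),
        ← ENNReal.ofReal_mul (by positivity)]
      refine ENNReal.ofReal_le_ofReal ?_
      have h1 := refSymb_ge_of_le' hN hc hc1 hn (ξ := η) (by linarith)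
      have hpos : 0 < c ^ (1/6 : ℝ) * ((N / n) ^ (1/6 : ℝ) * ‖η‖) := by positivity
      have h2 : ((refSymb N η)⁻¹) ^ 2 ≤ D * (‖η‖⁻¹) ^ 2 := by
        calc _ ≤ ((c ^ (1/6 : ℝ) * ((N / n) ^ (1/6 : ℝ) * ‖η‖))⁻¹) ^ 2 :=
              pow_le_pow_left₀ (inv_nonneg.2 (refSymb_nonneg hN0.le η)) (inv_anti₀ hpos h1) 2
          _ = _ := by
            rw [hD, mul_inv, mul_inv, mul_pow, mul_pow, ← Real.rpow_neg hc.le,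
              ← Real.inv_rpow (by positivity), inv_div, ← Real.rpow_mul_natCast hc.le,
              ← Real.rpow_mul_natCast (by positivity)]
            norm_num
            ring
      calc _ ≤ D * (|η (j.succAbove 0)| ^ (-1 + e) * |η (j.succAbove 1)| ^ (-1 + e)
            * |η j| ^ (-(2 * e))) * (1 + |resFn n k η|)⁻¹ := by
            refine mul_le_mul_of_nonneg_right (h2.trans ?_) (by positivity)
            exact mul_le_mul_of_nonneg_left (norm_inv_sq_le he he1 j hη) hD0.le
        _ = _ := by ring
    · simp [h]
  refine step.trans ?_
  rw [lintegral_splitCoord' j hFm]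
  have hball := lintegral_abs_rpow_ball (p := -1 + e) (by linarith) hn0
  rw [show -1 + e + 1 = e by ring] at hball
  calc _ ≤ ∫⁻ y : ℝ × ℝ, ENNReal.ofReal D * (g y.1 * g y.2 *
          ENNReal.ofReal (C1 * n ^ (-1 + 4 * e))) := by
        refine lintegral_mono fun y => ?_
        simp only [F, splitCoord_zero, splitCoord_one, splitCoord_same]
        have hmx := hm3.comp ((measurable_splitCoord j).comp (measurable_prodMk_right (y := y)))
        simp only [Function.comp_def, splitCoord_same] at hmx
        rw [lintegral_const_mul _ (hmx.const_mul _), lintegral_const_mul _ hmx]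
        gcongr
        exact hj y
    _ = ENNReal.ofReal D * (((∫⁻ x, g x) * ∫⁻ x, g x) *
          ENNReal.ofReal (C1 * n ^ (-1 + 4 * e))) := by
        have hgg : Measurable fun y : ℝ × ℝ => g y.1 * g y.2 := by fun_prop
        rw [lintegral_const_mul _ (hgg.mul_const _), lintegral_mul_const _ hgg,
          Measure.volume_eq_prod, lintegral_prod_mul hgm.aemeasurable hgm.aemeasurable]
    _ ≤ ENNReal.ofReal D * ((ENNReal.ofReal (2 * (n ^ e / e)) * ENNReal.ofReal (2 * (n ^ e / e))) *
          ENNReal.ofReal (C1 * n ^ (-1 + 4 * e))) := by gcongr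
    _ ≤ _ := by
        rw [← ENNReal.ofReal_mul (by positivity), ← ENNReal.ofReal_mul (by positivity),
          ← ENNReal.ofReal_mul (by positivity)]
        refine ENNReal.ofReal_le_ofReal ?_
        have h1 : n ^ (-(2/3) + 6 * e) ≤ c ^ (-(2/3) + 6 * e) * N ^ (-(2/3) + 6 * e) := by
          rw [← Real.mul_rpow hc.le hN0.le]
          exact Real.rpow_le_rpow_of_nonpos (by positivity) hn (by linarith)
        have h2 : N ^ (-1 + 6 * e) = N ^ (-(1/3) : ℝ) * N ^ (-(2/3) + 6 * e) := by
          rw [← Real.rpow_add hN0]; congr 1; ring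
        have h3 : (n / N) ^ (1/3 : ℝ) * (n ^ e * n ^ e * n ^ (-1 + 4 * e)) =
            N ^ (-(1/3) : ℝ) * n ^ (-(2/3) + 6 * e) := by
          rw [Real.div_rpow hn0.le hN0.le, Real.rpow_neg hN0.le, div_mul_eq_mul_div,
            ← Real.rpow_add hn0, ← Real.rpow_add hn0, ← Real.rpow_add hn0, div_eq_inv_mul]
          congr 2; ring
        calc _ = c ^ (-(1/3) : ℝ) * ((2 / e) * (2 / e)) * C1 *
              ((n / N) ^ (1/3 : ℝ) * (n ^ e * n ^ e * n ^ (-1 + 4 * e))) := by rw [hD]; ring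
          _ ≤ c ^ (-(1/3) : ℝ) * ((2 / e) * (2 / e)) * C1 *
              (N ^ (-(1/3) : ℝ) * (c ^ (-(2/3) + 6 * e) * N ^ (-(2/3) + 6 * e))) := by
              rw [h3]; gcongr
          _ = _ := by rw [h2]; ring

/-- The resonant integral with a large frequency gains almost a full power of `N`. -/
theorem resonant_integral_bound {c e : ℝ} (hc : 0 < c) (hc1 : c ≤ 1) (he : 0 < e)
    (he1 : e ≤ 1/10) :
    ∃ C > 0, ∀ N n : ℝ, 1 ≤ N → 0 ≤ n → ∀ k : E3, ‖k‖ ^ 2 ≤ 2 * n ^ 2 →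
    ∫⁻ η : E3, ENNReal.ofReal (if c * N ≤ n ∨ c * N ≤ ‖η‖ then
      ((refSymb N η)⁻¹) ^ 2 * (1 + |resFn n k η|)⁻¹ else 0)
      ≤ ENNReal.ofReal (C * N ^ (-1 + 6 * e)) := by
  obtain ⟨CA, hCA, hA⟩ := regionA_bound (c := c / 10) (by positivity) (by linarith) he he1
  obtain ⟨CB, hCB, hB⟩ := regionB_bound hc hc1 he he1
  refine ⟨CA + CB, by positivity, fun N n hN hn k hk => ?_⟩
  have hN0 : 0 < N := by linarith
  have hmF : Measurable fun η : E3 => ((refSymb N η)⁻¹) ^ 2 * (1 + |resFn n k η|)⁻¹ := by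
    have hr := (continuous_resFn n k).measurable
    exact ((measurable_refSymb N).inv.pow_const 2).mul ((hr.norm.const_add 1).inv)
  have hF0 : ∀ η : E3, 0 ≤ ((refSymb N η)⁻¹) ^ 2 * (1 + |resFn n k η|)⁻¹ := fun η => by
    positivity
  have hmA : Measurable fun η : E3 => ENNReal.ofReal (if n / 10 ≤ ‖η‖ ∧ c / 10 * N ≤ ‖η‖ then
      ((refSymb N η)⁻¹) ^ 2 * (1 + |resFn n k η|)⁻¹ else 0) :=
    (Measurable.ite ((measurableSet_le measurable_const measurable_norm).inter
      (measurableSet_le measurable_const measurable_norm)) hmF measurable_const).ennreal_ofReal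
  by_cases hcn : c * N ≤ n
  · calc _ ≤ ∫⁻ η : E3, (ENNReal.ofReal (if n / 10 ≤ ‖η‖ ∧ c / 10 * N ≤ ‖η‖ then
          ((refSymb N η)⁻¹) ^ 2 * (1 + |resFn n k η|)⁻¹ else 0) +
          ENNReal.ofReal (if ‖η‖ ≤ n / 10 then
          ((refSymb N η)⁻¹) ^ 2 * (1 + |resFn n k η|)⁻¹ else 0)) := by
          refine lintegral_mono fun η => ?_
          rw [if_pos (Or.inl hcn)]
          rcases le_total ‖η‖ (n / 10) with h | h
          · rw [if_pos h]; exact le_add_self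
          · rw [if_pos ⟨h, by linarith⟩]; exact le_self_add
      _ ≤ ENNReal.ofReal (CA * N ^ (-1 + 2 * e)) + ENNReal.ofReal (CB * N ^ (-1 + 6 * e)) := by
          rw [lintegral_add_left hmA]
          exact add_le_add (hA N n hN hn k hk) (hB N n hN hcn k)
      _ ≤ _ := by
          rw [← ENNReal.ofReal_add (by positivity) (by positivity), add_mul]
          have : N ^ (-1 + 2 * e) ≤ N ^ (-1 + 6 * e) :=
            Real.rpow_le_rpow_of_exponent_le hN (by linarith)
          exact ENNReal.ofReal_le_ofReal (by gcongr)
  · calc _ ≤ ∫⁻ η : E3, ENNReal.ofReal (if n / 10 ≤ ‖η‖ ∧ c / 10 * N ≤ ‖η‖ then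
          ((refSymb N η)⁻¹) ^ 2 * (1 + |resFn n k η|)⁻¹ else 0) := by
          refine lintegral_mono fun η => ?_
          push Not at hcn
          split_ifs with h1 h2 h2
          · exact le_rfl
          · refine absurd ?_ h2
            rcases h1 with h1 | h1
            · linarith
            · constructor <;> linarith [(by positivity : 0 < c * N)]
          · simp
          · simp
      _ ≤ _ := (hA N n hN hn k hk).trans (ENNReal.ofReal_le_ofReal (by
          have : N ^ (-1 + 2 * e) ≤ N ^ (-1 + 6 * e) :=
            Real.rpow_le_rpow_of_exponent_le hN (by linarith)
          gcongr
          linarith))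

/-- The quadrilinear integral over `ξ - α + β - γ = 0`. -/
def quadInt (F : E3 → E3 → E3 → E3 → ENNReal) : ENNReal :=
  ∫⁻ ξ, ∫⁻ α, ∫⁻ β, F ξ α β (ξ - α + β)

/-- Joint measurability in the four frequencies. -/
def Meas4 (F : E3 → E3 → E3 → E3 → ENNReal) : Prop :=
  Measurable fun p : E3 × E3 × E3 × E3 => F p.1 p.2.1 p.2.2.1 p.2.2.2

theorem Meas4.comp {F : E3 → E3 → E3 → E3 → ENNReal} (hF : Meas4 F) {X : Type*}
    [MeasurableSpace X] {a b c d : X → E3} (ha : Measurable a) (hb : Measurable b)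
    (hc : Measurable c) (hd : Measurable d) : Measurable fun x => F (a x) (b x) (c x) (d x) :=
  Measurable.comp hF (ha.prodMk (hb.prodMk (hc.prodMk hd)))

theorem quadInt_mono {F G : E3 → E3 → E3 → E3 → ENNReal}
    (h : ∀ ξ α β γ, ξ - α + β - γ = 0 → F ξ α β γ ≤ G ξ α β γ) : quadInt F ≤ quadInt G :=
  lintegral_mono fun _ => lintegral_mono fun _ => lintegral_mono fun _ => h _ _ _ _ (by abel)

theorem quadInt_congr {F G : E3 → E3 → E3 → E3 → ENNReal}
    (h : ∀ ξ α β γ, ξ - α + β - γ = 0 → F ξ α β γ = G ξ α β γ) : quadInt F = quadInt G :=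
  le_antisymm (quadInt_mono fun _ _ _ _ e => (h _ _ _ _ e).le)
    (quadInt_mono fun _ _ _ _ e => (h _ _ _ _ e).ge)

theorem quadInt_add {F G : E3 → E3 → E3 → E3 → ENNReal} (hF : Meas4 F) :
    quadInt (fun ξ α β γ => F ξ α β γ + G ξ α β γ) ≤ quadInt F + quadInt G := by
  unfold quadInt
  have h1 : ∀ ξ α, Measurable fun β => F ξ α β (ξ - α + β) := fun ξ α =>
    hF.comp (by fun_prop) (by fun_prop) (by fun_prop) (by fun_prop)
  have h2 : ∀ ξ, Measurable fun α => ∫⁻ β, F ξ α β (ξ - α + β) := fun ξ => by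
    apply Measurable.lintegral_prod_right'
      (f := fun p : E3 × E3 => F ξ p.1 p.2 (ξ - p.1 + p.2))
    exact hF.comp (by fun_prop) (by fun_prop) (by fun_prop) (by fun_prop)
  have h3 : Measurable fun ξ => ∫⁻ α, ∫⁻ β, F ξ α β (ξ - α + β) := by
    apply Measurable.lintegral_prod_right'
      (f := fun p : E3 × E3 => ∫⁻ β, F p.1 p.2 β (p.1 - p.2 + β))
    apply Measurable.lintegral_prod_right'
      (f := fun p : (E3 × E3) × E3 => F p.1.1 p.1.2 p.2 (p.1.1 - p.1.2 + p.2))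
    exact hF.comp (by fun_prop) (by fun_prop) (by fun_prop) (by fun_prop)
  simp_rw [lintegral_add_left (h1 _ _), lintegral_add_left (h2 _)]
  rw [lintegral_add_left h3]

theorem quadInt_const_mul {F : E3 → E3 → E3 → E3 → ENNReal} {c : ENNReal} (hc : c ≠ ⊤) :
    quadInt (fun ξ α β γ => c * F ξ α β γ) = c * quadInt F := by
  unfold quadInt
  simp_rw [lintegral_const_mul' c _ hc]

theorem quadInt_omit_snd {F : E3 → E3 → E3 → E3 → ENNReal} (hF : Meas4 F) :
    quadInt F = ∫⁻ ξ, ∫⁻ β, ∫⁻ γ, F ξ (ξ + β - γ) β γ := by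
  unfold quadInt
  refine lintegral_congr fun ξ => ?_
  rw [lintegral_lintegral_swap]
  · refine lintegral_congr fun β => ?_
    rw [← lintegral_sub_left_eq_self (fun γ => F ξ (ξ + β - γ) β γ) (ξ + β)]
    refine lintegral_congr fun α => ?_
    congr 1 <;> abel
  · exact (hF.comp (by fun_prop) (by fun_prop) (by fun_prop) (by fun_prop)).aemeasurable

theorem quadInt_omit_third {F : E3 → E3 → E3 → E3 → ENNReal} :
    quadInt F = ∫⁻ ξ, ∫⁻ α, ∫⁻ γ, F ξ α (γ - ξ + α) γ := by
  unfold quadInt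
  refine lintegral_congr fun ξ => lintegral_congr fun α => ?_
  rw [← lintegral_add_left_eq_self (fun γ => F ξ α (γ - ξ + α) γ) (ξ - α)]
  refine lintegral_congr fun β => ?_
  congr 1; abel

theorem quadInt_omit_fst {F : E3 → E3 → E3 → E3 → ENNReal} (hF : Meas4 F) :
    quadInt F = ∫⁻ α, ∫⁻ γ, ∫⁻ β, F (α - β + γ) α β γ := by
  unfold quadInt
  rw [lintegral_lintegral_swap]
  · refine lintegral_congr fun α => ?_
    calc ∫⁻ ξ, ∫⁻ β, F ξ α β (ξ - α + β) = ∫⁻ β, ∫⁻ ξ, F ξ α β (ξ - α + β) :=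
          lintegral_lintegral_swap
            (hF.comp (by fun_prop) (by fun_prop) (by fun_prop) (by fun_prop)).aemeasurable
      _ = ∫⁻ β, ∫⁻ γ, F (α - β + γ) α β γ := by
          refine lintegral_congr fun β => ?_
          rw [← lintegral_add_left_eq_self (fun γ => F (α - β + γ) α β γ) (β - α)]
          refine lintegral_congr fun ξ => ?_
          congr 1 <;> abel
      _ = _ := lintegral_lintegral_swap
            (hF.comp (by fun_prop) (by fun_prop) (by fun_prop) (by fun_prop)).aemeasurable
  · refine Measurable.aemeasurable ?_
    apply Measurable.lintegral_prod_right'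
      (f := fun p : (E3 × E3) × E3 => F p.1.1 p.1.2 p.2 (p.1.1 - p.1.2 + p.2))
    exact hF.comp (by fun_prop) (by fun_prop) (by fun_prop) (by fun_prop)

theorem quadInt_swap_snd_fourth {F : E3 → E3 → E3 → E3 → ENNReal} (hF : Meas4 F) :
    quadInt F = quadInt fun ξ α β γ => F ξ γ β α := by
  rw [quadInt_omit_snd hF]
  unfold quadInt
  refine lintegral_congr fun ξ => ?_
  rw [lintegral_lintegral_swap]
  · refine lintegral_congr fun α => lintegral_congr fun β => ?_
    congr 1; abel
  · exact (hF.comp (by fun_prop) (by fun_prop) (by fun_prop) (by fun_prop)).aemeasurable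

theorem ENNReal.mul_le_sq_add_sq (x y : ENNReal) : x * y ≤ x ^ 2 + y ^ 2 := by
  rcases le_total x y with h | h
  · calc x * y ≤ y * y := by gcongr
      _ = y ^ 2 := (sq y).symm
      _ ≤ _ := le_add_self
  · calc x * y ≤ x * x := by gcongr
      _ = x ^ 2 := (sq x).symm
      _ ≤ _ := le_self_add

/-- The resonance function in four frequencies. -/
def res4 (ξ α β γ : E3) : ℝ := ‖ξ‖ ^ 2 - ‖α‖ ^ 2 + ‖β‖ ^ 2 - ‖γ‖ ^ 2

/-- The quadrilinear kernel with high second frequency. -/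
def topKernel (c N : ℝ) (ξ α β γ : E3) : ℝ :=
  if c * N ≤ ‖α‖ then (refSymb N β)⁻¹ * (refSymb N γ)⁻¹ * (1 + |res4 ξ α β γ|)⁻¹ else 0

theorem quadInt_fst_le {w : E3 → E3 → E3 → E3 → ENNReal} (hw : Meas4 w) {b : E3 → ENNReal}
    (hb : Measurable b) {K : ENNReal} (h : ∀ α γ, ∫⁻ β, w (α - β + γ) α β γ ≤ K) :
    quadInt (fun ξ α β γ => w ξ α β γ * (b α * b γ)) ≤ K * (∫⁻ η, b η) ^ 2 := by
  have hm : Meas4 fun ξ α β γ => w ξ α β γ * (b α * b γ) := by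
    unfold Meas4 at hw ⊢; exact hw.mul (by fun_prop)
  rw [quadInt_omit_fst hm]
  have hwm : ∀ α γ, Measurable fun β => w (α - β + γ) α β γ := fun α γ =>
    hw.comp (by fun_prop) (by fun_prop) (by fun_prop) (by fun_prop)
  calc ∫⁻ α, ∫⁻ γ, ∫⁻ β, w (α - β + γ) α β γ * (b α * b γ)
      ≤ ∫⁻ α, ∫⁻ γ, K * (b α * b γ) := by
        refine lintegral_mono fun α => lintegral_mono fun γ => ?_
        simp only
        rw [lintegral_mul_const _ (hwm α γ)]
        gcongr; exact h α γ
    _ = K * (∫⁻ η, b η) ^ 2 := by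
        simp_rw [fun α γ => show K * (b α * b γ) = (K * b α) * b γ by ring]
        simp_rw [lintegral_const_mul _ hb]
        rw [lintegral_mul_const _ (by fun_prop), lintegral_const_mul _ hb]; ring

theorem quadInt_snd_le {w : E3 → E3 → E3 → E3 → ENNReal} (hw : Meas4 w) {b : E3 → ENNReal}
    (hb : Measurable b) {K : ENNReal} (h : ∀ ξ β, ∫⁻ γ, w ξ (ξ + β - γ) β γ ≤ K) :
    quadInt (fun ξ α β γ => w ξ α β γ * (b ξ * b β)) ≤ K * (∫⁻ η, b η) ^ 2 := by
  have hm : Meas4 fun ξ α β γ => w ξ α β γ * (b ξ * b β) := by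
    unfold Meas4 at hw ⊢; exact hw.mul (by fun_prop)
  rw [quadInt_omit_snd hm]
  have hwm : ∀ ξ β, Measurable fun γ => w ξ (ξ + β - γ) β γ := fun α γ =>
    hw.comp (by fun_prop) (by fun_prop) (by fun_prop) (by fun_prop)
  calc ∫⁻ ξ, ∫⁻ β, ∫⁻ γ, w ξ (ξ + β - γ) β γ * (b ξ * b β)
      ≤ ∫⁻ ξ, ∫⁻ β, K * (b ξ * b β) := by
        refine lintegral_mono fun ξ => lintegral_mono fun β => ?_
        simp only
        rw [lintegral_mul_const _ (hwm ξ β)]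
        gcongr; exact h ξ β
    _ = K * (∫⁻ η, b η) ^ 2 := by
        simp_rw [fun α γ => show K * (b α * b γ) = (K * b α) * b γ by ring]
        simp_rw [lintegral_const_mul _ hb]
        rw [lintegral_mul_const _ (by fun_prop), lintegral_const_mul _ hb]; ring

theorem measurable_indicator_kernel (c N : ℝ) {r : E3 → E3 → E3 → E3 → ℝ}
    (hr : Measurable fun p : E3 × E3 × E3 × E3 => r p.1 p.2.1 p.2.2.1 p.2.2.2) :
    Meas4 fun ξ α β γ => ENNReal.ofReal (if c * N ≤ ‖α‖ then r ξ α β γ else 0) := by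
  unfold Meas4
  refine ENNReal.measurable_ofReal.comp ?_
  exact Measurable.ite (measurableSet_le (by fun_prop) (by fun_prop)) hr measurable_const

theorem measurable_res4 : Measurable fun p : E3 × E3 × E3 × E3 =>
    res4 p.1 p.2.1 p.2.2.1 p.2.2.2 := by
  unfold res4; fun_prop

theorem norm_add_sq_le_two (x y : E3) : ‖x + y‖ ^ 2 ≤ 2 * (‖x‖ ^ 2 + ‖y‖ ^ 2) := by
  nlinarith [norm_add_le x y, norm_nonneg x, norm_nonneg y, norm_nonneg (x + y),
    sq_nonneg (‖x‖ - ‖y‖)]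

theorem quadInt_topKernel_le {c e : ℝ} (hc : 0 < c) (hc1 : c ≤ 1) (he : 0 < e) (he1 : e ≤ 1 / 10) :
    ∃ C > 0, ∀ N : ℝ, 1 ≤ N → ∀ a : E3 → ENNReal, Measurable a →
      quadInt (fun ξ α β γ => ENNReal.ofReal (topKernel c N ξ α β γ) *
        (a ξ * a α * a β * a γ)) ≤ ENNReal.ofReal (C * N ^ (-1 + 6 * e)) * (∫⁻ η, a η ^ 2) ^ 2 := by
  obtain ⟨C, hC, hS⟩ := resonant_integral_bound (c := c / 3) (e := e) (by positivity)
    (by linarith) he he1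
  refine ⟨2 * C, by positivity, fun N hN a ha => ?_⟩
  set w1 : E3 → E3 → E3 → E3 → ENNReal := fun ξ α β γ => ENNReal.ofReal
    (if c * N ≤ ‖α‖ then ((refSymb N β)⁻¹) ^ 2 * (1 + |res4 ξ α β γ|)⁻¹ else 0) with hw1
  set w2 : E3 → E3 → E3 → E3 → ENNReal := fun ξ α β γ => ENNReal.ofReal
    (if c * N ≤ ‖α‖ then ((refSymb N γ)⁻¹) ^ 2 * (1 + |res4 ξ α β γ|)⁻¹ else 0) with hw2
  have hrm := measurable_refSymb N
  have hr4 := measurable_res4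
  have m1 : Meas4 w1 := by
    apply measurable_indicator_kernel
    have : Measurable fun p : E3 × E3 × E3 × E3 => refSymb N p.2.2.1 := hrm.comp (by fun_prop)
    have := hr4.abs
    fun_prop
  have m2 : Meas4 w2 := by
    apply measurable_indicator_kernel
    have : Measurable fun p : E3 × E3 × E3 × E3 => refSymb N p.2.2.2 := hrm.comp (by fun_prop)
    have := hr4.abs
    fun_prop
  have hab : Measurable fun η => a η ^ 2 := ha.pow_const 2
  have b1 : ∀ α γ, ∫⁻ β, w1 (α - β + γ) α β γ ≤ ENNReal.ofReal (C * N ^ (-1 + 6 * e)) := by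
    intro α γ
    set n := √(‖α‖ ^ 2 + ‖γ‖ ^ 2) with hn
    have hn2 : n ^ 2 = ‖α‖ ^ 2 + ‖γ‖ ^ 2 := Real.sq_sqrt (by positivity)
    refine le_trans (lintegral_mono fun β => ?_) (hS N n hN (Real.sqrt_nonneg _) (α + γ)
      (by rw [hn2]; exact norm_add_sq_le_two _ _))
    apply ENNReal.ofReal_le_ofReal
    have hr : |resFn n (α + γ) β| = |res4 (α - β + γ) α β γ| := by
      rw [← abs_neg]; congr 1
      simp only [resFn, res4, hn2, show α + γ - β = α - β + γ by abel]; ring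
    rw [hr]
    split_ifs with h1 h2
    · exact le_rfl
    · exfalso; apply h2; left
      have : ‖α‖ ≤ n := Real.le_sqrt_of_sq_le (by nlinarith [sq_nonneg ‖γ‖])
      nlinarith [mul_pos hc (by linarith : 0 < N)]
    · positivity
    · exact le_rfl
  have b2 : ∀ ξ β, ∫⁻ γ, w2 ξ (ξ + β - γ) β γ ≤ ENNReal.ofReal (C * N ^ (-1 + 6 * e)) := by
    intro ξ β
    set n := √(‖ξ‖ ^ 2 + ‖β‖ ^ 2) with hn
    have hn0 : 0 ≤ n := Real.sqrt_nonneg _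
    have hn2 : n ^ 2 = ‖ξ‖ ^ 2 + ‖β‖ ^ 2 := Real.sq_sqrt (by positivity)
    have hk : ‖ξ + β‖ ^ 2 ≤ 2 * n ^ 2 := by rw [hn2]; exact norm_add_sq_le_two _ _
    refine le_trans (lintegral_mono fun γ => ?_) (hS N n hN hn0 (ξ + β) hk)
    apply ENNReal.ofReal_le_ofReal
    have hr : |resFn n (ξ + β) γ| = |res4 ξ (ξ + β - γ) β γ| := by
      congr 1
      simp only [resFn, res4, hn2]; ring
    rw [hr]
    split_ifs with h1 h2
    · exact le_rfl
    · exfalso; apply h2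
      by_contra! h3
      have h4 : ‖ξ + β - γ‖ ≤ ‖ξ + β‖ + ‖γ‖ := norm_sub_le _ _
      have h5 : ‖ξ + β‖ ≤ 2 * n := abs_le_of_sq_le_sq' (by nlinarith) (by positivity) |>.2
      nlinarith
    · positivity
    · exact le_rfl
  calc _ ≤ quadInt (fun ξ α β γ => w1 ξ α β γ * (a α ^ 2 * a γ ^ 2) +
          w2 ξ α β γ * (a ξ ^ 2 * a β ^ 2)) := by
        refine quadInt_mono fun ξ α β γ _ => ?_
        simp only [topKernel, hw1, hw2]
        split_ifs with h
        · have hβ := inv_nonneg.2 (refSymb_nonneg (by linarith : 0 ≤ N) β)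
          have hγ := inv_nonneg.2 (refSymb_nonneg (by linarith : 0 ≤ N) γ)
          have hr : 0 ≤ (1 + |res4 ξ α β γ|)⁻¹ := by positivity
          rw [ENNReal.ofReal_mul (by positivity), ENNReal.ofReal_mul (by positivity),
            ENNReal.ofReal_mul (by positivity), ENNReal.ofReal_mul (by positivity),
            ENNReal.ofReal_pow hβ, ENNReal.ofReal_pow hγ]
          calc _ = ENNReal.ofReal (1 + |res4 ξ α β γ|)⁻¹ *
                ((ENNReal.ofReal (refSymb N β)⁻¹ * (a α * a γ)) *
                (ENNReal.ofReal (refSymb N γ)⁻¹ * (a ξ * a β))) := by ring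
            _ ≤ ENNReal.ofReal (1 + |res4 ξ α β γ|)⁻¹ *
                ((ENNReal.ofReal (refSymb N β)⁻¹ * (a α * a γ)) ^ 2 +
                (ENNReal.ofReal (refSymb N γ)⁻¹ * (a ξ * a β)) ^ 2) := by
              gcongr; exact ENNReal.mul_le_sq_add_sq _ _
            _ = _ := by ring
        · simp
    _ ≤ _ := by
        refine (quadInt_add (by unfold Meas4 at m1 ⊢; exact m1.mul (by fun_prop))).trans ?_
        refine (add_le_add (quadInt_fst_le m1 hab b1) (quadInt_snd_le m2 hab b2)).trans ?_
        rw [← two_mul, ← mul_assoc, mul_assoc 2 C, ENNReal.ofReal_mul (by norm_num : (0:ℝ) ≤ 2)]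
        simp

theorem sq_lintegral_mul_le {X : Type*} [MeasurableSpace X] (μ : Measure X) {f g : X → ENNReal}
    (hf : AEMeasurable f μ) (hg : AEMeasurable g μ) :
    (∫⁻ x, f x * g x ∂μ) ^ 2 ≤ (∫⁻ x, f x ^ 2 ∂μ) * ∫⁻ x, g x ^ 2 ∂μ := by
  have h := ENNReal.lintegral_mul_le_Lp_mul_Lq μ Real.HolderConjugate.two_two hf hg
  simp only [Pi.mul_apply, ENNReal.rpow_two] at h
  calc (∫⁻ x, f x * g x ∂μ) ^ 2 ≤
      ((∫⁻ x, f x ^ 2 ∂μ) ^ (1 / 2 : ℝ) * (∫⁻ x, g x ^ 2 ∂μ) ^ (1 / 2 : ℝ)) ^ 2 := by gcongr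
    _ = _ := by
      rw [mul_pow, ← ENNReal.rpow_natCast, ← ENNReal.rpow_natCast, ← ENNReal.rpow_mul,
        ← ENNReal.rpow_mul]
      norm_num

/-- The weight turning `L²` into `L¹` after division by `refSymb`. -/
def weightL1 (e N : ℝ) (ξ : E3) : ℝ :=
  max (max 1 ‖ξ‖ ^ (1 / 2 + e)) (N ^ (-(1 / 6) : ℝ) * max 1 ‖ξ‖ ^ (2 / 3 + e))

theorem measurable_weightL1 (e N : ℝ) : Measurable (weightL1 e N) := by
  unfold weightL1; fun_prop

theorem weightL1_pos (e N : ℝ) (ξ : E3) : 0 < weightL1 e N ξ :=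
  lt_max_of_lt_left (by positivity)

theorem weightL1_mono {e N : ℝ} (he : 0 < e) (hN : 0 ≤ N) {ξ η : E3} (h : ‖ξ‖ ≤ ‖η‖) :
    weightL1 e N ξ ≤ weightL1 e N η := by
  unfold weightL1
  gcongr

/-- A radial integrable majorant of `(refSymb * weightL1)⁻²`. -/
def radialMajorant (e y : ℝ) : ℝ := if y ≤ 1 then y ^ (-2 : ℝ) else y ^ (-3 - 2 * e)

theorem integrable_radialMajorant {e : ℝ} (he : 0 < e) :
    Integrable fun ξ : E3 => radialMajorant e ‖ξ‖ := by
  rw [integrable_fun_norm_addHaar volume (f := radialMajorant e)]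
  have hd : Module.finrank ℝ E3 = 3 := by simp
  rw [hd, ← Ioc_union_Ioi_eq_Ioi (zero_le_one (α := ℝ)), integrableOn_union]
  constructor
  · refine IntegrableOn.congr_fun (f := fun _ => (1 : ℝ)) (by simp) ?_ measurableSet_Ioc
    intro y hy
    simp only [radialMajorant, if_pos hy.2, smul_eq_mul]
    rw [← Real.rpow_natCast, ← Real.rpow_add hy.1]; norm_num
  · have := integrableOn_Ioi_rpow_of_lt (a := -1 - 2 * e) (c := 1) (by linarith) one_pos
    refine IntegrableOn.congr_fun this ?_ measurableSet_Ioi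
    intro y hy
    have hy' : (1 : ℝ) < y := hy
    simp only [radialMajorant, if_neg (not_le.2 hy'), smul_eq_mul]
    rw [← Real.rpow_natCast, ← Real.rpow_add (by linarith)]
    congr 1; norm_num; ring

theorem inv_refSymb_weightL1_sq_le {e N : ℝ} (hN : 1 ≤ N) {ξ : E3} :
    ((refSymb N ξ * weightL1 e N ξ)⁻¹) ^ 2 ≤ radialMajorant e ‖ξ‖ := by
  have hN0 : 0 < N := by linarith
  rcases eq_or_ne ξ 0 with rfl | hξ
  · simp [refSymb, radialMajorant]
  have hr : 0 < ‖ξ‖ := norm_pos_iff.2 hξ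
  set r := ‖ξ‖ with hrr
  have key : ∀ L : ℝ, 0 < L → L ≤ r * max 1 r ^ (1 / 2 + e) →
      L ≤ r ^ (5 / 6 : ℝ) * max 1 r ^ (2 / 3 + e) → L ≤ refSymb N ξ * weightL1 e N ξ := by
    intro L hL h1 h2
    unfold refSymb weightL1
    rw [← hrr]
    rcases le_total r (N ^ (1 / 6 : ℝ) * r ^ (5 / 6 : ℝ)) with h | h
    · rw [min_eq_left h]
      exact h1.trans (by gcongr; exact le_max_left _ _)
    · rw [min_eq_right h]
      calc L ≤ r ^ (5 / 6 : ℝ) * max 1 r ^ (2 / 3 + e) := h2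
        _ = N ^ (1 / 6 : ℝ) * r ^ (5 / 6 : ℝ) * (N ^ (-(1 / 6) : ℝ) * max 1 r ^ (2 / 3 + e)) := by
            have : N ^ (1 / 6 : ℝ) * N ^ (-(1 / 6) : ℝ) = 1 := by
              rw [← Real.rpow_add hN0]; norm_num
            linear_combination (-(r ^ (5 / 6 : ℝ) * max 1 r ^ (2 / 3 + e))) * this
        _ ≤ _ := by gcongr; exact le_max_right _ _
  have hi : 0 ≤ (refSymb N ξ * weightL1 e N ξ)⁻¹ :=
    inv_nonneg.2 (mul_nonneg (refSymb_nonneg hN0.le ξ) (weightL1_pos e N ξ).le)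
  unfold radialMajorant
  split_ifs with h
  · have := key r hr (by rw [max_eq_left h]; simp) (by
      rw [max_eq_left h, Real.one_rpow, mul_one]
      exact Real.self_le_rpow_of_le_one hr.le h (by norm_num))
    rw [Real.rpow_neg hr.le, Real.rpow_two, ← inv_pow]
    gcongr
  · have h' : 1 ≤ r := by linarith
    have := key (r ^ (3 / 2 + e)) (by positivity) (by
        rw [max_eq_right h']; nth_rw 2 [← Real.rpow_one r]
        rw [← Real.rpow_add hr]; apply le_of_eq; congr 1; ring) (by
        rw [max_eq_right h', ← Real.rpow_add hr]; apply le_of_eq; congr 1; ring)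
    calc ((refSymb N ξ * weightL1 e N ξ)⁻¹) ^ 2 ≤ ((r ^ (3 / 2 + e))⁻¹) ^ 2 := by gcongr
      _ = _ := by
        rw [← Real.rpow_neg hr.le, ← Real.rpow_natCast, ← Real.rpow_mul hr.le]
        congr 1; norm_num; ring

theorem weight_pair_bound {c e : ℝ} (hc : 0 < c) (hc1 : c ≤ 1) (he : 0 < e) (he1 : e ≤ 1 / 10) :
    ∃ C > 0, ∀ N : ℝ, 1 ≤ N → ∀ x y : E3, c * N ≤ ‖x‖ → ‖x‖ / 3 ≤ ‖y‖ →
      weightL1 e N x ^ 2 * ((refSymb N x)⁻¹ * (refSymb N y)⁻¹) ≤ C * N ^ (-1 + 2 * e) := by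
  set D := c ^ (-(1 / 6) : ℝ) * c⁻¹ ^ (2 / 3 + e) with hD
  set B := (c / 3) ^ (1 / 6 : ℝ) * 3⁻¹ ^ (5 / 6 : ℝ) with hB
  have hD0 : 0 < D := by positivity
  have hB0 : 0 < B := by positivity
  refine ⟨D ^ 2 * (B⁻¹) ^ 2 * c ^ (-(1 / 3) + 2 * e), by positivity, fun N hN x y hx hy => ?_⟩
  have hN0 : 0 < N := by linarith
  set r := ‖x‖ with hr
  have hcr : c ≤ r := by nlinarith
  have hr0 : 0 < r := by linarith
  have h6 : N ^ (-(1 / 6) : ℝ) ≤ 1 := Real.rpow_le_one_of_one_le_of_nonpos hN (by norm_num)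
  have hJ : max 1 r ≤ c⁻¹ * r := by
    apply max_le
    · rw [inv_mul_eq_div, le_div_iff₀ hc]; linarith
    · exact le_mul_of_one_le_left hr0.le (one_le_inv_iff₀.2 ⟨hc, hc1⟩)
  have hJ' : c * N ≤ max 1 r := hx.trans (le_max_right _ _)
  have hw : weightL1 e N x ≤ D * (N ^ (-(1 / 6) : ℝ) * r ^ (2 / 3 + e)) := by
    have h1 : c ^ (-(1 / 6) : ℝ) * (N ^ (-(1 / 6) : ℝ) * max 1 r ^ (2 / 3 + e)) ≤
        D * (N ^ (-(1 / 6) : ℝ) * r ^ (2 / 3 + e)) := by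
      calc _ ≤ c ^ (-(1 / 6) : ℝ) * (N ^ (-(1 / 6) : ℝ) * (c⁻¹ * r) ^ (2 / 3 + e)) := by gcongr
        _ = _ := by rw [Real.mul_rpow (by positivity) hr0.le, hD]; ring
    refine max_le ?_ ?_
    · refine le_trans ?_ h1
      have hj0 : 0 < max 1 r := by positivity
      calc max 1 r ^ (1 / 2 + e) = max 1 r ^ (-(1 / 6) : ℝ) * max 1 r ^ (2 / 3 + e) := by
            rw [← Real.rpow_add hj0]; congr 1; ring
        _ ≤ (c * N) ^ (-(1 / 6) : ℝ) * max 1 r ^ (2 / 3 + e) := by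
            gcongr ?_ * _
            exact Real.rpow_le_rpow_of_nonpos (by positivity) hJ' (by norm_num)
        _ = _ := by rw [Real.mul_rpow hc.le hN0.le]; ring
    · refine le_trans ?_ h1
      exact le_mul_of_one_le_left (by positivity)
        (Real.one_le_rpow_of_pos_of_le_one_of_nonpos hc hc1 (by norm_num))
  have hΘ : ∀ z : E3, r / 3 ≤ ‖z‖ → B * (N ^ (1 / 6 : ℝ) * r ^ (5 / 6 : ℝ)) ≤ refSymb N z := by
    intro z hz
    refine le_trans ?_ (refSymb_ge_of_le hN (by positivity : 0 < c / 3) (by linarith)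
      (by linarith : c / 3 * N ≤ ‖z‖))
    calc _ = (c / 3) ^ (1 / 6 : ℝ) * (N ^ (1 / 6 : ℝ) * (3⁻¹ * r) ^ (5 / 6 : ℝ)) := by
          rw [Real.mul_rpow (by positivity) hr0.le, hB]; ring
      _ ≤ _ := by gcongr; linarith
  have hx' := hΘ x (by linarith)
  have hy' := hΘ y hy
  have hw0 := weightL1_pos e N x
  have hp : 0 < B * (N ^ (1 / 6 : ℝ) * r ^ (5 / 6 : ℝ)) := by positivity
  calc weightL1 e N x ^ 2 * ((refSymb N x)⁻¹ * (refSymb N y)⁻¹)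
      ≤ (D * (N ^ (-(1 / 6) : ℝ) * r ^ (2 / 3 + e))) ^ 2 *
        ((B * (N ^ (1 / 6 : ℝ) * r ^ (5 / 6 : ℝ)))⁻¹ *
          (B * (N ^ (1 / 6 : ℝ) * r ^ (5 / 6 : ℝ)))⁻¹) := by
        have h0 : 0 ≤ (refSymb N y)⁻¹ := inv_nonneg.2 (refSymb_nonneg hN0.le y)
        have h0' : 0 ≤ (refSymb N x)⁻¹ := inv_nonneg.2 (refSymb_nonneg hN0.le x)
        gcongr
    _ = D ^ 2 * (B⁻¹) ^ 2 * (N ^ (-(2 / 3) : ℝ) * r ^ (-(1 / 3) + 2 * e)) := by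
        have e1 : N ^ (-(2 / 3) : ℝ) = (N ^ (-(1 / 6) : ℝ)) ^ 2 * ((N ^ (1 / 6 : ℝ))⁻¹) ^ 2 := by
          rw [← Real.rpow_neg hN0.le, ← Real.rpow_natCast,
            ← Real.rpow_mul hN0.le, ← Real.rpow_add hN0]; norm_num
        have e2 : r ^ (-(1 / 3) + 2 * e) = (r ^ (2 / 3 + e)) ^ 2 * ((r ^ (5 / 6 : ℝ))⁻¹) ^ 2 := by
          rw [← Real.rpow_neg hr0.le, ← Real.rpow_natCast, ← Real.rpow_natCast,
            ← Real.rpow_mul hr0.le, ← Real.rpow_mul hr0.le, ← Real.rpow_add hr0]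
          congr 1; norm_num; ring
        rw [e1, e2, mul_inv, mul_inv]; ring
    _ ≤ D ^ 2 * (B⁻¹) ^ 2 * (N ^ (-(2 / 3) : ℝ) * (c * N) ^ (-(1 / 3) + 2 * e)) := by
        gcongr _ * (_ * ?_)
        exact Real.rpow_le_rpow_of_nonpos (by positivity) hx (by linarith)
    _ = _ := by
        have e3 : N ^ (-1 + 2 * e) = N ^ (-(2 / 3) : ℝ) * N ^ (-(1 / 3) + 2 * e) := by
          rw [← Real.rpow_add hN0]; congr 1; ring
        rw [Real.mul_rpow hc.le hN0.le, e3]; ring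

section prod
variable {u v w : E3 → ENNReal}

theorem lintegral_prod_three (hu : Measurable u) (hv : Measurable v) (hw : Measurable w) :
    ∫⁻ x, ∫⁻ y, ∫⁻ z, u x * v y * w z = (∫⁻ x, u x) * (∫⁻ y, v y) * ∫⁻ z, w z := by
  simp_rw [lintegral_const_mul _ hw]
  simp_rw [fun x y => show u x * v y * (∫⁻ z, w z) = (u x * (∫⁻ z, w z)) * v y by ring]
  simp_rw [lintegral_const_mul _ hv, mul_assoc]
  rw [lintegral_mul_const _ hu]; ring

theorem quadInt_prod_omit_fourth (hu : Measurable u) (hv : Measurable v) (hw : Measurable w) :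
    quadInt (fun ξ α β _ => u ξ * v α * w β) = (∫⁻ x, u x) * (∫⁻ y, v y) * ∫⁻ z, w z :=
  lintegral_prod_three hu hv hw

theorem quadInt_prod_omit_third (hu : Measurable u) (hv : Measurable v) (hw : Measurable w) :
    quadInt (fun ξ α _ γ => u ξ * v α * w γ) = (∫⁻ x, u x) * (∫⁻ y, v y) * ∫⁻ z, w z := by
  rw [quadInt_omit_third]; exact lintegral_prod_three hu hv hw

theorem quadInt_prod_omit_snd (hu : Measurable u) (hv : Measurable v) (hw : Measurable w) :
    quadInt (fun ξ _ β γ => u ξ * v β * w γ) = (∫⁻ x, u x) * (∫⁻ y, v y) * ∫⁻ z, w z := by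
  rw [quadInt_omit_snd (by unfold Meas4; fun_prop)]; exact lintegral_prod_three hu hv hw

theorem quadInt_prod_omit_fst (hu : Measurable u) (hv : Measurable v) (hw : Measurable w) :
    quadInt (fun _ α β γ => u α * v β * w γ) = (∫⁻ x, u x) * (∫⁻ y, v y) * ∫⁻ z, w z := by
  rw [quadInt_omit_fst (by unfold Meas4; fun_prop)]
  simp_rw [fun α γ β => show u α * v β * w γ = u α * w γ * v β by ring]
  rw [lintegral_prod_three hu hw hv]; ring

end prod

/-- The two-tops product `(a(x)² + a(y)²) g(b) g(c)`. -/
def twoTops (a g : E3 → ENNReal) (x y b c : E3) : ENNReal := (a x ^ 2 + a y ^ 2) * (g b * g c)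

theorem twoTops_symm (a g : E3 → ENNReal) (x y b c : E3) :
    twoTops a g x y b c = twoTops a g y x b c := by unfold twoTops; ring

/-- Sum of `twoTops` over all pairs of frequencies. -/
def allTops (a g : E3 → ENNReal) (ξ α β γ : E3) : ENNReal :=
  twoTops a g ξ α β γ + twoTops a g ξ β α γ + twoTops a g ξ γ α β + twoTops a g α β ξ γ +
    twoTops a g α γ ξ β + twoTops a g β γ ξ α

theorem quadInt_allTops_le {a g : E3 → ENNReal} (ha : Measurable a) (hg : Measurable g) :
    quadInt (allTops a g) ≤ 12 * ((∫⁻ η, a η ^ 2) * (∫⁻ η, g η) ^ 2) := by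
  have ha2 : Measurable fun η => a η ^ 2 := ha.pow_const 2
  set K := (∫⁻ η, a η ^ 2) * (∫⁻ η, g η) ^ 2 with hK
  have two : ∀ F G : E3 → E3 → E3 → E3 → ENNReal, Meas4 F → quadInt F = K → quadInt G = K →
      quadInt (fun ξ α β γ => F ξ α β γ + G ξ α β γ) ≤ 2 * K := by
    intro F G hF h1 h2
    refine (quadInt_add hF).trans ?_
    rw [h1, h2, two_mul]
  have t1 : quadInt (fun ξ α β γ => twoTops a g ξ α β γ) ≤ 2 * K := by
    refine le_trans (quadInt_congr fun ξ α β γ _ => ?_).le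
      (two (fun ξ α β γ => a ξ ^ 2 * g β * g γ) (fun ξ α β γ => a α ^ 2 * g β * g γ)
        (by unfold Meas4; fun_prop) ?_ ?_)
    · unfold twoTops; ring
    · rw [quadInt_prod_omit_snd ha2 hg hg]; ring
    · rw [quadInt_prod_omit_fst ha2 hg hg]; ring
  have t2 : quadInt (fun ξ α β γ => twoTops a g ξ β α γ) ≤ 2 * K := by
    refine le_trans (quadInt_congr fun ξ α β γ _ => ?_).le
      (two (fun ξ α β γ => a ξ ^ 2 * g α * g γ) (fun ξ α β γ => g α * a β ^ 2 * g γ)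
        (by unfold Meas4; fun_prop) ?_ ?_)
    · unfold twoTops; ring
    · rw [quadInt_prod_omit_third ha2 hg hg]; ring
    · rw [quadInt_prod_omit_fst hg ha2 hg]; ring
  have t3 : quadInt (fun ξ α β γ => twoTops a g ξ γ α β) ≤ 2 * K := by
    refine le_trans (quadInt_congr fun ξ α β γ _ => ?_).le
      (two (fun ξ α β γ => a ξ ^ 2 * g α * g β) (fun ξ α β γ => g α * g β * a γ ^ 2)
        (by unfold Meas4; fun_prop) ?_ ?_)
    · unfold twoTops; ring
    · rw [quadInt_prod_omit_fourth ha2 hg hg]; ring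
    · rw [quadInt_prod_omit_fst hg hg ha2]; ring
  have t4 : quadInt (fun ξ α β γ => twoTops a g α β ξ γ) ≤ 2 * K := by
    refine le_trans (quadInt_congr fun ξ α β γ _ => ?_).le
      (two (fun ξ α β γ => g ξ * a α ^ 2 * g γ) (fun ξ α β γ => g ξ * a β ^ 2 * g γ)
        (by unfold Meas4; fun_prop) ?_ ?_)
    · unfold twoTops; ring
    · rw [quadInt_prod_omit_third hg ha2 hg]; ring
    · rw [quadInt_prod_omit_snd hg ha2 hg]; ring
  have t5 : quadInt (fun ξ α β γ => twoTops a g α γ ξ β) ≤ 2 * K := by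
    refine le_trans (quadInt_congr fun ξ α β γ _ => ?_).le
      (two (fun ξ α β γ => g ξ * a α ^ 2 * g β) (fun ξ α β γ => g ξ * g β * a γ ^ 2)
        (by unfold Meas4; fun_prop) ?_ ?_)
    · unfold twoTops; ring
    · rw [quadInt_prod_omit_fourth hg ha2 hg]; ring
    · rw [quadInt_prod_omit_snd hg hg ha2]; ring
  have t6 : quadInt (fun ξ α β γ => twoTops a g β γ ξ α) ≤ 2 * K := by
    refine le_trans (quadInt_congr fun ξ α β γ _ => ?_).le
      (two (fun ξ α β γ => g ξ * g α * a β ^ 2) (fun ξ α β γ => g ξ * g α * a γ ^ 2)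
        (by unfold Meas4; fun_prop) ?_ ?_)
    · unfold twoTops; ring
    · rw [quadInt_prod_omit_fourth hg hg ha2]; ring
    · rw [quadInt_prod_omit_third hg hg ha2]; ring
  unfold allTops
  refine (quadInt_add (by unfold Meas4 twoTops; fun_prop)).trans ?_
  refine (add_le_add ((quadInt_add (by unfold Meas4 twoTops; fun_prop)).trans <|
    add_le_add ((quadInt_add (by unfold Meas4 twoTops; fun_prop)).trans <|
    add_le_add ((quadInt_add (by unfold Meas4 twoTops; fun_prop)).trans <|
    add_le_add ((quadInt_add (by unfold Meas4 twoTops; fun_prop)).trans <|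
    add_le_add t1 t2) t3) t4) t5) t6).trans ?_
  apply le_of_eq; ring

/-- The static quadrilinear kernel. -/
def staticKernel (c N : ℝ) (ξ α β γ : E3) : ℝ :=
  if c * N ≤ ‖ξ‖ ∨ c * N ≤ ‖α‖ ∨ c * N ≤ ‖β‖ ∨ c * N ≤ ‖γ‖ then
    (refSymb N ξ)⁻¹ * (refSymb N α)⁻¹ * (refSymb N β)⁻¹ * (refSymb N γ)⁻¹ else 0

theorem quadInt_staticKernel_le {c e : ℝ} (hc : 0 < c) (hc1 : c ≤ 1) (he : 0 < e)
    (he1 : e ≤ 1 / 10) :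
    ∃ C > 0, ∀ N : ℝ, 1 ≤ N → ∀ a : E3 → ENNReal, Measurable a →
      quadInt (fun ξ α β γ => ENNReal.ofReal (staticKernel c N ξ α β γ) *
        (a ξ * a α * a β * a γ)) ≤ ENNReal.ofReal (C * N ^ (-1 + 2 * e)) * (∫⁻ η, a η ^ 2) ^ 2 := by
  obtain ⟨C, hC, hCb⟩ := weight_pair_bound hc hc1 he he1
  set M := ∫ ξ : E3, radialMajorant e ‖ξ‖ with hM
  have hM0 : 0 ≤ M := integral_nonneg fun ξ => by
    simp only [Pi.zero_apply, radialMajorant]; split_ifs <;> positivity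
  refine ⟨12 * C * (M + 1), by positivity, fun N hN a ha => ?_⟩
  have hN0 : 0 < N := by linarith
  have hΘ0 : ∀ x, 0 ≤ (refSymb N x)⁻¹ := fun x => inv_nonneg.2 (refSymb_nonneg hN0.le x)
  set ρ : E3 → ENNReal := fun η => ENNReal.ofReal (refSymb N η * weightL1 e N η)⁻¹ with hρ
  have hρm : Measurable ρ := ENNReal.measurable_ofReal.comp
    (((measurable_refSymb N).mul (measurable_weightL1 e N)).inv)
  set g : E3 → ENNReal := fun η => a η * ρ η with hg
  have hgm : Measurable g := ha.mul hρm
  have hg1 : (∫⁻ η, g η) ^ 2 ≤ (∫⁻ η, a η ^ 2) * ENNReal.ofReal M := by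
    refine (sq_lintegral_mul_le volume ha.aemeasurable hρm.aemeasurable).trans ?_
    gcongr
    rw [hM, ofReal_integral_eq_lintegral_ofReal (integrable_radialMajorant he)
      (.of_forall fun ξ => by
        simp only [Pi.zero_apply, radialMajorant]; split_ifs <;> positivity)]
    refine lintegral_mono fun η => ?_
    simp only [hρ]
    rw [← ENNReal.ofReal_pow
      (inv_nonneg.2 (mul_nonneg (refSymb_nonneg hN0.le _) (weightL1_pos e N _).le))]
    exact ENNReal.ofReal_le_ofReal (inv_refSymb_weightL1_sq_le hN)
  have hsplit : ∀ η, ENNReal.ofReal (refSymb N η)⁻¹ * a η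
      = ENNReal.ofReal (weightL1 e N η) * g η := by
    intro η
    simp only [hg, hρ]
    have hw := weightL1_pos e N η
    rw [mul_comm (a η), ← mul_assoc, ← ENNReal.ofReal_mul hw.le, mul_inv]
    congr 2; field_simp
  have pair : ∀ x y b d : E3, c * N ≤ ‖x‖ → ‖x‖ / 3 ≤ ‖y‖ → ‖b‖ ≤ ‖x‖ → ‖d‖ ≤ ‖x‖ →
      ENNReal.ofReal ((refSymb N x)⁻¹ * (refSymb N y)⁻¹ * (refSymb N b)⁻¹ * (refSymb N d)⁻¹) *
        (a x * a y * a b * a d) ≤ ENNReal.ofReal (C * N ^ (-1 + 2 * e)) * twoTops a g x y b d := by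
    intro x y b d hx hy hb hd
    have hxy := mul_nonneg (hΘ0 x) (hΘ0 y)
    rw [ENNReal.ofReal_mul (mul_nonneg hxy (hΘ0 b)), ENNReal.ofReal_mul hxy]
    calc _ = ENNReal.ofReal ((refSymb N x)⁻¹ * (refSymb N y)⁻¹) *
          (ENNReal.ofReal (refSymb N b)⁻¹ * a b) * (ENNReal.ofReal (refSymb N d)⁻¹ * a d) *
          (a x * a y) := by ring
      _ = ENNReal.ofReal ((refSymb N x)⁻¹ * (refSymb N y)⁻¹) *
          (ENNReal.ofReal (weightL1 e N b) * ENNReal.ofReal (weightL1 e N d)) * (g b * g d) *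
          (a x * a y) := by rw [hsplit, hsplit]; ring
      _ ≤ ENNReal.ofReal ((refSymb N x)⁻¹ * (refSymb N y)⁻¹) *
          (ENNReal.ofReal (weightL1 e N x) * ENNReal.ofReal (weightL1 e N x)) * (g b * g d) *
          (a x ^ 2 + a y ^ 2) := by
        gcongr
        · exact weightL1_mono he hN0.le hb
        · exact weightL1_mono he hN0.le hd
        · exact ENNReal.mul_le_sq_add_sq _ _
      _ = ENNReal.ofReal (weightL1 e N x ^ 2 * ((refSymb N x)⁻¹ * (refSymb N y)⁻¹)) *
          twoTops a g x y b d := by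
        rw [ENNReal.ofReal_mul (p := weightL1 e N x ^ 2) (by positivity),
          ENNReal.ofReal_pow (weightL1_pos e N x).le, twoTops]
        ring
      _ ≤ _ := by
        exact mul_le_mul' (ENNReal.ofReal_le_ofReal (hCb N hN x y hx hy)) le_rfl
  have tops : ∀ x y b d : E3, c * N ≤ ‖x‖ → ‖y‖ ≤ ‖x‖ → ‖b‖ ≤ ‖x‖ → ‖d‖ ≤ ‖x‖ →
      ‖x‖ ≤ ‖y‖ + ‖b‖ + ‖d‖ →
      ENNReal.ofReal ((refSymb N x)⁻¹ * (refSymb N y)⁻¹ * (refSymb N b)⁻¹ * (refSymb N d)⁻¹) *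
        (a x * a y * a b * a d) ≤ ENNReal.ofReal (C * N ^ (-1 + 2 * e)) *
          (twoTops a g x y b d + twoTops a g x b y d + twoTops a g x d y b) := by
    intro x y b d hx hy hb hd hs
    by_cases h1 : ‖x‖ / 3 ≤ ‖y‖
    · refine (pair x y b d hx h1 hb hd).trans ?_
      gcongr; rw [add_assoc]; exact le_self_add
    by_cases h2 : ‖x‖ / 3 ≤ ‖b‖
    · refine (le_of_eq ?_).trans ((pair x b y d hx h2 hy hd).trans ?_)
      · congr 1
        · congr 1; ring
        · ring
      · gcongr; rw [add_comm (twoTops a g x y b d), add_assoc]; exact le_self_add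
    · refine (le_of_eq ?_).trans ((pair x d y b hx (by linarith) hy hb).trans ?_)
      · congr 1
        · congr 1; ring
        · ring
      · gcongr; exact le_add_self
  have pt : ∀ ξ α β γ : E3, ξ - α + β - γ = 0 →
      ENNReal.ofReal (staticKernel c N ξ α β γ) * (a ξ * a α * a β * a γ) ≤
        ENNReal.ofReal (C * N ^ (-1 + 2 * e)) * allTops a g ξ α β γ := by
    intro ξ α β γ h0
    have tri : ∀ x y z : E3, ‖x + y + z‖ ≤ ‖x‖ + ‖y‖ + ‖z‖ := fun x y z => norm_add₃_le
    have n1 : ‖ξ‖ ≤ ‖α‖ + ‖β‖ + ‖γ‖ := by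
      have : ξ = α + -β + γ := by rw [← sub_eq_zero, ← h0]; abel
      calc ‖ξ‖ = ‖α + -β + γ‖ := by rw [← this]
        _ ≤ _ := (tri _ _ _).trans (by rw [norm_neg])
    have n2 : ‖α‖ ≤ ‖ξ‖ + ‖β‖ + ‖γ‖ := by
      have : α = ξ + β + -γ := by rw [← sub_eq_zero, ← neg_eq_zero, ← h0]; abel
      calc ‖α‖ = ‖ξ + β + -γ‖ := by rw [← this]
        _ ≤ _ := (tri _ _ _).trans (by rw [norm_neg])
    have n3 : ‖β‖ ≤ ‖ξ‖ + ‖α‖ + ‖γ‖ := by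
      have : β = -ξ + α + γ := by rw [← sub_eq_zero, ← h0]; abel
      calc ‖β‖ = ‖-ξ + α + γ‖ := by rw [← this]
        _ ≤ _ := (tri _ _ _).trans (by rw [norm_neg])
    have n4 : ‖γ‖ ≤ ‖ξ‖ + ‖α‖ + ‖β‖ := by
      have : γ = ξ + -α + β := by rw [← sub_eq_zero, ← neg_eq_zero, ← h0]; abel
      calc ‖γ‖ = ‖ξ + -α + β‖ := by rw [← this]
        _ ≤ _ := (tri _ _ _).trans (by rw [norm_neg])
    unfold staticKernel
    split_ifs with hh
    swap
    · simp
    have cases : (‖α‖ ≤ ‖ξ‖ ∧ ‖β‖ ≤ ‖ξ‖ ∧ ‖γ‖ ≤ ‖ξ‖) ∨ (‖ξ‖ ≤ ‖α‖ ∧ ‖β‖ ≤ ‖α‖ ∧ ‖γ‖ ≤ ‖α‖) ∨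
        (‖ξ‖ ≤ ‖β‖ ∧ ‖α‖ ≤ ‖β‖ ∧ ‖γ‖ ≤ ‖β‖) ∨ (‖ξ‖ ≤ ‖γ‖ ∧ ‖α‖ ≤ ‖γ‖ ∧ ‖β‖ ≤ ‖γ‖) := by grind
    rcases cases with h | h | h | h
    · refine (tops ξ α β γ (by grind) h.1 h.2.1 h.2.2 n1).trans ?_
      gcongr
      rw [allTops]; simp only [add_assoc]
      gcongr; exact le_self_add
    · refine (le_of_eq ?_).trans ((tops α ξ β γ (by grind) h.1 h.2.1 h.2.2 n2).trans ?_)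
      · congr 1
        · congr 1; ring
        · ring
      · gcongr
        rw [twoTops_symm a g α ξ]
        calc _ ≤ (twoTops a g ξ α β γ + twoTops a g α β ξ γ + twoTops a g α γ ξ β) +
              (twoTops a g ξ β α γ + twoTops a g ξ γ α β + twoTops a g β γ ξ α) := le_self_add
          _ = _ := by unfold allTops; ring
    · refine (le_of_eq ?_).trans ((tops β ξ α γ (by grind) h.1 h.2.1 h.2.2 n3).trans ?_)
      · congr 1
        · congr 1; ring
        · ring
      · gcongr
        rw [twoTops_symm a g β ξ, twoTops_symm a g β α]
        calc _ ≤ (twoTops a g ξ β α γ + twoTops a g α β ξ γ + twoTops a g β γ ξ α) +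
              (twoTops a g ξ α β γ + twoTops a g ξ γ α β + twoTops a g α γ ξ β) := le_self_add
          _ = _ := by unfold allTops; ring
    · refine (le_of_eq ?_).trans ((tops γ ξ α β (by grind) h.1 h.2.1 h.2.2 n4).trans ?_)
      · congr 1
        · congr 1; ring
        · ring
      · gcongr
        rw [twoTops_symm a g γ ξ, twoTops_symm a g γ α, twoTops_symm a g γ β]
        calc _ ≤ (twoTops a g ξ γ α β + twoTops a g α γ ξ β + twoTops a g β γ ξ α) +
              (twoTops a g ξ α β γ + twoTops a g ξ β α γ + twoTops a g α β ξ γ) := le_self_add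
          _ = _ := by unfold allTops; ring
  calc _ ≤ quadInt fun ξ α β γ =>
        ENNReal.ofReal (C * N ^ (-1 + 2 * e)) * allTops a g ξ α β γ := quadInt_mono pt
    _ = ENNReal.ofReal (C * N ^ (-1 + 2 * e)) * quadInt (allTops a g) :=
        quadInt_const_mul ENNReal.ofReal_ne_top
    _ ≤ ENNReal.ofReal (C * N ^ (-1 + 2 * e)) * (12 * ((∫⁻ η, a η ^ 2) *
        ((∫⁻ η, a η ^ 2) * ENNReal.ofReal (M + 1)))) := by
      gcongr
      refine (quadInt_allTops_le ha hgm).trans ?_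
      gcongr
      refine hg1.trans ?_
      gcongr; linarith
    _ = _ := by
      rw [show 12 * C * (M + 1) * N ^ (-1 + 2 * e) = 12 * (C * N ^ (-1 + 2 * e) * (M + 1)) by ring,
        ENNReal.ofReal_mul (by norm_num : (0:ℝ) ≤ 12),
        ENNReal.ofReal_mul (p := C * N ^ (-1 + 2 * e)) (by positivity)]
      rw [show ENNReal.ofReal 12 = 12 by norm_num]; ring

/-- The model symbol `min(|ξ|, N^{1-s}|ξ|^s)`. -/
def modSymb (s N : ℝ) (ξ : E3) : ℝ := min ‖ξ‖ (N ^ (1 - s) * ‖ξ‖ ^ s)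

theorem modSymb_nonneg {s N : ℝ} (hN : 0 ≤ N) (ξ : E3) : 0 ≤ modSymb s N ξ :=
  le_min (norm_nonneg _) (by positivity)

theorem modSymb_le_mul {s N K : ℝ} (hs : 0 < s) (hs1 : s < 1) (hN : 0 ≤ N) (hK : 1 ≤ K) {ξ η : E3}
    (h : ‖ξ‖ ≤ K * ‖η‖) : modSymb s N ξ ≤ K * modSymb s N η := by
  have hK0 : 0 ≤ K := by linarith
  unfold modSymb
  rw [mul_min_of_nonneg _ _ hK0]
  refine min_le_min h ?_
  calc N ^ (1 - s) * ‖ξ‖ ^ s ≤ N ^ (1 - s) * (K * ‖η‖) ^ s := by gcongr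
    _ = K ^ s * (N ^ (1 - s) * ‖η‖ ^ s) := by
      rw [Real.mul_rpow hK0 (norm_nonneg _)]; ring
    _ ≤ K * (N ^ (1 - s) * ‖η‖ ^ s) := by
      gcongr; exact Real.rpow_le_self_of_one_le hK hs1.le

theorem modSymb_of_le {s N : ℝ} (hs1 : s < 1) {ξ : E3} (h : ‖ξ‖ ≤ N) :
    modSymb s N ξ = ‖ξ‖ := by
  refine min_eq_left ?_
  rcases (norm_nonneg ξ).eq_or_lt with h0 | hξ
  · rw [← h0] at h ⊢; positivity
  calc ‖ξ‖ = ‖ξ‖ ^ (1 - s) * ‖ξ‖ ^ s := by rw [← Real.rpow_add hξ]; simp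
    _ ≤ _ := by gcongr

theorem modSymb_of_ge {s N : ℝ} (hs1 : s < 1) (hN : 0 < N) {ξ : E3} (h : N ≤ ‖ξ‖) :
    modSymb s N ξ = N ^ (1 - s) * ‖ξ‖ ^ s := by
  refine min_eq_right ?_
  have hξ : 0 < ‖ξ‖ := by linarith
  calc N ^ (1 - s) * ‖ξ‖ ^ s ≤ ‖ξ‖ ^ (1 - s) * ‖ξ‖ ^ s := by gcongr
    _ = ‖ξ‖ := by rw [← Real.rpow_add hξ]; simp

theorem refSymb_le_modSymb {s N : ℝ} (hs : 5 / 6 < s) (hs1 : s < 1) (hN : 0 < N) (ξ : E3) :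
    refSymb N ξ ≤ modSymb s N ξ := by
  rcases le_total ‖ξ‖ N with h | h
  · rw [modSymb_of_le hs1 h]; exact min_le_left _ _
  · rw [modSymb_of_ge hs1 hN h]
    refine (min_le_right _ _).trans ?_
    have hξ : 0 < ‖ξ‖ := by linarith
    calc N ^ (1 / 6 : ℝ) * ‖ξ‖ ^ (5 / 6 : ℝ)
        = N ^ (1 - s) * (N ^ (s - 5 / 6) * ‖ξ‖ ^ (5 / 6 : ℝ)) := by
          rw [← mul_assoc, ← Real.rpow_add hN]; congr 2; ring
      _ ≤ N ^ (1 - s) * (‖ξ‖ ^ (s - 5 / 6) * ‖ξ‖ ^ (5 / 6 : ℝ)) := by gcongr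
      _ = _ := by rw [← Real.rpow_add hξ]; congr 2; ring

/-- The properties of the rescaled multiplier that are used. -/
structure GoodMult (s N : ℝ) (m : E3 → ℝ) : Prop where
  cont : Continuous m
  pos : ∀ ξ, 0 < m ξ
  le_one : ∀ ξ, m ξ ≤ 1
  anti : ∀ ξ η, ‖ξ‖ ≤ ‖η‖ → m η ≤ m ξ
  eq_one : ∀ ξ, ‖ξ‖ ≤ N → m ξ = 1
  lower : ∀ ξ, modSymb s N ξ ≤ 2 * (m ξ * ‖ξ‖)
  upper : ∀ ξ, m ξ * ‖ξ‖ ≤ 2 * modSymb s N ξ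

theorem goodMult_mN {s N : ℝ} (hs : 5 / 6 < s) (hs1 : s < 1) (hN : 0 < N) {m₁ : Rn 3 → ℝ}
    (h : IsAdmissibleMultiplier 3 s m₁) : GoodMult s N (mN m₁ N) := by
  obtain ⟨hc, hb, -, ha, h1, h2⟩ := h
  have hn : ∀ ξ : E3, ‖N⁻¹ • ξ‖ = ‖ξ‖ / N := fun ξ => by
    rw [norm_smul, norm_inv, Real.norm_of_nonneg hN.le, inv_mul_eq_div]
  have anti : ∀ ξ η : E3, ‖ξ‖ ≤ ‖η‖ → mN m₁ N η ≤ mN m₁ N ξ := fun ξ η h => by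
    apply ha; rw [hn, hn]; gcongr
  have one : ∀ ξ : E3, ‖ξ‖ ≤ N → mN m₁ N ξ = 1 := fun ξ h => by
    apply h1; rw [hn, div_le_one hN]; exact h
  have tail : ∀ ξ : E3, 2 * N ≤ ‖ξ‖ → mN m₁ N ξ * ‖ξ‖ = N ^ (1 - s) * ‖ξ‖ ^ s := fun ξ h => by
    have hξ : 0 < ‖ξ‖ := by linarith
    rw [mN, h2 _ (by rw [hn, le_div_iff₀ hN]; exact h), hn, Real.div_rpow hξ.le hN.le,
      Real.rpow_neg hN.le, div_inv_eq_mul]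
    have : ‖ξ‖ ^ s = ‖ξ‖ ^ (-(1 - s)) * ‖ξ‖ := by
      nth_rw 3 [← Real.rpow_one ‖ξ‖]
      rw [← Real.rpow_add hξ]; congr 1; ring
    rw [this]; ring
  have key : ∀ ξ : E3, N ≤ ‖ξ‖ → ‖ξ‖ ≤ 2 * N → 1 / 2 ≤ mN m₁ N ξ ∧
      ‖ξ‖ / 2 ≤ modSymb s N ξ := fun ξ h1 h2 => by
    have hξ : 0 < ‖ξ‖ := by linarith
    obtain ⟨η, hη⟩ : ∃ η : E3, ‖η‖ = 2 * N := ⟨EuclideanSpace.single 0 (2 * N), by simp [abs_of_pos hN]⟩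
    have ht := tail η hη.ge
    have h2s : (1 : ℝ) ≤ 2 ^ s := Real.one_le_rpow (by norm_num) (by linarith)
    have hNN : N ^ (1 - s) * N ^ s = N := by rw [← Real.rpow_add hN]; simp
    refine ⟨le_trans ?_ (anti ξ η (by rw [hη]; exact h2)), ?_⟩
    · rw [hη, Real.mul_rpow (by norm_num) hN.le] at ht
      have : mN m₁ N η * (2 * N) = 2 ^ s * N := by rw [ht]; linear_combination 2 ^ s * hNN
      nlinarith
    · rw [modSymb_of_ge hs1 hN h1]
      calc ‖ξ‖ / 2 ≤ N := by linarith
        _ = N ^ (1 - s) * N ^ s := hNN.symm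
        _ ≤ _ := by gcongr
  refine ⟨?_, fun ξ => (hb _).1, fun ξ => (hb _).2, anti, one, fun ξ => ?_, fun ξ => ?_⟩
  · have := hc.continuous
    unfold mN; fun_prop
  · rcases le_total ‖ξ‖ N with h | h
    · rw [one ξ h, modSymb_of_le hs1 h]; linarith [norm_nonneg ξ]
    rcases le_total ‖ξ‖ (2 * N) with h' | h'
    · have := (key ξ h h').1
      have h3 : modSymb s N ξ ≤ ‖ξ‖ := min_le_left _ _
      nlinarith [norm_nonneg ξ]
    · rw [tail ξ h', modSymb_of_ge hs1 hN h]
      have : 0 ≤ N ^ (1 - s) * ‖ξ‖ ^ s := by positivity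
      linarith
  · rcases le_total ‖ξ‖ N with h | h
    · rw [one ξ h, modSymb_of_le hs1 h]; linarith [norm_nonneg ξ]
    rcases le_total ‖ξ‖ (2 * N) with h' | h'
    · have := (key ξ h h').2
      have h3 : mN m₁ N ξ * ‖ξ‖ ≤ ‖ξ‖ := mul_le_of_le_one_left (norm_nonneg ξ) (hb _).2
      linarith
    · rw [tail ξ h', modSymb_of_ge hs1 hN h]
      have : 0 ≤ N ^ (1 - s) * ‖ξ‖ ^ s := by positivity
      linarith

theorem refSymb_pos {N : ℝ} (hN : 0 < N) {ξ : E3} (h : ξ ≠ 0) : 0 < refSymb N ξ := by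
  have := norm_pos_iff.2 h
  exact lt_min this (by positivity)

theorem res4_swap (ξ α β γ : E3) : res4 ξ γ β α = res4 ξ α β γ := by unfold res4; ring

/-- The sum of the kernels dominating the commutator symbol. -/
def domKernel (N : ℝ) (ξ α β γ : E3) : ℝ :=
  topKernel (1 / 12) N ξ α β γ + topKernel (1 / 12) N ξ γ β α + staticKernel (1 / 12) N ξ α β γ

section
variable {s N : ℝ} {m : E3 → ℝ}

namespace GoodMult

theorem refSymb_le (hm : GoodMult s N m) (hs : 5 / 6 < s) (hs1 : s < 1) (hN : 1 ≤ N) (x : E3) :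
    refSymb N x ≤ 2 * (m x * ‖x‖) :=
  (refSymb_le_modSymb hs hs1 (by linarith) x).trans (hm.lower x)

theorem inv_le (hm : GoodMult s N m) (hs : 5 / 6 < s) (hs1 : s < 1) (hN : 1 ≤ N) {x : E3}
    (hx : x ≠ 0) : (m x * ‖x‖)⁻¹ ≤ 2 * (refSymb N x)⁻¹ := by
  have h0 := refSymb_pos (by linarith : 0 < N) hx
  have h1 := hm.refSymb_le hs hs1 hN x
  rw [inv_le_comm₀ (by linarith) (by positivity), mul_inv, inv_inv]; linarith

theorem le_mul (hm : GoodMult s N m) (hs : 5 / 6 < s) (hs1 : s < 1) (hN : 1 ≤ N) {K : ℝ}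
    (hK : 1 ≤ K) {x y : E3} (h : ‖x‖ ≤ K * ‖y‖) : m x * ‖x‖ ≤ 4 * K * (m y * ‖y‖) := by
  have h1 := hm.upper x
  have h2 := hm.lower y
  have h3 := modSymb_le_mul (s := s) (N := N) (by linarith) hs1 (by linarith) hK h
  nlinarith [mul_le_mul_of_nonneg_left h2 (by linarith : 0 ≤ K)]

theorem commutator_le (hm : GoodMult s N m) (hs : 5 / 6 < s) (hs1 : s < 1) (hN : 1 ≤ N)
    {ξ α β γ x : E3} (h3 : ‖ξ‖ ≤ 3 * ‖x‖) (hx : m α * m β * m γ ≤ m x) :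
    ‖ξ‖ * |m ξ - m α * m β * m γ| ≤ 12 * (m x * ‖x‖) := by
  have h1 := hm.le_mul hs hs1 hN (by norm_num : (1:ℝ) ≤ 3) h3
  have hp := mul_pos (mul_pos (hm.pos α) (hm.pos β)) (hm.pos γ)
  have h2 : ‖ξ‖ * (m α * m β * m γ) ≤ 3 * (m x * ‖x‖) := by
    calc ‖ξ‖ * (m α * m β * m γ) ≤ (3 * ‖x‖) * m x := by gcongr
      _ = _ := by ring
  have hx0 : 0 ≤ m x * ‖x‖ := mul_nonneg (hm.pos x).le (norm_nonneg x)
  have h0 : 0 ≤ ‖ξ‖ * m ξ := mul_nonneg (norm_nonneg _) (hm.pos ξ).le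
  have h00 : 0 ≤ ‖ξ‖ * (m α * m β * m γ) := mul_nonneg (norm_nonneg _) hp.le
  rw [← abs_of_nonneg (norm_nonneg ξ), ← abs_mul, mul_sub, abs_le]
  constructor <;> nlinarith

theorem prod_le (hm : GoodMult s N m) (α β γ : E3) :
    m α * m β * m γ ≤ m α ∧ m α * m β * m γ ≤ m β ∧ m α * m β * m γ ≤ m γ := by
  have hα := hm.pos α; have hβ := hm.pos β; have hγ := hm.pos γ
  have hα1 := hm.le_one α; have hβ1 := hm.le_one β; have hγ1 := hm.le_one γ
  have h1 : m α * m β ≤ m α := mul_le_of_le_one_right hα.le hβ1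
  have h2 : m α * m β ≤ m β := mul_le_of_le_one_left hβ.le hα1
  have h12 : m α * m β ≤ 1 := h1.trans hα1
  have h3 : m α * m β * m γ ≤ m α * m β := mul_le_of_le_one_right (by positivity) hγ1
  exact ⟨h3.trans h1, h3.trans h2, mul_le_of_le_one_left hγ.le h12⟩

theorem top_bound (hm : GoodMult s N m) (hs : 5 / 6 < s) (hs1 : s < 1) (hN : 1 ≤ N)
    {ξ α β γ : E3} (hα : α ≠ 0) (hβ : β ≠ 0) (hγ : γ ≠ 0) (htop : 1 / 12 * N ≤ ‖α‖) {K : ℝ}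
    (hK : 0 ≤ K) (h : ‖ξ‖ * |m ξ - m α * m β * m γ| ≤ K * (m α * ‖α‖)) :
    ‖ξ‖ * |m ξ - m α * m β * m γ| * ((m α * ‖α‖) * (m β * ‖β‖) * (m γ * ‖γ‖))⁻¹ *
      (1 + |res4 ξ α β γ|)⁻¹ ≤ 4 * K * topKernel (1 / 12) N ξ α β γ := by
  have ha := mul_pos (hm.pos α) (norm_pos_iff.2 hα)
  have hb := mul_pos (hm.pos β) (norm_pos_iff.2 hβ)
  have hc := mul_pos (hm.pos γ) (norm_pos_iff.2 hγ)
  have ib := hm.inv_le hs hs1 hN hβ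
  have ic := hm.inv_le hs hs1 hN hγ
  have rb := refSymb_pos (by linarith : 0 < N) hβ
  rw [topKernel, if_pos htop]
  calc _ ≤ K * (m α * ‖α‖) * ((m α * ‖α‖) * (m β * ‖β‖) * (m γ * ‖γ‖))⁻¹ *
      (1 + |res4 ξ α β γ|)⁻¹ := by gcongr
    _ = K * (m β * ‖β‖)⁻¹ * (m γ * ‖γ‖)⁻¹ * (1 + |res4 ξ α β γ|)⁻¹ := by
      congr 1
      generalize m α * ‖α‖ = a at *
      generalize m β * ‖β‖ = b at *
      generalize m γ * ‖γ‖ = c at *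
      field_simp
    _ ≤ K * (2 * (refSymb N β)⁻¹) * (2 * (refSymb N γ)⁻¹) * (1 + |res4 ξ α β γ|)⁻¹ := by
      gcongr
    _ = _ := by ring

theorem topKernel_nonneg (hN : 0 ≤ N) {c : ℝ} (ξ α β γ : E3) : 0 ≤ topKernel c N ξ α β γ := by
  unfold topKernel
  have h1 := inv_nonneg.2 (refSymb_nonneg hN β)
  have h2 := inv_nonneg.2 (refSymb_nonneg hN γ)
  split_ifs
  · positivity
  · exact le_rfl

theorem staticKernel_nonneg (hN : 0 ≤ N) {c : ℝ} (ξ α β γ : E3) :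
    0 ≤ staticKernel c N ξ α β γ := by
  unfold staticKernel
  have h1 := inv_nonneg.2 (refSymb_nonneg hN β)
  have h2 := inv_nonneg.2 (refSymb_nonneg hN γ)
  have h3 := inv_nonneg.2 (refSymb_nonneg hN ξ)
  have h4 := inv_nonneg.2 (refSymb_nonneg hN α)
  split_ifs
  · positivity
  · exact le_rfl

theorem kernel_le (hm : GoodMult s N m) (hs : 5 / 6 < s) (hs1 : s < 1) (hN : 1 ≤ N)
    {ξ α β γ : E3} (h0 : ξ - α + β - γ = 0) (hξ : ξ ≠ 0) (hα : α ≠ 0) (hβ : β ≠ 0) (hγ : γ ≠ 0) :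
    ‖ξ‖ * |m ξ - m α * m β * m γ| * ((m α * ‖α‖) * (m β * ‖β‖) * (m γ * ‖γ‖))⁻¹ *
      (1 + |res4 ξ α β γ|)⁻¹ ≤ 768 * domKernel N ξ α β γ := by
  have hN0 : 0 < N := by linarith
  have n1 : ‖ξ‖ ≤ ‖α‖ + ‖β‖ + ‖γ‖ := by
    have : ξ = α + -β + γ := by rw [← sub_eq_zero, ← h0]; abel
    calc ‖ξ‖ = ‖α + -β + γ‖ := by rw [← this]
      _ ≤ _ := norm_add₃_le.trans (by rw [norm_neg])
  have n3 : ‖β‖ ≤ ‖ξ‖ + ‖α‖ + ‖γ‖ := by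
    have : β = -ξ + α + γ := by rw [← sub_eq_zero, ← h0]; abel
    calc ‖β‖ = ‖-ξ + α + γ‖ := by rw [← this]
      _ ≤ _ := norm_add₃_le.trans (by rw [norm_neg])
  have t1 := topKernel_nonneg hN0.le (c := 1 / 12) ξ α β γ
  have t2 := topKernel_nonneg hN0.le (c := 1 / 12) ξ γ β α
  have t3 := staticKernel_nonneg hN0.le (c := 1 / 12) ξ α β γ
  obtain ⟨p1, p2, p3⟩ := hm.prod_le α β γ
  have nα := norm_pos_iff.2 hα
  have nβ := norm_pos_iff.2 hβ
  have nγ := norm_pos_iff.2 hγ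
  have ha := mul_pos (hm.pos α) nα
  have hb := mul_pos (hm.pos β) nβ
  have hc := mul_pos (hm.pos γ) nγ
  have topα : ∀ K : ℝ, 0 ≤ K → K ≤ 192 → 1 / 12 * N ≤ ‖α‖ →
      ‖ξ‖ * |m ξ - m α * m β * m γ| ≤ K * (m α * ‖α‖) →
      ‖ξ‖ * |m ξ - m α * m β * m γ| * ((m α * ‖α‖) * (m β * ‖β‖) * (m γ * ‖γ‖))⁻¹ *
        (1 + |res4 ξ α β γ|)⁻¹ ≤ 768 * domKernel N ξ α β γ := by
    intro K hK hK' h1 h2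
    refine (hm.top_bound hs hs1 hN hα hβ hγ h1 hK h2).trans ?_
    unfold domKernel
    nlinarith
  have topγ : ∀ K : ℝ, 0 ≤ K → K ≤ 192 → 1 / 12 * N ≤ ‖γ‖ →
      ‖ξ‖ * |m ξ - m α * m β * m γ| ≤ K * (m γ * ‖γ‖) →
      ‖ξ‖ * |m ξ - m α * m β * m γ| * ((m α * ‖α‖) * (m β * ‖β‖) * (m γ * ‖γ‖))⁻¹ *
        (1 + |res4 ξ α β γ|)⁻¹ ≤ 768 * domKernel N ξ α β γ := by
    intro K hK hK' h1 h2
    have e1 : m α * m β * m γ = m γ * m β * m α := by ring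
    have e2 : (m α * ‖α‖) * (m β * ‖β‖) * (m γ * ‖γ‖) =
      (m γ * ‖γ‖) * (m β * ‖β‖) * (m α * ‖α‖) := by ring
    rw [e1] at h2 ⊢
    rw [e2, ← res4_swap]
    refine (hm.top_bound hs hs1 hN hγ hβ hα h1 hK h2).trans ?_
    unfold domKernel
    nlinarith
  by_cases hsmall : ‖α‖ < N / 3 ∧ ‖β‖ < N / 3 ∧ ‖γ‖ < N / 3
  · obtain ⟨s1, s2, s3⟩ := hsmall
    rw [hm.eq_one ξ (by linarith), hm.eq_one α (by linarith), hm.eq_one β (by linarith),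
      hm.eq_one γ (by linarith)]
    unfold domKernel
    simp only [mul_one, sub_self, abs_zero, mul_zero, zero_mul]
    positivity
  by_cases cα : ‖β‖ ≤ ‖α‖ ∧ ‖γ‖ ≤ ‖α‖
  · exact topα 12 (by norm_num) (by norm_num) (by grind)
      (hm.commutator_le hs hs1 hN (by linarith) p1)
  by_cases cγ : ‖β‖ ≤ ‖γ‖ ∧ ‖α‖ ≤ ‖γ‖
  · exact topγ 12 (by norm_num) (by norm_num) (by grind)
      (hm.commutator_le hs hs1 hN (by linarith) p3)
  have hβα : ‖α‖ ≤ ‖β‖ := by grind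
  have hβγ : ‖γ‖ ≤ ‖β‖ := by grind
  have hβN : N / 3 ≤ ‖β‖ := by grind
  have hcomm := hm.commutator_le (γ := γ) hs hs1 hN (by linarith : ‖ξ‖ ≤ 3 * ‖β‖) p2
  by_cases dα : ‖β‖ ≤ 4 * ‖α‖
  · have := hm.le_mul hs hs1 hN (by norm_num : (1:ℝ) ≤ 4) dα
    exact topα 192 (by norm_num) le_rfl (by linarith) (by linarith)
  by_cases dγ : ‖β‖ ≤ 4 * ‖γ‖
  · have := hm.le_mul hs hs1 hN (by norm_num : (1:ℝ) ≤ 4) dγ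
    exact topγ 192 (by norm_num) le_rfl (by linarith) (by linarith)
  have nξ := norm_pos_iff.2 hξ
  have hres : (1 + |res4 ξ α β γ|)⁻¹ ≤ 3 * ((refSymb N ξ)⁻¹ * (refSymb N β)⁻¹) := by
    have rξ := refSymb_pos hN0 hξ
    have rβ := refSymb_pos hN0 hβ
    have l1 : refSymb N ξ ≤ 3 * ‖β‖ := (min_le_left _ _).trans (by linarith)
    have l2 : refSymb N β ≤ ‖β‖ := min_le_left _ _
    have hΩ : ‖β‖ ^ 2 ≤ res4 ξ α β γ := by
      unfold res4
      nlinarith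
    rw [← mul_inv, ← div_eq_mul_inv, inv_le_comm₀ (by positivity) (by positivity), inv_div,
      div_le_iff₀ (by norm_num)]
    have := le_abs_self (res4 ξ α β γ)
    nlinarith [mul_le_mul l1 l2 rβ.le (by positivity)]
  have hs0 : staticKernel (1 / 12) N ξ α β γ =
      (refSymb N ξ)⁻¹ * (refSymb N α)⁻¹ * (refSymb N β)⁻¹ * (refSymb N γ)⁻¹ := by
    rw [staticKernel, if_pos]
    right; right; left; linarith
  have ia := hm.inv_le hs hs1 hN hα
  have ic := hm.inv_le hs hs1 hN hγ
  have ra := refSymb_pos hN0 hα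
  have rc := refSymb_pos hN0 hγ
  calc _ ≤ 12 * (m β * ‖β‖) * ((m α * ‖α‖) * (m β * ‖β‖) * (m γ * ‖γ‖))⁻¹ *
      (3 * ((refSymb N ξ)⁻¹ * (refSymb N β)⁻¹)) := by gcongr
    _ = 36 * (m α * ‖α‖)⁻¹ * (m γ * ‖γ‖)⁻¹ * ((refSymb N ξ)⁻¹ * (refSymb N β)⁻¹) := by
      generalize m α * ‖α‖ = a at *
      generalize m β * ‖β‖ = b at *
      generalize m γ * ‖γ‖ = c at *
      field_simp
      try ring
    _ ≤ 36 * (2 * (refSymb N α)⁻¹) * (2 * (refSymb N γ)⁻¹) *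
        ((refSymb N ξ)⁻¹ * (refSymb N β)⁻¹) := by
      have rξ := refSymb_pos hN0 hξ
      have rβ := refSymb_pos hN0 hβ
      gcongr
    _ = 144 * staticKernel (1 / 12) N ξ α β γ := by rw [hs0]; ring
    _ ≤ _ := by unfold domKernel; nlinarith

theorem static_le (hm : GoodMult s N m) (hs : 5 / 6 < s) (hs1 : s < 1) (hN : 1 ≤ N)
    {ξ α β γ : E3} (h0 : ξ - α + β - γ = 0) (hξ : ξ ≠ 0) (hα : α ≠ 0) (hβ : β ≠ 0) (hγ : γ ≠ 0) :
    |m ξ - m α * m β * m γ| * ((m ξ * ‖ξ‖) * (m α * ‖α‖) * (m β * ‖β‖) * (m γ * ‖γ‖))⁻¹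
      ≤ 16 * staticKernel (1 / 12) N ξ α β γ := by
  have hN0 : 0 < N := by linarith
  have n1 : ‖ξ‖ ≤ ‖α‖ + ‖β‖ + ‖γ‖ := by
    have : ξ = α + -β + γ := by rw [← sub_eq_zero, ← h0]; abel
    calc ‖ξ‖ = ‖α + -β + γ‖ := by rw [← this]
      _ ≤ _ := norm_add₃_le.trans (by rw [norm_neg])
  by_cases hsmall : ‖α‖ < N / 3 ∧ ‖β‖ < N / 3 ∧ ‖γ‖ < N / 3
  · obtain ⟨s1, s2, s3⟩ := hsmall
    rw [hm.eq_one ξ (by linarith), hm.eq_one α (by linarith), hm.eq_one β (by linarith),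
      hm.eq_one γ (by linarith)]
    have t3 := staticKernel_nonneg hN0.le (c := 1 / 12) ξ α β γ
    simp only [mul_one, sub_self, abs_zero, zero_mul]
    positivity
  have i0 := hm.inv_le hs hs1 hN hξ
  have ia := hm.inv_le hs hs1 hN hα
  have ib := hm.inv_le hs hs1 hN hβ
  have ic := hm.inv_le hs hs1 hN hγ
  have r0 := refSymb_pos hN0 hξ
  have ra := refSymb_pos hN0 hα
  have rb := refSymb_pos hN0 hβ
  have rc := refSymb_pos hN0 hγ
  have h0' := mul_pos (hm.pos ξ) (norm_pos_iff.2 hξ)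
  have ha := mul_pos (hm.pos α) (norm_pos_iff.2 hα)
  have hb := mul_pos (hm.pos β) (norm_pos_iff.2 hβ)
  have hc := mul_pos (hm.pos γ) (norm_pos_iff.2 hγ)
  have h1 : |m ξ - m α * m β * m γ| ≤ 1 := by
    have := (hm.prod_le α β γ).1
    have := hm.le_one α
    have := hm.le_one ξ
    have := hm.pos ξ
    have := mul_pos (mul_pos (hm.pos α) (hm.pos β)) (hm.pos γ)
    rw [abs_le]; constructor <;> linarith
  have hbig : 1 / 12 * N ≤ ‖ξ‖ ∨ 1 / 12 * N ≤ ‖α‖ ∨ 1 / 12 * N ≤ ‖β‖ ∨ 1 / 12 * N ≤ ‖γ‖ := by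
    by_contra! h
    exact hsmall ⟨by linarith, by linarith, by linarith⟩
  rw [staticKernel, if_pos hbig, mul_inv, mul_inv, mul_inv]
  calc _ ≤ 1 * (2 * (refSymb N ξ)⁻¹ * (2 * (refSymb N α)⁻¹) * (2 * (refSymb N β)⁻¹) *
      (2 * (refSymb N γ)⁻¹)) := by gcongr
    _ = _ := by ring

end GoodMult
end

/-- A `C¹` path with initial value plus total variation at most `a`. -/
structure BVOn (δ : ℝ) (f f' : ℝ → ℂ) (a : ℝ) : Prop where
  cont : ContinuousOn f (Icc 0 δ)
  hasDeriv : ∀ t ∈ Ioo 0 δ, HasDerivAt f (f' t) t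
  cont' : ContinuousOn f' (Icc 0 δ)
  bound : ‖f 0‖ + ∫ t in (0:ℝ)..δ, ‖f' t‖ ≤ a

namespace BVOn
variable {δ : ℝ} {f f' g g' : ℝ → ℂ} {a b : ℝ}

theorem intervalIntegrable_of_cont {E : Type*} [NormedAddCommGroup E] {h : ℝ → E}
    (hh : ContinuousOn h (Icc 0 δ)) {x y : ℝ} (hx : x ∈ Icc 0 δ) (hy : y ∈ Icc 0 δ) :
    IntervalIntegrable h volume x y :=
  (hh.mono (uIcc_subset_Icc hx hy)).intervalIntegrable

theorem sub_eq (hf : BVOn δ f f' a) {t : ℝ} (ht : t ∈ Icc 0 δ) :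
    ∫ s in (0:ℝ)..t, f' s = f t - f 0 :=
  intervalIntegral.integral_eq_sub_of_hasDerivAt_of_le ht.1
    (hf.cont.mono (Icc_subset_Icc_right ht.2))
    (fun s hs => hf.hasDeriv s ⟨hs.1, hs.2.trans_le ht.2⟩)
    (intervalIntegrable_of_cont hf.cont' ⟨le_rfl, ht.1.trans ht.2⟩ ht)

theorem integral_norm_mono (hf : ContinuousOn f' (Icc 0 δ)) {t : ℝ} (ht : t ∈ Icc 0 δ) :
    ∫ s in (0:ℝ)..t, ‖f' s‖ ≤ ∫ s in (0:ℝ)..δ, ‖f' s‖ :=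
  intervalIntegral.integral_mono_interval le_rfl ht.1 ht.2 (.of_forall fun _ => norm_nonneg _)
    (intervalIntegrable_of_cont hf.norm ⟨le_rfl, ht.1.trans ht.2⟩ ⟨ht.1.trans ht.2, le_rfl⟩)

theorem norm_le (hf : BVOn δ f f' a) {t : ℝ} (ht : t ∈ Icc 0 δ) : ‖f t‖ ≤ a := by
  have h1 := hf.sub_eq ht
  have h2 : f t = f 0 + ∫ s in (0:ℝ)..t, f' s := by rw [h1]; ring
  rw [h2]
  have := intervalIntegral.norm_integral_le_integral_norm (f := f') (μ := volume) ht.1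
  have := integral_norm_mono hf.cont' ht
  linarith [norm_add_le (f 0) (∫ s in (0:ℝ)..t, f' s), hf.bound]

theorem nonneg (hf : BVOn δ f f' a) (hδ : 0 ≤ δ) : 0 ≤ a :=
  (norm_nonneg _).trans (hf.norm_le ⟨le_rfl, hδ⟩)

theorem mul (hδ : 0 ≤ δ) (hf : BVOn δ f f' a) (hg : BVOn δ g g' b) :
    BVOn δ (fun t => f t * g t) (fun t => f' t * g t + f t * g' t) (2 * (a * b)) where
  cont := hf.cont.mul hg.cont
  hasDeriv t ht := (hf.hasDeriv t ht).mul (hg.hasDeriv t ht)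
  cont' := (hf.cont'.mul hg.cont).add (hf.cont.mul hg.cont')
  bound := by
    have h0 : (0:ℝ) ∈ Icc 0 δ := ⟨le_rfl, hδ⟩
    have h1 : δ ∈ Icc 0 δ := ⟨hδ, le_rfl⟩
    have i1 := intervalIntegrable_of_cont hf.cont'.norm h0 h1
    have i2 := intervalIntegrable_of_cont hg.cont'.norm h0 h1
    have a0 := hf.nonneg hδ
    have b0 := hg.nonneg hδ
    have h2 : ∫ t in (0:ℝ)..δ, ‖f' t * g t + f t * g' t‖ ≤
        ∫ t in (0:ℝ)..δ, (‖f' t‖ * b + a * ‖g' t‖) := by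
      refine intervalIntegral.integral_mono_on hδ ?_ ((i1.mul_const b).add (i2.const_mul a)) ?_
      · exact intervalIntegrable_of_cont
          ((hf.cont'.mul hg.cont).add (hf.cont.mul hg.cont')).norm h0 h1
      · intro t ht
        refine (norm_add_le _ _).trans ?_
        rw [norm_mul, norm_mul]
        have := hf.norm_le ht
        have := hg.norm_le ht
        gcongr
    rw [intervalIntegral.integral_add (i1.mul_const b) (i2.const_mul a),
      intervalIntegral.integral_mul_const, intervalIntegral.integral_const_mul] at h2
    have h3 := hf.bound
    have h4 := hg.bound
    have h5 : ‖f 0 * g 0‖ ≤ ‖f 0‖ * b := by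
      rw [norm_mul]; gcongr; exact hg.norm_le h0
    nlinarith [norm_nonneg (g 0)]

theorem conj (hf : BVOn δ f f' a) :
    BVOn δ (fun t => (starRingEnd ℂ) (f t)) (fun t => (starRingEnd ℂ) (f' t)) a where
  cont := Complex.continuous_conj.comp_continuousOn hf.cont
  hasDeriv t ht := (hf.hasDeriv t ht).star
  cont' := Complex.continuous_conj.comp_continuousOn hf.cont'
  bound := by simpa using hf.bound

theorem oscillatory_le (hδ1 : δ ≤ 1) (hf : BVOn δ f f' a) (w : ℝ) {t : ℝ}
    (ht : t ∈ Icc 0 δ) :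
    (1 + |w|) * ‖∫ s in (0:ℝ)..t, Complex.exp ((w * s : ℝ) * I) * f s‖ ≤ 4 * a := by
  have hδ : 0 ≤ δ := ht.1.trans ht.2
  have a0 := hf.nonneg hδ
  have h0 : (0:ℝ) ∈ Icc 0 δ := ⟨le_rfl, hδ⟩
  set e : ℝ → ℂ := fun s => Complex.exp ((w * s : ℝ) * I) with he
  have hen : ∀ s, ‖e s‖ = 1 := fun s => Complex.norm_exp_ofReal_mul_I _
  have hec : Continuous e := by fun_prop
  have hed : ∀ s, HasDerivAt e (e s * (w * I)) s := fun s => by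
    have h1 : HasDerivAt (fun s : ℝ => ((w * s : ℝ) : ℂ) * I) (w * I) s := by
      have := ((hasDerivAt_id s).const_mul w).ofReal_comp.mul_const I
      simpa using this
    exact h1.cexp
  have trivial_bd : ‖∫ s in (0:ℝ)..t, e s * f s‖ ≤ a := by
    have := intervalIntegral.norm_integral_le_of_norm_le_const (a := 0) (b := t) (C := a)
      (f := fun s => e s * f s) (fun s hs => by
        rw [uIoc_of_le ht.1] at hs
        rw [norm_mul, hen, one_mul]; exact hf.norm_le ⟨hs.1.le, hs.2.trans ht.2⟩)
    rw [sub_zero, abs_of_nonneg ht.1] at this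
    nlinarith [ht.2]
  have ibp : (w * I) * ∫ s in (0:ℝ)..t, e s * f s = e t * f t - e 0 * f 0 -
      ∫ s in (0:ℝ)..t, e s * f' s := by
    have hc : ContinuousOn (fun s => e s * f s) (Icc 0 δ) := hec.continuousOn.mul hf.cont
    have hc' : ContinuousOn (fun s => e s * f' s) (Icc 0 δ) := hec.continuousOn.mul hf.cont'
    have hc1 : ContinuousOn (fun s => (w * I) * (e s * f s)) (Icc 0 δ) :=
      continuousOn_const.mul hc
    have := intervalIntegral.integral_eq_sub_of_hasDerivAt_of_le ht.1
      (hc.mono (Icc_subset_Icc_right ht.2))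
      (f' := fun s => (w * I) * (e s * f s) + e s * f' s)
      (fun s hs => by
        have := (hed s).mul (hf.hasDeriv s ⟨hs.1, hs.2.trans_le ht.2⟩)
        refine this.congr_deriv ?_; ring)
      (intervalIntegrable_of_cont (hc1.add hc') h0 ht)
    rw [intervalIntegral.integral_add (intervalIntegrable_of_cont hc1 h0 ht)
      (intervalIntegrable_of_cont hc' h0 ht), intervalIntegral.integral_const_mul] at this
    rw [← this]; ring
  have h3 : |w| * ‖∫ s in (0:ℝ)..t, e s * f s‖ ≤ 3 * a := by
    have hw : |w| = ‖(w * I : ℂ)‖ := by simp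
    rw [hw, ← norm_mul, ibp]
    have n1 : ‖e t * f t‖ ≤ a := by rw [norm_mul, hen, one_mul]; exact hf.norm_le ht
    have n2 : ‖e 0 * f 0‖ = ‖f 0‖ := by rw [norm_mul, hen, one_mul]
    have n3 : ‖∫ s in (0:ℝ)..t, e s * f' s‖ ≤ ∫ s in (0:ℝ)..t, ‖f' s‖ := by
      refine (intervalIntegral.norm_integral_le_integral_norm ht.1).trans (le_of_eq ?_)
      refine intervalIntegral.integral_congr fun s _ => ?_
      simp only [norm_mul, hen, one_mul]
    have n4 := integral_norm_mono hf.cont' ht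
    have := hf.bound
    linarith [norm_sub_le (e t * f t - e 0 * f 0) (∫ s in (0:ℝ)..t, e s * f' s),
      norm_sub_le (e t * f t) (e 0 * f 0)]
  linarith

end BVOn

/-- Phase of the free Schrödinger flow. -/
def phase (t : ℝ) (x ξ : E3) : ℂ :=
  cexp (((2 * Real.pi * ⟪x, ξ⟫ - 4 * Real.pi ^ 2 * t * ‖ξ‖ ^ 2 : ℝ) : ℂ) * I)

theorem norm_phase (t : ℝ) (x ξ : E3) : ‖phase t x ξ‖ = 1 := by
  rw [phase, norm_exp_ofReal_mul_I]

theorem continuous_phase : Continuous fun p : ℝ × E3 × E3 => phase p.1 p.2.1 p.2.2 := by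
  unfold phase; fun_prop

theorem phase_mul_conj (lam t s : ℝ) (x y ξ : E3) :
    cexp (-(lam : ℂ) * ‖ξ‖ ^ 2) * (phase t x ξ * (starRingEnd ℂ) (phase s y ξ))
      = cexp (-((lam : ℂ) + (4 * Real.pi ^ 2 * (t - s) : ℝ) * I) * ‖ξ‖ ^ 2
        + (2 * Real.pi * I) * ⟪x - y, ξ⟫) := by
  unfold phase
  rw [← Complex.exp_conj, ← Complex.exp_add, ← Complex.exp_add]
  congr 1
  simp only [map_mul, conj_ofReal, conj_I, inner_sub_left]
  push_cast
  ring

/-- The dispersive bound for the Gaussian-regularized free propagator. -/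
theorem norm_gaussian_kernel_le {lam : ℝ} (hl : 0 < lam) (t s : ℝ) (x y : E3) :
    ‖∫ ξ : E3, cexp (-(lam : ℂ) * ‖ξ‖ ^ 2) * (phase t x ξ * (starRingEnd ℂ) (phase s y ξ))‖
      ≤ Real.pi ^ (3/2 : ℝ) * (max lam |t - s|) ^ (-(3/2) : ℝ) := by
  simp_rw [phase_mul_conj]
  set B : ℂ := (lam : ℂ) + (4 * Real.pi ^ 2 * (t - s) : ℝ) * I with hB
  have hre : B.re = lam := by
    rw [hB, add_re, ofReal_re, re_ofReal_mul, I_re, mul_zero, add_zero]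
  have him : B.im = 4 * Real.pi ^ 2 * (t - s) := by
    rw [hB, add_im, ofReal_im, im_ofReal_mul, I_im, mul_one, zero_add]
  have hre0 : 0 < B.re := by rw [hre]; exact hl
  rw [GaussianFourier.integral_cexp_neg_mul_sq_norm_add hre0]
  rw [norm_mul]
  have h1 : ‖cexp ((2 * Real.pi * I) ^ 2 * (‖x - y‖ : ℂ) ^ 2 / (4 * B))‖ ≤ 1 := by
    rw [Complex.norm_exp, Real.exp_le_one_iff]
    have : (2 * Real.pi * I) ^ 2 * (‖x - y‖ : ℂ) ^ 2 / (4 * B)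
        = ((-(Real.pi ^ 2 * ‖x - y‖ ^ 2) : ℝ) : ℂ) * B⁻¹ := by
      rw [mul_pow, I_sq]; push_cast
      field_simp
      ring
    rw [this, re_ofReal_mul, inv_re]
    have : 0 ≤ B.re / normSq B := div_nonneg hre0.le (normSq_nonneg _)
    nlinarith [mul_nonneg (by positivity : 0 ≤ Real.pi ^ 2 * ‖x - y‖ ^ 2) this]
  have hB0 : B ≠ 0 := fun h => by rw [h] at hre0; simp at hre0
  have hnB : 0 < ‖B‖ := norm_pos_iff.mpr hB0
  have hm : max lam |t - s| ≤ ‖B‖ := by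
    refine max_le ?_ ?_
    · rw [← hre]; exact re_le_norm B
    · refine le_trans ?_ (abs_im_le_norm B)
      have : 1 ≤ 4 * Real.pi ^ 2 := by nlinarith [Real.pi_gt_three]
      rw [him, abs_mul, abs_of_pos (by linarith : 0 < 4 * Real.pi ^ 2)]
      nlinarith [abs_nonneg (t - s)]
  have h2 : ‖((Real.pi : ℂ) / B) ^ ((Module.finrank ℝ E3 : ℂ) / 2)‖
      ≤ Real.pi ^ (3/2 : ℝ) * (max lam |t - s|) ^ (-(3/2) : ℝ) := by
    have e : ((Module.finrank ℝ E3 : ℂ) / 2) = ((3/2 : ℝ) : ℂ) := by simp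
    rw [e, norm_cpow_real]
    rw [norm_div, norm_real, Real.norm_of_nonneg Real.pi_pos.le,
      Real.div_rpow Real.pi_pos.le hnB.le, div_eq_mul_inv, ← Real.rpow_neg hnB.le]
    refine mul_le_mul_of_nonneg_left ?_ (by positivity)
    exact Real.rpow_le_rpow_of_nonpos (lt_max_of_lt_left hl) hm (by norm_num)
  calc _ ≤ _ * 1 := mul_le_mul h2 h1 (norm_nonneg _) (by positivity)
    _ = _ := mul_one _

/-- Fourier-side dual of evaluation along a path. -/
def dualPath (μ : Measure ℝ) (b : ℝ → ℂ) (x : ℝ → E3) (ξ : E3) : ℂ :=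
  ∫ t, b t * phase t (x t) ξ ∂μ

section DualPath
variable {μ : Measure ℝ} [IsFiniteMeasure μ] {b : ℝ → ℂ} {x : ℝ → E3}

theorem measurable_phase_path (hx : Measurable x) :
    Measurable fun p : E3 × ℝ => phase p.2 (x p.2) p.1 :=
  continuous_phase.measurable.comp (f := fun p : E3 × ℝ => (p.2, x p.2, p.1))
    (measurable_snd.prodMk ((hx.comp measurable_snd).prodMk measurable_fst))

theorem stronglyMeasurable_dualPath (hb : Measurable b) (hx : Measurable x) :
    StronglyMeasurable (dualPath μ b x) := by
  have : StronglyMeasurable (Function.uncurry fun ξ t => b t * phase t (x t) ξ) :=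
    ((hb.comp measurable_snd).mul (measurable_phase_path hx)).stronglyMeasurable
  exact this.integral_prod_right

theorem integrable_gaussian {lam : ℝ} (hl : 0 < lam) :
    Integrable fun ξ : E3 => cexp (-(lam : ℂ) * ‖ξ‖ ^ 2) := by
  have := GaussianFourier.integrable_cexp_neg_mul_sq_norm_add (V := E3) (b := lam)
    (by simpa using hl) 0 0
  simpa using this

theorem norm_gaussian (lam : ℝ) (ξ : E3) :
    ‖cexp (-(lam : ℂ) * ‖ξ‖ ^ 2)‖ = Real.exp (-lam * ‖ξ‖ ^ 2) := by
  rw [Complex.norm_exp]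
  congr 1
  rw [← ofReal_neg, ← ofReal_pow, ← ofReal_mul, ofReal_re]

theorem lintegral_gaussian_dualPath_le (hb : Measurable b) (hx : Measurable x) {M : ℝ}
    (hM : ∀ t, ‖b t‖ ≤ M) {lam : ℝ} (hl : 0 < lam) :
    ∫⁻ ξ : E3, ENNReal.ofReal (Real.exp (-lam * ‖ξ‖ ^ 2)) * ‖dualPath μ b x ξ‖ₑ ^ 2
      ≤ ∫⁻ t, ∫⁻ s, ‖b t‖ₑ * ‖b s‖ₑ *
        ENNReal.ofReal (Real.pi ^ (3/2 : ℝ) * (max lam |t - s|) ^ (-(3/2) : ℝ)) ∂μ ∂μ := by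
  set β := dualPath μ b x with hβ
  have hM0 : 0 ≤ M := (norm_nonneg _).trans (hM 0)
  have e1 : ∀ ξ, ENNReal.ofReal (Real.exp (-lam * ‖ξ‖ ^ 2)) * ‖β ξ‖ₑ ^ 2
      = ‖cexp (-(lam : ℂ) * ‖ξ‖ ^ 2) * (β ξ * (starRingEnd ℂ) (β ξ))‖ₑ := by
    intro ξ
    rw [enorm_mul, enorm_mul, ← ofReal_norm (cexp _), norm_gaussian, sq ‖β ξ‖ₑ,
      ← ofReal_norm ((starRingEnd ℂ) (β ξ)), RCLike.norm_conj, ofReal_norm]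
  set K : E3 → ℝ × ℝ → ℂ := fun ξ z =>
    cexp (-(lam : ℂ) * ‖ξ‖ ^ 2) * ((b z.1 * phase z.1 (x z.1) ξ) *
      (starRingEnd ℂ) (b z.2 * phase z.2 (x z.2) ξ)) with hK
  have e2 : ∀ ξ, cexp (-(lam : ℂ) * ‖ξ‖ ^ 2) * (β ξ * (starRingEnd ℂ) (β ξ))
      = ∫ z, K ξ z ∂(μ.prod μ) := by
    intro ξ
    simp only [hK]
    rw [integral_const_mul]
    congr 1
    rw [integral_prod_mul (fun t => b t * phase t (x t) ξ)
      (fun t => (starRingEnd ℂ) (b t * phase t (x t) ξ)), integral_conj]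
    rfl
  have hKm : Measurable (Function.uncurry K) := by
    have h1 : Measurable fun p : E3 × ℝ × ℝ => b p.2.1 * phase p.2.1 (x p.2.1) p.1 :=
      (hb.comp (measurable_fst.comp measurable_snd)).mul
        ((measurable_phase_path hx).comp (f := fun p : E3 × ℝ × ℝ => (p.1, p.2.1))
          (measurable_fst.prodMk (measurable_fst.comp measurable_snd)))
    have h2 : Measurable fun p : E3 × ℝ × ℝ => b p.2.2 * phase p.2.2 (x p.2.2) p.1 :=
      (hb.comp (measurable_snd.comp measurable_snd)).mul
        ((measurable_phase_path hx).comp (f := fun p : E3 × ℝ × ℝ => (p.1, p.2.2))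
          (measurable_fst.prodMk (measurable_snd.comp measurable_snd)))
    have h3 : Measurable fun p : E3 × ℝ × ℝ => cexp (-(lam : ℂ) * ‖p.1‖ ^ 2) := by fun_prop
    exact h3.mul (h1.mul (continuous_conj.measurable.comp h2))
  have hKn : ∀ ξ z, ‖K ξ z‖ ≤ Real.exp (-lam * ‖ξ‖ ^ 2) * (M * M) := by
    intro ξ z
    simp only [hK]
    rw [norm_mul, norm_gaussian, norm_mul, RCLike.norm_conj, norm_mul, norm_mul, norm_phase,
      norm_phase, mul_one, mul_one]
    have := hM z.1
    have := hM z.2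
    gcongr
  have hexp : Integrable fun ξ : E3 => Real.exp (-lam * ‖ξ‖ ^ 2) := by
    refine (integrable_gaussian hl).norm.congr (.of_forall fun ξ => norm_gaussian lam ξ)
  have hKi : Integrable (Function.uncurry K) ((volume : Measure E3).prod (μ.prod μ)) := by
    have : Integrable (fun p : E3 × ℝ × ℝ => Real.exp (-lam * ‖p.1‖ ^ 2) * (M * M))
        ((volume : Measure E3).prod (μ.prod μ)) :=
      hexp.mul_prod (integrable_const (M * M))
    exact this.mono' hKm.aestronglyMeasurable (.of_forall fun p => hKn p.1 p.2)
  have hGi : Integrable fun ξ => ∫ z, K ξ z ∂(μ.prod μ) := hKi.integral_prod_left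
  have e3 : ∫⁻ ξ : E3, ENNReal.ofReal (Real.exp (-lam * ‖ξ‖ ^ 2)) * ‖β ξ‖ₑ ^ 2
      = ‖∫ ξ, ∫ z, K ξ z ∂(μ.prod μ)‖ₑ := by
    have e4 : ∀ ξ, ∫ z, K ξ z ∂(μ.prod μ)
        = ((Real.exp (-lam * ‖ξ‖ ^ 2) * ‖β ξ‖ ^ 2 : ℝ) : ℂ) := by
      intro ξ
      rw [← e2, mul_conj, normSq_eq_norm_sq]
      push_cast
      rfl
    have hG' : Integrable fun ξ : E3 => Real.exp (-lam * ‖ξ‖ ^ 2) * ‖β ξ‖ ^ 2 := by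
      have := hGi.re
      refine this.congr (.of_forall fun ξ => ?_)
      simp only [e4]
      exact ofReal_re _
    simp_rw [e4]
    rw [integral_complex_ofReal, ← ofReal_norm, norm_real, Real.norm_of_nonneg
      (integral_nonneg fun ξ => by positivity),
      ofReal_integral_eq_lintegral_ofReal hG' (.of_forall fun ξ => by positivity)]
    refine lintegral_congr fun ξ => ?_
    rw [ENNReal.ofReal_mul (Real.exp_nonneg _), ENNReal.ofReal_pow (norm_nonneg _),
      ofReal_norm]
  rw [e3, integral_integral_swap hKi]
  refine (enorm_integral_le_lintegral_enorm _).trans ?_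
  rw [lintegral_prod]
  · refine lintegral_mono fun t => lintegral_mono fun s => ?_
    have : ∫ ξ, K ξ (t, s) = b t * (starRingEnd ℂ) (b s) *
        ∫ ξ : E3, cexp (-(lam : ℂ) * ‖ξ‖ ^ 2) *
          (phase t (x t) ξ * (starRingEnd ℂ) (phase s (x s) ξ)) := by
      rw [← integral_const_mul]
      refine integral_congr_ae (.of_forall fun ξ => ?_)
      simp only [hK, map_mul]
      ring
    simp only [this]
    rw [enorm_mul, enorm_mul, ← ofReal_norm ((starRingEnd ℂ) (b s)), RCLike.norm_conj,
      ofReal_norm]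
    refine mul_le_mul' le_rfl ?_
    rw [← ofReal_norm]
    exact ENNReal.ofReal_le_ofReal (norm_gaussian_kernel_le hl _ _ _ _)
  · exact hKi.integral_prod_right.aestronglyMeasurable.enorm

end DualPath

theorem lintegral_rpow_mul_exp_neg {a r : ℝ} (ha : 0 < a) (hr : 0 < r) :
    ∫⁻ l in Ioi (0:ℝ), ENNReal.ofReal (l ^ (a - 1)) * ENNReal.ofReal (Real.exp (-l * r ^ 2))
      = ENNReal.ofReal (Real.Gamma a) * ENNReal.ofReal (r ^ (-2 * a)) := by
  have h := Real.integral_rpow_mul_exp_neg_mul_Ioi ha (by positivity : 0 < r ^ 2)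
  have hpos : 0 < (1 / r ^ 2) ^ a * Real.Gamma a :=
    mul_pos (by positivity) (Real.Gamma_pos_of_pos ha)
  have hi : IntegrableOn (fun l : ℝ => l ^ (a - 1) * Real.exp (-(r ^ 2 * l))) (Ioi 0) := by
    by_contra hc
    rw [integral_undef hc] at h
    linarith
  rw [← ENNReal.ofReal_mul (Real.Gamma_pos_of_pos ha).le]
  have e : Real.Gamma a * r ^ (-2 * a) = (1 / r ^ 2) ^ a * Real.Gamma a := by
    rw [mul_comm]
    congr 1
    rw [one_div, Real.inv_rpow (by positivity), ← Real.rpow_natCast, ← Real.rpow_mul hr.le,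
      ← Real.rpow_neg hr.le]
    congr 1
    push_cast; ring
  rw [e, ← h, ofReal_integral_eq_lintegral_ofReal hi]
  · refine setLIntegral_congr_fun measurableSet_Ioi fun l hl => ?_
    rw [← ENNReal.ofReal_mul (Real.rpow_nonneg (le_of_lt hl) _)]
    congr 3
    ring
  · exact (ae_restrict_mem measurableSet_Ioi).mono fun l hl =>
      mul_nonneg (Real.rpow_nonneg (le_of_lt hl) _) (Real.exp_nonneg _)

/-- Superposition over `l` of the regularized dispersive bounds. -/
def dispWeight (a τ : ℝ) : ENNReal :=
  ∫⁻ l in Ioi (0:ℝ), ENNReal.ofReal (l ^ (a - 1)) *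
    ENNReal.ofReal (Real.pi ^ (3/2 : ℝ) * (max l |τ|) ^ (-(3/2) : ℝ))

theorem measurable_dispWeight (a : ℝ) : Measurable (dispWeight a) := by
  have : Measurable fun p : ℝ × ℝ => ENNReal.ofReal (p.2 ^ (a - 1)) *
    ENNReal.ofReal (Real.pi ^ (3/2 : ℝ) * (max p.2 |p.1|) ^ (-(3/2) : ℝ)) := by fun_prop
  exact this.lintegral_prod_right'

theorem dispWeight_le {a τ : ℝ} (ha : 0 < a) (ha' : a < 3/2) (hτ : τ ≠ 0) :
    dispWeight a τ ≤ ENNReal.ofReal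
      (Real.pi ^ (3/2 : ℝ) * (2 / a + 2 / (3/2 - a)) * |τ| ^ (a - 3/2)) := by
  have hτ0 : 0 < |τ| := abs_pos.mpr hτ
  set R := |τ| with hR
  set P := Real.pi ^ (3/2 : ℝ) with hP
  have hP0 : 0 < P := by positivity
  have hpt : ∀ l ∈ Ioi (0:ℝ), ENNReal.ofReal (l ^ (a - 1)) *
      ENNReal.ofReal (P * (max l R) ^ (-(3/2) : ℝ))
      ≤ ENNReal.ofReal (P * R ^ (-(3/2) : ℝ)) *
          ENNReal.ofReal (if |l| ≤ R then |l| ^ (a - 1) else 0)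
        + ENNReal.ofReal P * ENNReal.ofReal (if R ≤ |l| then |l| ^ (a - 5/2) else 0) := by
    intro l hl
    have hl0 : 0 < l := hl
    rw [abs_of_pos hl0]
    rcases le_total l R with h | h
    · rw [if_pos h, max_eq_right h, mul_comm]
      exact le_self_add
    · rw [if_pos h, max_eq_left h, ← ENNReal.ofReal_mul (by positivity),
        ← ENNReal.ofReal_mul hP0.le]
      refine le_trans (le_of_eq ?_) le_add_self
      congr 1
      rw [mul_left_comm, ← Real.rpow_add hl0]
      congr 2; ring
  unfold dispWeight
  refine (setLIntegral_mono' measurableSet_Ioi hpt).trans ?_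
  refine (setLIntegral_le_lintegral _ _).trans ?_
  rw [lintegral_add_left (by
    refine Measurable.const_mul (ENNReal.measurable_ofReal.comp ?_) _
    exact Measurable.ite (measurableSet_le measurable_norm measurable_const)
      (by fun_prop) measurable_const), lintegral_const_mul' _ _ ENNReal.ofReal_ne_top,
    lintegral_const_mul' _ _ ENNReal.ofReal_ne_top]
  have h1 := lintegral_abs_rpow_ball (p := a - 1) (by linarith) hτ0
  have h2 := lintegral_abs_rpow_tail (p := a - 5/2) (by linarith) hτ0
  refine (add_le_add (mul_le_mul' le_rfl h1) (mul_le_mul' le_rfl h2)).trans ?_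
  have ha2 : 0 < 3/2 - a := by linarith
  have e2 : -(a - 5/2 + 1) = 3/2 - a := by ring
  have e1 : a - 1 + 1 = a := by ring
  rw [e2, e1, ← ENNReal.ofReal_mul (by positivity), ← ENNReal.ofReal_mul hP0.le,
    ← ENNReal.ofReal_add (by positivity) (by positivity)]
  refine ENNReal.ofReal_le_ofReal (le_of_eq ?_)
  have e3 : R ^ (a - 3/2) = R ^ (-(3/2) : ℝ) * R ^ a := by
    rw [← Real.rpow_add hτ0]; congr 1; ring
  have e4 : a - 5/2 + 1 = a - 3/2 := by ring
  rw [e4, e3]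
  ring

theorem setLIntegral_dispWeight_le {a : ℝ} (ha : 1/2 < a) (ha' : a < 3/2) {T s : ℝ} (hT : 0 < T)
    (hs : s ∈ Icc 0 T) :
    ∫⁻ t in Icc 0 T, dispWeight a (t - s) ≤ ENNReal.ofReal
      (Real.pi ^ (3/2 : ℝ) * (2 / a + 2 / (3/2 - a)) * (2 * (T ^ (a - 1/2) / (a - 1/2)))) := by
  have ha2 : 0 < 3/2 - a := by linarith
  have ha0 : 0 < a := by linarith
  set D := Real.pi ^ (3/2 : ℝ) * (2 / a + 2 / (3/2 - a)) with hD
  have hD0 : 0 < D := by positivity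
  calc ∫⁻ t in Icc 0 T, dispWeight a (t - s)
      ≤ ∫⁻ t, (fun u => if |u| ≤ T then dispWeight a u else 0) (t - s) := by
        rw [← lintegral_indicator measurableSet_Icc]
        refine lintegral_mono fun t => ?_
        by_cases h : t ∈ Icc 0 T
        · rw [indicator_of_mem h]
          simp only
          rw [if_pos]
          rw [abs_le]; constructor <;> linarith [h.1, h.2, hs.1, hs.2]
        · rw [indicator_of_notMem h]; exact zero_le
    _ = ∫⁻ u, if |u| ≤ T then dispWeight a u else 0 :=
        lintegral_sub_right_eq_self (fun u => if |u| ≤ T then dispWeight a u else 0) s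
    _ ≤ ∫⁻ u, ENNReal.ofReal D * ENNReal.ofReal (if |u| ≤ T then |u| ^ (a - 3/2) else 0) := by
        refine lintegral_mono_ae ?_
        filter_upwards [Measure.ae_ne volume (0:ℝ)] with u hu
        split_ifs with h
        · rw [← ENNReal.ofReal_mul hD0.le]
          exact dispWeight_le ha0 ha' hu
        · exact zero_le
    _ ≤ _ := by
        rw [lintegral_const_mul' _ _ ENNReal.ofReal_ne_top, ENNReal.ofReal_mul hD0.le]
        refine mul_le_mul' le_rfl ?_
        have := lintegral_abs_rpow_ball (p := a - 3/2) (by linarith) hT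
        rwa [show a - 3/2 + 1 = a - 1/2 by ring] at this

theorem dispWeight_neg (a τ : ℝ) : dispWeight a (-τ) = dispWeight a τ := by
  simp [dispWeight]

theorem lintegral_dispWeight_schur {a : ℝ} (ha : 1/2 < a) (ha' : a < 3/2) {T : ℝ} (hT : 0 < T)
    {B : ℝ → ENNReal} (hB : Measurable B) :
    ∫⁻ t in Icc 0 T, ∫⁻ s in Icc 0 T, B t * B s * dispWeight a (t - s)
      ≤ 2 * ENNReal.ofReal
      (Real.pi ^ (3/2 : ℝ) * (2 / a + 2 / (3/2 - a)) * (2 * (T ^ (a - 1/2) / (a - 1/2)))) *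
        ∫⁻ t in Icc 0 T, B t ^ 2 := by
  set Θ := ENNReal.ofReal
    (Real.pi ^ (3/2 : ℝ) * (2 / a + 2 / (3/2 - a)) * (2 * (T ^ (a - 1/2) / (a - 1/2))))
  have hk := measurable_dispWeight a
  have hks : ∀ t, Measurable fun s => dispWeight a (t - s) := fun t =>
    hk.comp (measurable_const.sub measurable_id)
  have h1 : ∫⁻ t in Icc 0 T, ∫⁻ s in Icc 0 T, B t ^ 2 * dispWeight a (t - s)
      ≤ Θ * ∫⁻ t in Icc 0 T, B t ^ 2 := by
    rw [← lintegral_const_mul _ (hB.pow_const 2)]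
    refine setLIntegral_mono' measurableSet_Icc fun t ht => ?_
    rw [lintegral_const_mul _ (hks t), mul_comm]
    refine mul_le_mul' ?_ le_rfl
    simp_rw [← dispWeight_neg a (t - _), neg_sub]
    exact setLIntegral_dispWeight_le ha ha' hT ht
  have h2 : ∫⁻ t in Icc 0 T, ∫⁻ s in Icc 0 T, B s ^ 2 * dispWeight a (t - s)
      = ∫⁻ t in Icc 0 T, ∫⁻ s in Icc 0 T, B t ^ 2 * dispWeight a (t - s) := by
    rw [lintegral_lintegral_swap]
    · refine lintegral_congr fun t => lintegral_congr fun s => ?_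
      rw [← dispWeight_neg, neg_sub]
    · exact (((hB.comp measurable_snd).pow_const 2).mul
        (hk.comp (measurable_fst.sub measurable_snd))).aemeasurable
  calc _ ≤ ∫⁻ t in Icc 0 T, ∫⁻ s in Icc 0 T, (B t ^ 2 * dispWeight a (t - s)
        + B s ^ 2 * dispWeight a (t - s)) := by
        refine lintegral_mono fun t => lintegral_mono fun s => ?_
        rw [← add_mul]
        exact mul_le_mul' (ENNReal.mul_le_sq_add_sq _ _) le_rfl
    _ = ∫⁻ t in Icc 0 T, (∫⁻ s in Icc 0 T, B t ^ 2 * dispWeight a (t - s))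
        + ∫⁻ s in Icc 0 T, B s ^ 2 * dispWeight a (t - s) := by
        refine lintegral_congr fun t => ?_
        rw [lintegral_add_left]
        exact (hks t).const_mul _
    _ = _ := lintegral_add_left (by
        have : Measurable fun p : ℝ × ℝ => B p.1 ^ 2 * dispWeight a (p.1 - p.2) :=
          ((hB.comp measurable_fst).pow_const 2).mul
            (hk.comp (measurable_fst.sub measurable_snd))
        exact this.lintegral_prod_right') _
    _ ≤ Θ * (∫⁻ t in Icc 0 T, B t ^ 2) + Θ * ∫⁻ t in Icc 0 T, B t ^ 2 := by
        rw [h2]; exact add_le_add h1 h1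
    _ = _ := by rw [mul_assoc, two_mul]

/-- The dual form of the `L²_t L^∞_x` bound for data in a homogeneous Sobolev space. -/
theorem lintegral_rpow_dualPath_le {a : ℝ} (ha : 1/2 < a) (ha' : a < 3/2) :
    ∃ C > 0, ∀ T > 0, ∀ (b : ℝ → ℂ) (x : ℝ → E3) (M : ℝ), Measurable b → Measurable x →
      (∀ t, ‖b t‖ ≤ M) →
      ∫⁻ ξ : E3, ENNReal.ofReal (‖ξ‖ ^ (-2 * a)) *
          ‖dualPath (volume.restrict (Icc 0 T)) b x ξ‖ₑ ^ 2
        ≤ ENNReal.ofReal (C * T ^ (a - 1/2)) * ∫⁻ t in Icc 0 T, ‖b t‖ₑ ^ 2 := by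
  have ha2 : 0 < 3/2 - a := by linarith
  have ha0 : 0 < a := by linarith
  have ha1 : 0 < a - 1/2 := by linarith
  have hG := Real.Gamma_pos_of_pos ha0
  refine ⟨(Real.Gamma a)⁻¹ * (2 * (Real.pi ^ (3/2 : ℝ) * (2 / a + 2 / (3/2 - a)) *
    (2 * (1 / (a - 1/2))))), by positivity, ?_⟩
  intro T hT b x M hb hx hM
  set μ := (volume : Measure ℝ).restrict (Icc 0 T)
  set β := dualPath μ b x with hβ
  have hβm : Measurable β := (stronglyMeasurable_dualPath hb hx).measurable
  have key : ENNReal.ofReal (Real.Gamma a) * ∫⁻ ξ : E3, ENNReal.ofReal (‖ξ‖ ^ (-2 * a)) *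
      ‖β ξ‖ₑ ^ 2 ≤ 2 * ENNReal.ofReal
      (Real.pi ^ (3/2 : ℝ) * (2 / a + 2 / (3/2 - a)) * (2 * (T ^ (a - 1/2) / (a - 1/2)))) *
        ∫⁻ t in Icc 0 T, ‖b t‖ₑ ^ 2 := by
    calc _ = ∫⁻ ξ : E3, ENNReal.ofReal (Real.Gamma a) * (ENNReal.ofReal (‖ξ‖ ^ (-2 * a)) *
          ‖β ξ‖ₑ ^ 2) := by rw [lintegral_const_mul' _ _ ENNReal.ofReal_ne_top]
      _ ≤ ∫⁻ ξ : E3, ∫⁻ l in Ioi (0:ℝ), ENNReal.ofReal (l ^ (a - 1)) *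
          (ENNReal.ofReal (Real.exp (-l * ‖ξ‖ ^ 2)) * ‖β ξ‖ₑ ^ 2) := by
          refine lintegral_mono_ae ?_
          filter_upwards [Measure.ae_ne volume (0 : E3)] with ξ hξ
          rw [← mul_assoc, ← lintegral_rpow_mul_exp_neg ha0 (norm_pos_iff.mpr hξ),
            ← lintegral_mul_const']
          · exact le_of_eq (lintegral_congr fun l => by rw [mul_assoc])
          · exact ENNReal.pow_ne_top enorm_ne_top
      _ = ∫⁻ l in Ioi (0:ℝ), ∫⁻ ξ : E3, ENNReal.ofReal (l ^ (a - 1)) *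
          (ENNReal.ofReal (Real.exp (-l * ‖ξ‖ ^ 2)) * ‖β ξ‖ₑ ^ 2) := by
          rw [lintegral_lintegral_swap]
          refine Measurable.aemeasurable ?_
          have : Measurable fun p : E3 × ℝ => ‖β p.1‖ₑ ^ 2 :=
            (hβm.comp measurable_fst).enorm.pow_const 2
          refine Measurable.mul (by fun_prop) (Measurable.mul (by fun_prop) this)
      _ ≤ ∫⁻ l in Ioi (0:ℝ), ∫⁻ t, ∫⁻ s, ENNReal.ofReal (l ^ (a - 1)) * (‖b t‖ₑ * ‖b s‖ₑ *
          ENNReal.ofReal (Real.pi ^ (3/2 : ℝ) * (max l |t - s|) ^ (-(3/2) : ℝ))) ∂μ ∂μ := by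
          refine setLIntegral_mono' measurableSet_Ioi fun l hl => ?_
          rw [lintegral_const_mul' _ _ ENNReal.ofReal_ne_top]
          simp_rw [lintegral_const_mul' _ _ (ENNReal.ofReal_ne_top (r := l ^ (a - 1)))]
          exact mul_le_mul' le_rfl (lintegral_gaussian_dualPath_le hb hx hM hl)
      _ = ∫⁻ t, ∫⁻ s, (∫⁻ l in Ioi (0:ℝ), ENNReal.ofReal (l ^ (a - 1)) * (‖b t‖ₑ * ‖b s‖ₑ *
          ENNReal.ofReal (Real.pi ^ (3/2 : ℝ) * (max l |t - s|) ^ (-(3/2) : ℝ)))) ∂μ ∂μ := by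
          have hm : Measurable fun p : (ℝ × ℝ) × ℝ => ENNReal.ofReal (p.1.1 ^ (a - 1)) *
              (‖b p.1.2‖ₑ * ‖b p.2‖ₑ *
              ENNReal.ofReal (Real.pi ^ (3/2 : ℝ) * (max p.1.1 |p.1.2 - p.2|) ^ (-(3/2) : ℝ))) := by
            fun_prop
          rw [lintegral_lintegral_swap]
          · refine lintegral_congr fun t => ?_
            rw [lintegral_lintegral_swap]
            exact (hm.comp (f := fun q : ℝ × ℝ => ((q.1, t), q.2)) (by fun_prop)).aemeasurable
          · exact (hm.lintegral_prod_right' (ν := μ)).aemeasurable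
      _ = ∫⁻ t in Icc 0 T, ∫⁻ s in Icc 0 T, ‖b t‖ₑ * ‖b s‖ₑ * dispWeight a (t - s) := by
          refine lintegral_congr fun t => lintegral_congr fun s => ?_
          unfold dispWeight
          rw [← lintegral_const_mul' _ _ (ENNReal.mul_ne_top enorm_ne_top enorm_ne_top)]
          exact lintegral_congr fun l => by ring
      _ ≤ _ := lintegral_dispWeight_schur ha ha' hT hb.enorm
  have hG' : ENNReal.ofReal (Real.Gamma a) ≠ 0 := by simpa using hG
  have := mul_le_mul' (le_refl (ENNReal.ofReal (Real.Gamma a))⁻¹) key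
  rw [← mul_assoc, ENNReal.inv_mul_cancel hG' ENNReal.ofReal_ne_top, one_mul] at this
  refine this.trans (le_of_eq ?_)
  rw [← mul_assoc]
  congr 1
  rw [← ENNReal.ofReal_inv_of_pos hG, show (2 : ENNReal) = ENNReal.ofReal 2 by simp,
    ← ENNReal.ofReal_mul (by norm_num), ← ENNReal.ofReal_mul (by positivity)]
  congr 1
  ring

/-- The free Schrödinger evolution of the function with Fourier transform `f`. -/
def freeEvol (f : E3 → ℂ) (t : ℝ) (x : E3) : ℂ := ∫ ξ, phase t x ξ * f ξ

theorem continuous_phase_left (ξ : E3) : Continuous fun p : ℝ × E3 => phase p.1 p.2 ξ :=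
  continuous_phase.comp (f := fun p : ℝ × E3 => (p.1, p.2, ξ)) (by fun_prop)

theorem continuous_phase_right (t : ℝ) (x : E3) : Continuous fun ξ => phase t x ξ :=
  continuous_phase.comp (f := fun ξ : E3 => (t, x, ξ)) (by fun_prop)

theorem continuous_freeEvol {f : E3 → ℂ} (hf : Integrable f) :
    Continuous fun p : ℝ × E3 => freeEvol f p.1 p.2 := by
  unfold freeEvol
  refine continuous_of_dominated (bound := fun ξ => ‖f ξ‖) (fun p => ?_) (fun p => ?_) hf.norm ?_
  · exact (continuous_phase_right _ _).aestronglyMeasurable.mul hf.1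
  · exact .of_forall fun ξ => by rw [norm_mul, norm_phase, one_mul]
  · exact .of_forall fun ξ => (continuous_phase_left ξ).mul continuous_const

theorem norm_freeEvol_le (f : E3 → ℂ) (t : ℝ) (x : E3) :
    ‖freeEvol f t x‖ ≤ ∫ ξ, ‖f ξ‖ := by
  refine (norm_integral_le_integral_norm _).trans (le_of_eq ?_)
  simp_rw [norm_mul, norm_phase, one_mul]

theorem refSymb_rpow_neg_le {N : ℝ} (hN : 1 ≤ N) {ξ : E3} (hξ : ξ ≠ 0) :
    ((refSymb N ξ)⁻¹) ^ 2 ≤ ‖ξ‖ ^ (-2 * 1 : ℝ) + ‖ξ‖ ^ (-2 * (5/6) : ℝ) := by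
  have hr : 0 < ‖ξ‖ := norm_pos_iff.mpr hξ
  have e1 : ‖ξ‖ ^ (-2 * 1 : ℝ) = (‖ξ‖⁻¹) ^ 2 := by
    rw [mul_one, Real.rpow_neg hr.le, inv_pow]; norm_num
  have e2 : ‖ξ‖ ^ (-2 * (5/6) : ℝ) = ((‖ξ‖ ^ (5/6 : ℝ))⁻¹) ^ 2 := by
    rw [← Real.rpow_neg hr.le, ← Real.rpow_natCast, ← Real.rpow_mul hr.le]; norm_num
  have hN6 : 1 ≤ N ^ (1/6 : ℝ) := Real.one_le_rpow hN (by norm_num)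
  have hp : 0 < ‖ξ‖ ^ (5/6 : ℝ) := by positivity
  rw [e1, e2, refSymb]
  rcases min_cases ‖ξ‖ (N ^ (1/6 : ℝ) * ‖ξ‖ ^ (5/6 : ℝ)) with h | h
  · rw [h.1]; nlinarith [sq_nonneg ((‖ξ‖ ^ (5/6 : ℝ))⁻¹)]
  · rw [h.1]
    have : (N ^ (1/6 : ℝ) * ‖ξ‖ ^ (5/6 : ℝ))⁻¹ ≤ (‖ξ‖ ^ (5/6 : ℝ))⁻¹ := by
      refine inv_anti₀ hp ?_
      nlinarith
    have h3 : ((N ^ (1/6 : ℝ) * ‖ξ‖ ^ (5/6 : ℝ))⁻¹) ^ 2 ≤ ((‖ξ‖ ^ (5/6 : ℝ))⁻¹) ^ 2 := by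
      gcongr
    nlinarith [sq_nonneg (‖ξ‖⁻¹)]

theorem ENNReal.le_of_sq_le_mul {a b : ENNReal} (ha : a ≠ ⊤) (h : a ^ 2 ≤ b * a) : a ≤ b := by
  rcases eq_or_ne a 0 with h0 | h0
  · simp [h0]
  · rw [sq] at h
    exact (ENNReal.mul_le_mul_iff_left h0 ha).mp h

/-- `L²` bound for the free evolution along a moving point. -/
theorem lintegral_freeEvol_path_le :
    ∃ C > 0, ∀ N ≥ 1, ∀ T > 0, T ≤ 1 → ∀ (f : E3 → ℂ) (x : ℝ → E3), Integrable f → Measurable x →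
      ∫⁻ t in Icc 0 T, ‖freeEvol f t (x t)‖ₑ ^ 2
        ≤ ENNReal.ofReal (C * T ^ (1/3 : ℝ)) *
          ∫⁻ ξ, ENNReal.ofReal (refSymb N ξ ^ 2) * ‖f ξ‖ₑ ^ 2 := by
  obtain ⟨C1, hC1, H1⟩ := lintegral_rpow_dualPath_le (a := 1) (by norm_num) (by norm_num)
  obtain ⟨C2, hC2, H2⟩ := lintegral_rpow_dualPath_le (a := 5/6) (by norm_num) (by norm_num)
  refine ⟨C1 + C2, by positivity, ?_⟩
  intro N hN T hT hT1 f x hf hx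
  set μ := (volume : Measure ℝ).restrict (Icc 0 T) with hμ
  set b : ℝ → ℂ := fun t => (starRingEnd ℂ) (freeEvol f t (x t)) with hb
  have hum : Measurable fun t => freeEvol f t (x t) :=
    (continuous_freeEvol hf).measurable.comp (f := fun t => (t, x t)) (by fun_prop)
  have hbm : Measurable b := continuous_conj.measurable.comp hum
  have hbn : ∀ t, ‖b t‖ = ‖freeEvol f t (x t)‖ := fun t => RCLike.norm_conj _
  have hbe : ∀ t, ‖b t‖ₑ = ‖freeEvol f t (x t)‖ₑ := fun t => by
    rw [← ofReal_norm, hbn, ofReal_norm]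
  set M := ∫ ξ, ‖f ξ‖ with hM
  have hbM : ∀ t, ‖b t‖ ≤ M := fun t => (hbn t).trans_le (norm_freeEvol_le f t _)
  set A := ∫⁻ t in Icc 0 T, ‖freeEvol f t (x t)‖ₑ ^ 2 with hA
  set β := dualPath μ b x with hβ
  have hβm : Measurable β := (stronglyMeasurable_dualPath hbm hx).measurable
  have hA' : A = ∫⁻ t in Icc 0 T, ‖b t‖ₑ ^ 2 := lintegral_congr fun t => by rw [hbe]
  have hAtop : A ≠ ⊤ := by
    rw [hA']
    refine ne_of_lt (lt_of_le_of_lt (lintegral_mono (g := fun _ => ENNReal.ofReal M ^ 2)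
      fun t => ?_) ?_)
    · simp only [← ofReal_norm]
      exact pow_le_pow_left' (ENNReal.ofReal_le_ofReal (hbM t)) 2
    · rw [lintegral_const]
      exact ENNReal.mul_lt_top (ENNReal.pow_lt_top ENNReal.ofReal_lt_top) (measure_lt_top _ _)
  have hdual : A = ‖∫ ξ, f ξ * β ξ‖ₑ := by
    have e1 : ∫ ξ, f ξ * β ξ = ∫ t, b t * freeEvol f t (x t) ∂μ := by
      have : ∀ ξ, f ξ * β ξ = ∫ t, b t * (phase t (x t) ξ * f ξ) ∂μ := by
        intro ξ
        rw [hβ, dualPath, ← integral_const_mul]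
        exact integral_congr_ae (.of_forall fun t => by ring)
      simp_rw [this]
      rw [integral_integral_swap]
      · refine integral_congr_ae (.of_forall fun t => ?_)
        simp only [freeEvol]
        rw [integral_const_mul]
      · have h1 : Integrable (fun p : E3 × ℝ => ‖f p.1‖ * M) ((volume : Measure E3).prod μ) :=
          hf.norm.mul_prod (integrable_const M)
        refine h1.mono' ?_ (.of_forall fun p => ?_)
        · exact ((hbm.comp measurable_snd).aestronglyMeasurable).mul
            ((measurable_phase_path hx).aestronglyMeasurable.mul
              hf.1.comp_fst)
        · simp only [Function.uncurry]
          rw [norm_mul, norm_mul, norm_phase, one_mul, mul_comm]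
          exact mul_le_mul_of_nonneg_left (hbM _) (norm_nonneg _)
    have e2 : ∀ t, b t * freeEvol f t (x t) = ((‖freeEvol f t (x t)‖ ^ 2 : ℝ) : ℂ) := by
      intro t
      rw [hb]
      simp only
      rw [mul_comm, mul_conj, normSq_eq_norm_sq]
    have hi : Integrable (fun t => ‖freeEvol f t (x t)‖ ^ 2) μ := by
      refine (integrable_const (M ^ 2)).mono' (hum.norm.pow_const 2).aestronglyMeasurable
        (.of_forall fun t => ?_)
      rw [Real.norm_of_nonneg (by positivity)]
      exact pow_le_pow_left₀ (norm_nonneg _) (norm_freeEvol_le f t _) 2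
    rw [e1]
    simp_rw [e2]
    rw [integral_complex_ofReal, ← ofReal_norm, norm_real, Real.norm_of_nonneg
      (integral_nonneg fun ξ => by positivity),
      ofReal_integral_eq_lintegral_ofReal hi (.of_forall fun ξ => by positivity), hA]
    refine lintegral_congr fun ξ => ?_
    rw [ENNReal.ofReal_pow (norm_nonneg _), ofReal_norm]
  have hCS : A ^ 2 ≤ (∫⁻ ξ, ENNReal.ofReal (refSymb N ξ ^ 2) * ‖f ξ‖ₑ ^ 2) *
      ∫⁻ ξ, ENNReal.ofReal (((refSymb N ξ)⁻¹) ^ 2) * ‖β ξ‖ₑ ^ 2 := by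
    have h1 : A ≤ ∫⁻ ξ, (ENNReal.ofReal (refSymb N ξ) * ‖f ξ‖ₑ) *
        (ENNReal.ofReal ((refSymb N ξ)⁻¹) * ‖β ξ‖ₑ) := by
      rw [hdual]
      refine (enorm_integral_le_lintegral_enorm _).trans (lintegral_mono_ae ?_)
      filter_upwards [Measure.ae_ne volume (0 : E3)] with ξ hξ
      have hp := refSymb_pos (by linarith : 0 < N) hξ
      rw [mul_mul_mul_comm, ← ENNReal.ofReal_mul hp.le, mul_inv_cancel₀ hp.ne',
        ENNReal.ofReal_one, one_mul, enorm_mul]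
    refine (pow_le_pow_left' h1 2).trans ((sq_lintegral_mul_le _ ?_ ?_).trans (le_of_eq ?_))
    · exact (measurable_refSymb N).ennreal_ofReal.aemeasurable.mul hf.1.enorm
    · exact ((measurable_refSymb N).inv.ennreal_ofReal.mul hβm.enorm).aemeasurable
    · have hn := fun ξ => refSymb_nonneg (by linarith : 0 ≤ N) ξ
      congr 1
      · refine lintegral_congr fun ξ => ?_
        rw [mul_pow, ENNReal.ofReal_pow (hn ξ)]
      · refine lintegral_congr fun ξ => ?_
        rw [mul_pow, ENNReal.ofReal_pow (inv_nonneg.mpr (hn ξ))]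
  have hβb : ∫⁻ ξ, ENNReal.ofReal (((refSymb N ξ)⁻¹) ^ 2) * ‖β ξ‖ₑ ^ 2
      ≤ ENNReal.ofReal ((C1 + C2) * T ^ (1/3 : ℝ)) * A := by
    calc _ ≤ ∫⁻ ξ, (ENNReal.ofReal (‖ξ‖ ^ (-2 * 1 : ℝ)) * ‖β ξ‖ₑ ^ 2 +
          ENNReal.ofReal (‖ξ‖ ^ (-2 * (5/6) : ℝ)) * ‖β ξ‖ₑ ^ 2) := by
          refine lintegral_mono_ae ?_
          filter_upwards [Measure.ae_ne volume (0 : E3)] with ξ hξ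
          rw [← add_mul, ← ENNReal.ofReal_add (by positivity) (by positivity)]
          exact mul_le_mul' (ENNReal.ofReal_le_ofReal (refSymb_rpow_neg_le hN hξ)) le_rfl
      _ ≤ ENNReal.ofReal (C1 * T ^ (1 - 1/2 : ℝ)) * A
          + ENNReal.ofReal (C2 * T ^ (5/6 - 1/2 : ℝ)) * A := by
          rw [lintegral_add_left]
          · rw [hA']
            exact add_le_add (H1 T hT b x M hbm hx hbM) (H2 T hT b x M hbm hx hbM)
          · exact Measurable.mul (by fun_prop) (hβm.enorm.pow_const 2)
      _ ≤ _ := by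
          rw [← add_mul, ← ENNReal.ofReal_add (by positivity) (by positivity)]
          refine mul_le_mul' (ENNReal.ofReal_le_ofReal ?_) le_rfl
          have h1 : T ^ (1 - 1/2 : ℝ) ≤ T ^ (1/3 : ℝ) :=
            Real.rpow_le_rpow_of_exponent_ge hT hT1 (by norm_num)
          have h2 : T ^ (5/6 - 1/2 : ℝ) = T ^ (1/3 : ℝ) := by norm_num
          rw [h2]
          nlinarith
  refine ENNReal.le_of_sq_le_mul hAtop ((hCS.trans (mul_le_mul' le_rfl hβb)).trans (le_of_eq ?_))
  ring

/-- A measurable path along which a continuous function dominates finitely many competitors. -/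
def argmaxPath (u : ℝ → E3 → ℂ) (y : ℕ → E3) : ℕ → ℝ → E3
  | 0 => fun _ => y 0
  | n + 1 => fun t =>
      if ‖u t (y (n + 1))‖ ≤ ‖u t (argmaxPath u y n t)‖ then argmaxPath u y n t else y (n + 1)

section ArgmaxPath
variable {u : ℝ → E3 → ℂ} {y : ℕ → E3}

theorem measurable_argmaxPath (hu : Measurable fun p : ℝ × E3 => u p.1 p.2) (n : ℕ) :
    Measurable (argmaxPath u y n) := by
  induction n with
  | zero => exact measurable_const
  | succ n ih =>
    refine Measurable.ite (measurableSet_le ?_ ?_) ih measurable_const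
    · exact (hu.comp (f := fun t => (t, y (n + 1))) (by fun_prop)).norm
    · exact (hu.comp (f := fun t => (t, argmaxPath u y n t)) (measurable_id.prodMk ih)).norm

theorem norm_argmaxPath_mono (t : ℝ) : Monotone fun n => ‖u t (argmaxPath u y n t)‖ := by
  refine monotone_nat_of_le_succ fun n => ?_
  simp only [argmaxPath]
  split_ifs with h
  · exact le_rfl
  · exact (not_le.mp h).le

theorem le_norm_argmaxPath (t : ℝ) (n : ℕ) : ‖u t (y n)‖ ≤ ‖u t (argmaxPath u y n t)‖ := by
  cases n with
  | zero => exact le_rfl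
  | succ n =>
    simp only [argmaxPath]
    split_ifs with h
    · exact h
    · exact le_rfl

end ArgmaxPath

/-- Essential size in space at fixed time. -/
def supNorm (u : ℝ → E3 → ℂ) (t : ℝ) : ENNReal := ⨆ x, ‖u t x‖ₑ

theorem lintegral_supNorm_le {u : ℝ → E3 → ℂ} (hu : Continuous fun p : ℝ × E3 => u p.1 p.2)
    {s : Set ℝ} {B : ENNReal}
    (h : ∀ x : ℝ → E3, Measurable x → ∫⁻ t in s, ‖u t (x t)‖ₑ ^ 2 ≤ B) :
    ∫⁻ t in s, supNorm u t ^ 2 ≤ B := by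
  set y := TopologicalSpace.denseSeq E3
  have hm := fun n => measurable_argmaxPath (y := y) hu.measurable n
  have e : ∀ t, supNorm u t ^ 2 = ⨆ n, ‖u t (argmaxPath u y n t)‖ₑ ^ 2 := by
    intro t
    refine le_antisymm ?_ (iSup_le fun n => pow_le_pow_left' (le_iSup (fun x => ‖u t x‖ₑ) _) 2)
    set S := ⨆ n, ‖u t (argmaxPath u y n t)‖ₑ ^ 2 with hS
    have hx : ∀ x, ‖u t x‖ₑ ^ 2 ≤ S := by
      have hc : Continuous fun x => ‖u t x‖ₑ ^ 2 :=
        (ENNReal.continuous_pow 2).comp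
          (continuous_enorm.comp (hu.comp (f := fun x => (t, x)) (by fun_prop)))
      have hcl : IsClosed {x | ‖u t x‖ₑ ^ 2 ≤ S} := isClosed_le hc continuous_const
      have hd : DenseRange y := TopologicalSpace.denseRange_denseSeq E3
      intro x
      have hr : range y ⊆ {x | ‖u t x‖ₑ ^ 2 ≤ S} := ?_
      · have := hcl.closure_subset_iff.mpr hr
        rw [hd.closure_range] at this
        exact this (mem_univ x)
      rintro _ ⟨n, rfl⟩
      refine le_trans (pow_le_pow_left' ?_ 2) (le_iSup (fun n => ‖u t (argmaxPath u y n t)‖ₑ ^ 2) n)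
      rw [← ofReal_norm, ← ofReal_norm]
      exact ENNReal.ofReal_le_ofReal (le_norm_argmaxPath t n)
    unfold supNorm
    have hs : ∀ x, ‖u t x‖ₑ ≤ S ^ (1/2 : ℝ) := by
      intro x
      have := ENNReal.rpow_le_rpow (hx x) (by norm_num : (0:ℝ) ≤ 1/2)
      rwa [← ENNReal.rpow_natCast, ← ENNReal.rpow_mul,
        show ((2:ℕ):ℝ) * (1/2) = 1 by norm_num, ENNReal.rpow_one] at this
    refine (pow_le_pow_left' (iSup_le hs) 2).trans (le_of_eq ?_)
    rw [← ENNReal.rpow_natCast, ← ENNReal.rpow_mul, show (1/2:ℝ) * ((2:ℕ):ℝ) = 1 by norm_num,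
      ENNReal.rpow_one]
  simp_rw [e]
  rw [lintegral_iSup]
  · exact iSup_le fun n => h _ (hm n)
  · intro n
    exact (hu.measurable.comp (f := fun t => (t, argmaxPath u y n t))
      (measurable_id.prodMk (hm n))).enorm.pow_const 2
  · intro m n hmn t
    simp only
    refine pow_le_pow_left' ?_ 2
    rw [← ofReal_norm, ← ofReal_norm]
    exact ENNReal.ofReal_le_ofReal (norm_argmaxPath_mono t hmn)

theorem measurable_supNorm {u : ℝ → E3 → ℂ} (hu : Continuous fun p : ℝ × E3 => u p.1 p.2) :
    Measurable (supNorm u) := by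
  have : LowerSemicontinuous (supNorm u) :=
    lowerSemicontinuous_iSup fun x =>
      (continuous_enorm.comp (hu.comp (f := fun t => (t, x)) (by fun_prop))).lowerSemicontinuous
  exact this.measurable

/-- The `L²_t L^∞_x` estimate for the free Schrödinger evolution. -/
theorem lintegral_supNorm_freeEvol_le :
    ∃ C > 0, ∀ N ≥ 1, ∀ T > 0, T ≤ 1 → ∀ f : E3 → ℂ, Integrable f →
      ∫⁻ t in Icc 0 T, supNorm (freeEvol f) t ^ 2
        ≤ ENNReal.ofReal (C * T ^ (1/3 : ℝ)) *
          ∫⁻ ξ, ENNReal.ofReal (refSymb N ξ ^ 2) * ‖f ξ‖ₑ ^ 2 := by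
  obtain ⟨C, hC, H⟩ := lintegral_freeEvol_path_le
  exact ⟨C, hC, fun N hN T hT hT1 f hf =>
    lintegral_supNorm_le (continuous_freeEvol hf) fun x hx => H N hN T hT hT1 f x hf hx⟩

theorem setLIntegral_rpow_Ioc {p R : ℝ} (hp : -1 < p) (hR : 0 ≤ R) :
    ∫⁻ x in Ioc 0 R, ENNReal.ofReal (x ^ p) = ENNReal.ofReal (R ^ (p + 1) / (p + 1)) := by
  have hi : IntervalIntegrable (fun x : ℝ => x ^ p) volume 0 R :=
    intervalIntegral.intervalIntegrable_rpow' hp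
  rw [← ofReal_integral_eq_lintegral_ofReal
    ((intervalIntegrable_iff_integrableOn_Ioc_of_le hR).1 hi),
    ← intervalIntegral.integral_of_le hR, integral_rpow (Or.inl hp),
    Real.zero_rpow (by linarith), sub_zero]
  filter_upwards [ae_restrict_mem measurableSet_Ioc] with x hx
  exact Real.rpow_nonneg hx.1.le _

/-- Density in the step size of the averaged squared difference quotients. -/
def stepDensity (s N ρ : ℝ) : ℝ := (2 - 2 * s) * N ^ (2 - 2 * s) * ρ ^ (-1 - 2 * s)

/-- A one-dimensional symbol built from averaged squared differences. -/
def diffWeight (s N x : ℝ) : ENNReal :=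
  ∫⁻ ρ in Ioc 0 N⁻¹, ENNReal.ofReal (stepDensity s N ρ) *
    ‖cexp (I * (2 * Real.pi * ρ * x : ℝ)) - 1‖ₑ ^ 2

theorem enorm_exp_sub_one_sq (y : ℝ) :
    ‖cexp (I * (y : ℝ)) - 1‖ₑ ^ 2 = ENNReal.ofReal (‖cexp (I * (y : ℝ)) - 1‖ ^ 2) := by
  rw [ENNReal.ofReal_pow (norm_nonneg _), ofReal_norm]

theorem norm_exp_sub_one_le_two (y : ℝ) : ‖cexp (I * (y : ℝ)) - 1‖ ≤ 2 := by
  rw [Complex.norm_exp_I_mul_ofReal_sub_one, norm_mul, Real.norm_of_nonneg zero_le_two]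
  have := Real.abs_sin_le_one (y / 2)
  rw [← Real.norm_eq_abs] at this
  linarith

theorem le_norm_exp_sub_one {ρ x : ℝ} (h : |ρ * x| ≤ 1 / 2) :
    4 * |ρ * x| ≤ ‖cexp (I * (2 * Real.pi * ρ * x : ℝ)) - 1‖ := by
  rw [Complex.norm_exp_I_mul_ofReal_sub_one, norm_mul, Real.norm_of_nonneg zero_le_two,
    Real.norm_eq_abs]
  have e : 2 * Real.pi * ρ * x / 2 = Real.pi * (ρ * x) := by ring
  have hpi := Real.pi_pos
  have := Real.mul_abs_le_abs_sin (x := Real.pi * (ρ * x)) (by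
    rw [abs_mul, abs_of_pos hpi]; nlinarith)
  rw [abs_mul, abs_of_pos hpi] at this
  rw [e]
  have e2 : 2 / Real.pi * (Real.pi * |ρ * x|) = 2 * |ρ * x| := by field_simp
  linarith

theorem setLIntegral_stepDensity_sq {s N : ℝ} (hs1 : s < 1) (hN : 0 < N)
    {R : ℝ} (hR : 0 ≤ R) (c : ℝ) (hc : 0 ≤ c) :
    ∫⁻ ρ in Ioc 0 R, ENNReal.ofReal (stepDensity s N ρ) * ENNReal.ofReal (c * ρ ^ 2)
      = ENNReal.ofReal (c * (N * R) ^ (2 - 2 * s)) := by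
  have h0 : 0 < 2 - 2 * s := by linarith
  have : ∀ ρ ∈ Ioc 0 R, ENNReal.ofReal (stepDensity s N ρ) * ENNReal.ofReal (c * ρ ^ 2)
      = ENNReal.ofReal (c * (2 - 2 * s) * N ^ (2 - 2 * s)) * ENNReal.ofReal (ρ ^ (1 - 2 * s)) := by
    intro ρ hρ
    have hρ0 := hρ.1
    rw [← ENNReal.ofReal_mul' (by positivity), ← ENNReal.ofReal_mul (by positivity)]
    congr 1
    unfold stepDensity
    have : ρ ^ (1 - 2 * s) = ρ ^ (-1 - 2 * s) * ρ ^ 2 := by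
      rw [← Real.rpow_natCast, ← Real.rpow_add hρ0]; congr 1; push_cast; ring
    rw [this]; ring
  rw [setLIntegral_congr_fun measurableSet_Ioc this, lintegral_const_mul' _ _ ENNReal.ofReal_ne_top,
    setLIntegral_rpow_Ioc (by linarith) hR, ← ENNReal.ofReal_mul (by positivity),
    show 1 - 2 * s + 1 = 2 - 2 * s by ring, Real.mul_rpow hN.le hR]
  congr 1
  generalize 2 - 2 * s = q at h0 ⊢
  field_simp

theorem diffWeight_le {s N : ℝ} (hs : 5 / 6 < s) (hs1 : s < 1) (hN : 0 < N)
    {x : ℝ} {w : E3} (hw : ‖w‖ = |x|) :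
    diffWeight s N x ≤ ENNReal.ofReal (44 * modSymb s N w ^ 2) := by
  have h0 : 0 < 2 - 2 * s := by linarith
  have hpi2 : Real.pi ^ 2 ≤ 10 := by nlinarith [Real.pi_lt_d2, Real.pi_pos]
  have hsq : ∀ ρ : ℝ, ‖cexp (I * (2 * Real.pi * ρ * x : ℝ)) - 1‖ₑ ^ 2
      ≤ ENNReal.ofReal (40 * |x| ^ 2 * ρ ^ 2) := by
    intro ρ
    rw [enorm_exp_sub_one_sq]
    refine ENNReal.ofReal_le_ofReal ?_
    have := Real.norm_exp_I_mul_ofReal_sub_one_le (x := 2 * Real.pi * ρ * x)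
    calc _ ≤ ‖2 * Real.pi * ρ * x‖ ^ 2 := by gcongr
      _ = 4 * Real.pi ^ 2 * (|x| ^ 2 * ρ ^ 2) := by
        rw [Real.norm_eq_abs, sq_abs, sq_abs]; ring
      _ ≤ 4 * 10 * (|x| ^ 2 * ρ ^ 2) := by gcongr
      _ = _ := by ring
  rcases le_total |x| N with h | h
  · rw [modSymb_of_le hs1 (hw.trans_le h), hw]
    calc diffWeight s N x ≤ ∫⁻ ρ in Ioc 0 N⁻¹, ENNReal.ofReal (stepDensity s N ρ) *
          ENNReal.ofReal (40 * |x| ^ 2 * ρ ^ 2) :=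
          lintegral_mono fun ρ => mul_le_mul' le_rfl (hsq ρ)
      _ = _ := setLIntegral_stepDensity_sq hs1 hN (by positivity) _ (by positivity)
      _ ≤ _ := by
        rw [mul_inv_cancel₀ hN.ne', Real.one_rpow]
        refine ENNReal.ofReal_le_ofReal ?_
        nlinarith [sq_nonneg |x|]
  · have hx0 : 0 < |x| := by linarith
    rw [modSymb_of_ge hs1 hN (h.trans_eq hw.symm), hw]
    have hsq2 : ∀ ρ : ℝ, ‖cexp (I * (2 * Real.pi * ρ * x : ℝ)) - 1‖ₑ ^ 2 ≤ ENNReal.ofReal 4 := by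
      intro ρ
      rw [enorm_exp_sub_one_sq]
      refine ENNReal.ofReal_le_ofReal ?_
      have := norm_exp_sub_one_le_two (2 * Real.pi * ρ * x)
      nlinarith [norm_nonneg (cexp (I * (2 * Real.pi * ρ * x : ℝ)) - 1)]
    have e2s : 0 < 2 * s := by linarith
    calc diffWeight s N x
        ≤ ∫⁻ ρ in Ioc 0 |x|⁻¹ ∪ Ioi |x|⁻¹, ENNReal.ofReal (stepDensity s N ρ) *
            ‖cexp (I * (2 * Real.pi * ρ * x : ℝ)) - 1‖ₑ ^ 2 := by
          refine lintegral_mono_set fun ρ hρ => ?_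
          rcases le_or_gt ρ |x|⁻¹ with h | h
          · exact Or.inl ⟨hρ.1, h⟩
          · exact Or.inr h
      _ ≤ _ := lintegral_union_le _ _ _
      _ ≤ (∫⁻ ρ in Ioc 0 |x|⁻¹, ENNReal.ofReal (stepDensity s N ρ) *
          ENNReal.ofReal (40 * |x| ^ 2 * ρ ^ 2)) + ∫⁻ ρ in Ioi |x|⁻¹,
          ENNReal.ofReal ((2 - 2 * s) * N ^ (2 - 2 * s) * 4) *
          ENNReal.ofReal (if |x|⁻¹ ≤ |ρ| then |ρ| ^ (-1 - 2 * s) else 0) := by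
          refine add_le_add (lintegral_mono fun ρ => mul_le_mul' le_rfl (hsq ρ)) ?_
          refine setLIntegral_mono' measurableSet_Ioi fun ρ hρ => ?_
          have hρ' : |x|⁻¹ < ρ := hρ
          have hρ0 : 0 < ρ := (inv_pos.mpr hx0).trans hρ
          refine (mul_le_mul' le_rfl (hsq2 ρ)).trans (le_of_eq ?_)
          rw [abs_of_pos hρ0, if_pos hρ'.le, ← ENNReal.ofReal_mul' (by norm_num),
            ← ENNReal.ofReal_mul (by positivity), stepDensity]
          congr 1; ring
      _ ≤ ENNReal.ofReal (40 * |x| ^ 2 * (N * |x|⁻¹) ^ (2 - 2 * s)) +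
          ENNReal.ofReal ((2 - 2 * s) * N ^ (2 - 2 * s) * 4) *
            ENNReal.ofReal (2 * ((|x|⁻¹) ^ (-1 - 2 * s + 1) / (-(-1 - 2 * s + 1)))) := by
          rw [setLIntegral_stepDensity_sq hs1 hN (by positivity) _ (by positivity),
            lintegral_const_mul' _ _ ENNReal.ofReal_ne_top]
          refine add_le_add le_rfl (mul_le_mul' le_rfl ?_)
          exact (setLIntegral_le_lintegral _ _).trans
            (lintegral_abs_rpow_tail (by linarith) (by positivity))
      _ ≤ _ := by
          have e1 : -1 - 2 * s + 1 = -(2 * s) := by ring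
          have e3 : (|x|⁻¹) ^ (-(2 * s)) = |x| ^ (2 * s) := by
            rw [Real.inv_rpow hx0.le, Real.rpow_neg hx0.le, inv_inv]
          have e4 : |x| ^ 2 * (N * |x|⁻¹) ^ (2 - 2 * s) = N ^ (2 - 2 * s) * |x| ^ (2 * s) := by
            rw [Real.mul_rpow hN.le (by positivity), Real.inv_rpow hx0.le,
              ← Real.rpow_neg hx0.le, mul_left_comm, ← Real.rpow_natCast |x| 2,
              ← Real.rpow_add hx0]
            congr 2; push_cast; ring
          have e5 : (N ^ (1 - s) * |x| ^ s) ^ 2 = N ^ (2 - 2 * s) * |x| ^ (2 * s) := by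
            rw [mul_pow, ← Real.rpow_natCast, ← Real.rpow_natCast, ← Real.rpow_mul hN.le,
              ← Real.rpow_mul hx0.le]
            congr 2 <;> push_cast <;> ring
          rw [e1, e3, neg_neg, ← ENNReal.ofReal_mul (by positivity),
            ← ENNReal.ofReal_add (by positivity) (by positivity)]
          refine ENNReal.ofReal_le_ofReal ?_
          rw [mul_assoc 40, e4, e5]
          set Z := N ^ (2 - 2 * s) * |x| ^ (2 * s) with hZ
          have hZ0 : 0 ≤ Z := by positivity
          have : (2 - 2 * s) * N ^ (2 - 2 * s) * 4 * (2 * (|x| ^ (2 * s) / (2 * s)))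
              = ((2 - 2 * s) * 8 / (2 * s)) * Z := by rw [hZ]; field_simp; ring
          rw [this]
          have h8 : (2 - 2 * s) * 8 / (2 * s) ≤ 4 := by
            rw [div_le_iff₀ e2s]; linarith
          nlinarith

theorem le_diffWeight {s N : ℝ} (hs : 5 / 6 < s) (hs1 : s < 1) (hN : 0 < N)
    {x : ℝ} {w : E3} (hw : ‖w‖ = |x|) :
    ENNReal.ofReal (8 * modSymb s N w ^ 2) ≤ diffWeight s N x := by
  have h0 : 0 < 2 - 2 * s := by linarith
  have key : ∀ R : ℝ, 0 ≤ R → R ≤ N⁻¹ → R * |x| ≤ 1 / 2 →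
      ENNReal.ofReal (16 * |x| ^ 2 * (N * R) ^ (2 - 2 * s)) ≤ diffWeight s N x := by
    intro R hR hRN hRx
    rw [← setLIntegral_stepDensity_sq hs1 hN hR _ (by positivity)]
    unfold diffWeight
    refine le_trans ?_ (lintegral_mono_set (Ioc_subset_Ioc_right hRN))
    refine setLIntegral_mono' measurableSet_Ioc fun ρ hρ => mul_le_mul' le_rfl ?_
    rw [enorm_exp_sub_one_sq]
    refine ENNReal.ofReal_le_ofReal ?_
    have hρx : |ρ * x| = ρ * |x| := by rw [abs_mul, abs_of_pos hρ.1]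
    have := le_norm_exp_sub_one (ρ := ρ) (x := x) (by
      rw [hρx]
      exact (mul_le_mul_of_nonneg_right hρ.2 (abs_nonneg x)).trans hRx)
    rw [hρx] at this
    have hnn : 0 ≤ ρ * |x| := mul_nonneg hρ.1.le (abs_nonneg x)
    calc 16 * |x| ^ 2 * ρ ^ 2 = (4 * (ρ * |x|)) ^ 2 := by ring
      _ ≤ _ := by gcongr
  rcases le_total |x| (N / 2) with h | h
  · refine le_trans ?_ (key N⁻¹ (by positivity) le_rfl ?_)
    · rw [mul_inv_cancel₀ hN.ne', Real.one_rpow, modSymb_of_le hs1 (by rw [hw]; linarith), hw]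
      refine ENNReal.ofReal_le_ofReal ?_
      nlinarith [sq_nonneg |x|]
    · calc N⁻¹ * |x| ≤ N⁻¹ * (N / 2) := by gcongr
        _ = 1 / 2 := by field_simp
  · have hx0 : 0 < |x| := by linarith
    refine le_trans ?_ (key (2 * |x|)⁻¹ (by positivity) (inv_anti₀ hN (by linarith))
      (le_of_eq (by field_simp)))
    refine ENNReal.ofReal_le_ofReal ?_
    have e4 : |x| ^ 2 * (N * (2 * |x|)⁻¹) ^ (2 - 2 * s)
        = 2 ^ (-(2 - 2 * s)) * (N ^ (2 - 2 * s) * |x| ^ (2 * s)) := by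
      rw [Real.mul_rpow hN.le (by positivity), Real.inv_rpow (by positivity),
        ← Real.rpow_neg (by positivity), Real.mul_rpow (by norm_num) hx0.le,
        show |x| ^ (2 * s) = |x| ^ 2 * |x| ^ (-(2 - 2 * s)) by
          rw [← Real.rpow_natCast, ← Real.rpow_add hx0]; congr 1; push_cast; ring]
      ring
    have e5 : (N ^ (1 - s) * |x| ^ s) ^ 2 = N ^ (2 - 2 * s) * |x| ^ (2 * s) := by
      rw [mul_pow, ← Real.rpow_natCast, ← Real.rpow_natCast, ← Real.rpow_mul hN.le,
        ← Real.rpow_mul hx0.le]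
      congr 2 <;> push_cast <;> ring
    have h2 : (1/2 : ℝ) ≤ 2 ^ (-(2 - 2 * s)) := by
      calc (1/2 : ℝ) = 2 ^ (-1 : ℝ) := by rw [Real.rpow_neg_one]; norm_num
        _ ≤ _ := Real.rpow_le_rpow_of_exponent_le (by norm_num) (by linarith)
    have h3 : modSymb s N w ^ 2 ≤ N ^ (2 - 2 * s) * |x| ^ (2 * s) := by
      rw [← e5, ← hw]
      exact pow_le_pow_left₀ (modSymb_nonneg hN.le w) (min_le_right _ _) 2
    rw [mul_assoc, e4]
    have : 0 ≤ N ^ (2 - 2 * s) * |x| ^ (2 * s) := by positivity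
    nlinarith

theorem sum_diffWeight_le {s N : ℝ} (hs : 5 / 6 < s) (hs1 : s < 1) (hN : 0 < N)
    (ξ : E3) :
    ∑ i, diffWeight s N (ξ i) ≤ ENNReal.ofReal (132 * modSymb s N ξ ^ 2) := by
  have : ∀ i, diffWeight s N (ξ i) ≤ ENNReal.ofReal (44 * modSymb s N ξ ^ 2) := by
    intro i
    refine (diffWeight_le hs hs1 hN (w := EuclideanSpace.single i (ξ i)) (by simp)).trans
      (ENNReal.ofReal_le_ofReal ?_)
    have h1 : modSymb s N (EuclideanSpace.single i (ξ i)) ≤ 1 * modSymb s N ξ :=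
      modSymb_le_mul (by linarith) hs1 hN.le le_rfl (by
        simpa using PiLp.norm_apply_le ξ i)
    rw [one_mul] at h1
    have := modSymb_nonneg (s := s) hN.le (EuclideanSpace.single i (ξ i) : E3)
    gcongr
  refine (Finset.sum_le_sum fun i _ => this i).trans (le_of_eq ?_)
  rw [Finset.sum_const, Finset.card_univ, Fintype.card_fin, nsmul_eq_mul,
    show ((3 : ℕ) : ENNReal) = ENNReal.ofReal 3 by simp, ← ENNReal.ofReal_mul (by norm_num)]
  congr 1; ring

theorem le_sum_diffWeight {s N : ℝ} (hs : 5 / 6 < s) (hs1 : s < 1) (hN : 0 < N)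
    (ξ : E3) :
    ENNReal.ofReal (2 * modSymb s N ξ ^ 2) ≤ ∑ i, diffWeight s N (ξ i) := by
  obtain ⟨i, -, hi⟩ := Finset.exists_max_image Finset.univ (fun i => |ξ i|) Finset.univ_nonempty
  have hn : ‖ξ‖ ≤ 2 * |ξ i| := by
    have h1 : ‖ξ‖ ^ 2 ≤ 3 * |ξ i| ^ 2 := by
      rw [EuclideanSpace.norm_sq_eq, Fin.sum_univ_three]
      have : ∀ j, ‖ξ j‖ ^ 2 ≤ |ξ i| ^ 2 := fun j => by
        have := hi j (Finset.mem_univ j)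
        rw [Real.norm_eq_abs]; gcongr
      linarith [this 0, this 1, this 2]
    refine le_of_sq_le_sq ?_ (by positivity)
    nlinarith [sq_nonneg |ξ i|]
  refine le_trans ?_ ((le_diffWeight hs hs1 hN (w := EuclideanSpace.single i (ξ i))
    (by simp)).trans (Finset.single_le_sum (f := fun i => diffWeight s N (ξ i))
      (fun _ _ => zero_le) (Finset.mem_univ i)))
  refine ENNReal.ofReal_le_ofReal ?_
  have h1 : modSymb s N ξ ≤ 2 * modSymb s N (EuclideanSpace.single i (ξ i)) :=
    modSymb_le_mul (by linarith) hs1 hN.le one_le_two (by simpa using hn)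
  have := modSymb_nonneg (s := s) hN.le ξ
  nlinarith

theorem measurable_diffWeight (s N : ℝ) : Measurable (diffWeight s N) := by
  have : Measurable fun p : ℝ × ℝ => ENNReal.ofReal (stepDensity s N p.2) *
      ‖cexp (I * (2 * Real.pi * p.2 * p.1 : ℝ)) - 1‖ₑ ^ 2 := by
    unfold stepDensity; fun_prop
  exact this.lintegral_prod_right'

lemma integral_mul_fourierInv_eq {f g : E3 → ℂ} (hf : Integrable f) (hg : Integrable g) :
    ∫ x, 𝓕⁻ f x * g x = ∫ x, f x * 𝓕⁻ g x := by
  have h := VectorFourier.integral_fourierIntegral_smul_eq_flip (e := Real.fourierChar)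
    (L := -innerₗ E3) (μ := volume) (ν := volume) (f := f) (g := g)
    Real.continuous_fourierChar (continuous_inner (𝕜 := ℝ) (E := E3)).neg hf hg
  have hflip : (-innerₗ E3).flip = -innerₗ E3 := by
    ext x y
    simp [real_inner_comm]
  rw [hflip] at h
  simpa [smul_eq_mul] using! h

lemma fourierInv_toLp_ae_eq {f : E3 → ℂ} (hf : Integrable f) (hf2 : MemLp f 2) :
    (𝓕⁻ (hf2.toLp f) : Lp ℂ 2 (volume : Measure E3)) =ᵐ[volume] 𝓕⁻ f := by
  have hcont : Continuous (𝓕⁻ f) := by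
    have : 𝓕⁻ f = fun x => 𝓕 f (-x) := by
      ext x
      rw [Real.fourierInv_eq_fourier_neg]
    rw [this]
    exact (VectorFourier.fourierIntegral_continuous Real.continuous_fourierChar
      (L := innerₗ E3) (continuous_inner (𝕜 := ℝ) (E := E3)) hf).comp continuous_neg
  have hG := Lp.memLp (𝓕⁻ (hf2.toLp f) : Lp ℂ 2 (volume : Measure E3))
  refine ae_eq_of_integral_contDiff_smul_eq (hG.locallyIntegrable (by norm_num))
    hcont.locallyIntegrable fun g hg hgc => ?_
  have hgc' : HasCompactSupport (fun x => (g x : ℂ)) :=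
    hgc.comp_left (g := fun y : ℝ => (y : ℂ)) (by simp)
  let G : SchwartzMap E3 ℂ := hgc'.toSchwartzMap (Complex.ofRealCLM.contDiff.comp hg)
  have hGapp : ∀ x, G x = (g x : ℂ) := fun x => rfl
  have h1 := congrArg (fun T : TemperedDistribution E3 ℂ => T G)
    (Lp.fourierInv_toTemperedDistribution_eq (hf2.toLp f))
  simp only [TemperedDistribution.fourierInv_apply, Lp.toTemperedDistribution_apply,
    smul_eq_mul] at h1
  have h2 : ∫ x, (𝓕⁻ G : SchwartzMap E3 ℂ) x * (hf2.toLp f) x = ∫ x, 𝓕⁻ (G : E3 → ℂ) x * f x := by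
    apply integral_congr_ae
    filter_upwards [hf2.coeFn_toLp] with x hx
    rw [hx, SchwartzMap.fourierInv_coe]
  rw [h2, integral_mul_fourierInv_eq G.integrable hf] at h1
  simp only [Complex.real_smul]
  simpa [hGapp] using h1.symm

lemma memLp_fourierInv {f : E3 → ℂ} (hf : Integrable f) (hf2 : MemLp f 2) :
    MemLp (𝓕⁻ f) 2 :=
  (Lp.memLp _).ae_eq (fourierInv_toLp_ae_eq hf hf2)

lemma norm_toLp_fourierInv {f : E3 → ℂ} (hf : Integrable f) (hf2 : MemLp f 2) :
    𝓕⁻ (hf2.toLp f) = (memLp_fourierInv hf hf2).toLp (𝓕⁻ f) := by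
  apply Lp.ext
  exact (fourierInv_toLp_ae_eq hf hf2).trans (memLp_fourierInv hf hf2).coeFn_toLp.symm

lemma integral_conj_fourierInv_mul {f g : E3 → ℂ} (hf : Integrable f) (hf2 : MemLp f 2)
    (hg : Integrable g) (hg2 : MemLp g 2) :
    ∫ x, starRingEnd ℂ (𝓕⁻ f x) * 𝓕⁻ g x = ∫ ξ, starRingEnd ℂ (f ξ) * g ξ := by
  have key : ∀ {a b : E3 → ℂ} (ha : MemLp a 2) (hb : MemLp b 2),
      inner ℂ (ha.toLp a) (hb.toLp b) = ∫ x, starRingEnd ℂ (a x) * b x := by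
    intro a b ha hb
    rw [L2.inner_def]
    apply integral_congr_ae
    filter_upwards [ha.coeFn_toLp, hb.coeFn_toLp] with x h1 h2
    rw [h1, h2, RCLike.inner_apply, mul_comm]
  rw [← key (memLp_fourierInv hf hf2) (memLp_fourierInv hg hg2), ← key hf2 hg2,
    ← norm_toLp_fourierInv hf hf2, ← norm_toLp_fourierInv hg hg2,
    ← Lp.inner_fourier_eq (𝓕⁻ (hf2.toLp f)) (𝓕⁻ (hg2.toLp g)),
    FourierTransform.fourier_fourierInv_eq, FourierTransform.fourier_fourierInv_eq]

lemma lintegral_fourierInv_sq {f : E3 → ℂ} (hf : Integrable f) (hf2 : MemLp f 2) :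
    ∫⁻ x, ‖𝓕⁻ f x‖ₑ ^ 2 = ∫⁻ ξ, ‖f ξ‖ₑ ^ 2 := by
  have key : ∀ {a : E3 → ℂ} (ha : MemLp a 2),
      ∫⁻ x, ‖a x‖ₑ ^ 2 = ENNReal.ofReal (‖ha.toLp a‖ ^ 2) := by
    intro a ha
    rw [Lp.norm_toLp, ← ENNReal.toReal_pow, ENNReal.ofReal_toReal (by simp [ha.2.ne]),
      eLpNorm_eq_lintegral_rpow_enorm_toReal (by norm_num) (by norm_num), ← ENNReal.rpow_natCast,
      ← ENNReal.rpow_mul]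
    simp
  rw [key (memLp_fourierInv hf hf2), key hf2, ← norm_toLp_fourierInv hf hf2,
    ← Lp.norm_fourier_eq (𝓕⁻ (hf2.toLp f)), FourierTransform.fourier_fourierInv_eq]

/-- An integrable polynomial weight on `ℝ³`. -/
def polyWeight (ξ : E3) : ℝ := ((1 + ‖ξ‖) ^ 4)⁻¹

lemma polyWeight_pos (ξ : E3) : 0 < polyWeight ξ := by unfold polyWeight; positivity

lemma polyWeight_le_one (ξ : E3) : polyWeight ξ ≤ 1 := by
  unfold polyWeight
  exact inv_le_one_of_one_le₀ (one_le_pow₀ (by linarith [norm_nonneg ξ]))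

lemma integrable_polyWeight : Integrable polyWeight := by
  have h := integrable_one_add_norm (E := E3) (μ := volume) (r := 4)
    (by rw [finrank_euclideanSpace_fin]; norm_num)
  refine h.congr (Filter.Eventually.of_forall fun ξ => ?_)
  simp only [polyWeight]
  rw [Real.rpow_neg (by positivity)]
  norm_cast

/-- A jointly continuous family of functions decaying faster than any polynomial, uniformly in the
parameter. -/
structure RapidFam (w : ℝ → E3 → ℂ) : Prop where
  cont : Continuous fun p : ℝ × E3 => w p.1 p.2
  decay : ∀ k : ℕ, ∃ D : ℝ, ∀ t ξ, ‖w t ξ‖ * (1 + ‖ξ‖) ^ k ≤ D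

namespace RapidFam

variable {w v : ℝ → E3 → ℂ}

lemma exists_le (hw : RapidFam w) (k : ℕ) :
    ∃ D : ℝ, 0 < D ∧ ∀ t ξ, ‖w t ξ‖ * (1 + ‖ξ‖) ^ k ≤ D * polyWeight ξ := by
  obtain ⟨D, hD⟩ := hw.decay (k + 4)
  refine ⟨max D 1, by positivity, fun t ξ => ?_⟩
  have := (hD t ξ).trans (le_max_left D 1)
  rw [polyWeight, ← div_eq_mul_inv, le_div_iff₀ (by positivity)]
  rwa [mul_assoc, ← pow_add]

lemma norm_le (hw : RapidFam w) : ∃ D : ℝ, 0 < D ∧ ∀ t ξ, ‖w t ξ‖ ≤ D * polyWeight ξ := by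
  simpa using hw.exists_le 0

lemma continuous_left (hw : RapidFam w) (ξ : E3) : Continuous fun t => w t ξ :=
  hw.cont.comp (Continuous.prodMk_left ξ)

lemma continuous_right (hw : RapidFam w) (t : ℝ) : Continuous (w t) :=
  hw.cont.comp (Continuous.prodMk_right t)

lemma integrable (hw : RapidFam w) (t : ℝ) : Integrable (w t) := by
  obtain ⟨D, _, hD⟩ := hw.norm_le
  exact (integrable_polyWeight.const_mul D).mono' (hw.continuous_right t).aestronglyMeasurable
    (Filter.Eventually.of_forall (hD t))

lemma memLp_two (hw : RapidFam w) (t : ℝ) : MemLp (w t) 2 := by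
  obtain ⟨D, hD0, hD⟩ := hw.norm_le
  rw [memLp_two_iff_integrable_sq_norm (hw.continuous_right t).aestronglyMeasurable]
  refine (integrable_polyWeight.const_mul (D ^ 2)).mono'
    ((hw.continuous_right t).norm.pow 2).aestronglyMeasurable
    (Filter.Eventually.of_forall fun ξ => ?_)
  rw [Real.norm_of_nonneg (by positivity)]
  calc ‖w t ξ‖ ^ 2 ≤ (D * polyWeight ξ) ^ 2 := by gcongr; exact hD t ξ
    _ = D ^ 2 * (polyWeight ξ * polyWeight ξ) := by ring
    _ ≤ D ^ 2 * (polyWeight ξ * 1) := by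
        gcongr
        · exact (polyWeight_pos ξ).le
        · exact polyWeight_le_one ξ
    _ = _ := by ring

lemma mul_left (hw : RapidFam w) {b : ℝ → E3 → ℂ} (hb : Continuous fun p : ℝ × E3 => b p.1 p.2)
    {K : ℝ} {j : ℕ} (hbK : ∀ t ξ, ‖b t ξ‖ ≤ K * (1 + ‖ξ‖) ^ j) :
    RapidFam fun t ξ => b t ξ * w t ξ := by
  refine ⟨hb.mul hw.cont, fun k => ?_⟩
  obtain ⟨D, hD⟩ := hw.decay (j + k)
  have hK : 0 ≤ K := by simpa using (norm_nonneg _).trans (hbK 0 0)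
  refine ⟨K * D, fun t ξ => ?_⟩
  calc ‖b t ξ * w t ξ‖ * (1 + ‖ξ‖) ^ k ≤ (K * (1 + ‖ξ‖) ^ j) * ‖w t ξ‖ * (1 + ‖ξ‖) ^ k := by
        rw [norm_mul]; gcongr; exact hbK t ξ
    _ = K * (‖w t ξ‖ * (1 + ‖ξ‖) ^ (j + k)) := by rw [pow_add]; ring
    _ ≤ K * D := by gcongr; exact hD t ξ

lemma const_mul (hw : RapidFam w) (c : ℂ) : RapidFam fun t ξ => c * w t ξ :=
  hw.mul_left (b := fun _ _ => c) continuous_const (K := ‖c‖) (j := 0) (by simp)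

lemma add (hw : RapidFam w) (hv : RapidFam v) : RapidFam fun t ξ => w t ξ + v t ξ := by
  refine ⟨hw.cont.add hv.cont, fun k => ?_⟩
  obtain ⟨D, hD⟩ := hw.decay k
  obtain ⟨D', hD'⟩ := hv.decay k
  refine ⟨D + D', fun t ξ => ?_⟩
  calc _ ≤ (‖w t ξ‖ + ‖v t ξ‖) * (1 + ‖ξ‖) ^ k := by gcongr; exact norm_add_le _ _
    _ = _ := add_mul _ _ _
    _ ≤ _ := add_le_add (hD t ξ) (hD' t ξ)

lemma triple_le (hw : RapidFam w) (k : ℕ) : ∃ D : ℝ, 0 < D ∧ ∀ t ξ α β,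
    ‖w t α‖ * ‖w t β‖ * ‖w t (ξ - α + β)‖ * (1 + ‖ξ‖) ^ k
      ≤ D * (polyWeight α * polyWeight β) := by
  obtain ⟨D, hD0, hD⟩ := hw.exists_le k
  refine ⟨D ^ 3, by positivity, fun t ξ α β => ?_⟩
  have h1 : 1 + ‖ξ‖ ≤ (1 + ‖α‖) * (1 + ‖β‖) * (1 + ‖ξ - α + β‖) := by
    have : ‖ξ‖ ≤ ‖α‖ + ‖β‖ + ‖ξ - α + β‖ := by
      calc ‖ξ‖ = ‖α - β + (ξ - α + β)‖ := by congr 1; abel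
        _ ≤ _ := (norm_add_le _ _).trans (add_le_add_left (norm_sub_le _ _) _)
    have ha := norm_nonneg α
    have hb := norm_nonneg β
    have hc := norm_nonneg (ξ - α + β)
    nlinarith [mul_nonneg ha hb, mul_nonneg ha hc, mul_nonneg hb hc,
      mul_nonneg (mul_nonneg ha hb) hc]
  calc _ ≤ ‖w t α‖ * ‖w t β‖ * ‖w t (ξ - α + β)‖ *
        ((1 + ‖α‖) * (1 + ‖β‖) * (1 + ‖ξ - α + β‖)) ^ k := by gcongr
    _ = (‖w t α‖ * (1 + ‖α‖) ^ k) * (‖w t β‖ * (1 + ‖β‖) ^ k) *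
        (‖w t (ξ - α + β)‖ * (1 + ‖ξ - α + β‖) ^ k) := by rw [mul_pow, mul_pow]; ring
    _ ≤ (D * polyWeight α) * (D * polyWeight β) * (D * 1) := by
        have h2 := polyWeight_pos α
        have h3 := polyWeight_pos β
        exact mul_le_mul (mul_le_mul (hD t α) (hD t β) (by positivity) (by positivity))
          ((hD t _).trans (mul_le_mul_of_nonneg_left (polyWeight_le_one _) hD0.le))
          (by positivity) (by positivity)
    _ = _ := by ring

end RapidFam

lemma integrable_polyWeight_prod :
    Integrable fun z : E3 × E3 => polyWeight z.1 * polyWeight z.2 :=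
  integrable_polyWeight.mul_prod integrable_polyWeight

/-- The Fourier side of the cubic nonlinearity `|u|²u`. -/
def cubicConv (w : E3 → ℂ) (ξ : E3) : ℂ :=
  ∫ z : E3 × E3, w z.1 * starRingEnd ℂ (w z.2) * w (ξ - z.1 + z.2)

namespace RapidFam

variable {w : ℝ → E3 → ℂ}

lemma continuous_triple (hw : RapidFam w) :
    Continuous fun q : (ℝ × E3) × (E3 × E3) =>
      w q.1.1 q.2.1 * starRingEnd ℂ (w q.1.1 q.2.2) * w q.1.1 (q.1.2 - q.2.1 + q.2.2) := by
  refine Continuous.mul (Continuous.mul ?_ (Complex.continuous_conj.comp ?_)) ?_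
  · exact hw.cont.comp (f := fun q : (ℝ × E3) × (E3 × E3) => (q.1.1, q.2.1)) (by fun_prop)
  · exact hw.cont.comp (f := fun q : (ℝ × E3) × (E3 × E3) => (q.1.1, q.2.2)) (by fun_prop)
  · exact hw.cont.comp (f := fun q : (ℝ × E3) × (E3 × E3) => (q.1.1, q.1.2 - q.2.1 + q.2.2))
      (by fun_prop)

lemma cubicConv (hw : RapidFam w) : RapidFam fun t => cubicConv (w t) := by
  constructor
  · obtain ⟨D, hD0, hD⟩ := hw.triple_le 0
    refine continuous_of_dominated (F := fun (p : ℝ × E3) (z : E3 × E3) =>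
        w p.1 z.1 * starRingEnd ℂ (w p.1 z.2) * w p.1 (p.2 - z.1 + z.2))
      (bound := fun z => D * (polyWeight z.1 * polyWeight z.2)) ?_ ?_
      (integrable_polyWeight_prod.const_mul D) ?_
    · exact fun p => (hw.continuous_triple.comp
        (Continuous.prodMk_right p)).aestronglyMeasurable
    · refine fun p => Filter.Eventually.of_forall fun z => ?_
      simpa using hD p.1 p.2 z.1 z.2
    · exact Filter.Eventually.of_forall fun z =>
        hw.continuous_triple.comp (Continuous.prodMk_left z)
  · intro k
    obtain ⟨D, hD0, hD⟩ := hw.triple_le k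
    refine ⟨∫ z : E3 × E3, D * (polyWeight z.1 * polyWeight z.2), fun t ξ => ?_⟩
    rw [← le_div_iff₀ (by positivity), ← integral_div]
    refine norm_integral_le_of_norm_le
      ((integrable_polyWeight_prod.const_mul D).div_const _)
      (Filter.Eventually.of_forall fun z => ?_)
    rw [le_div_iff₀ (by positivity)]
    simpa using hD t ξ z.1 z.2

lemma integrable_triple (hw : RapidFam w) (t : ℝ) :
    Integrable fun q : E3 × (E3 × E3) =>
      w t q.2.1 * starRingEnd ℂ (w t q.2.2) * w t (q.1 - q.2.1 + q.2.2) := by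
  obtain ⟨D, hD0, hD⟩ := hw.triple_le 4
  refine Integrable.mono' (g := fun q : E3 × (E3 × E3) =>
      D * (polyWeight q.1 * (polyWeight q.2.1 * polyWeight q.2.2)))
    ((integrable_polyWeight.mul_prod integrable_polyWeight_prod).const_mul D)
    (hw.continuous_triple.comp (f := fun q : E3 × (E3 × E3) => ((t, q.1), q.2))
      (by fun_prop)).aestronglyMeasurable (Filter.Eventually.of_forall fun q => ?_)
  have := hD t q.1 q.2.1 q.2.2
  rw [← le_div_iff₀ (by positivity)] at this
  simp only [norm_mul, RCLike.norm_conj]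
  refine this.trans (le_of_eq ?_)
  rw [polyWeight, polyWeight, polyWeight]
  ring

end RapidFam

lemma fourierInv_eq_integral_phase (f : E3 → ℂ) (x : E3) :
    𝓕⁻ f x = ∫ ξ, phase 0 x ξ * f ξ := by
  rw [Real.fourierInv_eq']
  refine integral_congr_ae (Filter.Eventually.of_forall fun ξ => ?_)
  simp only [phase, smul_eq_mul, real_inner_comm]
  congr 3
  push_cast
  ring

lemma phase_zero_add (x ξ η : E3) : phase 0 x (ξ + η) = phase 0 x ξ * phase 0 x η := by
  simp only [phase, ← Complex.exp_add, inner_add_right]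
  congr 1
  push_cast
  ring

lemma conj_phase_zero (x ξ : E3) : starRingEnd ℂ (phase 0 x ξ) = phase 0 x (-ξ) := by
  simp only [phase, ← Complex.exp_conj, inner_neg_right, map_mul, conj_ofReal, conj_I]
  congr 1
  push_cast
  ring

lemma fourierInv_cubicConv {w : ℝ → E3 → ℂ} (hw : RapidFam w) (t : ℝ) (x : E3) :
    𝓕⁻ (cubicConv (w t)) x = (‖𝓕⁻ (w t) x‖ : ℂ) ^ 2 * 𝓕⁻ (w t) x := by
  have hint : Integrable (Function.uncurry fun (ξ : E3) (z : E3 × E3) =>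
      phase 0 x ξ * (w t z.1 * starRingEnd ℂ (w t z.2) * w t (ξ - z.1 + z.2))) := by
    refine (hw.integrable_triple t).norm.mono' ?_ (Filter.Eventually.of_forall fun q => ?_)
    · refine Continuous.aestronglyMeasurable (Continuous.mul ?_ ?_)
      · exact (continuous_phase_right 0 x).comp continuous_fst
      · exact hw.continuous_triple.comp (f := fun q : E3 × (E3 × E3) => ((t, q.1), q.2))
          (by fun_prop)
    · simp [Function.uncurry, norm_phase]
  have hu : ∀ z : E3 × E3, ∫ ξ, phase 0 x ξ * w t (ξ - z.1 + z.2)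
      = phase 0 x z.1 * starRingEnd ℂ (phase 0 x z.2) * 𝓕⁻ (w t) x := by
    intro z
    rw [← integral_add_right_eq_self _ (z.1 - z.2), fourierInv_eq_integral_phase,
      ← integral_const_mul]
    refine integral_congr_ae (Filter.Eventually.of_forall fun ξ => ?_)
    simp only
    rw [phase_zero_add, sub_eq_add_neg, phase_zero_add, conj_phase_zero,
      show ξ + (z.1 + -z.2) - z.1 + z.2 = ξ by abel]
    ring
  rw [fourierInv_eq_integral_phase]
  simp only [cubicConv, ← integral_const_mul]
  rw [integral_integral_swap hint]
  have h1 : ∀ z : E3 × E3, ∫ ξ, phase 0 x ξ *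
      (w t z.1 * starRingEnd ℂ (w t z.2) * w t (ξ - z.1 + z.2)) =
      𝓕⁻ (w t) x * ((phase 0 x z.1 * w t z.1) * starRingEnd ℂ (phase 0 x z.2 * w t z.2)) := by
    intro z
    rw [map_mul, show 𝓕⁻ (w t) x * ((phase 0 x z.1 * w t z.1) *
        (starRingEnd ℂ (phase 0 x z.2) * starRingEnd ℂ (w t z.2)))
      = (w t z.1 * starRingEnd ℂ (w t z.2)) *
        (phase 0 x z.1 * starRingEnd ℂ (phase 0 x z.2) * 𝓕⁻ (w t) x) by ring, ← hu z,
      ← integral_const_mul]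
    refine integral_congr_ae (Filter.Eventually.of_forall fun ξ => ?_)
    simp only
    ring
  simp only [h1]
  rw [integral_const_mul, Measure.volume_eq_prod, integral_prod_mul
    (f := fun α => phase 0 x α * w t α) (g := fun β => starRingEnd ℂ (phase 0 x β * w t β)),
    integral_conj, ← fourierInv_eq_integral_phase, mul_conj, normSq_eq_norm_sq]
  push_cast
  ring

lemma one_add_pow_le {a : ℝ} (ha : 0 ≤ a) (k : ℕ) : (1 + a) ^ k ≤ 2 ^ k * (1 + a ^ k) := by
  have h : (1 + a) ^ k ≤ (2 * max 1 a) ^ k := by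
    gcongr
    linarith [le_max_left 1 a, le_max_right 1 a]
  refine h.trans ?_
  rw [mul_pow]
  gcongr
  rcases max_cases 1 a with ⟨h, _⟩ | ⟨h, _⟩ <;> rw [h] <;> simp <;> positivity

namespace IsNLSSolution

variable {T : ℝ} {φ : Rn 3 → ℝ → ℂ} {φ₀ : Rn 3 → ℂ}

lemma contDiff_slice (h : IsNLSSolution 3 T φ φ₀) (t : ℝ) :
    ContDiff ℝ (⊤ : ℕ∞) fun y => φ y t :=
  h.1.comp (f := fun y : Rn 3 => (y, t)) (contDiff_id.prodMk contDiff_const)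

/-- The spatial slice of a solution, as a Schwartz function. -/
def slice (h : IsNLSSolution 3 T φ φ₀) {t : ℝ} (ht : t ∈ Icc 0 T) : SchwartzMap (Rn 3) ℂ where
  toFun x := φ x t
  smooth' := h.contDiff_slice t
  decay' k l := (h.2.1 k l).imp fun _ hC x => hC t ht x

lemma weighted_bound (h : IsNLSSolution 3 T φ φ₀) (k l : ℕ) : ∃ C : ℝ, 0 < C ∧ ∀ t ∈ Icc 0 T, ∀ x,
    ‖x‖ ^ k * ‖iteratedFDeriv ℝ l (fun y => φ y t) x‖ ≤ C * polyWeight x := by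
  obtain ⟨C1, hC1⟩ := h.2.1 k l
  obtain ⟨C2, hC2⟩ := h.2.1 (k + 4) l
  refine ⟨16 * (|C1| + |C2|) + 1, by positivity, fun t ht x => ?_⟩
  rw [polyWeight, ← div_eq_mul_inv, le_div_iff₀ (by positivity)]
  have h1 := (hC1 t ht x).trans (le_abs_self _)
  have h2 := (hC2 t ht x).trans (le_abs_self _)
  set A := ‖iteratedFDeriv ℝ l (fun y => φ y t) x‖
  calc ‖x‖ ^ k * A * (1 + ‖x‖) ^ 4 ≤ ‖x‖ ^ k * A * (2 ^ 4 * (1 + ‖x‖ ^ 4)) := by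
        gcongr
        exact one_add_pow_le (norm_nonneg x) 4
    _ = 16 * (‖x‖ ^ k * A + ‖x‖ ^ (k + 4) * A) := by rw [pow_add]; ring
    _ ≤ _ := by linarith

lemma norm_le (h : IsNLSSolution 3 T φ φ₀) : ∃ C : ℝ, 0 < C ∧ ∀ t ∈ Icc 0 T, ∀ x,
    ‖φ x t‖ ≤ C * polyWeight x := by
  obtain ⟨C, hC0, hC⟩ := h.weighted_bound 0 0
  exact ⟨C, hC0, fun t ht x => by simpa using hC t ht x⟩

lemma norm_laplacian_le (h : IsNLSSolution 3 T φ φ₀) : ∃ C : ℝ, 0 < C ∧ ∀ t ∈ Icc 0 T, ∀ x,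
    ‖laplacian (fun y => φ y t) x‖ ≤ C * polyWeight x := by
  obtain ⟨C, hC0, hC⟩ := h.weighted_bound 0 2
  refine ⟨3 * C, by positivity, fun t ht x => ?_⟩
  have hd : DifferentiableAt ℝ (fderiv ℝ fun y => φ y t) x :=
    ((h.contDiff_slice t).fderiv_right (m := 1) (by norm_cast)).differentiable (by norm_num) x
  have key : ∀ i : Fin 3, ‖fderiv ℝ (fun y => fderiv ℝ (fun y => φ y t) y
      (EuclideanSpace.single i 1)) x (EuclideanSpace.single i 1)‖ ≤ C * polyWeight x := by
    intro i
    have h1 : fderiv ℝ (fun y => fderiv ℝ (fun y => φ y t) y (EuclideanSpace.single i 1)) x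
        (EuclideanSpace.single i 1) = iteratedFDeriv ℝ 2 (fun y => φ y t) x
          (fun _ => EuclideanSpace.single i 1) := by
      rw [iteratedFDeriv_two_apply, fderiv_clm_apply hd (differentiableAt_const _)]
      simp
    rw [h1]
    refine (ContinuousMultilinearMap.le_opNorm _ _).trans ?_
    have := hC t ht x
    simpa using this
  calc _ ≤ ∑ i : Fin 3, C * polyWeight x := (norm_sum_le _ _).trans
        (Finset.sum_le_sum fun i _ => key i)
    _ = _ := by simp; ring

/-- The Fourier transform of a solution, frozen outside the time interval. -/
def fourierFam (T : ℝ) (φ : Rn 3 → ℝ → ℂ) (t : ℝ) (ξ : Rn 3) : ℂ :=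
  𝓕 (fun x => φ x (max 0 (min t T))) ξ

lemma clamp_mem (hT : 0 < T) (t : ℝ) : max 0 (min t T) ∈ Icc 0 T :=
  ⟨le_max_left _ _, max_le hT.le (min_le_right _ _)⟩

lemma clamp_eq {t : ℝ} (ht : t ∈ Icc 0 T) : max 0 (min t T) = t := by
  rw [min_eq_left ht.2, max_eq_right ht.1]

lemma fourierFam_eq {t : ℝ} (ht : t ∈ Icc 0 T) :
    fourierFam T φ t = 𝓕 (fun x => φ x t) := by
  ext ξ
  rw [fourierFam, clamp_eq ht]

lemma rapidFam_fourierFam (h : IsNLSSolution 3 T φ φ₀) (hT : 0 < T) :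
    RapidFam (fourierFam T φ) := by
  constructor
  · obtain ⟨C, hC0, hC⟩ := h.norm_le
    simp only [fourierFam, Real.fourier_eq', smul_eq_mul]
    have hcont : Continuous fun q : (ℝ × E3) × E3 =>
        cexp (((-2 * Real.pi * ⟪q.2, q.1.2⟫ : ℝ) : ℂ) * I) * φ q.2 (max 0 (min q.1.1 T)) := by
      refine Continuous.mul ?_ ?_
      · fun_prop
      · exact h.1.continuous.comp (f := fun q : (ℝ × E3) × E3 => (q.2, max 0 (min q.1.1 T)))
          (by fun_prop)
    refine continuous_of_dominated (F := fun (p : ℝ × E3) (x : E3) =>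
        cexp (((-2 * Real.pi * ⟪x, p.2⟫ : ℝ) : ℂ) * I) * φ x (max 0 (min p.1 T))) (bound := fun x => C * polyWeight x)
      (fun p => ?_) (fun p => Filter.Eventually.of_forall fun x => ?_)
      (integrable_polyWeight.const_mul C) (Filter.Eventually.of_forall fun x => ?_)
    · exact (hcont.comp (f := fun x : E3 => (p, x)) (by fun_prop)).aestronglyMeasurable
    · rw [norm_mul, norm_exp_ofReal_mul_I, one_mul]
      exact hC _ (clamp_mem hT _) x
    · exact hcont.comp (f := fun q : ℝ × E3 => (q, x)) (by fun_prop)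
  · intro k
    have hb : ∀ n ≤ k, ∃ D : ℝ, ∀ t ξ, ‖ξ‖ ^ n * ‖fourierFam T φ t ξ‖ ≤ D := by
      intro n _
      choose C hC0 hC using fun l => h.weighted_bound 0 l
      refine ⟨2 ^ n * ∑ p ∈ Finset.range 1 ×ˢ Finset.range (n + 1),
        ∫ v, C p.2 * polyWeight v, fun t ξ => ?_⟩
      have := Real.pow_mul_norm_iteratedFDeriv_fourier_le (K := ⊤) (N := ⊤) (k := 0) (n := n)
        (h.contDiff_slice (max 0 (min t T)))
        (fun k l _ _ => (h.slice (clamp_mem hT t)).integrable_pow_mul_iteratedFDeriv volume k l)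
        (by simp) (by simp) ξ
      simp only [norm_iteratedFDeriv_zero] at this
      refine this.trans ?_
      simp only [pow_zero, one_mul, Nat.cast_zero, mul_zero, zero_add]
      refine mul_le_mul_of_nonneg_left (Finset.sum_le_sum fun p hp => ?_) (by positivity)
      refine integral_mono_of_nonneg (Filter.Eventually.of_forall fun v => by positivity)
        (integrable_polyWeight.const_mul _) (Filter.Eventually.of_forall fun v => ?_)
      simp only [Finset.mem_product, Finset.mem_range, Nat.lt_one_iff] at hp
      have := hC p.2 _ (clamp_mem hT t) v
      simp only [hp.1]
      exact this
    obtain ⟨D0, hD0⟩ := hb 0 (by simp)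
    obtain ⟨D1, hD1⟩ := hb k le_rfl
    refine ⟨2 ^ k * (D0 + D1), fun t ξ => ?_⟩
    have h0 := hD0 t ξ
    have h1 := hD1 t ξ
    calc ‖fourierFam T φ t ξ‖ * (1 + ‖ξ‖) ^ k
        ≤ ‖fourierFam T φ t ξ‖ * (2 ^ k * (1 + ‖ξ‖ ^ k)) := by
          gcongr; exact one_add_pow_le (norm_nonneg _) k
      _ = 2 ^ k * (‖ξ‖ ^ 0 * ‖fourierFam T φ t ξ‖ + ‖ξ‖ ^ k * ‖fourierFam T φ t ξ‖) := by ring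
      _ ≤ _ := by gcongr

lemma fourierInv_fourierFam (h : IsNLSSolution 3 T φ φ₀) (hT : 0 < T) {t : ℝ}
    (ht : t ∈ Icc 0 T) : 𝓕⁻ (fourierFam T φ t) = fun x => φ x t := by
  have hi := (h.rapidFam_fourierFam hT).integrable t
  rw [fourierFam_eq ht] at hi ⊢
  exact (h.contDiff_slice t).continuous.fourierInv_fourier_eq (h.slice ht).integrable hi

lemma fourier_cubic (h : IsNLSSolution 3 T φ φ₀) (hT : 0 < T) {t : ℝ} (ht : t ∈ Icc 0 T) :
    𝓕 (fun x => (‖φ x t‖ : ℂ) ^ 2 * φ x t) = cubicConv (fourierFam T φ t) := by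
  have hw := h.rapidFam_fourierFam hT
  have h1 : (fun x => (‖φ x t‖ : ℂ) ^ 2 * φ x t) = 𝓕⁻ (cubicConv (fourierFam T φ t)) := by
    ext x
    rw [fourierInv_cubicConv hw, h.fourierInv_fourierFam hT ht]
  rw [h1]
  have hc := hw.cubicConv
  refine (hc.continuous_right t).fourier_fourierInv_eq (hc.integrable t) ?_
  have h2 : 𝓕 (cubicConv (fourierFam T φ t)) = fun x =>
      𝓕⁻ (cubicConv (fourierFam T φ t)) (-x) := by
    ext x
    rw [Real.fourierInv_eq_fourier_neg, neg_neg]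
  rw [h2]
  refine Integrable.comp_neg ?_
  rw [← h1]
  obtain ⟨C, hC0, hC⟩ := h.norm_le
  have hcont := (h.contDiff_slice t).continuous
  refine (integrable_polyWeight.const_mul (C ^ 3)).mono'
    (Continuous.aestronglyMeasurable (by fun_prop)) (Filter.Eventually.of_forall fun x => ?_)
  have hp := polyWeight_pos x
  have hp1 := polyWeight_le_one x
  rw [norm_mul, norm_pow, norm_real, norm_norm, ← pow_succ]
  calc ‖φ x t‖ ^ 3 ≤ (C * polyWeight x) ^ 3 := by gcongr; exact hC t ht x
    _ = C ^ 3 * (polyWeight x * polyWeight x ^ 2) := by ring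
    _ ≤ C ^ 3 * (polyWeight x * 1) := by gcongr; exact pow_le_one₀ hp.le hp1
    _ = _ := by ring

lemma fourier_laplacian (h : IsNLSSolution 3 T φ φ₀) {t : ℝ} (ht : t ∈ Icc 0 T) (ξ : Rn 3) :
    𝓕 (laplacian fun x => φ x t) ξ
      = ((-(4 * Real.pi ^ 2 * ‖ξ‖ ^ 2) : ℝ) : ℂ) * 𝓕 (fun x => φ x t) ξ := by
  set S := h.slice ht with hS
  have h1 : (laplacian fun x => φ x t) = ((∑ i : Fin 3, LineDeriv.lineDerivOp
      (EuclideanSpace.single i (1 : ℝ)) (LineDeriv.lineDerivOp (EuclideanSpace.single i (1 : ℝ)) S) :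
      SchwartzMap (Rn 3) ℂ) : Rn 3 → ℂ) := by
    ext x
    rw [sum_apply]
    rfl
  have h2 : (fun x => φ x t) = (S : Rn 3 → ℂ) := rfl
  rw [h1, h2, ← SchwartzMap.fourier_coe, ← SchwartzMap.fourier_coe, FourierTransform.fourier_sum,
    sum_apply]
  have h3 : ∀ i : Fin 3, (fun x : Rn 3 => ⟪x, EuclideanSpace.single i (1 : ℝ)⟫).HasTemperateGrowth :=
    fun i => by fun_prop
  simp only [SchwartzMap.fourier_lineDerivOp_eq, smul_apply,
    SchwartzMap.smulLeftCLM_apply_apply (h3 _), smul_eq_mul, Complex.real_smul]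
  rw [EuclideanSpace.norm_sq_eq, Fin.sum_univ_three, Fin.sum_univ_three]
  simp only [EuclideanSpace.inner_single_right]
  simp
  ring_nf
  simp
  ring

lemma hasDerivAt_fourierFam (h : IsNLSSolution 3 T φ φ₀) {t : ℝ} (ht : t ∈ Ioo 0 T)
    (ξ : Rn 3) : HasDerivAt (fun t => fourierFam T φ t ξ)
      (-I * (((4 * Real.pi ^ 2 * ‖ξ‖ ^ 2 : ℝ) : ℂ) * fourierFam T φ t ξ
        + cubicConv (fourierFam T φ t) ξ)) t := by
  have hT : 0 < T := ht.1.trans ht.2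
  have hmem : t ∈ Icc 0 T := Ioo_subset_Icc_self ht
  obtain ⟨C, hC0, hC⟩ := h.norm_le
  obtain ⟨L, hL0, hL⟩ := h.norm_laplacian_le
  have hdt : ∀ s x, HasDerivAt (fun t' => φ x t') (deriv (fun t' => φ x t') s) s := by
    intro s x
    have : ContDiff ℝ (⊤ : ℕ∞) fun t' => φ x t' :=
      h.1.comp (f := fun t' : ℝ => (x, t')) (contDiff_const.prodMk contDiff_id)
    exact (this.differentiable (by simp) s).hasDerivAt
  have hpde : ∀ s ∈ Icc 0 T, ∀ x, deriv (fun t' => φ x t') s =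
      I * laplacian (fun y => φ y s) x - I * ((‖φ x s‖ : ℂ) ^ 2 * φ x s) := by
    intro s hs x
    rw [← h.2.2.1 x s hs]
    ring_nf
    simp
  have hlapc : ∀ s, Continuous (laplacian fun y => φ y s) := by
    intro s
    unfold laplacian
    refine continuous_finsetSum _ fun i _ => ?_
    have h1 : ContDiff ℝ 1 fun y => fderiv ℝ (fun y => φ y s) y (EuclideanSpace.single i 1) :=
      ((h.contDiff_slice s).fderiv_right (m := 1) (by norm_cast)).clm_apply contDiff_const
    exact (h1.continuous_fderiv (by norm_num)).clm_apply continuous_const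
  set B := L + C ^ 3 with hB
  have hcube : ∀ s ∈ Icc 0 T, ∀ x, ‖(‖φ x s‖ : ℂ) ^ 2 * φ x s‖ ≤ C ^ 3 * polyWeight x := by
    intro s hs x
    have hp := polyWeight_pos x
    have hp1 := polyWeight_le_one x
    rw [norm_mul, norm_pow, norm_real, norm_norm, ← pow_succ]
    calc ‖φ x s‖ ^ 3 ≤ (C * polyWeight x) ^ 3 := by gcongr; exact hC s hs x
      _ = C ^ 3 * (polyWeight x * polyWeight x ^ 2) := by ring
      _ ≤ C ^ 3 * (polyWeight x * 1) := by gcongr; exact pow_le_one₀ hp.le hp1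
      _ = _ := by ring
  have hcontφ : ∀ s, Continuous fun x => φ x s := fun s => (h.contDiff_slice s).continuous
  have key := (hasDerivAt_integral_of_dominated_loc_of_deriv_le (𝕜 := ℝ) (μ := volume)
    (F := fun s x => cexp (((-2 * Real.pi * ⟪x, ξ⟫ : ℝ) : ℂ) * I) • φ x s)
    (F' := fun s x => cexp (((-2 * Real.pi * ⟪x, ξ⟫ : ℝ) : ℂ) * I) •
      deriv (fun t' => φ x t') s) (x₀ := t) (s := Ioo 0 T)
    (bound := fun x => B * polyWeight x) (isOpen_Ioo.mem_nhds ht)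
    (Filter.Eventually.of_forall fun s => ?_) ?_ ?_
    (Filter.Eventually.of_forall fun x s hs => ?_) (integrable_polyWeight.const_mul B)
    (Filter.Eventually.of_forall fun x s _ => ?_)).2
  rotate_left
  · exact Continuous.aestronglyMeasurable (by have := hcontφ s; fun_prop)
  · refine (integrable_polyWeight.const_mul C).mono'
      (Continuous.aestronglyMeasurable (by have := hcontφ t; fun_prop))
      (Filter.Eventually.of_forall fun x => ?_)
    rw [norm_smul, norm_exp_ofReal_mul_I, one_mul]
    exact hC t hmem x
  · simp only [hpde t hmem]
    exact Continuous.aestronglyMeasurable (by have := hcontφ t; have := hlapc t; fun_prop)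
  · have hs' := Ioo_subset_Icc_self hs
    rw [norm_smul, norm_exp_ofReal_mul_I, one_mul, hpde s hs']
    refine (norm_sub_le _ _).trans ?_
    rw [norm_mul, norm_I, one_mul, norm_mul I, norm_I, one_mul, hB, add_mul]
    exact add_le_add (hL s hs' x) (hcube s hs' x)
  · exact (hdt s x).const_mul _
  have hev : (fun t => fourierFam T φ t ξ) =ᶠ[nhds t] fun s =>
      ∫ x, cexp (((-2 * Real.pi * ⟪x, ξ⟫ : ℝ) : ℂ) * I) • φ x s := by
    filter_upwards [isOpen_Ioo.mem_nhds ht] with s hs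
    rw [fourierFam_eq (Ioo_subset_Icc_self hs), Real.fourier_eq']
  refine (key.congr_of_eventuallyEq hev).congr_deriv ?_
  simp only [hpde t hmem]
  have hlapi : Integrable fun x => cexp (((-2 * Real.pi * ⟪x, ξ⟫ : ℝ) : ℂ) * I) •
      laplacian (fun y => φ y t) x := by
    refine (integrable_polyWeight.const_mul L).mono'
      (Continuous.aestronglyMeasurable (by have := hlapc t; fun_prop))
      (Filter.Eventually.of_forall fun x => ?_)
    rw [norm_smul, norm_exp_ofReal_mul_I, one_mul]
    exact hL t hmem x
  have hcubi : Integrable fun x => cexp (((-2 * Real.pi * ⟪x, ξ⟫ : ℝ) : ℂ) * I) •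
      ((‖φ x t‖ : ℂ) ^ 2 * φ x t) := by
    refine (integrable_polyWeight.const_mul (C ^ 3)).mono'
      (Continuous.aestronglyMeasurable (by have := hcontφ t; fun_prop))
      (Filter.Eventually.of_forall fun x => ?_)
    rw [norm_smul, norm_exp_ofReal_mul_I, one_mul]
    exact hcube t hmem x
  have hsplit : ∀ x, cexp (((-2 * Real.pi * ⟪x, ξ⟫ : ℝ) : ℂ) * I) •
      (I * laplacian (fun y => φ y t) x - I * ((‖φ x t‖ : ℂ) ^ 2 * φ x t)) =
      I * (cexp (((-2 * Real.pi * ⟪x, ξ⟫ : ℝ) : ℂ) * I) • laplacian (fun y => φ y t) x) -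
      I * (cexp (((-2 * Real.pi * ⟪x, ξ⟫ : ℝ) : ℂ) * I) • ((‖φ x t‖ : ℂ) ^ 2 * φ x t)) := by
    intro x
    simp only [smul_eq_mul]
    ring
  simp only [hsplit]
  rw [integral_sub (hlapi.const_mul I) (hcubi.const_mul I), integral_const_mul,
    integral_const_mul, ← Real.fourier_eq', ← Real.fourier_eq', h.fourier_cubic hT hmem,
    fourierFam_eq hmem]
  have := h.fourier_laplacian hmem ξ
  rw [show 𝓕 (fun x => laplacian (fun y => φ y t) x) ξ = 𝓕 (laplacian fun x => φ x t) ξ from rfl,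
    this]
  push_cast
  ring

end IsNLSSolution

lemma fderiv_fourierInv_apply {f : E3 → ℂ} (hf : Integrable f)
    (hf' : Integrable fun ξ => ‖ξ‖ * ‖f ξ‖) (x e : E3) :
    fderiv ℝ (𝓕⁻ f) x e = 𝓕⁻ (fun ξ => (2 * Real.pi * ⟪ξ, e⟫ : ℝ) * I * f ξ) x := by
  have h1 : 𝓕⁻ f = fun x => 𝓕 f (-x) := by
    ext x
    rw [Real.fourierInv_eq_fourier_neg]
  have h2 := (Real.hasFDerivAt_fourier hf hf' (-x)).comp x (hasFDerivAt_id x).neg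
  have hi : Integrable (VectorFourier.fourierSMulRight (innerSL ℝ) f) := by
    refine (hf'.const_mul (2 * Real.pi)).mono' ?_ (Filter.Eventually.of_forall fun ξ => ?_)
    · exact hf.1.fourierSMulRight
    · have := VectorFourier.norm_fourierSMulRight_le (innerSL ℝ) f ξ
      refine this.trans ?_
      have h3 := norm_innerSL_le ℝ (E := E3)
      have h4 : 0 ≤ ‖ξ‖ * ‖f ξ‖ := by positivity
      have h5 := Real.pi_pos
      calc 2 * Real.pi * ‖innerSL ℝ (E := E3)‖ * ‖ξ‖ * ‖f ξ‖
          = (2 * Real.pi * (‖ξ‖ * ‖f ξ‖)) * ‖innerSL ℝ (E := E3)‖ := by ring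
        _ ≤ (2 * Real.pi * (‖ξ‖ * ‖f ξ‖)) * 1 := by gcongr
        _ = _ := by ring
  rw [h1]
  have h2' : HasFDerivAt (fun x => 𝓕 f (-x)) _ x := h2
  rw [h2'.fderiv, Real.fourierInv_eq_fourier_neg]
  simp only [ContinuousLinearMap.comp_apply, neg_apply,
    ContinuousLinearMap.id_apply, map_neg]
  rw [Real.fourier_eq', Real.fourier_eq', ContinuousLinearMap.integral_apply, ← integral_neg]
  · refine integral_congr_ae (Filter.Eventually.of_forall fun ξ => ?_)
    have h6 : (innerSL ℝ ξ) e = ⟪ξ, e⟫ := rfl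
    simp [h6]
    ring
  · refine hi.norm.mono' ?_ (Filter.Eventually.of_forall fun ξ => ?_)
    · exact (Continuous.aestronglyMeasurable
        (f := fun v : E3 => cexp (((-2 * Real.pi * ⟪v, -x⟫ : ℝ) : ℂ) * I))
        (by fun_prop)).smul hi.1
    · rw [norm_smul, norm_exp_ofReal_mul_I, one_mul]

namespace RapidFam

variable {w : ℝ → E3 → ℂ}

lemma continuous_fourierInv (hw : RapidFam w) :
    Continuous fun p : ℝ × E3 => 𝓕⁻ (w p.1) p.2 := by
  obtain ⟨D, hD0, hD⟩ := hw.norm_le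
  simp only [fourierInv_eq_integral_phase]
  have hc : Continuous fun q : (ℝ × E3) × E3 => phase 0 q.1.2 q.2 * w q.1.1 q.2 := by
    refine Continuous.mul ?_ (hw.cont.comp (f := fun q : (ℝ × E3) × E3 => (q.1.1, q.2))
      (by fun_prop))
    unfold phase
    fun_prop
  refine continuous_of_dominated (F := fun (p : ℝ × E3) (ξ : E3) => phase 0 p.2 ξ * w p.1 ξ)
    (bound := fun ξ => D * polyWeight ξ)
    (fun p => (hc.comp (f := fun x : E3 => (p, x)) (by fun_prop)).aestronglyMeasurable)
    (fun p => Filter.Eventually.of_forall fun ξ => ?_) (integrable_polyWeight.const_mul D)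
    (Filter.Eventually.of_forall fun ξ =>
      hc.comp (f := fun q : ℝ × E3 => (q, ξ)) (by fun_prop))
  rw [norm_mul, norm_phase, one_mul]
  exact hD p.1 ξ

lemma norm_fourierInv_le (hw : RapidFam w) : ∃ M : ℝ, 0 < M ∧ ∀ t x, ‖𝓕⁻ (w t) x‖ ≤ M := by
  obtain ⟨D, hD0, hD⟩ := hw.norm_le
  refine ⟨(∫ ξ, D * polyWeight ξ) + 1, ?_, fun t x => ?_⟩
  · have : 0 ≤ ∫ ξ, D * polyWeight ξ :=
      integral_nonneg fun ξ => mul_nonneg hD0.le (polyWeight_pos ξ).le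
    linarith
  · rw [fourierInv_eq_integral_phase]
    refine (norm_integral_le_of_norm_le (integrable_polyWeight.const_mul D)
      (Filter.Eventually.of_forall fun ξ => ?_)).trans (le_add_of_nonneg_right zero_le_one)
    rw [norm_mul, norm_phase, one_mul]
    exact hD t ξ

lemma norm_mul_self (hw : RapidFam w) : RapidFam fun t ξ => (‖ξ‖ : ℂ) * w t ξ :=
  hw.mul_left (b := fun _ ξ => (‖ξ‖ : ℂ)) (by fun_prop) (K := 1) (j := 1) fun t ξ => by simp

lemma coord_mul (hw : RapidFam w) (e : E3) :
    RapidFam fun t ξ => ((2 * Real.pi * ⟪ξ, e⟫ : ℝ) : ℂ) * I * w t ξ := by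
  refine hw.mul_left (b := fun _ ξ => ((2 * Real.pi * ⟪ξ, e⟫ : ℝ) : ℂ) * I) (by fun_prop)
    (K := 2 * Real.pi * ‖e‖) (j := 1) fun t ξ => ?_
  rw [norm_mul, norm_I, mul_one, norm_real, norm_mul, Real.norm_of_nonneg (by positivity)]
  have h1 := norm_inner_le_norm (𝕜 := ℝ) ξ e
  have h2 := Real.pi_pos
  calc 2 * Real.pi * ‖⟪ξ, e⟫‖ ≤ 2 * Real.pi * (‖ξ‖ * ‖e‖) := by gcongr
    _ ≤ 2 * Real.pi * ((1 + ‖ξ‖) * ‖e‖) := by gcongr; linarith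
    _ = _ := by ring

lemma integrable_sq (hw : RapidFam w) (t : ℝ) : Integrable fun ξ => ‖w t ξ‖ ^ 2 :=
  (memLp_two_iff_integrable_sq_norm (hw.continuous_right t).aestronglyMeasurable).1 (hw.memLp_two t)

lemma integral_fourierInv_sq (hw : RapidFam w) (t : ℝ) :
    ∫ x, ‖𝓕⁻ (w t) x‖ ^ 2 = ∫ ξ, ‖w t ξ‖ ^ 2 := by
  have key : ∀ f : E3 → ℂ, AEStronglyMeasurable f → ∫ x, ‖f x‖ ^ 2 = (∫⁻ x, ‖f x‖ₑ ^ 2).toReal := by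
    intro f hf
    rw [integral_eq_lintegral_of_nonneg_ae (f := fun x => ‖f x‖ ^ 2)
      (Filter.Eventually.of_forall fun x => sq_nonneg ‖f x‖) (hf.norm.pow 2)]
    congr 2
    ext x
    rw [ENNReal.ofReal_pow (norm_nonneg _), ofReal_norm]
  rw [key _ (memLp_fourierInv (hw.integrable t) (hw.memLp_two t)).1,
    key _ (hw.memLp_two t).1, lintegral_fourierInv_sq (hw.integrable t) (hw.memLp_two t)]

lemma integrable_fourierInv_sq (hw : RapidFam w) (t : ℝ) :
    Integrable fun x => ‖𝓕⁻ (w t) x‖ ^ 2 := by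
  have := memLp_fourierInv (hw.integrable t) (hw.memLp_two t)
  exact (memLp_two_iff_integrable_sq_norm this.1).1 this

lemma integrable_fourierInv_pow_four (hw : RapidFam w) (t : ℝ) :
    Integrable fun x => ‖𝓕⁻ (w t) x‖ ^ 4 := by
  obtain ⟨M, hM0, hM⟩ := hw.norm_fourierInv_le
  refine ((hw.integrable_fourierInv_sq t).const_mul (M ^ 2)).mono'
    ((memLp_fourierInv (hw.integrable t) (hw.memLp_two t)).1.norm.pow 4)
    (Filter.Eventually.of_forall fun x => ?_)
  rw [Real.norm_of_nonneg (by positivity)]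
  have := hM t x
  calc ‖𝓕⁻ (w t) x‖ ^ 4 = ‖𝓕⁻ (w t) x‖ ^ 2 * ‖𝓕⁻ (w t) x‖ ^ 2 := by ring
    _ ≤ _ := by gcongr

lemma energy_fourierInv (hw : RapidFam w) (t : ℝ) : energy (𝓕⁻ (w t)) =
    2 * Real.pi ^ 2 * (∫ ξ, ‖ξ‖ ^ 2 * ‖w t ξ‖ ^ 2) + 1 / 4 * ∫ x, ‖𝓕⁻ (w t) x‖ ^ 4 := by
  have hf : ∀ i : Fin 3, ∀ x, fderiv ℝ (𝓕⁻ (w t)) x (EuclideanSpace.single i 1) =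
      𝓕⁻ (fun ξ => ((2 * Real.pi * ⟪ξ, EuclideanSpace.single i 1⟫ : ℝ) : ℂ) * I * w t ξ) x :=
    fun i x => fderiv_fourierInv_apply (hw.integrable t)
      (by simpa using (hw.norm_mul_self.integrable t).norm) x _
  have hc := fun i : Fin 3 => hw.coord_mul (EuclideanSpace.single i 1)
  simp only [energy, hf]
  have h1 := fun i : Fin 3 => (hc i).integrable_fourierInv_sq t
  rw [integral_add ((integrable_finsetSum _ fun i _ => h1 i).const_mul _)
    ((hw.integrable_fourierInv_pow_four t).const_mul _), integral_const_mul, integral_const_mul,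
    integral_finsetSum _ fun i _ => h1 i]
  have h2 : ∀ i : Fin 3, ∫ x, ‖𝓕⁻ (fun ξ => ((2 * Real.pi * ⟪ξ, EuclideanSpace.single i 1⟫ : ℝ) : ℂ)
      * I * w t ξ) x‖ ^ 2 = ∫ ξ, 4 * Real.pi ^ 2 * (‖ξ i‖ ^ 2 * ‖w t ξ‖ ^ 2) := by
    intro i
    rw [(hc i).integral_fourierInv_sq t]
    refine integral_congr_ae (Filter.Eventually.of_forall fun ξ => ?_)
    simp [EuclideanSpace.inner_single_right, mul_pow]
    ring
  simp only [h2]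
  rw [← integral_finsetSum]
  · congr 1
    rw [← integral_const_mul, ← integral_const_mul]
    refine integral_congr_ae (Filter.Eventually.of_forall fun ξ => ?_)
    simp only [EuclideanSpace.norm_sq_eq, Fin.sum_univ_three]
    ring
  · intro i _
    refine ((hc i).integrable_sq t).congr (Filter.Eventually.of_forall fun ξ => ?_)
    simp [EuclideanSpace.inner_single_right, mul_pow]
    ring

end RapidFam

lemma integral_sub_eq_of_hasDerivAt {g g' : ℝ → E3 → ℝ} {t : ℝ} (ht : 0 ≤ t)
    (hg : Continuous fun p : ℝ × E3 => g p.1 p.2) (hg' : Continuous fun p : ℝ × E3 => g' p.1 p.2)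
    (hd : ∀ s ∈ Ioo 0 t, ∀ x, HasDerivAt (fun s => g s x) (g' s x) s)
    (hint : ∀ s, Integrable (g s))
    (hint' : Integrable (Function.uncurry g') ((volume.restrict (Set.uIoc 0 t)).prod volume)) :
    (∫ x, g t x) - ∫ x, g 0 x = ∫ s in 0..t, ∫ x, g' s x := by
  rw [intervalIntegral_integral_swap hint', ← integral_sub (hint t) (hint 0)]
  refine integral_congr_ae (Filter.Eventually.of_forall fun x => ?_)
  have h1 : Continuous fun s => g' s x :=
    hg'.comp (f := fun s : ℝ => (s, x)) (by fun_prop)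
  have h2 : Continuous fun s => g s x := hg.comp (f := fun s : ℝ => (s, x)) (by fun_prop)
  exact (intervalIntegral.integral_eq_sub_of_hasDerivAt_of_le ht h2.continuousOn
    (fun s hs => hd s hs x) (h1.intervalIntegrable _ _)).symm

lemma integrable_uncurry_of_le_mul_polyWeight {g : ℝ → E3 → ℝ} {D : ℝ} (t : ℝ)
    (hg : Continuous fun p : ℝ × E3 => g p.1 p.2) (h : ∀ s x, ‖g s x‖ ≤ D * polyWeight x) :
    Integrable (Function.uncurry g) ((volume.restrict (Set.uIoc 0 t)).prod volume) := by
  have h1 : Integrable (fun _ : ℝ => (1 : ℝ)) (volume.restrict (Set.uIoc 0 t)) := by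
    rw [← IntegrableOn, ← intervalIntegrable_iff]
    exact intervalIntegrable_const
  refine ((h1.mul_prod integrable_polyWeight).const_mul D).mono' hg.aestronglyMeasurable
    (Filter.Eventually.of_forall fun p => ?_)
  rw [one_mul]
  exact h p.1 p.2

namespace RapidFam

variable {w w' v : ℝ → E3 → ℂ} {T t : ℝ}

lemma continuous_integral_sq (hw : RapidFam w) : Continuous fun s => ∫ ξ, ‖w s ξ‖ ^ 2 := by
  obtain ⟨D, hD0, hD⟩ := hw.norm_le
  refine continuous_of_dominated (F := fun s ξ => ‖w s ξ‖ ^ 2)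
    (bound := fun ξ => D ^ 2 * polyWeight ξ)
    (fun s => ((hw.continuous_right s).norm.pow 2).aestronglyMeasurable)
    (fun s => Filter.Eventually.of_forall fun ξ => ?_) (integrable_polyWeight.const_mul _)
    (Filter.Eventually.of_forall fun ξ => (hw.continuous_left ξ).norm.pow 2)
  have hp := polyWeight_pos ξ
  have hp1 := polyWeight_le_one ξ
  rw [Real.norm_of_nonneg (sq_nonneg ‖w s ξ‖)]
  calc ‖w s ξ‖ ^ 2 ≤ (D * polyWeight ξ) ^ 2 := by gcongr; exact hD s ξ
    _ = D ^ 2 * (polyWeight ξ * polyWeight ξ) := by ring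
    _ ≤ D ^ 2 * (polyWeight ξ * 1) := by gcongr
    _ = _ := by ring

lemma integrable_uncurry_fourierInv_sq (hw : RapidFam w) (t : ℝ) :
    Integrable (fun p : ℝ × E3 => ‖𝓕⁻ (w p.1) p.2‖ ^ 2)
      ((volume.restrict (Set.uIoc 0 t)).prod volume) := by
  have hm : AEStronglyMeasurable (fun p : ℝ × E3 => ‖𝓕⁻ (w p.1) p.2‖ ^ 2)
      ((volume.restrict (Set.uIoc 0 t)).prod volume) :=
    (hw.continuous_fourierInv.norm.pow 2).aestronglyMeasurable
  rw [integrable_prod_iff hm]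
  refine ⟨Filter.Eventually.of_forall fun s => hw.integrable_fourierInv_sq s, ?_⟩
  have h1 := hw.continuous_integral_sq
  have h2 : (fun s => ∫ x, ‖‖𝓕⁻ (w s) x‖ ^ 2‖) = fun s => ∫ ξ, ‖w s ξ‖ ^ 2 := by
    ext s
    simp only [norm_pow, norm_norm]
    exact hw.integral_fourierInv_sq s
  refine Integrable.congr ?_ (Filter.EventuallyEq.of_eq h2.symm)
  rw [← IntegrableOn, ← intervalIntegrable_iff]
  exact h1.intervalIntegrable _ _

lemma hasDerivAt_fourierInv (hw : RapidFam w) (hw' : RapidFam w')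
    (hd : ∀ s ∈ Ioo 0 T, ∀ ξ, HasDerivAt (fun s => w s ξ) (w' s ξ) s) (ht : t ∈ Ioo 0 T) (x : E3) :
    HasDerivAt (fun s => 𝓕⁻ (w s) x) (𝓕⁻ (w' t) x) t := by
  obtain ⟨D', hD0', hD'⟩ := hw'.norm_le
  simp only [fourierInv_eq_integral_phase]
  have hph : Continuous (phase 0 x) := by unfold phase; fun_prop
  refine (hasDerivAt_integral_of_dominated_loc_of_deriv_le (𝕜 := ℝ) (μ := volume)
    (F := fun s ξ => phase 0 x ξ * w s ξ) (F' := fun s ξ => phase 0 x ξ * w' s ξ)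
    (x₀ := t) (s := Ioo 0 T) (bound := fun ξ => D' * polyWeight ξ) (isOpen_Ioo.mem_nhds ht)
    (Filter.Eventually.of_forall fun s => (hph.mul (hw.continuous_right s)).aestronglyMeasurable)
    ?_ (hph.mul (hw'.continuous_right t)).aestronglyMeasurable
    (Filter.Eventually.of_forall fun ξ s hs => ?_) (integrable_polyWeight.const_mul D')
    (Filter.Eventually.of_forall fun ξ s hs => (hd s hs ξ).const_mul _)).2
  · refine (hw.integrable t).norm.mono' (hph.mul (hw.continuous_right t)).aestronglyMeasurable
      (Filter.Eventually.of_forall fun ξ => ?_)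
    rw [norm_mul, norm_phase, one_mul]
  · rw [norm_mul, norm_phase, one_mul]
    exact hD' s ξ

lemma kinetic_sub_eq (hw : RapidFam w) (hw' : RapidFam w')
    (hd : ∀ s ∈ Ioo 0 T, ∀ ξ, HasDerivAt (fun s => w s ξ) (w' s ξ) s) (ht : t ∈ Icc 0 T) :
    (∫ ξ, ‖ξ‖ ^ 2 * ‖w t ξ‖ ^ 2) - ∫ ξ, ‖ξ‖ ^ 2 * ‖w 0 ξ‖ ^ 2 =
      ∫ s in 0..t, ∫ ξ, ‖ξ‖ ^ 2 * (2 * ⟪w s ξ, w' s ξ⟫) := by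
  obtain ⟨D, hD0, hD⟩ := hw.exists_le 2
  obtain ⟨D', hD0', hD'⟩ := hw'.norm_le
  have hc := hw.cont
  have hc' := hw'.cont
  refine integral_sub_eq_of_hasDerivAt (g := fun t ξ => ‖ξ‖ ^ 2 * ‖w t ξ‖ ^ 2)
    (g' := fun s ξ => ‖ξ‖ ^ 2 * (2 * ⟪w s ξ, w' s ξ⟫)) ht.1 (by fun_prop) (by fun_prop)
    (fun s hs ξ => ((hd s ⟨hs.1, hs.2.trans_le ht.2⟩ ξ).norm_sq).const_mul _) (fun s => ?_)
    (integrable_uncurry_of_le_mul_polyWeight t (D := 2 * (D * D')) (by fun_prop) fun s ξ => ?_)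
  · refine (hw.norm_mul_self.integrable_sq s).congr (Filter.Eventually.of_forall fun ξ => ?_)
    simp [mul_pow]
  · have h1 := norm_inner_le_norm (𝕜 := ℝ) (w s ξ) (w' s ξ)
    have hp := polyWeight_pos ξ
    have hp1 := polyWeight_le_one ξ
    rw [norm_mul, norm_mul, norm_pow, norm_norm, Real.norm_of_nonneg zero_le_two]
    calc ‖ξ‖ ^ 2 * (2 * ‖⟪w s ξ, w' s ξ⟫‖) ≤ (1 + ‖ξ‖) ^ 2 * (2 * (‖w s ξ‖ * ‖w' s ξ‖)) := by
          gcongr; linarith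
      _ = 2 * (‖w s ξ‖ * (1 + ‖ξ‖) ^ 2 * ‖w' s ξ‖) := by ring
      _ ≤ 2 * (D * polyWeight ξ * (D' * 1)) := by
          refine mul_le_mul_of_nonneg_left (mul_le_mul (hD s ξ) ((hD' s ξ).trans ?_)
            (norm_nonneg _) (by positivity)) zero_le_two
          gcongr
      _ = _ := by ring

lemma potential_sub_eq (hw : RapidFam w) (hw' : RapidFam w')
    (hd : ∀ s ∈ Ioo 0 T, ∀ ξ, HasDerivAt (fun s => w s ξ) (w' s ξ) s) (ht : t ∈ Icc 0 T) :
    (∫ x, ‖𝓕⁻ (w t) x‖ ^ 4) - ∫ x, ‖𝓕⁻ (w 0) x‖ ^ 4 =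
      ∫ s in 0..t, 4 * (∫ ξ, starRingEnd ℂ (w' s ξ) * _root_.cubicConv (w s) ξ).re := by
  obtain ⟨M, hM0, hM⟩ := hw.norm_fourierInv_le
  have hc := hw.continuous_fourierInv
  have hc' := hw'.continuous_fourierInv
  have h1 := integral_sub_eq_of_hasDerivAt (g := fun t x => ‖𝓕⁻ (w t) x‖ ^ 4)
    (g' := fun s x => 4 * ‖𝓕⁻ (w s) x‖ ^ 2 * ⟪𝓕⁻ (w s) x, 𝓕⁻ (w' s) x⟫) ht.1 (hc.norm.pow 4)
    ((continuous_const.mul (hc.norm.pow 2)).mul (hc.inner hc')) (fun s hs x => ?_)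
    (fun s => hw.integrable_fourierInv_pow_four s) ?_
  · rw [h1]
    refine intervalIntegral.integral_congr fun s _ => ?_
    have hc2 := hw.cubicConv
    have h2 := integral_conj_fourierInv_mul (hw'.integrable s) (hw'.memLp_two s)
      (hc2.integrable s) (hc2.memLp_two s)
    simp only [← h2, fourierInv_cubicConv hw]
    have h3 : Integrable fun x => starRingEnd ℂ (𝓕⁻ (w' s) x) *
        ((‖𝓕⁻ (w s) x‖ : ℂ) ^ 2 * 𝓕⁻ (w s) x) := by
      have := (memLp_fourierInv (hw'.integrable s) (hw'.memLp_two s)).star.integrable_mul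
        (memLp_fourierInv (hc2.integrable s) (hc2.memLp_two s))
      refine this.congr (Filter.Eventually.of_forall fun x => ?_)
      simp only [Pi.mul_apply, Pi.star_apply, fourierInv_cubicConv hw]
      rfl
    have h4 := integral_re h3
    simp only [RCLike.re_eq_complex_re] at h4
    rw [← h4, ← integral_const_mul]
    refine integral_congr_ae (Filter.Eventually.of_forall fun x => ?_)
    have h5 : starRingEnd ℂ (𝓕⁻ (w' s) x) * ((‖𝓕⁻ (w s) x‖ : ℂ) ^ 2 * 𝓕⁻ (w s) x) =
        ((‖𝓕⁻ (w s) x‖ ^ 2 : ℝ) : ℂ) * (starRingEnd ℂ (𝓕⁻ (w' s) x) * 𝓕⁻ (w s) x) := by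
      push_cast; ring
    simp only [h5, re_ofReal_mul]
    simp only [Complex.inner, mul_re, conj_re, conj_im]
    ring
  · have h2 := ((hw.hasDerivAt_fourierInv hw' hd ⟨hs.1, hs.2.trans_le ht.2⟩ x).norm_sq).pow 2
    have h3 : (fun s => ‖𝓕⁻ (w s) x‖ ^ 4) = (fun s => ‖𝓕⁻ (w s) x‖ ^ 2) ^ 2 := by
      ext s; simp only [Pi.pow_apply]; ring
    rw [h3]
    refine h2.congr_deriv ?_
    norm_num
    ring
  · have hi := ((hw.integrable_uncurry_fourierInv_sq t).add
      (hw'.integrable_uncurry_fourierInv_sq t)).const_mul (4 * M ^ 2)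
    refine hi.mono' (((continuous_const.mul (hc.norm.pow 2)).mul
      (hc.inner hc')).aestronglyMeasurable (f := fun p : ℝ × E3 => 4 * ‖𝓕⁻ (w p.1) p.2‖ ^ 2 *
        ⟪𝓕⁻ (w p.1) p.2, 𝓕⁻ (w' p.1) p.2⟫))
      (Filter.Eventually.of_forall fun ⟨s, x⟩ => ?_)
    have h4 := norm_inner_le_norm (𝕜 := ℝ) (𝓕⁻ (w s) x) (𝓕⁻ (w' s) x)
    have h5 := hM s x
    simp only [Function.uncurry, Pi.add_apply]
    rw [norm_mul, norm_mul, norm_pow, norm_norm, Real.norm_of_nonneg zero_le_four]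
    calc 4 * ‖𝓕⁻ (w s) x‖ ^ 2 * ‖⟪𝓕⁻ (w s) x, 𝓕⁻ (w' s) x⟫‖
        ≤ 4 * M ^ 2 * (‖𝓕⁻ (w s) x‖ * ‖𝓕⁻ (w' s) x‖) := by gcongr
      _ ≤ 4 * M ^ 2 * (‖𝓕⁻ (w s) x‖ ^ 2 + ‖𝓕⁻ (w' s) x‖ ^ 2) := by
        gcongr
        nlinarith [sq_nonneg (‖𝓕⁻ (w s) x‖ - ‖𝓕⁻ (w' s) x‖), sq_nonneg ‖𝓕⁻ (w s) x‖,
          sq_nonneg ‖𝓕⁻ (w' s) x‖]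

end RapidFam

/-- A rapidly decreasing family solving the cubic Schrödinger equation on the Fourier side. -/
structure NLSFam (T : ℝ) (h : ℝ → E3 → ℂ) : Prop where
  rapid : RapidFam h
  hasDeriv : ∀ t ∈ Ioo 0 T, ∀ ξ, HasDerivAt (fun t => h t ξ)
    (-I * (((4 * Real.pi ^ 2 * ‖ξ‖ ^ 2 : ℝ) : ℂ) * h t ξ + cubicConv (h t) ξ)) t

namespace NLSFam

variable {T t : ℝ} {h : ℝ → E3 → ℂ} {m : E3 → ℝ}

lemma rapid_mul (hh : NLSFam T h) (hm : Continuous m) (hm0 : ∀ ξ, 0 < m ξ) (hm1 : ∀ ξ, m ξ ≤ 1) :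
    RapidFam fun t ξ => (m ξ : ℂ) * h t ξ :=
  hh.rapid.mul_left (b := fun _ ξ => (m ξ : ℂ)) (by fun_prop) (K := 1) (j := 0) fun t ξ => by
    simpa [abs_of_pos (hm0 ξ)] using hm1 ξ

lemma rapid_deriv (hh : NLSFam T h) : RapidFam fun t ξ =>
    -I * (((4 * Real.pi ^ 2 * ‖ξ‖ ^ 2 : ℝ) : ℂ) * h t ξ + cubicConv (h t) ξ) := by
  refine (RapidFam.add ?_ hh.rapid.cubicConv).const_mul (-I)
  refine hh.rapid.mul_left (b := fun _ ξ => ((4 * Real.pi ^ 2 * ‖ξ‖ ^ 2 : ℝ) : ℂ)) (by fun_prop)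
    (K := 4 * Real.pi ^ 2) (j := 2) fun t ξ => ?_
  rw [norm_real, Real.norm_of_nonneg (by positivity)]
  gcongr
  linarith

lemma energy_sub_eq (hh : NLSFam T h) (hm : Continuous m) (hm0 : ∀ ξ, 0 < m ξ)
    (hm1 : ∀ ξ, m ξ ≤ 1) (ht : t ∈ Icc 0 T) :
    energy (𝓕⁻ fun ξ => (m ξ : ℂ) * h t ξ) - energy (𝓕⁻ fun ξ => (m ξ : ℂ) * h 0 ξ) =
      ∫ s in 0..t, (∫ ξ, (m ξ : ℂ) * (I * (starRingEnd ℂ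
        (((4 * Real.pi ^ 2 * ‖ξ‖ ^ 2 : ℝ) : ℂ) * h s ξ + cubicConv (h s) ξ) *
        (cubicConv (fun η => (m η : ℂ) * h s η) ξ - m ξ * cubicConv (h s) ξ)))).re := by
  have hw := hh.rapid_mul hm hm0 hm1
  have hF := hh.rapid.cubicConv
  set w' : ℝ → E3 → ℂ := fun t ξ => (m ξ : ℂ) *
    (-I * (((4 * Real.pi ^ 2 * ‖ξ‖ ^ 2 : ℝ) : ℂ) * h t ξ + cubicConv (h t) ξ)) with hw'def
  have hw' : RapidFam w' :=
    hh.rapid_deriv.mul_left (b := fun _ ξ => (m ξ : ℂ)) (by fun_prop) (K := 1) (j := 0) fun t ξ => by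
      simpa [abs_of_pos (hm0 ξ)] using hm1 ξ
  have hd : ∀ s ∈ Ioo 0 T, ∀ ξ, HasDerivAt (fun s => (m ξ : ℂ) * h s ξ) (w' s ξ) s :=
    fun s hs ξ => (hh.hasDeriv s hs ξ).const_mul _
  have h1 := hw.kinetic_sub_eq hw' hd ht
  have h2 := hw.potential_sub_eq hw' hd ht
  have hcw := hw.cubicConv
  rw [hw.energy_fourierInv t, hw.energy_fourierInv 0]
  have h3 : ∀ a b c d : ℝ, 2 * Real.pi ^ 2 * a + 1 / 4 * b - (2 * Real.pi ^ 2 * c + 1 / 4 * d) =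
    2 * Real.pi ^ 2 * (a - c) + 1 / 4 * (b - d) := fun a b c d => by ring
  have hK : RapidFam fun s ξ => ((4 * Real.pi ^ 2 * ‖ξ‖ ^ 2 : ℝ) : ℂ) * ((m ξ : ℂ) * h s ξ) := by
    refine hw.mul_left (b := fun _ ξ => ((4 * Real.pi ^ 2 * ‖ξ‖ ^ 2 : ℝ) : ℂ)) (by fun_prop)
      (K := 4 * Real.pi ^ 2) (j := 2) fun t ξ => ?_
    rw [norm_real, Real.norm_of_nonneg (by positivity)]
    gcongr
    linarith
  have hprod : ∀ {v : ℝ → E3 → ℂ}, RapidFam v → ∀ s,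
      Integrable fun ξ => starRingEnd ℂ (w' s ξ) * v s ξ := fun hv s =>
    (hw'.memLp_two s).star.integrable_mul (hv.memLp_two s)
  have hpc : ∀ {v : ℝ → E3 → ℂ}, RapidFam v →
      Continuous fun s => ∫ ξ, starRingEnd ℂ (w' s ξ) * v s ξ := by
    intro v hv
    obtain ⟨D, hD0, hD⟩ := hw'.norm_le
    obtain ⟨D', hD0', hD'⟩ := hv.norm_le
    refine continuous_of_dominated (F := fun s ξ => starRingEnd ℂ (w' s ξ) * v s ξ)
      (bound := fun ξ => D * D' * polyWeight ξ) (fun s => (hprod hv s).1)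
      (fun s => Filter.Eventually.of_forall fun ξ => ?_) (integrable_polyWeight.const_mul _)
      (Filter.Eventually.of_forall fun ξ =>
        (continuous_conj.comp (hw'.continuous_left ξ)).mul (hv.continuous_left ξ))
    have hp := polyWeight_pos ξ
    have hp1 := polyWeight_le_one ξ
    rw [norm_mul, RCLike.norm_conj]
    calc ‖w' s ξ‖ * ‖v s ξ‖ ≤ (D * polyWeight ξ) * (D' * polyWeight ξ) :=
          mul_le_mul (hD s ξ) (hD' s ξ) (norm_nonneg _) (by positivity)
      _ = D * D' * polyWeight ξ * polyWeight ξ := by ring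
      _ ≤ D * D' * polyWeight ξ * 1 := by gcongr
      _ = _ := by ring
  have hkin : ∀ s, 2 * Real.pi ^ 2 * ∫ ξ, ‖ξ‖ ^ 2 * (2 * ⟪(m ξ : ℂ) * h s ξ, w' s ξ⟫) =
      (∫ ξ, starRingEnd ℂ (w' s ξ) *
        (((4 * Real.pi ^ 2 * ‖ξ‖ ^ 2 : ℝ) : ℂ) * ((m ξ : ℂ) * h s ξ))).re := by
    intro s
    have := integral_re (hprod hK s)
    simp only [RCLike.re_eq_complex_re] at this
    rw [← this, ← integral_const_mul]
    refine integral_congr_ae (Filter.Eventually.of_forall fun ξ => ?_)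
    have h5 : starRingEnd ℂ (w' s ξ) *
        (((4 * Real.pi ^ 2 * ‖ξ‖ ^ 2 : ℝ) : ℂ) * ((m ξ : ℂ) * h s ξ)) =
        ((4 * Real.pi ^ 2 * ‖ξ‖ ^ 2 : ℝ) : ℂ) * (starRingEnd ℂ (w' s ξ) * ((m ξ : ℂ) * h s ξ)) := by
      ring
    simp only [h5, re_ofReal_mul]
    generalize (m ξ : ℂ) * h s ξ = a
    generalize w' s ξ = b
    simp only [Complex.inner, mul_re, conj_re, conj_im]
    ring
  rw [h3, h1, h2, ← intervalIntegral.integral_const_mul, ← intervalIntegral.integral_const_mul]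
  simp only [hkin]
  rw [← intervalIntegral.integral_add]
  · refine intervalIntegral.integral_congr fun s _ => ?_
    have e1 : ∀ a : ℝ, 1 / 4 * (4 * a) = a := fun a => by ring
    simp only [e1]
    rw [← add_re, ← integral_add (hprod hK s) (hprod hcw s)]
    have hi1 : Integrable fun ξ => starRingEnd ℂ (w' s ξ) *
        (((4 * Real.pi ^ 2 * ‖ξ‖ ^ 2 : ℝ) : ℂ) * ((m ξ : ℂ) * h s ξ)) +
        starRingEnd ℂ (w' s ξ) * cubicConv (fun η => (m η : ℂ) * h s η) ξ :=
      (hprod hK s).add (hprod hcw s)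
    have hi2 : Integrable fun ξ => (m ξ : ℂ) * (I * (starRingEnd ℂ
        (((4 * Real.pi ^ 2 * ‖ξ‖ ^ 2 : ℝ) : ℂ) * h s ξ + cubicConv (h s) ξ) *
        (cubicConv (fun η => (m η : ℂ) * h s η) ξ - m ξ * cubicConv (h s) ξ))) := by
      have hmF : RapidFam fun s ξ => (m ξ : ℂ) * cubicConv (h s) ξ :=
        hF.mul_left (b := fun _ ξ => (m ξ : ℂ)) (by fun_prop) (K := 1) (j := 0) fun t ξ => by
          simpa [abs_of_pos (hm0 ξ)] using hm1 ξ
      refine ((hprod hcw s).sub (hprod hmF s)).congr (Filter.Eventually.of_forall fun ξ => ?_)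
      simp only [hw'def, Pi.sub_apply, map_mul, map_neg, conj_I, conj_ofReal]
      ring
    have h6 := integral_re hi1
    have h7 := integral_re hi2
    simp only [RCLike.re_eq_complex_re] at h6 h7
    rw [← h6, ← h7]
    refine integral_congr_ae (Filter.Eventually.of_forall fun ξ => ?_)
    simp only [hw'def, map_mul, map_neg, conj_I, conj_ofReal]
    generalize cubicConv (fun η => (m η : ℂ) * h s η) ξ = G
    generalize cubicConv (h s) ξ = F
    generalize h s ξ = a
    generalize 4 * Real.pi ^ 2 * ‖ξ‖ ^ 2 = r
    simp [mul_re, mul_im]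
    ring
  · exact (continuous_re.comp (hpc hK)).intervalIntegrable _ _
  · exact ((continuous_const.mul (continuous_const.mul (continuous_re.comp
      (hpc hcw))))).intervalIntegrable _ _

end NLSFam

lemma phase_zero_add_left (x y ξ : E3) : phase 0 (x + y) ξ = phase 0 x ξ * phase 0 y ξ := by
  simp only [phase, ← Complex.exp_add, inner_add_left]
  congr 1
  push_cast
  ring

lemma norm_cube_sub_cube_le {a b : ℂ} {M : ℝ} (ha : ‖a‖ ≤ M) (hb : ‖b‖ ≤ M) :
    ‖(‖a‖ : ℂ) ^ 2 * a - (‖b‖ : ℂ) ^ 2 * b‖ ≤ 3 * M ^ 2 * ‖a - b‖ := by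
  have h1 : (‖a‖ : ℂ) ^ 2 * a - (‖b‖ : ℂ) ^ 2 * b =
      (‖a‖ : ℂ) ^ 2 * (a - b) + ((‖a‖ - ‖b‖ : ℝ) : ℂ) * ((‖a‖ + ‖b‖ : ℝ) : ℂ) * b := by
    push_cast; ring
  have hM : 0 ≤ M := (norm_nonneg a).trans ha
  have h2 := abs_norm_sub_norm_le a b
  rw [h1]
  refine (norm_add_le _ _).trans ?_
  rw [norm_mul, norm_mul, norm_mul, norm_pow, norm_real, norm_real, norm_real, norm_norm,
    Real.norm_eq_abs, Real.norm_of_nonneg (by positivity : 0 ≤ ‖a‖ + ‖b‖)]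
  calc ‖a‖ ^ 2 * ‖a - b‖ + |‖a‖ - ‖b‖| * (‖a‖ + ‖b‖) * ‖b‖
      ≤ M ^ 2 * ‖a - b‖ + ‖a - b‖ * (M + M) * M := by gcongr
    _ = _ := by ring

lemma lintegral_diffWeight_mul_sq (s N : ℝ) (i : Fin 3) {f : E3 → ℂ} (hfc : Continuous f)
    (hf : Integrable f) (hf2 : MemLp f 2) :
    ∫⁻ ξ, diffWeight s N (ξ i) * ‖f ξ‖ₑ ^ 2 = ∫⁻ ρ in Ioc 0 N⁻¹,
      ENNReal.ofReal (stepDensity s N ρ) *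
        ∫⁻ x, ‖𝓕⁻ f (x + ρ • EuclideanSpace.single i 1) - 𝓕⁻ f x‖ₑ ^ 2 := by
  have hsd : Measurable (stepDensity s N) := by unfold stepDensity; fun_prop
  have h1 : ∀ ρ : ℝ, ∫⁻ x, ‖𝓕⁻ f (x + ρ • EuclideanSpace.single i 1) - 𝓕⁻ f x‖ₑ ^ 2 =
      ∫⁻ ξ, ‖cexp (I * (2 * Real.pi * ρ * ξ i : ℝ)) - 1‖ₑ ^ 2 * ‖f ξ‖ₑ ^ 2 := by
    intro ρ
    have hc : Continuous fun ξ : E3 => cexp (I * (2 * Real.pi * ρ * ξ i : ℝ)) - 1 := by fun_prop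
    have hb : ∀ ξ : E3, ‖cexp (I * (2 * Real.pi * ρ * ξ i : ℝ)) - 1‖ ≤ 2 := fun ξ => by
      refine (norm_sub_le _ _).trans ?_
      rw [mul_comm, norm_exp_ofReal_mul_I, norm_one]
      norm_num
    have hgi : Integrable fun ξ => (cexp (I * (2 * Real.pi * ρ * ξ i : ℝ)) - 1) * f ξ :=
      hf.bdd_mul hc.aestronglyMeasurable (c := 2) (Filter.Eventually.of_forall hb)
    have hg2 : MemLp (fun ξ => (cexp (I * (2 * Real.pi * ρ * ξ i : ℝ)) - 1) * f ξ) 2 :=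
      hf2.of_le_mul (c := 2) (hc.mul hfc).aestronglyMeasurable
        (Filter.Eventually.of_forall fun ξ => by
          rw [norm_mul]; exact mul_le_mul_of_nonneg_right (hb ξ) (norm_nonneg _))
    have h2 := lintegral_fourierInv_sq hgi hg2
    simp only [enorm_mul, mul_pow] at h2
    rw [← h2]
    refine lintegral_congr fun x => ?_
    congr 2
    simp only [fourierInv_eq_integral_phase]
    have hi : ∀ y, Integrable fun ξ => phase 0 y ξ * f ξ := fun y =>
      hf.bdd_mul (continuous_phase_right 0 y).aestronglyMeasurable (c := 1)
        (Filter.Eventually.of_forall fun ξ => (norm_phase _ _ _).le)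
    rw [← integral_sub (hi _) (hi _)]
    refine integral_congr_ae (Filter.Eventually.of_forall fun ξ => ?_)
    simp only [phase_zero_add_left]
    have h3 : phase 0 (ρ • EuclideanSpace.single i 1) ξ = cexp (I * (2 * Real.pi * ρ * ξ i : ℝ)) := by
      simp only [phase, inner_smul_left, EuclideanSpace.inner_single_left]
      congr 1
      simp
      ring
    rw [h3]
    ring
  simp only [h1, diffWeight]
  have hm : Measurable fun q : ℝ × E3 => ENNReal.ofReal (stepDensity s N q.1) *
      ‖cexp (I * (2 * Real.pi * q.1 * q.2 i : ℝ)) - 1‖ₑ ^ 2 := by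
    have : Continuous fun q : ℝ × E3 => cexp (I * (2 * Real.pi * q.1 * q.2 i : ℝ)) - 1 := by
      fun_prop
    exact ((hsd.comp measurable_fst).ennreal_ofReal).mul (this.enorm.measurable.pow_const 2)
  have hfm : Measurable fun ξ => ‖f ξ‖ₑ ^ 2 := (hfc.enorm.measurable).pow_const 2
  calc ∫⁻ ξ, (∫⁻ ρ in Ioc 0 N⁻¹, ENNReal.ofReal (stepDensity s N ρ) *
        ‖cexp (I * (2 * Real.pi * ρ * ξ i : ℝ)) - 1‖ₑ ^ 2) * ‖f ξ‖ₑ ^ 2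
      = ∫⁻ ξ, ∫⁻ ρ in Ioc 0 N⁻¹, ENNReal.ofReal (stepDensity s N ρ) *
        ‖cexp (I * (2 * Real.pi * ρ * ξ i : ℝ)) - 1‖ₑ ^ 2 * ‖f ξ‖ₑ ^ 2 := by
        refine lintegral_congr fun ξ => ?_
        rw [lintegral_mul_const]
        exact hm.comp (measurable_id.prodMk measurable_const)
    _ = ∫⁻ ρ in Ioc 0 N⁻¹, ∫⁻ ξ, ENNReal.ofReal (stepDensity s N ρ) *
        ‖cexp (I * (2 * Real.pi * ρ * ξ i : ℝ)) - 1‖ₑ ^ 2 * ‖f ξ‖ₑ ^ 2 := by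
        refine lintegral_lintegral_swap ?_
        refine Measurable.aemeasurable ?_
        exact (hm.comp (measurable_snd.prodMk measurable_fst)).mul (hfm.comp measurable_fst)
    _ = _ := by
        refine lintegral_congr fun ρ => ?_
        rw [← lintegral_const_mul]
        · simp only [mul_assoc]
        · have : Continuous fun ξ : E3 => cexp (I * (2 * Real.pi * ρ * ξ i : ℝ)) - 1 := by
            fun_prop
          exact (this.enorm.measurable.pow_const 2).mul hfm

/-- The weighted `L²` norm of the cubic nonlinearity is controlled by the sup norm of the
function. -/
lemma RapidFam.lintegral_weight_cubicConv_le {s N : ℝ} {m : E3 → ℝ} {w : ℝ → E3 → ℂ}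
    (hs : 5 / 6 < s) (hs1 : s < 1) (hN : 0 < N) (hm : GoodMult s N m) (hw : RapidFam w) (t : ℝ) :
    ∫⁻ ξ, ENNReal.ofReal ((m ξ * ‖ξ‖) ^ 2) * ‖_root_.cubicConv (w t) ξ‖ₑ ^ 2 ≤
      10000 * (⨆ x, ‖𝓕⁻ (w t) x‖ₑ) ^ 4 *
        ∫⁻ ξ, ENNReal.ofReal ((m ξ * ‖ξ‖) ^ 2) * ‖w t ξ‖ₑ ^ 2 := by
  have hF := hw.cubicConv
  obtain ⟨K, hK0, hK⟩ := hw.norm_fourierInv_le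
  have hfin : (⨆ x, ‖𝓕⁻ (w t) x‖ₑ) ≠ ⊤ := by
    refine ((iSup_le fun x => ?_).trans_lt (ENNReal.ofReal_lt_top (r := K))).ne
    rw [← ofReal_norm]
    exact ENNReal.ofReal_le_ofReal (hK t x)
  set M := (⨆ x, ‖𝓕⁻ (w t) x‖ₑ).toReal with hM
  have hMof : ENNReal.ofReal M = ⨆ x, ‖𝓕⁻ (w t) x‖ₑ := ENNReal.ofReal_toReal hfin
  have hM0 : 0 ≤ M := ENNReal.toReal_nonneg
  have hMx : ∀ x, ‖𝓕⁻ (w t) x‖ ≤ M := fun x => by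
    rw [← toReal_enorm]
    exact ENNReal.toReal_mono hfin (le_iSup (fun x => ‖𝓕⁻ (w t) x‖ₑ) x)
  have hcw := hw.continuous_right t
  have hcF := hF.continuous_right t
  have hdiff : ∀ i : Fin 3, ∫⁻ ξ, diffWeight s N (ξ i) * ‖_root_.cubicConv (w t) ξ‖ₑ ^ 2 ≤
      ENNReal.ofReal (9 * M ^ 4) * ∫⁻ ξ, diffWeight s N (ξ i) * ‖w t ξ‖ₑ ^ 2 := by
    intro i
    rw [lintegral_diffWeight_mul_sq s N i hcF (hF.integrable t) (hF.memLp_two t),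
      lintegral_diffWeight_mul_sq s N i hcw (hw.integrable t) (hw.memLp_two t),
      ← lintegral_const_mul' _ _ ENNReal.ofReal_ne_top]
    refine lintegral_mono fun ρ => ?_
    rw [mul_left_comm]
    refine mul_le_mul_right ?_ _
    rw [← lintegral_const_mul' _ _ ENNReal.ofReal_ne_top]
    refine lintegral_mono fun x => ?_
    rw [fourierInv_cubicConv hw, fourierInv_cubicConv hw, ← ofReal_norm,
      ← ofReal_norm, ← ENNReal.ofReal_pow (norm_nonneg _),
      ← ENNReal.ofReal_pow (norm_nonneg _), ← ENNReal.ofReal_mul (by positivity)]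
    refine ENNReal.ofReal_le_ofReal ?_
    calc _ ≤ (3 * M ^ 2 * ‖𝓕⁻ (w t) (x + ρ • EuclideanSpace.single i 1) - 𝓕⁻ (w t) x‖) ^ 2 :=
          pow_le_pow_left₀ (norm_nonneg _) (norm_cube_sub_cube_le (hMx _) (hMx _)) 2
      _ = _ := by ring
  have hdm : ∀ (f : E3 → ℂ), Continuous f → ∀ i : Fin 3,
      Measurable fun ξ : E3 => diffWeight s N (ξ i) * ‖f ξ‖ₑ ^ 2 := fun f hf i =>
    ((measurable_diffWeight s N).comp (by fun_prop)).mul (hf.enorm.measurable.pow_const 2)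
  calc ∫⁻ ξ, ENNReal.ofReal ((m ξ * ‖ξ‖) ^ 2) * ‖_root_.cubicConv (w t) ξ‖ₑ ^ 2
      ≤ ∫⁻ ξ, 2 * ∑ i : Fin 3, diffWeight s N (ξ i) * ‖_root_.cubicConv (w t) ξ‖ₑ ^ 2 := by
        refine lintegral_mono fun ξ => ?_
        rw [← Finset.sum_mul, ← mul_assoc]
        refine mul_le_mul_left ?_ _
        have h1 := le_sum_diffWeight hs hs1 hN ξ
        have h2 := hm.upper ξ
        have h3 : 0 ≤ m ξ * ‖ξ‖ := mul_nonneg (hm.pos ξ).le (norm_nonneg _)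
        calc ENNReal.ofReal ((m ξ * ‖ξ‖) ^ 2) ≤ ENNReal.ofReal (2 * (2 * modSymb s N ξ ^ 2)) :=
              ENNReal.ofReal_le_ofReal (by nlinarith)
          _ = 2 * ENNReal.ofReal (2 * modSymb s N ξ ^ 2) := by
              rw [ENNReal.ofReal_mul zero_le_two]; simp
          _ ≤ _ := mul_le_mul_right h1 _
    _ = 2 * ∑ i : Fin 3, ∫⁻ ξ, diffWeight s N (ξ i) * ‖_root_.cubicConv (w t) ξ‖ₑ ^ 2 := by
        rw [lintegral_const_mul _ (Finset.measurable_sum _ fun i _ => hdm _ hcF i),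
          lintegral_finsetSum _ fun i _ => hdm _ hcF i]
    _ ≤ 2 * ∑ i : Fin 3, ENNReal.ofReal (9 * M ^ 4) *
          ∫⁻ ξ, diffWeight s N (ξ i) * ‖w t ξ‖ₑ ^ 2 := by
        gcongr with i
        exact hdiff i
    _ = ∫⁻ ξ, 2 * ENNReal.ofReal (9 * M ^ 4) * ∑ i : Fin 3, diffWeight s N (ξ i) * ‖w t ξ‖ₑ ^ 2 := by
        rw [lintegral_const_mul _ (Finset.measurable_sum _ fun i _ => hdm _ hcw i),
          lintegral_finsetSum _ fun i _ => hdm _ hcw i, ← Finset.mul_sum, mul_assoc]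
    _ ≤ ∫⁻ ξ, ENNReal.ofReal (10000 * M ^ 4) *
          (ENNReal.ofReal ((m ξ * ‖ξ‖) ^ 2) * ‖w t ξ‖ₑ ^ 2) := by
        refine lintegral_mono fun ξ => ?_
        rw [← Finset.sum_mul, ← mul_assoc, ← mul_assoc]
        refine mul_le_mul_left ?_ _
        have h1 := sum_diffWeight_le hs hs1 hN ξ
        have h2 := hm.lower ξ
        have h3 := modSymb_nonneg (s := s) hN.le ξ
        calc 2 * ENNReal.ofReal (9 * M ^ 4) * ∑ i : Fin 3, diffWeight s N (ξ i)
            ≤ 2 * ENNReal.ofReal (9 * M ^ 4) * ENNReal.ofReal (132 * modSymb s N ξ ^ 2) :=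
              mul_le_mul_right h1 _
          _ = ENNReal.ofReal (2 * (9 * M ^ 4) * (132 * modSymb s N ξ ^ 2)) := by
              rw [ENNReal.ofReal_mul (p := 2 * (9 * M ^ 4)) (by positivity),
                ENNReal.ofReal_mul (p := 2) zero_le_two, ENNReal.ofReal_ofNat]
          _ ≤ ENNReal.ofReal (10000 * M ^ 4 * (m ξ * ‖ξ‖) ^ 2) := by
              refine ENNReal.ofReal_le_ofReal ?_
              have h4 : modSymb s N ξ ^ 2 ≤ 4 * (m ξ * ‖ξ‖) ^ 2 := by nlinarith
              calc 2 * (9 * M ^ 4) * (132 * modSymb s N ξ ^ 2)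
                  ≤ 2 * (9 * M ^ 4) * (132 * (4 * (m ξ * ‖ξ‖) ^ 2)) := by gcongr
                _ = 9504 * (M ^ 4 * (m ξ * ‖ξ‖) ^ 2) := by ring
                _ ≤ 10000 * (M ^ 4 * (m ξ * ‖ξ‖) ^ 2) := by gcongr; norm_num
                _ = _ := by ring
          _ = _ := ENNReal.ofReal_mul (by positivity)
    _ = _ := by
        rw [lintegral_const_mul' _ _ ENNReal.ofReal_ne_top, ENNReal.ofReal_mul (by norm_num),
          ENNReal.ofReal_pow hM0, hMof]
        simp

/-- Minkowski's integral inequality in `L²`. -/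
lemma sq_lintegral_lintegral_le {S X : Type*} [MeasurableSpace S] [MeasurableSpace X]
    {μ : Measure S} {ν : Measure X} [SFinite μ] [SFinite ν] {G : S → X → ENNReal}
    (hG : Measurable (Function.uncurry G)) {n : S → ENNReal} (hn : Measurable n)
    (h : ∀ s, ∫⁻ x, G s x ^ 2 ∂ν ≤ n s ^ 2) :
    ∫⁻ x, (∫⁻ s, G s x ∂μ) ^ 2 ∂ν ≤ (∫⁻ s, n s ∂μ) ^ 2 := by
  have hGx : ∀ x, Measurable fun s => G s x := fun x =>
    hG.comp (f := fun s => (s, x)) (by fun_prop)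
  have hGs : ∀ s, Measurable (G s) := fun s => hG.comp (f := fun x => (s, x)) (by fun_prop)
  have h3 : Measurable fun q : X × (S × S) => G q.2.1 q.1 * G q.2.2 q.1 :=
    (hG.comp (f := fun q : X × (S × S) => (q.2.1, q.1)) (by fun_prop)).mul
      (hG.comp (f := fun q : X × (S × S) => (q.2.2, q.1)) (by fun_prop))
  have sq : ∀ f : S → ENNReal, Measurable f →
      (∫⁻ s, f s ∂μ) ^ 2 = ∫⁻ q : S × S, f q.1 * f q.2 ∂(μ.prod μ) := fun f hf => by
    rw [lintegral_prod_mul hf.aemeasurable hf.aemeasurable, _root_.sq]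
  calc ∫⁻ x, (∫⁻ s, G s x ∂μ) ^ 2 ∂ν
      = ∫⁻ x, (∫⁻ q : S × S, G q.1 x * G q.2 x ∂(μ.prod μ)) ∂ν :=
        lintegral_congr fun x => sq _ (hGx x)
    _ = ∫⁻ q : S × S, (∫⁻ x, G q.1 x * G q.2 x ∂ν) ∂(μ.prod μ) :=
        lintegral_lintegral_swap h3.aemeasurable
    _ ≤ ∫⁻ q : S × S, n q.1 * n q.2 ∂(μ.prod μ) := by
        refine lintegral_mono fun q => ?_
        refine (ENNReal.pow_le_pow_left_iff two_ne_zero).1 ?_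
        refine (sq_lintegral_mul_le ν (hGs q.1).aemeasurable (hGs q.2).aemeasurable).trans ?_
        rw [mul_pow]
        exact mul_le_mul' (h _) (h _)
    _ = _ := (sq _ hn).symm

namespace RapidFam

variable {w : ℝ → E3 → ℂ}

lemma ofReal_integral_sq (hw : RapidFam w) (s : ℝ) :
    ENNReal.ofReal (∫ ξ, ‖w s ξ‖ ^ 2) = ∫⁻ ξ, ‖w s ξ‖ₑ ^ 2 := by
  rw [ofReal_integral_eq_lintegral_ofReal (hw.integrable_sq s)
    (Filter.Eventually.of_forall fun ξ => sq_nonneg ‖w s ξ‖)]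
  refine lintegral_congr fun ξ => ?_
  rw [ENNReal.ofReal_pow (norm_nonneg _), ofReal_norm]

lemma continuous_freeEvol_uncurry (hw : RapidFam w) :
    Continuous fun q : (ℝ × ℝ) × E3 => freeEvol (w q.1.1) q.1.2 q.2 := by
  obtain ⟨D, hD0, hD⟩ := hw.norm_le
  unfold freeEvol
  have hc : Continuous fun q : ((ℝ × ℝ) × E3) × E3 =>
      phase q.1.1.2 q.1.2 q.2 * w q.1.1.1 q.2 := by
    refine Continuous.mul ?_ (hw.cont.comp (f := fun q : ((ℝ × ℝ) × E3) × E3 => (q.1.1.1, q.2))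
      (by fun_prop))
    unfold phase
    fun_prop
  refine continuous_of_dominated
    (F := fun (p : (ℝ × ℝ) × E3) (ξ : E3) => phase p.1.2 p.2 ξ * w p.1.1 ξ)
    (bound := fun ξ => D * polyWeight ξ)
    (fun p => (hc.comp (f := fun x : E3 => (p, x)) (by fun_prop)).aestronglyMeasurable)
    (fun p => Filter.Eventually.of_forall fun ξ => ?_) (integrable_polyWeight.const_mul D)
    (Filter.Eventually.of_forall fun ξ =>
      hc.comp (f := fun q : (ℝ × ℝ) × E3 => (q, ξ)) (by fun_prop))
  rw [norm_mul, norm_phase, one_mul]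
  exact hD p.1.1 ξ

lemma measurable_supNorm_freeEvol (hw : RapidFam w) :
    Measurable fun q : ℝ × ℝ => supNorm (freeEvol (w q.1)) q.2 := by
  have : LowerSemicontinuous fun q : ℝ × ℝ => supNorm (freeEvol (w q.1)) q.2 :=
    lowerSemicontinuous_iSup fun x => (continuous_enorm.comp (hw.continuous_freeEvol_uncurry.comp
      (f := fun q : ℝ × ℝ => (q, x)) (by fun_prop))).lowerSemicontinuous
  exact this.measurable

end RapidFam

/-- The profile of a solution, with the free evolution removed. -/
def profile (h : ℝ → E3 → ℂ) (t : ℝ) (ξ : E3) : ℂ :=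
  cexp (((4 * Real.pi ^ 2 * t * ‖ξ‖ ^ 2 : ℝ) : ℂ) * I) * h t ξ

/-- The time derivative of the profile of a solution. -/
def profileDeriv (h : ℝ → E3 → ℂ) (t : ℝ) (ξ : E3) : ℂ :=
  cexp (((4 * Real.pi ^ 2 * t * ‖ξ‖ ^ 2 : ℝ) : ℂ) * I) * (-I * cubicConv (h t) ξ)

namespace NLSFam

variable {T t T' : ℝ} {h : ℝ → E3 → ℂ} {m : E3 → ℝ}

lemma norm_profile (h : ℝ → E3 → ℂ) (t : ℝ) (ξ : E3) : ‖profile h t ξ‖ = ‖h t ξ‖ := by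
  rw [profile, norm_mul, norm_exp_ofReal_mul_I, one_mul]

lemma norm_profileDeriv (h : ℝ → E3 → ℂ) (t : ℝ) (ξ : E3) :
    ‖profileDeriv h t ξ‖ = ‖cubicConv (h t) ξ‖ := by
  rw [profileDeriv, norm_mul, norm_exp_ofReal_mul_I, one_mul, norm_mul, norm_neg, norm_I, one_mul]

lemma rapid_profile (hh : NLSFam T h) : RapidFam (profile h) :=
  hh.rapid.mul_left (b := fun t ξ => cexp (((4 * Real.pi ^ 2 * t * ‖ξ‖ ^ 2 : ℝ) : ℂ) * I))
    (by fun_prop) (K := 1) (j := 0) fun t ξ => by rw [norm_exp_ofReal_mul_I]; simp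

lemma rapid_profileDeriv (hh : NLSFam T h) : RapidFam (profileDeriv h) :=
  (hh.rapid.cubicConv.const_mul (-I)).mul_left
    (b := fun t ξ => cexp (((4 * Real.pi ^ 2 * t * ‖ξ‖ ^ 2 : ℝ) : ℂ) * I))
    (by fun_prop) (K := 1) (j := 0) fun t ξ => by rw [norm_exp_ofReal_mul_I]; simp

lemma hasDerivAt_profile (hh : NLSFam T h) (ht : t ∈ Ioo 0 T) (ξ : E3) :
    HasDerivAt (fun t => profile h t ξ) (profileDeriv h t ξ) t := by
  have h1 : HasDerivAt (fun t : ℝ => ((4 * Real.pi ^ 2 * t * ‖ξ‖ ^ 2 : ℝ) : ℂ) * I)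
      (((4 * Real.pi ^ 2 * ‖ξ‖ ^ 2 : ℝ) : ℂ) * I) t := by
    have h2 : HasDerivAt (fun t : ℝ => 4 * Real.pi ^ 2 * t * ‖ξ‖ ^ 2)
        (4 * Real.pi ^ 2 * ‖ξ‖ ^ 2) t := by
      have := ((hasDerivAt_id t).const_mul (4 * Real.pi ^ 2)).mul_const (‖ξ‖ ^ 2)
      simpa using this
    exact h2.ofReal_comp.mul_const I
  refine (h1.cexp.mul (hh.hasDeriv t ht ξ)).congr_deriv ?_
  unfold profileDeriv
  ring

lemma profile_sub_eq (hh : NLSFam T h) (ht : t ∈ Icc 0 T) (ξ : E3) :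
    profile h t ξ = h 0 ξ + ∫ s in 0..t, profileDeriv h s ξ := by
  rw [intervalIntegral.integral_eq_sub_of_hasDerivAt_of_le ht.1
    (hh.rapid_profile.continuous_left ξ).continuousOn
    (fun s hs => hh.hasDerivAt_profile ⟨hs.1, hs.2.trans_le ht.2⟩ ξ)
    ((hh.rapid_profileDeriv.continuous_left ξ).intervalIntegrable _ _)]
  simp [profile]

lemma norm_le_amplitude (hh : NLSFam T h) (ht : t ∈ Icc 0 T) (htT' : t ≤ T') (ξ : E3) :
    ‖h t ξ‖ ≤ ‖h 0 ξ‖ + ∫ s in 0..T', ‖cubicConv (h s) ξ‖ := by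
  rw [← norm_profile, hh.profile_sub_eq ht]
  refine (norm_add_le _ _).trans (add_le_add le_rfl ?_)
  refine (intervalIntegral.norm_integral_le_integral_norm ht.1).trans ?_
  simp only [norm_profileDeriv]
  exact intervalIntegral.integral_mono_interval le_rfl ht.1 htT' (.of_forall fun _ => norm_nonneg _)
    ((hh.rapid.cubicConv.continuous_left ξ).norm.intervalIntegrable _ _)

lemma freeEvol_profile (h : ℝ → E3 → ℂ) (t : ℝ) (x : E3) :
    freeEvol (profile h t) t x = 𝓕⁻ (h t) x := by
  rw [fourierInv_eq_integral_phase]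
  refine integral_congr_ae (Filter.Eventually.of_forall fun ξ => ?_)
  simp only [profile, ← mul_assoc, phase, ← Complex.exp_add]
  congr 2
  push_cast
  ring

lemma duhamel (hh : NLSFam T h) (ht : t ∈ Icc 0 T) (x : E3) :
    𝓕⁻ (h t) x = freeEvol (h 0) t x + ∫ s in 0..t, freeEvol (profileDeriv h s) t x := by
  obtain ⟨D, hD0, hD⟩ := hh.rapid_profileDeriv.norm_le
  have hg := hh.rapid_profileDeriv
  have hi : ∀ f : E3 → ℂ, Integrable f → Integrable fun ξ => phase t x ξ * f ξ := fun f hf =>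
    hf.bdd_mul (continuous_phase_right t x).aestronglyMeasurable (c := 1)
      (Filter.Eventually.of_forall fun ξ => (norm_phase _ _ _).le)
  have hc : Continuous fun q : ℝ × E3 => phase t x q.2 * profileDeriv h q.1 q.2 :=
    ((continuous_phase_right t x).comp continuous_snd).mul hg.cont
  have hprod : Integrable (Function.uncurry fun (s : ℝ) (ξ : E3) =>
      phase t x ξ * profileDeriv h s ξ) ((volume.restrict (Set.uIoc 0 t)).prod volume) := by
    refine (integrable_uncurry_of_le_mul_polyWeight t (g := fun s ξ => ‖profileDeriv h s ξ‖)
      (D := D) hg.cont.norm fun s ξ => ?_).mono' hc.aestronglyMeasurable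
      (Filter.Eventually.of_forall fun q => ?_)
    · rw [norm_norm]; exact hD s ξ
    · simp [Function.uncurry, norm_phase]
  rw [← freeEvol_profile]
  unfold freeEvol
  rw [intervalIntegral_integral_swap hprod, ← integral_add (hi _ (hh.rapid.integrable 0))]
  · refine integral_congr_ae (Filter.Eventually.of_forall fun ξ => ?_)
    simp only
    rw [hh.profile_sub_eq ht, intervalIntegral.integral_const_mul]
    ring
  · have := hi _ ((hh.rapid_profile.integrable t).sub (hh.rapid.integrable 0))
    refine this.congr (Filter.Eventually.of_forall fun ξ => ?_)
    simp only [Pi.sub_apply]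
    rw [hh.profile_sub_eq ht, intervalIntegral.integral_const_mul]
    ring

lemma supNorm_le (hh : NLSFam T h) (ht : t ∈ Icc 0 T) (htT' : t ≤ T') :
    (⨆ x, ‖𝓕⁻ (h t) x‖ₑ) ≤ supNorm (freeEvol (h 0)) t +
      ∫⁻ s in Icc 0 T', supNorm (freeEvol (profileDeriv h s)) t := by
  refine iSup_le fun x => ?_
  rw [hh.duhamel ht]
  refine (enorm_add_le _ _).trans (add_le_add (le_iSup (fun x => ‖freeEvol (h 0) t x‖ₑ) x) ?_)
  rw [intervalIntegral.integral_of_le ht.1]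
  refine (enorm_integral_le_lintegral_enorm _).trans ?_
  refine (lintegral_mono fun s =>
    le_iSup (fun x => ‖freeEvol (profileDeriv h s) t x‖ₑ) x).trans ?_
  exact lintegral_mono_set (Ioc_subset_Icc_self.trans (Icc_subset_Icc_right htT'))

end NLSFam

lemma ENNReal.add_sq_le_two_mul (a b : ENNReal) : (a + b) ^ 2 ≤ 2 * a ^ 2 + 2 * b ^ 2 := by
  have := ENNReal.rpow_add_le_mul_rpow_add_rpow a b (p := 2) one_le_two
  norm_num at this
  rwa [mul_add] at this

/-- The square of the `L²` norm weighted by `m ξ * ‖ξ‖`. -/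
def weightSq (m : E3 → ℝ) (f : E3 → ℂ) : ENNReal :=
  ∫⁻ ξ, ENNReal.ofReal ((m ξ * ‖ξ‖) ^ 2) * ‖f ξ‖ₑ ^ 2

/-- The real-valued `L²` norm weighted by `m ξ * ‖ξ‖`. -/
def weightNorm (m : E3 → ℝ) (f : E3 → ℂ) : ℝ :=
  Real.sqrt (∫ ξ, ‖((m ξ * ‖ξ‖ : ℝ) : ℂ) * f ξ‖ ^ 2)

lemma weightNorm_nonneg (m : E3 → ℝ) (f : E3 → ℂ) : 0 ≤ weightNorm m f := Real.sqrt_nonneg _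

/-- A majorant, uniform on the time interval `[0, T]`, of a solution on the Fourier side. -/
def amplitude (h : ℝ → E3 → ℂ) (T : ℝ) (ξ : E3) : ℝ :=
  ‖h 0 ξ‖ + ∫ s in 0..T, ‖cubicConv (h s) ξ‖

namespace GoodMult

variable {s N : ℝ} {m : E3 → ℝ} {w : ℝ → E3 → ℂ}

lemma rapid_weight (hm : GoodMult s N m) (hw : RapidFam w) :
    RapidFam fun t ξ => ((m ξ * ‖ξ‖ : ℝ) : ℂ) * w t ξ := by
  have := hm.cont
  refine hw.mul_left (b := fun _ ξ => ((m ξ * ‖ξ‖ : ℝ) : ℂ)) (by fun_prop) (K := 1) (j := 1)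
    fun t ξ => ?_
  rw [norm_real, Real.norm_of_nonneg (mul_nonneg (hm.pos ξ).le (norm_nonneg _))]
  have := hm.le_one ξ
  nlinarith [norm_nonneg ξ]

lemma continuous_weightNorm (hm : GoodMult s N m) (hw : RapidFam w) :
    Continuous fun t => weightNorm m (w t) :=
  (hm.rapid_weight hw).continuous_integral_sq.sqrt

lemma ofReal_weightNorm_sq (hm : GoodMult s N m) (hw : RapidFam w) (t : ℝ) :
    ENNReal.ofReal (weightNorm m (w t)) ^ 2 = weightSq m (w t) := by
  rw [← ENNReal.ofReal_pow (weightNorm_nonneg _ _), weightNorm,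
    Real.sq_sqrt (integral_nonneg fun ξ => sq_nonneg _), (hm.rapid_weight hw).ofReal_integral_sq,
    weightSq]
  refine lintegral_congr fun ξ => ?_
  have := mul_nonneg (hm.pos ξ).le (norm_nonneg ξ)
  rw [enorm_mul, mul_pow, ENNReal.ofReal_pow this, ← ofReal_norm, norm_real,
    Real.norm_of_nonneg this]

end GoodMult

namespace NLSFam

variable {s N T T' t : ℝ} {m : E3 → ℝ} {h : ℝ → E3 → ℂ}

lemma continuous_integral_cubicConv (hh : NLSFam T h) (T' : ℝ) :
    Continuous fun ξ => ∫ s in 0..T', ‖cubicConv (h s) ξ‖ := by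
  have hc := hh.rapid.cubicConv.cont.norm
  exact intervalIntegral.continuous_parametric_intervalIntegral_of_continuous'
    (f := fun ξ s => ‖cubicConv (h s) ξ‖)
    (hc.comp (f := fun q : E3 × ℝ => (q.2, q.1)) (by fun_prop)) 0 T'

lemma continuous_amplitude (hh : NLSFam T h) (T' : ℝ) : Continuous (amplitude h T') :=
  (hh.rapid.continuous_right 0).norm.add (hh.continuous_integral_cubicConv T')

lemma ofReal_integral_cubicConv (hh : NLSFam T h) (hT' : 0 ≤ T') (ξ : E3) :
    ENNReal.ofReal (∫ s in 0..T', ‖cubicConv (h s) ξ‖) =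
      ∫⁻ s in Icc 0 T', ‖cubicConv (h s) ξ‖ₑ := by
  have hc := (hh.rapid.cubicConv.continuous_left ξ).norm
  rw [intervalIntegral.integral_of_le hT', ofReal_integral_eq_lintegral_ofReal
    (hc.integrableOn_Ioc) (Filter.Eventually.of_forall fun s => norm_nonneg _),
    setLIntegral_congr (Ioc_ae_eq_Icc (a := 0) (b := T'))]
  simp only [ofReal_norm]

lemma ofReal_integral_weightNorm (hh : NLSFam T h) (hm : GoodMult s N m) (hT' : 0 ≤ T') :
    ENNReal.ofReal (∫ s in 0..T', weightNorm m (cubicConv (h s))) =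
      ∫⁻ s in Icc 0 T', ENNReal.ofReal (weightNorm m (cubicConv (h s))) := by
  rw [intervalIntegral.integral_of_le hT', ofReal_integral_eq_lintegral_ofReal
    (hm.continuous_weightNorm hh.rapid.cubicConv).integrableOn_Ioc
    (Filter.Eventually.of_forall fun s => weightNorm_nonneg _ _),
    setLIntegral_congr (Ioc_ae_eq_Icc (a := 0) (b := T'))]

lemma amplitude_sq_le (hh : NLSFam T h) (hm : GoodMult s N m) (hT' : 0 ≤ T') :
    ∫⁻ ξ, ENNReal.ofReal ((m ξ * ‖ξ‖) ^ 2) * ENNReal.ofReal (amplitude h T' ξ) ^ 2 ≤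
      2 * weightSq m (h 0) +
        2 * ENNReal.ofReal (∫ s in 0..T', weightNorm m (cubicConv (h s))) ^ 2 := by
  have hF := hh.rapid.cubicConv
  have hmc := hm.cont
  have hcF := hF.cont
  have hc0 := hh.rapid.continuous_right 0
  have hθ : Measurable fun ξ : E3 => ENNReal.ofReal (m ξ * ‖ξ‖) :=
    Measurable.ennreal_ofReal (f := fun ξ : E3 => m ξ * ‖ξ‖) (by fun_prop)
  have hG : Measurable (Function.uncurry fun (s : ℝ) (ξ : E3) =>
      ENNReal.ofReal (m ξ * ‖ξ‖) * ‖cubicConv (h s) ξ‖ₑ) :=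
    (hθ.comp measurable_snd).mul hcF.enorm.measurable
  have h1 := sq_lintegral_lintegral_le (μ := volume.restrict (Icc 0 T')) (ν := volume)
    hG (n := fun s => ENNReal.ofReal (weightNorm m (cubicConv (h s))))
    (hm.continuous_weightNorm hF).measurable.ennreal_ofReal fun s => by
      rw [hm.ofReal_weightNorm_sq hF, weightSq]
      refine lintegral_mono fun ξ => le_of_eq ?_
      rw [mul_pow, ENNReal.ofReal_pow (mul_nonneg (hm.pos ξ).le (norm_nonneg _))]
  rw [hh.ofReal_integral_weightNorm hm hT']
  refine le_trans ?_ (add_le_add le_rfl (mul_le_mul_right h1 2))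
  rw [weightSq, ← lintegral_const_mul' _ _ (by simp), ← lintegral_const_mul' _ _ (by simp),
    ← lintegral_add_left]
  · refine lintegral_mono fun ξ => ?_
    have hn : 0 ≤ ∫ s in 0..T', ‖cubicConv (h s) ξ‖ :=
      intervalIntegral.integral_nonneg hT' fun _ _ => norm_nonneg _
    rw [lintegral_const_mul' _ _ ENNReal.ofReal_ne_top, ← hh.ofReal_integral_cubicConv hT',
      amplitude, ENNReal.ofReal_add (norm_nonneg _) hn, ofReal_norm]
    refine (mul_le_mul_right (ENNReal.add_sq_le_two_mul _ _) _).trans (le_of_eq ?_)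
    rw [ENNReal.ofReal_pow (mul_nonneg (hm.pos ξ).le (norm_nonneg _))]
    ring
  · exact measurable_const.mul ((Measurable.ennreal_ofReal
      (f := fun ξ : E3 => (m ξ * ‖ξ‖) ^ 2) (by fun_prop)).mul (hc0.enorm.measurable.pow_const 2))

end NLSFam

/-- The endpoint Strichartz-type bound with constant `C` on unit time intervals. -/
def SupNormBound (C : ℝ) : Prop :=
  ∀ N ≥ (1:ℝ), ∀ T > (0:ℝ), T ≤ 1 → ∀ f : E3 → ℂ, Integrable f →
    ∫⁻ t in Icc 0 T, supNorm (freeEvol f) t ^ 2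
      ≤ ENNReal.ofReal (C * T ^ (1/3 : ℝ)) *
        ∫⁻ ξ, ENNReal.ofReal (refSymb N ξ ^ 2) * ‖f ξ‖ₑ ^ 2

lemma SupNormBound.le_weightSq {C s N T : ℝ} {m : E3 → ℝ} (H : SupNormBound C) (hC : 0 < C)
    (hs : 5 / 6 < s) (hs1 : s < 1) (hN : 1 ≤ N) (hm : GoodMult s N m) (hT : 0 < T) (hT1 : T ≤ 1)
    {f : E3 → ℂ} (hf : Integrable f) :
    ∫⁻ t in Icc 0 T, supNorm (freeEvol f) t ^ 2
      ≤ ENNReal.ofReal (4 * C * T ^ (1/3 : ℝ)) * weightSq m f := by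
  refine (H N hN T hT hT1 f hf).trans ?_
  have hp : 0 ≤ C * T ^ (1/3 : ℝ) := by positivity
  rw [show 4 * C * T ^ (1/3 : ℝ) = (C * T ^ (1/3 : ℝ)) * 4 by ring,
    ENNReal.ofReal_mul (p := C * T ^ (1/3 : ℝ)) hp, mul_assoc, weightSq]
  refine mul_le_mul_right ?_ _
  rw [← lintegral_const_mul' _ _ ENNReal.ofReal_ne_top]
  refine lintegral_mono fun ξ => ?_
  rw [← mul_assoc, ← ENNReal.ofReal_mul (by norm_num)]
  refine mul_le_mul_left (ENNReal.ofReal_le_ofReal ?_) _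
  have h1 := hm.refSymb_le hs hs1 hN ξ
  have h2 := refSymb_nonneg (N := N) (by linarith) ξ
  nlinarith

namespace NLSFam

variable {C s N T T' t : ℝ} {m : E3 → ℝ} {h : ℝ → E3 → ℂ}

lemma lintegral_supNorm_sq_le (hh : NLSFam T h) (H : SupNormBound C) (hC : 0 < C)
    (hs : 5 / 6 < s) (hs1 : s < 1) (hN : 1 ≤ N) (hm : GoodMult s N m) (hT' : 0 < T')
    (hT'1 : T' ≤ 1) (hTT : T' ≤ T) (h0 : weightSq m (h 0) ≤ 1) :
    ∫⁻ t in Icc 0 T', (⨆ x, ‖𝓕⁻ (h t) x‖ₑ) ^ 2 ≤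
      ENNReal.ofReal (8 * C * T' ^ (1/3 : ℝ) *
        (1 + (∫ s in 0..T', weightNorm m (cubicConv (h s))) ^ 2)) := by
  set B := ∫ s in 0..T', weightNorm m (cubicConv (h s)) with hBdef
  have hB : 0 ≤ B := intervalIntegral.integral_nonneg hT'.le fun _ _ => weightNorm_nonneg _ _
  set K := 4 * C * T' ^ (1/3 : ℝ) with hK
  have hK0 : 0 ≤ K := by positivity
  have hF := hh.rapid.cubicConv
  have hP := hh.rapid_profileDeriv
  have hmeas := hP.measurable_supNorm_freeEvol
  have h1 := sq_lintegral_lintegral_le (μ := volume.restrict (Icc 0 T'))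
    (ν := volume.restrict (Icc 0 T'))
    (G := fun s t => supNorm (freeEvol (profileDeriv h s)) t) hmeas
    (n := fun s => ENNReal.ofReal (Real.sqrt K) *
      ENNReal.ofReal (weightNorm m (cubicConv (h s))))
    ((hm.continuous_weightNorm hF).measurable.ennreal_ofReal.const_mul _) fun s => by
      refine (H.le_weightSq hC hs hs1 hN hm hT' hT'1 (hP.integrable s)).trans (le_of_eq ?_)
      rw [mul_pow, hm.ofReal_weightNorm_sq hF, ← ENNReal.ofReal_pow (Real.sqrt_nonneg _),
        Real.sq_sqrt hK0]
      congr 1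
      unfold weightSq
      refine lintegral_congr fun ξ => ?_
      rw [← ofReal_norm, norm_profileDeriv, ofReal_norm]
  rw [lintegral_const_mul' _ _ ENNReal.ofReal_ne_top, ← hh.ofReal_integral_weightNorm hm hT'.le,
    ← hBdef, mul_pow, ← ENNReal.ofReal_pow (Real.sqrt_nonneg _), Real.sq_sqrt hK0,
    ← ENNReal.ofReal_pow hB] at h1
  have h2 := H.le_weightSq hC hs hs1 hN hm hT' hT'1 (hh.rapid.integrable 0)
  calc ∫⁻ t in Icc 0 T', (⨆ x, ‖𝓕⁻ (h t) x‖ₑ) ^ 2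
      ≤ ∫⁻ t in Icc 0 T', (2 * supNorm (freeEvol (h 0)) t ^ 2 +
          2 * (∫⁻ s in Icc 0 T', supNorm (freeEvol (profileDeriv h s)) t) ^ 2) := by
        refine setLIntegral_mono' measurableSet_Icc fun t ht => ?_
        exact (pow_le_pow_left' (hh.supNorm_le ⟨ht.1, ht.2.trans hTT⟩ ht.2) 2).trans
          (ENNReal.add_sq_le_two_mul _ _)
    _ = 2 * (∫⁻ t in Icc 0 T', supNorm (freeEvol (h 0)) t ^ 2) +
          2 * ∫⁻ t in Icc 0 T', (∫⁻ s in Icc 0 T', supNorm (freeEvol (profileDeriv h s)) t) ^ 2 := by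
        have hm0 : Measurable fun t => supNorm (freeEvol (h 0)) t :=
          measurable_supNorm (continuous_freeEvol (hh.rapid.integrable 0))
        rw [lintegral_add_left ((hm0.pow_const 2).const_mul 2),
          lintegral_const_mul' _ _ (by simp), lintegral_const_mul' _ _ (by simp)]
    _ ≤ 2 * (ENNReal.ofReal K * 1) + 2 * (ENNReal.ofReal K * ENNReal.ofReal (B ^ 2)) :=
        add_le_add (mul_le_mul_right (h2.trans (mul_le_mul_right h0 _)) _)
          (mul_le_mul_right h1 _)
    _ = ENNReal.ofReal (8 * C * T' ^ (1/3 : ℝ) * (1 + B ^ 2)) := by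
        rw [show 8 * C * T' ^ (1/3 : ℝ) * (1 + B ^ 2) = 2 * (K * 1) + 2 * (K * B ^ 2) by
          rw [hK]; ring, ENNReal.ofReal_add (by positivity) (by positivity),
          ENNReal.ofReal_mul (p := 2) (by norm_num), ENNReal.ofReal_mul (p := 2) (by norm_num),
          ENNReal.ofReal_mul (p := K) hK0, ENNReal.ofReal_mul (p := K) hK0]
        simp

lemma weightSq_le (hh : NLSFam T h) (hm : GoodMult s N m) (hT' : 0 ≤ T')
    (ht : t ∈ Icc 0 T) (htT' : t ≤ T') (h0 : weightSq m (h 0) ≤ 1) :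
    weightSq m (h t) ≤
      ENNReal.ofReal (2 * (1 + ∫ s in 0..T', weightNorm m (cubicConv (h s)))) ^ 2 := by
  set B := ∫ s in 0..T', weightNorm m (cubicConv (h s)) with hBdef
  have hB : 0 ≤ B := intervalIntegral.integral_nonneg hT' fun _ _ => weightNorm_nonneg _ _
  calc weightSq m (h t)
      ≤ ∫⁻ ξ, ENNReal.ofReal ((m ξ * ‖ξ‖) ^ 2) * ENNReal.ofReal (amplitude h T' ξ) ^ 2 := by
        refine lintegral_mono fun ξ => mul_le_mul_right (pow_le_pow_left' ?_ 2) _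
        rw [← ofReal_norm]
        exact ENNReal.ofReal_le_ofReal (hh.norm_le_amplitude ht htT' ξ)
    _ ≤ 2 * weightSq m (h 0) + 2 * ENNReal.ofReal B ^ 2 := hh.amplitude_sq_le hm hT'
    _ ≤ 2 * 1 + 2 * ENNReal.ofReal B ^ 2 := add_le_add (mul_le_mul_right h0 _) le_rfl
    _ = ENNReal.ofReal (2 + 2 * B ^ 2) := by
        rw [ENNReal.ofReal_add (by positivity) (by positivity),
          ENNReal.ofReal_mul (p := 2) (by norm_num), ENNReal.ofReal_pow hB]
        simp
    _ ≤ ENNReal.ofReal (2 * (1 + B)) ^ 2 := by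
        rw [← ENNReal.ofReal_pow (by positivity)]
        exact ENNReal.ofReal_le_ofReal (by nlinarith)

lemma weightNorm_cubicConv_le (hh : NLSFam T h) (hs : 5 / 6 < s) (hs1 : s < 1) (hN : 1 ≤ N)
    (hm : GoodMult s N m) (hT' : 0 ≤ T')
    (ht : t ∈ Icc 0 T) (htT' : t ≤ T') (h0 : weightSq m (h 0) ≤ 1) :
    ENNReal.ofReal (weightNorm m (cubicConv (h t))) ≤
      100 * (⨆ x, ‖𝓕⁻ (h t) x‖ₑ) ^ 2 *
        ENNReal.ofReal (2 * (1 + ∫ s in 0..T', weightNorm m (cubicConv (h s)))) := by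
  refine (ENNReal.pow_le_pow_left_iff two_ne_zero).1 ?_
  rw [hm.ofReal_weightNorm_sq hh.rapid.cubicConv]
  refine (hh.rapid.lintegral_weight_cubicConv_le hs hs1 (by linarith) hm t).trans ?_
  refine (mul_le_mul_right (hh.weightSq_le hm hT' ht htT' h0) _).trans (le_of_eq ?_)
  ring

lemma integral_weightNorm_le (hh : NLSFam T h) (H : SupNormBound C) (hC : 0 < C)
    (hs : 5 / 6 < s) (hs1 : s < 1) (hN : 1 ≤ N) (hm : GoodMult s N m) (hT' : 0 < T')
    (hT'1 : T' ≤ 1) (hTT : T' ≤ T) (h0 : weightSq m (h 0) ≤ 1) {B : ℝ}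
    (hBdef : B = ∫ s in 0..T', weightNorm m (cubicConv (h s))) :
    B ≤ 1600 * C * T' ^ (1/3 : ℝ) * (1 + B) * (1 + B ^ 2) := by
  have hB : 0 ≤ B := by
    rw [hBdef]
    exact intervalIntegral.integral_nonneg hT'.le fun _ _ => weightNorm_nonneg _ _
  have hK0 : 0 ≤ 8 * C * T' ^ (1/3 : ℝ) := by positivity
  have h1 := hh.lintegral_supNorm_sq_le H hC hs hs1 hN hm hT' hT'1 hTT h0
  rw [← hBdef] at h1
  refine (ENNReal.ofReal_le_ofReal_iff (by positivity)).1 ?_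
  calc ENNReal.ofReal B
      = ∫⁻ s in Icc 0 T', ENNReal.ofReal (weightNorm m (cubicConv (h s))) := by
        rw [hBdef, hh.ofReal_integral_weightNorm hm hT'.le]
    _ ≤ ∫⁻ t in Icc 0 T', 100 * (⨆ x, ‖𝓕⁻ (h t) x‖ₑ) ^ 2 * ENNReal.ofReal (2 * (1 + B)) := by
        refine setLIntegral_mono' measurableSet_Icc fun t ht => ?_
        rw [hBdef]
        exact hh.weightNorm_cubicConv_le hs hs1 hN hm hT'.le ⟨ht.1, ht.2.trans hTT⟩ ht.2 h0
    _ = 100 * (∫⁻ t in Icc 0 T', (⨆ x, ‖𝓕⁻ (h t) x‖ₑ) ^ 2) * ENNReal.ofReal (2 * (1 + B)) := by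
        rw [lintegral_mul_const' _ _ ENNReal.ofReal_ne_top, lintegral_const_mul' _ _ (by simp)]
    _ ≤ 100 * ENNReal.ofReal (8 * C * T' ^ (1/3 : ℝ) * (1 + B ^ 2)) *
          ENNReal.ofReal (2 * (1 + B)) := by gcongr
    _ = ENNReal.ofReal (1600 * C * T' ^ (1/3 : ℝ) * (1 + B) * (1 + B ^ 2)) := by
        rw [show (100 : ENNReal) = ENNReal.ofReal 100 by simp, ← ENNReal.ofReal_mul (by norm_num),
          ← ENNReal.ofReal_mul (by positivity)]
        congr 1
        ring

lemma integral_weightNorm_le_one (hh : NLSFam T h) (H : SupNormBound C) (hC : 0 < C)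
    (hs : 5 / 6 < s) (hs1 : s < 1) (hN : 1 ≤ N) (hm : GoodMult s N m) (hT : 0 < T)
    (hT1 : T ≤ 1) (hCT : 12800 * C * T ^ (1/3 : ℝ) < 1) (h0 : weightSq m (h 0) ≤ 1) :
    ∫ s in 0..T, weightNorm m (cubicConv (h s)) ≤ 1 := by
  have hc := hm.continuous_weightNorm hh.rapid.cubicConv
  by_contra! hlt
  have hcB : Continuous fun t => ∫ s in 0..t, weightNorm m (cubicConv (h s)) :=
    intervalIntegral.continuous_primitive (fun a b => hc.intervalIntegrable a b) 0
  obtain ⟨t, ht, hBt⟩ := intermediate_value_Icc hT.le hcB.continuousOn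
    (show (1:ℝ) ∈ Icc _ _ from ⟨by simp, hlt.le⟩)
  have ht0 : 0 < t := by
    rcases ht.1.eq_or_lt with h | h
    · rw [← h] at hBt; simp at hBt
    · exact h
  have := hh.integral_weightNorm_le H hC hs hs1 hN hm ht0 (ht.2.trans hT1) ht.2 h0 hBt.symm
  have h2 : t ^ (1/3 : ℝ) ≤ T ^ (1/3 : ℝ) := Real.rpow_le_rpow ht0.le ht.2 (by norm_num)
  have h3 : C * t ^ (1/3 : ℝ) ≤ C * T ^ (1/3 : ℝ) := mul_le_mul_of_nonneg_left h2 hC.le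
  nlinarith

end NLSFam

/-- Local theory on a time interval of absolute length. -/
theorem exists_amplitude_bound :
    ∃ δ : ℝ, 0 < δ ∧ δ ≤ 1 ∧ ∀ s N : ℝ, 5 / 6 < s → s < 1 → 1 ≤ N → ∀ m : E3 → ℝ,
      GoodMult s N m → ∀ h : ℝ → E3 → ℂ, NLSFam δ h → weightSq m (h 0) ≤ 1 →
        ∫⁻ ξ, ENNReal.ofReal ((m ξ * ‖ξ‖) ^ 2) * ENNReal.ofReal (amplitude h δ ξ) ^ 2 ≤ 4 := by
  obtain ⟨C, hC, H⟩ := lintegral_supNorm_freeEvol_le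
  have hd : 0 < (12801 * C + 1)⁻¹ := by positivity
  have hd1 : (12801 * C + 1)⁻¹ ≤ 1 := inv_le_one_of_one_le₀ (by linarith)
  have hroot : (((12801 * C + 1)⁻¹) ^ 3) ^ (1/3 : ℝ) = (12801 * C + 1)⁻¹ := by
    rw [← Real.rpow_natCast, ← Real.rpow_mul hd.le]
    norm_num
  refine ⟨((12801 * C + 1)⁻¹) ^ 3, by positivity, pow_le_one₀ hd.le hd1,
    fun s N hs hs1 hN m hm h hh h0 => ?_⟩
  have hCT : 12800 * C * (((12801 * C + 1)⁻¹) ^ 3) ^ (1/3 : ℝ) < 1 := by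
    rw [hroot, ← div_eq_mul_inv, div_lt_one (by positivity)]
    linarith
  have hB := hh.integral_weightNorm_le_one (C := C) H hC hs hs1 hN hm (by positivity)
    (pow_le_one₀ hd.le hd1) hCT h0
  refine (hh.amplitude_sq_le hm (by positivity)).trans ?_
  calc _ ≤ 2 * (1 : ENNReal) + 2 * ENNReal.ofReal 1 ^ 2 := by gcongr
    _ = 4 := by norm_num

/-- The symbol of the commutator of `m` with the cubic nonlinearity. -/
def commSymb (m : E3 → ℝ) (ξ α β γ : E3) : ℝ := m α * m β * m γ - m ξ

lemma abs_commSymb_le_one {m : E3 → ℝ} (hm0 : ∀ ξ, 0 < m ξ) (hm1 : ∀ ξ, m ξ ≤ 1) (ξ α β γ : E3) :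
    |commSymb m ξ α β γ| ≤ 1 := by
  have h1 : m α * m β * m γ ≤ 1 :=
    mul_le_one₀ (mul_le_one₀ (hm1 α) (hm0 β).le (hm1 β)) (hm0 γ).le (hm1 γ)
  have h2 : 0 < m α * m β * m γ := mul_pos (mul_pos (hm0 α) (hm0 β)) (hm0 γ)
  have h3 := hm0 ξ
  have h4 := hm1 ξ
  rw [commSymb, abs_le]
  constructor <;> linarith

namespace RapidFam

variable {w k : ℝ → E3 → ℂ} {m : E3 → ℝ}

lemma cubicConv_mul_sub (hw : RapidFam w) (hm : Continuous m) (hm0 : ∀ ξ, 0 < m ξ)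
    (hm1 : ∀ ξ, m ξ ≤ 1) (t : ℝ) (ξ : E3) :
    _root_.cubicConv (fun η => (m η : ℂ) * w t η) ξ - m ξ * _root_.cubicConv (w t) ξ =
      ∫ z : E3 × E3, (commSymb m ξ z.1 z.2 (ξ - z.1 + z.2) : ℂ) *
        (w t z.1 * starRingEnd ℂ (w t z.2) * w t (ξ - z.1 + z.2)) := by
  obtain ⟨D, hD0, hD⟩ := hw.triple_le 0
  have hi : Integrable fun z : E3 × E3 =>
      w t z.1 * starRingEnd ℂ (w t z.2) * w t (ξ - z.1 + z.2) := by
    refine (integrable_polyWeight_prod.const_mul D).mono' (hw.continuous_triple.comp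
      (Continuous.prodMk_right ((t, ξ) : ℝ × E3))).aestronglyMeasurable
      (Filter.Eventually.of_forall fun z => ?_)
    simpa using hD t ξ z.1 z.2
  have hb : ∀ z : E3 × E3, ‖((m z.1 * m z.2 * m (ξ - z.1 + z.2) : ℝ) : ℂ)‖ ≤ 1 := fun z => by
    rw [norm_real, Real.norm_of_nonneg
      (mul_pos (mul_pos (hm0 _) (hm0 _)) (hm0 _)).le]
    exact mul_le_one₀ (mul_le_one₀ (hm1 _) (hm0 _).le (hm1 _)) (hm0 _).le (hm1 _)
  have hi2 : Integrable fun z : E3 × E3 => ((m z.1 * m z.2 * m (ξ - z.1 + z.2) : ℝ) : ℂ) *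
      (w t z.1 * starRingEnd ℂ (w t z.2) * w t (ξ - z.1 + z.2)) :=
    hi.bdd_mul (Continuous.aestronglyMeasurable (by fun_prop)) (c := 1)
      (Filter.Eventually.of_forall hb)
  unfold _root_.cubicConv
  rw [← integral_const_mul]
  refine Eq.trans ?_ ((integral_sub hi2 (hi.const_mul (m ξ : ℂ))).symm.trans ?_)
  · congr 1
    refine integral_congr_ae (Filter.Eventually.of_forall fun z => ?_)
    simp only [map_mul, conj_ofReal]
    push_cast
    ring
  · refine integral_congr_ae (Filter.Eventually.of_forall fun z => ?_)
    simp only [commSymb]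
    push_cast
    ring

lemma abs_integral_re_le (hk : RapidFam k) (hw : RapidFam w) (hm : Continuous m)
    (hm0 : ∀ ξ, 0 < m ξ) (hm1 : ∀ ξ, m ξ ≤ 1) (t : ℝ) :
    ENNReal.ofReal |∫ s in 0..t, (∫ ξ, k s ξ * ∫ z : E3 × E3,
        (commSymb m ξ z.1 z.2 (ξ - z.1 + z.2) : ℂ) *
          (w s z.1 * starRingEnd ℂ (w s z.2) * w s (ξ - z.1 + z.2))).re| ≤
      quadInt fun ξ α β γ => ‖∫ s in 0..t, k s ξ * ((commSymb m ξ α β γ : ℂ) *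
        (w s α * starRingEnd ℂ (w s β) * w s γ))‖ₑ := by
  obtain ⟨D, hD0, hD⟩ := hw.triple_le 0
  obtain ⟨D', hD'0, hD'⟩ := hk.norm_le
  set f : ℝ → E3 × (E3 × E3) → ℂ := fun s q => k s q.1 *
    ((commSymb m q.1 q.2.1 q.2.2 (q.1 - q.2.1 + q.2.2) : ℂ) *
      (w s q.2.1 * starRingEnd ℂ (w s q.2.2) * w s (q.1 - q.2.1 + q.2.2))) with hf
  have hcf : Continuous fun p : ℝ × (E3 × (E3 × E3)) => f p.1 p.2 := by
    refine Continuous.mul ?_ (Continuous.mul ?_ ?_)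
    · exact hk.cont.comp (f := fun p : ℝ × (E3 × (E3 × E3)) => (p.1, p.2.1)) (by fun_prop)
    · unfold commSymb; fun_prop
    · exact hw.continuous_triple.comp
        (f := fun p : ℝ × (E3 × (E3 × E3)) => ((p.1, p.2.1), p.2.2)) (by fun_prop)
  set W : E3 × (E3 × E3) → ℝ := fun q =>
    D' * D * (polyWeight q.1 * (polyWeight q.2.1 * polyWeight q.2.2)) with hW
  have hWi : Integrable W :=
    (integrable_polyWeight.mul_prod integrable_polyWeight_prod).const_mul _
  have hfW : ∀ s q, ‖f s q‖ ≤ W q := fun s q => by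
    have h1 := hD s q.1 q.2.1 q.2.2
    rw [pow_zero, mul_one] at h1
    have h2 := hD' s q.1
    have h3 := abs_commSymb_le_one hm0 hm1 q.1 q.2.1 q.2.2 (q.1 - q.2.1 + q.2.2)
    simp only [hf, norm_mul, RCLike.norm_conj, norm_real, Real.norm_eq_abs]
    calc _ ≤ (D' * polyWeight q.1) * (1 * (D * (polyWeight q.2.1 * polyWeight q.2.2))) := by
          gcongr
          exact mul_nonneg hD'0.le (polyWeight_pos _).le
      _ = W q := by simp only [hW]; ring
  have hfi : ∀ s, Integrable (f s) := fun s =>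
    hWi.mono' (hcf.comp (Continuous.prodMk_right s)).aestronglyMeasurable
      (Filter.Eventually.of_forall (hfW s))
  have h1 : Integrable (fun _ : ℝ => (1 : ℝ)) (volume.restrict (Set.uIoc 0 t)) := by
    rw [← IntegrableOn, ← intervalIntegrable_iff]
    exact intervalIntegrable_const
  have hprod : Integrable (Function.uncurry f)
      ((volume.restrict (Set.uIoc 0 t)).prod volume) := by
    refine (h1.mul_prod hWi).mono' hcf.aestronglyMeasurable
      (Filter.Eventually.of_forall fun p => ?_)
    rw [one_mul]
    exact hfW p.1 p.2
  have hinner : ∀ s, (∫ ξ, k s ξ * ∫ z : E3 × E3,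
        (commSymb m ξ z.1 z.2 (ξ - z.1 + z.2) : ℂ) *
          (w s z.1 * starRingEnd ℂ (w s z.2) * w s (ξ - z.1 + z.2))) = ∫ q, f s q := fun s => by
    refine Eq.trans ?_ (integral_prod (μ := volume) (ν := volume) (f s) (hfi s)).symm
    simp only [hf, integral_const_mul]
  have hint : IntervalIntegrable (fun s => ∫ q, f s q) volume 0 t := by
    rw [intervalIntegrable_iff]
    exact hprod.integral_prod_left
  have hcI : Continuous fun q => ∫ s in 0..t, f s q :=
    intervalIntegral.continuous_parametric_intervalIntegral_of_continuous'
      (f := fun q s => f s q)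
      (hcf.comp (f := fun p : (E3 × (E3 × E3)) × ℝ => (p.2, p.1)) (by fun_prop)) 0 t
  have hre : (∫ s in 0..t, (∫ q, f s q).re) = (∫ s in 0..t, ∫ q, f s q).re :=
    Complex.reCLM.intervalIntegral_comp_comm hint
  simp only [hinner]
  rw [hre, intervalIntegral_integral_swap hprod]
  calc ENNReal.ofReal |(∫ q, ∫ s in 0..t, f s q).re|
      ≤ ‖∫ q, ∫ s in 0..t, f s q‖ₑ := by
        rw [← ofReal_norm]
        exact ENNReal.ofReal_le_ofReal (Complex.abs_re_le_norm _)
    _ ≤ ∫⁻ q, ‖∫ s in 0..t, f s q‖ₑ := enorm_integral_le_lintegral_enorm _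
    _ = ∫⁻ ξ, ∫⁻ z : E3 × E3, ‖∫ s in 0..t, f s (ξ, z)‖ₑ := by
        rw [Measure.volume_eq_prod, lintegral_prod _ hcI.enorm.aemeasurable]
    _ = _ := by
        unfold quadInt
        refine lintegral_congr fun ξ => ?_
        rw [Measure.volume_eq_prod, lintegral_prod]
        exact (hcI.comp (Continuous.prodMk_right ξ)).enorm.aemeasurable

end RapidFam

lemma quadInt_mono_of_ne_zero {F G : E3 → E3 → E3 → E3 → ENNReal}
    (h : ∀ ξ α β γ, ξ - α + β - γ = 0 → ξ ≠ 0 → α ≠ 0 → β ≠ 0 → γ ≠ 0 → F ξ α β γ ≤ G ξ α β γ) :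
    quadInt F ≤ quadInt G := by
  have h0 := Measure.ae_ne volume (0 : E3)
  refine lintegral_mono_ae (h0.mono fun ξ hξ => lintegral_mono_ae (h0.mono fun α hα => ?_))
  refine lintegral_mono_ae ?_
  filter_upwards [h0, Measure.ae_ne volume (α - ξ)] with β hβ hβ'
  refine h _ _ _ _ (by abel) hξ hα hβ fun hγ => hβ' ?_
  rw [← sub_eq_zero, ← hγ]
  abel

lemma quadInt_domKernel_le {e : ℝ} (he : 0 < e) (he1 : e ≤ 1 / 10) :
    ∃ C > 0, ∀ N : ℝ, 1 ≤ N → ∀ a : E3 → ENNReal, Measurable a →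
      quadInt (fun ξ α β γ => ENNReal.ofReal (domKernel N ξ α β γ) *
        (a ξ * a α * a β * a γ)) ≤ ENNReal.ofReal (C * N ^ (-1 + 6 * e)) * (∫⁻ η, a η ^ 2) ^ 2 := by
  obtain ⟨C₁, hC₁, H₁⟩ := quadInt_topKernel_le (c := 1 / 12) (by norm_num) (by norm_num) he he1
  obtain ⟨C₂, hC₂, H₂⟩ := quadInt_staticKernel_le (c := 1 / 12) (by norm_num) (by norm_num) he he1
  refine ⟨2 * C₁ + C₂, by positivity, fun N hN a ha => ?_⟩
  have hN0 : 0 ≤ N := by linarith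
  have hP : 0 ≤ N ^ (-1 + 6 * e) := Real.rpow_nonneg hN0 _
  have hmono : N ^ (-1 + 2 * e) ≤ N ^ (-1 + 6 * e) :=
    Real.rpow_le_rpow_of_exponent_le hN (by linarith)
  set A : E3 → E3 → E3 → E3 → ENNReal := fun ξ α β γ => a ξ * a α * a β * a γ with hA
  set F : E3 → E3 → E3 → E3 → ENNReal := fun ξ α β γ =>
    ENNReal.ofReal (topKernel (1 / 12) N ξ α β γ) * A ξ α β γ with hF
  set F' : E3 → E3 → E3 → E3 → ENNReal := fun ξ α β γ =>
    ENNReal.ofReal (topKernel (1 / 12) N ξ γ β α) * A ξ α β γ with hF'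
  set S : E3 → E3 → E3 → E3 → ENNReal := fun ξ α β γ =>
    ENNReal.ofReal (staticKernel (1 / 12) N ξ α β γ) * A ξ α β γ with hS
  have hAm : Meas4 A := by unfold Meas4; fun_prop
  have hFm : Meas4 F := by
    refine Measurable.mul (measurable_indicator_kernel (1 / 12) N
      (r := fun ξ α β γ => (refSymb N β)⁻¹ * (refSymb N γ)⁻¹ * (1 + |res4 ξ α β γ|)⁻¹) ?_) hAm
    have := measurable_refSymb N
    have := measurable_res4
    fun_prop
  have hFm' : Meas4 F' := by
    have : Measurable fun p : E3 × E3 × E3 × E3 => F p.1 p.2.2.2 p.2.2.1 p.2.1 :=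
      hFm.comp (by fun_prop) (by fun_prop) (by fun_prop) (by fun_prop)
    refine (congrArg Measurable (funext fun p => ?_)).mp this
    simp only [hF, hF', hA]
    ring
  have hswap : quadInt F' = quadInt F := by
    rw [quadInt_swap_snd_fourth hFm]
    refine quadInt_congr fun ξ α β γ _ => ?_
    simp only [hF, hF', hA]
    ring
  calc quadInt (fun ξ α β γ => ENNReal.ofReal (domKernel N ξ α β γ) * A ξ α β γ)
      = quadInt fun ξ α β γ => F ξ α β γ + (F' ξ α β γ + S ξ α β γ) := by
        refine quadInt_congr fun ξ α β γ _ => ?_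
        simp only [hF, hF', hS, domKernel]
        rw [ENNReal.ofReal_add (add_nonneg (GoodMult.topKernel_nonneg hN0 _ _ _ _)
            (GoodMult.topKernel_nonneg hN0 _ _ _ _)) (GoodMult.staticKernel_nonneg hN0 _ _ _ _),
          ENNReal.ofReal_add (GoodMult.topKernel_nonneg hN0 _ _ _ _)
            (GoodMult.topKernel_nonneg hN0 _ _ _ _)]
        ring
    _ ≤ quadInt F + (quadInt F' + quadInt S) :=
        (quadInt_add hFm).trans (add_le_add le_rfl (quadInt_add hFm'))
    _ ≤ ENNReal.ofReal (C₁ * N ^ (-1 + 6 * e)) * (∫⁻ η, a η ^ 2) ^ 2 +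
          (ENNReal.ofReal (C₁ * N ^ (-1 + 6 * e)) * (∫⁻ η, a η ^ 2) ^ 2 +
            ENNReal.ofReal (C₂ * N ^ (-1 + 6 * e)) * (∫⁻ η, a η ^ 2) ^ 2) := by
        rw [hswap]
        refine add_le_add (H₁ N hN a ha) (add_le_add (H₁ N hN a ha) ((H₂ N hN a ha).trans ?_))
        exact mul_le_mul_left (ENNReal.ofReal_le_ofReal
          (mul_le_mul_of_nonneg_left hmono hC₂.le)) _
    _ = _ := by
        rw [show (2 * C₁ + C₂) * N ^ (-1 + 6 * e) = C₁ * N ^ (-1 + 6 * e) +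
            (C₁ * N ^ (-1 + 6 * e) + C₂ * N ^ (-1 + 6 * e)) by ring,
          ENNReal.ofReal_add (by positivity) (by positivity),
          ENNReal.ofReal_add (by positivity) (by positivity)]
        ring

lemma RapidFam.conj {w : ℝ → E3 → ℂ} (hw : RapidFam w) :
    RapidFam fun t ξ => starRingEnd ℂ (w t ξ) :=
  ⟨Complex.continuous_conj.comp hw.cont, fun k => by simpa using hw.decay k⟩

namespace NLSFam

variable {s N T t : ℝ} {m : E3 → ℝ} {h : ℝ → E3 → ℂ}

lemma bvOn_profile (hh : NLSFam T h) (ξ : E3) :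
    BVOn T (fun s => profile h s ξ) (fun s => profileDeriv h s ξ) (amplitude h T ξ) where
  cont := (hh.rapid_profile.continuous_left ξ).continuousOn
  hasDeriv _ ht := hh.hasDerivAt_profile ht ξ
  cont' := (hh.rapid_profileDeriv.continuous_left ξ).continuousOn
  bound := by simp only [norm_profile, norm_profileDeriv, amplitude, le_refl]

lemma amplitude_nonneg (hh : NLSFam T h) (hT : 0 ≤ T) (ξ : E3) : 0 ≤ amplitude h T ξ :=
  (hh.bvOn_profile ξ).nonneg hT

lemma resonant_integral_le (hh : NLSFam T h) (hT1 : T ≤ 1) (ht : t ∈ Icc 0 T) (ξ α β γ : E3) :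
    (1 + |res4 ξ α β γ|) * ‖∫ s in 0..t, starRingEnd ℂ (h s ξ) *
      (h s α * starRingEnd ℂ (h s β) * h s γ)‖ ≤
    32 * (amplitude h T ξ * amplitude h T α * amplitude h T β * amplitude h T γ) := by
  have hT : 0 ≤ T := ht.1.trans ht.2
  have hbv := ((hh.bvOn_profile ξ).conj.mul hT (hh.bvOn_profile α)).mul hT
    ((hh.bvOn_profile β).conj.mul hT (hh.bvOn_profile γ))
  have hosc := hbv.oscillatory_le hT1 (4 * Real.pi ^ 2 * res4 ξ α β γ) ht
  have heq : ∀ s : ℝ, cexp (((4 * Real.pi ^ 2 * res4 ξ α β γ) * s : ℝ) * I) *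
      (starRingEnd ℂ (profile h s ξ) * profile h s α *
        (starRingEnd ℂ (profile h s β) * profile h s γ)) =
      starRingEnd ℂ (h s ξ) * (h s α * starRingEnd ℂ (h s β) * h s γ) := fun s => by
    have hexp : cexp (((4 * Real.pi ^ 2 * res4 ξ α β γ) * s : ℝ) * I) *
        starRingEnd ℂ (cexp (((4 * Real.pi ^ 2 * s * ‖ξ‖ ^ 2 : ℝ) : ℂ) * I)) *
        cexp (((4 * Real.pi ^ 2 * s * ‖α‖ ^ 2 : ℝ) : ℂ) * I) *
        starRingEnd ℂ (cexp (((4 * Real.pi ^ 2 * s * ‖β‖ ^ 2 : ℝ) : ℂ) * I)) *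
        cexp (((4 * Real.pi ^ 2 * s * ‖γ‖ ^ 2 : ℝ) : ℂ) * I) = 1 := by
      rw [← Complex.exp_conj, ← Complex.exp_conj, ← Complex.exp_add, ← Complex.exp_add,
        ← Complex.exp_add, ← Complex.exp_add, ← Complex.exp_zero]
      congr 1
      simp only [map_mul, conj_ofReal, conj_I, res4]
      push_cast
      ring
    simp only [profile, map_mul]
    linear_combination (starRingEnd ℂ (h s ξ) * (h s α * starRingEnd ℂ (h s β) * h s γ)) * hexp
  simp only [heq] at hosc
  refine (mul_le_mul_of_nonneg_right ?_ (norm_nonneg _)).trans (hosc.trans (le_of_eq (by ring)))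
  rw [abs_mul, abs_of_nonneg (a := 4 * Real.pi ^ 2) (by positivity)]
  have : 1 ≤ 4 * Real.pi ^ 2 := by nlinarith [Real.pi_gt_three]
  nlinarith [abs_nonneg (res4 ξ α β γ)]

lemma sextic_integral_le (hh : NLSFam T h) (ht : t ∈ Icc 0 T) (ξ α β γ : E3) :
    ‖∫ s in 0..t, starRingEnd ℂ (cubicConv (h s) ξ) *
      (h s α * starRingEnd ℂ (h s β) * h s γ)‖ ≤
    amplitude h T ξ * amplitude h T α * amplitude h T β * amplitude h T γ := by
  have hT : 0 ≤ T := ht.1.trans ht.2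
  have hA := hh.amplitude_nonneg hT
  have hcF := (hh.rapid.cubicConv.continuous_left ξ).norm
  have hc := fun η => hh.rapid.continuous_left η
  have hle : ∀ s ∈ Icc 0 t, ∀ η, ‖h s η‖ ≤ amplitude h T η := fun s hs η =>
    hh.norm_le_amplitude ⟨hs.1, hs.2.trans ht.2⟩ (hs.2.trans ht.2) η
  have hcont : Continuous fun s => ‖starRingEnd ℂ (cubicConv (h s) ξ) *
      (h s α * starRingEnd ℂ (h s β) * h s γ)‖ := by
    simp only [norm_mul, RCLike.norm_conj]
    exact hcF.mul (((hc α).norm.mul (hc β).norm).mul (hc γ).norm)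
  calc _ ≤ ∫ s in 0..t, ‖starRingEnd ℂ (cubicConv (h s) ξ) *
          (h s α * starRingEnd ℂ (h s β) * h s γ)‖ :=
        intervalIntegral.norm_integral_le_integral_norm ht.1
    _ ≤ ∫ s in 0..t, ‖cubicConv (h s) ξ‖ *
          (amplitude h T α * amplitude h T β * amplitude h T γ) := by
        refine intervalIntegral.integral_mono_on ht.1 (hcont.intervalIntegrable _ _)
          ((hcF.mul continuous_const).intervalIntegrable _ _) fun s hs => ?_
        simp only [norm_mul, RCLike.norm_conj]
        refine mul_le_mul_of_nonneg_left ?_ (norm_nonneg _)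
        exact mul_le_mul (mul_le_mul (hle s hs α) (hle s hs β) (norm_nonneg _) (hA α))
          (hle s hs γ) (norm_nonneg _) (mul_nonneg (hA α) (hA β))
    _ ≤ amplitude h T ξ * (amplitude h T α * amplitude h T β * amplitude h T γ) := by
        rw [intervalIntegral.integral_mul_const]
        refine mul_le_mul_of_nonneg_right ?_ (mul_nonneg (mul_nonneg (hA α) (hA β)) (hA γ))
        have := intervalIntegral.integral_mono_interval (μ := volume)
          (f := fun s => ‖cubicConv (h s) ξ‖) le_rfl ht.1 ht.2
          (.of_forall fun _ => norm_nonneg _) (hcF.intervalIntegrable _ _)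
        rw [amplitude]
        linarith [norm_nonneg (h 0 ξ)]
    _ = _ := by ring

lemma increment_kernel_le (hh : NLSFam T h) (hT1 : T ≤ 1) (ht : t ∈ Icc 0 T) (hs : 5 / 6 < s)
    (hs1 : s < 1) (hN : 1 ≤ N) (hm : GoodMult s N m) {ξ α β γ : E3} (h0 : ξ - α + β - γ = 0)
    (hξ : ξ ≠ 0) (hα : α ≠ 0) (hβ : β ≠ 0) (hγ : γ ≠ 0) :
    ‖∫ τ in 0..t, (m ξ : ℂ) * (I * starRingEnd ℂ
        (((4 * Real.pi ^ 2 * ‖ξ‖ ^ 2 : ℝ) : ℂ) * h τ ξ + cubicConv (h τ) ξ)) *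
        ((commSymb m ξ α β γ : ℂ) * (h τ α * starRingEnd ℂ (h τ β) * h τ γ))‖ ≤
      1000000 * (domKernel N ξ α β γ * ((m ξ * ‖ξ‖ * amplitude h T ξ) *
        (m α * ‖α‖ * amplitude h T α) * (m β * ‖β‖ * amplitude h T β) *
        (m γ * ‖γ‖ * amplitude h T γ))) := by
  have hT : 0 ≤ T := ht.1.trans ht.2
  have hN0 : 0 ≤ N := by linarith
  have hA := hh.amplitude_nonneg hT
  have hM : ∀ η : E3, η ≠ 0 → 0 < m η * ‖η‖ := fun η hη => mul_pos (hm.pos η) (norm_pos_iff.2 hη)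
  have hc := fun η => hh.rapid.continuous_left η
  have hcF := hh.rapid.cubicConv.continuous_left ξ
  have hP : Continuous fun τ => h τ α * starRingEnd ℂ (h τ β) * h τ γ :=
    ((hc α).mul (Complex.continuous_conj.comp (hc β))).mul (hc γ)
  set J₁ := ∫ τ in 0..t, starRingEnd ℂ (h τ ξ) * (h τ α * starRingEnd ℂ (h τ β) * h τ γ) with hJ₁
  set J₂ := ∫ τ in 0..t, starRingEnd ℂ (cubicConv (h τ) ξ) *
    (h τ α * starRingEnd ℂ (h τ β) * h τ γ) with hJ₂
  set c := commSymb m ξ α β γ with hcdef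
  set A := amplitude h T ξ * amplitude h T α * amplitude h T β * amplitude h T γ with hAdef
  have hA0 : 0 ≤ A := mul_nonneg (mul_nonneg (mul_nonneg (hA _) (hA _)) (hA _)) (hA _)
  have hsplit : (∫ τ in 0..t, (m ξ : ℂ) * (I * starRingEnd ℂ
        (((4 * Real.pi ^ 2 * ‖ξ‖ ^ 2 : ℝ) : ℂ) * h τ ξ + cubicConv (h τ) ξ)) *
        ((c : ℂ) * (h τ α * starRingEnd ℂ (h τ β) * h τ γ))) =
      ((m ξ : ℂ) * I * c * ((4 * Real.pi ^ 2 * ‖ξ‖ ^ 2 : ℝ) : ℂ)) * J₁ +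
        ((m ξ : ℂ) * I * c) * J₂ := by
    rw [hJ₁, hJ₂, ← intervalIntegral.integral_const_mul, ← intervalIntegral.integral_const_mul,
      ← intervalIntegral.integral_add]
    · refine intervalIntegral.integral_congr fun τ _ => ?_
      simp only [map_add, map_mul, conj_ofReal]
      ring
    · exact (continuous_const.mul
        ((Complex.continuous_conj.comp (hc ξ)).mul hP)).intervalIntegrable _ _
    · exact (continuous_const.mul
        ((Complex.continuous_conj.comp hcF).mul hP)).intervalIntegrable _ _
  have hJ1 := hh.resonant_integral_le hT1 ht ξ α β γ
  have hJ2 := hh.sextic_integral_le ht ξ α β γ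
  rw [← hJ₁, ← hAdef] at hJ1
  rw [← hJ₂, ← hAdef] at hJ2
  have hR : 0 < 1 + |res4 ξ α β γ| := by positivity
  have hJ1' : ‖J₁‖ ≤ 32 * A * (1 + |res4 ξ α β γ|)⁻¹ := by
    rw [← div_eq_mul_inv, le_div_iff₀ hR]
    linarith
  have hcabs : |m ξ - m α * m β * m γ| = |c| := by rw [hcdef, commSymb, abs_sub_comm]
  have hk := hm.kernel_le hs hs1 hN h0 hξ hα hβ hγ
  have hst := hm.static_le hs hs1 hN h0 hξ hα hβ hγ
  rw [hcabs] at hk hst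
  have h3 : 0 < (m α * ‖α‖) * (m β * ‖β‖) * (m γ * ‖γ‖) :=
    mul_pos (mul_pos (hM α hα) (hM β hβ)) (hM γ hγ)
  have h4 : 0 < (m ξ * ‖ξ‖) * (m α * ‖α‖) * (m β * ‖β‖) * (m γ * ‖γ‖) :=
    mul_pos (mul_pos (mul_pos (hM ξ hξ) (hM α hα)) (hM β hβ)) (hM γ hγ)
  rw [mul_right_comm, ← div_eq_mul_inv, div_le_iff₀ h3] at hk
  rw [← div_eq_mul_inv, div_le_iff₀ h4] at hst
  have hdom : staticKernel (1 / 12) N ξ α β γ ≤ domKernel N ξ α β γ := by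
    have h1 := GoodMult.topKernel_nonneg hN0 (c := 1 / 12) ξ α β γ
    have h2 := GoodMult.topKernel_nonneg hN0 (c := 1 / 12) ξ γ β α
    rw [domKernel]
    linarith
  have hdom0 : 0 ≤ domKernel N ξ α β γ := (GoodMult.staticKernel_nonneg hN0 ξ α β γ).trans hdom
  set M := (m ξ * ‖ξ‖) * (m α * ‖α‖) * (m β * ‖β‖) * (m γ * ‖γ‖) with hMdef
  have hpi : Real.pi ^ 2 ≤ 10 := by nlinarith [Real.pi_lt_d2, Real.pi_gt_three]
  have hX : 0 ≤ domKernel N ξ α β γ * M * A := mul_nonneg (mul_nonneg hdom0 h4.le) hA0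
  have hfirst : m ξ * |c| * (4 * Real.pi ^ 2 * ‖ξ‖ ^ 2) * ‖J₁‖ ≤
      983040 * (domKernel N ξ α β γ * M * A) := by
    calc m ξ * |c| * (4 * Real.pi ^ 2 * ‖ξ‖ ^ 2) * ‖J₁‖
        ≤ m ξ * |c| * (4 * Real.pi ^ 2 * ‖ξ‖ ^ 2) * (32 * A * (1 + |res4 ξ α β γ|)⁻¹) :=
          mul_le_mul_of_nonneg_left hJ1' (by have := (hm.pos ξ).le; positivity)
      _ = 128 * Real.pi ^ 2 * A * (m ξ * ‖ξ‖) * (‖ξ‖ * |c| * (1 + |res4 ξ α β γ|)⁻¹) := by ring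
      _ ≤ 128 * Real.pi ^ 2 * A * (m ξ * ‖ξ‖) * (768 * domKernel N ξ α β γ *
            ((m α * ‖α‖) * (m β * ‖β‖) * (m γ * ‖γ‖))) :=
          mul_le_mul_of_nonneg_left hk (by have := (hM ξ hξ).le; positivity)
      _ = Real.pi ^ 2 * (98304 * (domKernel N ξ α β γ * M * A)) := by rw [hMdef]; ring
      _ ≤ 10 * (98304 * (domKernel N ξ α β γ * M * A)) :=
          mul_le_mul_of_nonneg_right hpi (by positivity)
      _ = _ := by ring
  have hsecond : m ξ * |c| * ‖J₂‖ ≤ 16 * (domKernel N ξ α β γ * M * A) := by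
    calc m ξ * |c| * ‖J₂‖ ≤ 1 * (16 * domKernel N ξ α β γ * M) * A := by
          refine mul_le_mul (mul_le_mul (hm.le_one ξ) (hst.trans ?_) (abs_nonneg _) zero_le_one)
            hJ2 (norm_nonneg _) (by positivity)
          exact mul_le_mul_of_nonneg_right (by linarith) h4.le
      _ = _ := by ring
  rw [hsplit]
  refine (norm_add_le _ _).trans ?_
  have hpos : ‖((4 * Real.pi ^ 2 * ‖ξ‖ ^ 2 : ℝ) : ℂ)‖ = 4 * Real.pi ^ 2 * ‖ξ‖ ^ 2 := by
    rw [norm_real, Real.norm_of_nonneg (by positivity)]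
  have hmξ : ‖(m ξ : ℂ)‖ = m ξ := by rw [norm_real, Real.norm_of_nonneg (hm.pos ξ).le]
  rw [norm_mul, norm_mul _ J₂, norm_mul, norm_mul, norm_mul, hpos, hmξ, norm_I, mul_one,
    norm_real, Real.norm_eq_abs]
  refine (add_le_add hfirst hsecond).trans ?_
  refine le_trans (?_ : _ ≤ 1000000 * (domKernel N ξ α β γ * M * A)) (le_of_eq ?_)
  · linarith
  · rw [hMdef, hAdef]
    ring

end NLSFam

/-- The energy increment of a smoothed solution whose amplitude is controlled. -/
theorem exists_energy_increment_le {e : ℝ} (he : 0 < e) (he1 : e ≤ 1 / 10) :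
    ∃ C > 0, ∀ s N T t : ℝ, ∀ m : E3 → ℝ, ∀ h : ℝ → E3 → ℂ, 5 / 6 < s → s < 1 → 1 ≤ N →
      GoodMult s N m → NLSFam T h → T ≤ 1 → t ∈ Icc 0 T →
      ∫⁻ ξ, ENNReal.ofReal ((m ξ * ‖ξ‖) ^ 2) * ENNReal.ofReal (amplitude h T ξ) ^ 2 ≤ 4 →
      |energy (𝓕⁻ fun ξ => (m ξ : ℂ) * h t ξ) - energy (𝓕⁻ fun ξ => (m ξ : ℂ) * h 0 ξ)| ≤
        C * N ^ (-1 + 6 * e) := by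
  obtain ⟨C, hC, H⟩ := quadInt_domKernel_le he he1
  refine ⟨16000000 * C, by positivity, fun s N T t m h hs hs1 hN hm hh hT1 ht hA => ?_⟩
  have hT : 0 ≤ T := ht.1.trans ht.2
  have hN0 : 0 < N := by linarith
  have hA0 := hh.amplitude_nonneg hT
  have hcA := hh.continuous_amplitude T
  have hmc := hm.cont
  set k : ℝ → E3 → ℂ := fun s ξ => (m ξ : ℂ) * (I * starRingEnd ℂ
    (((4 * Real.pi ^ 2 * ‖ξ‖ ^ 2 : ℝ) : ℂ) * h s ξ + cubicConv (h s) ξ)) with hk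
  have hkr : RapidFam k := by
    refine RapidFam.mul_left ?_ (b := fun _ ξ => (m ξ : ℂ)) (by fun_prop) (K := 1) (j := 0)
      fun t ξ => ?_
    · refine RapidFam.const_mul (RapidFam.conj (RapidFam.add ?_ hh.rapid.cubicConv)) I
      refine hh.rapid.mul_left (b := fun _ ξ => ((4 * Real.pi ^ 2 * ‖ξ‖ ^ 2 : ℝ) : ℂ))
        (by fun_prop) (K := 4 * Real.pi ^ 2) (j := 2) fun t ξ => ?_
      rw [norm_real, Real.norm_of_nonneg (by positivity)]
      have := norm_nonneg ξ
      gcongr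
      linarith
    · rw [norm_real, Real.norm_of_nonneg (hm.pos ξ).le]
      simpa using hm.le_one ξ
  set a : E3 → ENNReal := fun ξ => ENNReal.ofReal (m ξ * ‖ξ‖ * amplitude h T ξ) with ha
  have ham : Measurable a :=
    Measurable.ennreal_ofReal (f := fun ξ => m ξ * ‖ξ‖ * amplitude h T ξ)
      ((hmc.mul continuous_norm).mul hcA).measurable
  have hMA : ∀ ξ, 0 ≤ m ξ * ‖ξ‖ * amplitude h T ξ := fun ξ =>
    mul_nonneg (mul_nonneg (hm.pos ξ).le (norm_nonneg _)) (hA0 ξ)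
  have ha2 : ∫⁻ ξ, a ξ ^ 2 ≤ 4 := by
    refine le_trans (le_of_eq (lintegral_congr fun ξ => ?_)) hA
    simp only [ha]
    rw [ENNReal.ofReal_mul (mul_nonneg (hm.pos ξ).le (norm_nonneg _)), mul_pow,
      ENNReal.ofReal_pow (mul_nonneg (hm.pos ξ).le (norm_nonneg _))]
  have hE : energy (𝓕⁻ fun ξ => (m ξ : ℂ) * h t ξ) - energy (𝓕⁻ fun ξ => (m ξ : ℂ) * h 0 ξ) =
      ∫ s in 0..t, (∫ ξ, k s ξ * ∫ z : E3 × E3,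
        (commSymb m ξ z.1 z.2 (ξ - z.1 + z.2) : ℂ) *
          (h s z.1 * starRingEnd ℂ (h s z.2) * h s (ξ - z.1 + z.2))).re := by
    rw [hh.energy_sub_eq hm.cont hm.pos hm.le_one ht]
    simp only [hh.rapid.cubicConv_mul_sub hm.cont hm.pos hm.le_one, hk, mul_assoc]
  refine (ENNReal.ofReal_le_ofReal_iff (by positivity)).1 ?_
  rw [hE]
  refine (hkr.abs_integral_re_le hh.rapid hm.cont hm.pos hm.le_one t).trans ?_
  calc _ ≤ quadInt fun ξ α β γ => ENNReal.ofReal 1000000 *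
          (ENNReal.ofReal (domKernel N ξ α β γ) * (a ξ * a α * a β * a γ)) := by
        refine quadInt_mono_of_ne_zero fun ξ α β γ h0 hξ hα hβ hγ => ?_
        have := hh.increment_kernel_le hT1 ht hs hs1 hN hm h0 hξ hα hβ hγ
        have hdom0 : 0 ≤ domKernel N ξ α β γ :=
          add_nonneg (add_nonneg (GoodMult.topKernel_nonneg hN0.le _ _ _ _)
            (GoodMult.topKernel_nonneg hN0.le _ _ _ _)) (GoodMult.staticKernel_nonneg hN0.le _ _ _ _)
        rw [← ofReal_norm]
        refine (ENNReal.ofReal_le_ofReal this).trans (le_of_eq ?_)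
        simp only [ha]
        rw [ENNReal.ofReal_mul (p := 1000000) (by norm_num), ENNReal.ofReal_mul hdom0,
          ENNReal.ofReal_mul (mul_nonneg (mul_nonneg (hMA _) (hMA _)) (hMA _)),
          ENNReal.ofReal_mul (mul_nonneg (hMA _) (hMA _)), ENNReal.ofReal_mul (hMA ξ)]
    _ = ENNReal.ofReal 1000000 * quadInt fun ξ α β γ =>
          ENNReal.ofReal (domKernel N ξ α β γ) * (a ξ * a α * a β * a γ) :=
        quadInt_const_mul ENNReal.ofReal_ne_top
    _ ≤ ENNReal.ofReal 1000000 * (ENNReal.ofReal (C * N ^ (-1 + 6 * e)) * 4 ^ 2) :=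
        mul_le_mul_right ((H N hN a ham).trans (mul_le_mul_right (pow_le_pow_left' ha2 2) _)) _
    _ = ENNReal.ofReal (16000000 * C * N ^ (-1 + 6 * e)) := by
        rw [show (4 : ENNReal) ^ 2 = ENNReal.ofReal 16 by norm_num,
          ← ENNReal.ofReal_mul (by positivity), ← ENNReal.ofReal_mul (by norm_num)]
        congr 1
        ring

/-- The kinetic energy controls the weighted norm. -/
lemma RapidFam.weightSq_le_one_of_energy_le_one {s N : ℝ} {m : E3 → ℝ} {w : ℝ → E3 → ℂ}
    (hw : RapidFam w) (hm : GoodMult s N m) (t : ℝ)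
    (hE : energy (𝓕⁻ fun ξ => (m ξ : ℂ) * w t ξ) ≤ 1) : weightSq m (w t) ≤ 1 := by
  have hc := hm.cont
  have hmw : RapidFam fun t ξ => (m ξ : ℂ) * w t ξ := by
    refine hw.mul_left (b := fun _ ξ => (m ξ : ℂ)) (by fun_prop) (K := 1) (j := 0) fun t ξ => ?_
    rw [norm_real, Real.norm_of_nonneg (hm.pos ξ).le]
    simpa using hm.le_one ξ
  rw [hmw.energy_fourierInv t] at hE
  have hpot : 0 ≤ ∫ x, ‖𝓕⁻ (fun ξ => (m ξ : ℂ) * w t ξ) x‖ ^ 4 :=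
    integral_nonneg fun x => by positivity
  have hkin : 0 ≤ ∫ ξ, ‖ξ‖ ^ 2 * ‖(m ξ : ℂ) * w t ξ‖ ^ 2 := integral_nonneg fun x => by positivity
  have hle : ∫ ξ, ‖ξ‖ ^ 2 * ‖(m ξ : ℂ) * w t ξ‖ ^ 2 ≤ 1 := by nlinarith [Real.pi_gt_three]
  have heq : ∫ ξ, ‖((m ξ * ‖ξ‖ : ℝ) : ℂ) * w t ξ‖ ^ 2 =
      ∫ ξ, ‖ξ‖ ^ 2 * ‖(m ξ : ℂ) * w t ξ‖ ^ 2 := by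
    refine integral_congr_ae (Filter.Eventually.of_forall fun ξ => ?_)
    simp only [norm_mul, norm_real, norm_norm]
    ring
  rw [← hm.ofReal_weightNorm_sq hw t, weightNorm, heq]
  exact pow_le_one₀ zero_le (ENNReal.ofReal_le_one.2 (Real.sqrt_le_one.2 hle))

namespace IsNLSSolution

variable {T : ℝ} {φ : Rn 3 → ℝ → ℂ} {φ₀ : Rn 3 → ℂ}

lemma nlsFam_fourierFam (h : IsNLSSolution 3 T φ φ₀) (hT : 0 < T) : NLSFam T (fourierFam T φ) :=
  ⟨h.rapidFam_fourierFam hT, fun _ ht ξ => h.hasDerivAt_fourierFam ht ξ⟩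

lemma Iop_eq {m₁ : Rn 3 → ℝ} {N t : ℝ} (ht : t ∈ Icc 0 T) :
    Iop m₁ N (fun x => φ x t) = 𝓕⁻ fun ξ => (mN m₁ N ξ : ℂ) * fourierFam T φ t ξ := by
  rw [fourierFam_eq ht]
  rfl

end IsNLSSolution

/-- Almost conservation law in ℝ³. -/
theorem statement_4 :
    ∃ δ > (0:ℝ),
    ∀ s : ℝ, 5/6 < s → s < 1 →
    ∀ m₁ : Rn 3 → ℝ, IsAdmissibleMultiplier 3 s m₁ →
    ∃ ε₀ > (0:ℝ), ∀ ε : ℝ, 0 < ε → ε < ε₀ →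
    ∃ C > (0:ℝ),
    ∀ N : ℝ, 1 ≤ N →
    ∀ φ₀ : SchwartzMap (Rn 3) ℂ, energy (Iop m₁ N ⇑φ₀) ≤ 1 →
    ∀ φ : Rn 3 → ℝ → ℂ, IsNLSSolution 3 δ φ ⇑φ₀ →
    ∀ t ∈ Icc (0:ℝ) δ,
      |energy (Iop m₁ N (fun x => φ x t)) - energy (Iop m₁ N ⇑φ₀)|
        ≤ C * N ^ (-(1:ℝ) + ε) := by
  obtain ⟨δ, hδ0, hδ1, hloc⟩ := exists_amplitude_bound
  refine ⟨δ, hδ0, fun s hs hs1 m₁ hm₁ => ⟨1 / 2, by norm_num, fun ε hε hε0 => ?_⟩⟩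
  obtain ⟨C, hC, H⟩ := exists_energy_increment_le (e := ε / 6) (by positivity) (by linarith)
  refine ⟨C, hC, fun N hN φ₀ hE φ hφ t ht => ?_⟩
  have hm := goodMult_mN hs hs1 (by linarith : 0 < N) hm₁
  have h0 : (0 : ℝ) ∈ Icc 0 δ := ⟨le_rfl, hδ0.le⟩
  have hh := hφ.nlsFam_fourierFam hδ0
  have hφ₀ : (φ₀ : Rn 3 → ℂ) = fun x => φ x 0 := funext fun x => (hφ.2.2.2 x).symm
  rw [hφ₀, IsNLSSolution.Iop_eq h0] at hE ⊢
  rw [IsNLSSolution.Iop_eq ht]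
  have hA := hloc s N hs hs1 hN _ hm _ hh (hh.rapid.weightSq_le_one_of_energy_le_one hm 0 hE)
  refine (H s N δ t _ _ hs hs1 hN hm hh hδ1 ht hA).trans (le_of_eq ?_)
  rw [show -1 + 6 * (ε / 6) = -(1 : ℝ) + ε by ring]

end
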